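/- Let 2 < α ≤ 3 and let u ∈ C^∞(S²) be a solution of −Δu + α = e^{2u} on S². Let q be a critical point of u and z ∈ T_qS² a unit eigenvector of the Hessian D²u(q). Set y = q × z (cross product in ℝ³), v = u ∘ R_y and w = u − v. If w is not identically zero, then the normal derivative ∂w/∂ν, where ν = −y is the unit outer normal of the half-sphere H_y along C_y, is nonzero and of one fixed sign on C_y \ {q}; since ∂w/∂ν = 2·∂u/∂ν on C_y, the derivative ∂u/∂ν is also nonzero and of one fixed sign on C_y \ {q}. -/

import Mathlib

open MeasureTheory Real
open scoped RealInnerProductSpace ContDiff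

noncomputable section

abbrev E3 : Type := EuclideanSpace ℝ (Fin 3)

/-- The unit sphere `S²` as a subset of `ℝ³`. -/
def S2 : Set E3 := Metric.sphere 0 1

/-- The Euclidean Laplacian of `u : ℝ³ → ℝ`.  For a `0`-homogeneous function it
coincides on `S²` with the Laplace–Beltrami operator of the round metric applied
to the restriction of `u` to `S²`. -/
def lap (u : E3 → ℝ) (x : E3) : ℝ :=
  ∑ i : Fin 3, iteratedFDeriv ℝ 2 u x ![EuclideanSpace.single i 1, EuclideanSpace.single i 1]

/-- `u : ℝ³ → ℝ` is positively homogeneous of degree `0`, i.e. it is the radial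
extension of a function on `S²`. -/
def Hom0 (u : E3 → ℝ) : Prop := ∀ (x : E3) (r : ℝ), 0 < r → u (r • x) = u x

/-- `u` represents a smooth solution of the mean field equation `-Δ_{S²} u + α = e^{2u}`
on `S²`, encoded through its degree-zero homogeneous extension to `ℝ³ \ {0}`. -/
def MFE (u : E3 → ℝ) (α : ℝ) : Prop :=
  ContDiffOn ℝ ∞ u {(0 : E3)}ᶜ ∧ Hom0 u ∧
    ∀ x ∈ S2, -lap u x + α = Real.exp (2 * u x)

/-- Reflection of `ℝ³` across the plane `{x · y = 0}`. -/
def Refl (y x : E3) : E3 := x - (2 * ⟪x, y⟫) • y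

/-- The closed half-sphere `H_y`. -/
def halfSphere (y : E3) : Set E3 := {x ∈ S2 | 0 ≤ ⟪x, y⟫}

/-- The great circle `C_y`. -/
def circleOf (y : E3) : Set E3 := {x ∈ S2 | ⟪x, y⟫ = 0}

/-- `u` is axially symmetric with respect to `p`: on the sphere it depends only on `x · p`. -/
def AxiallySymmetric (u : E3 → ℝ) (p : E3) : Prop :=
  ∀ x ∈ S2, ∀ y ∈ S2, ⟪x, p⟫ = ⟪y, p⟫ → u x = u y

/-- `p` is an umbilical critical point of `u` (viewed as a function on `S²`):
the (intrinsic) gradient vanishes and the Hessian, as a quadratic form on the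
tangent plane `p^⊥`, is a multiple of the metric. -/
def UmbilicalCritical (u : E3 → ℝ) (p : E3) : Prop :=
  fderiv ℝ u p = 0 ∧
    ∃ c : ℝ, ∀ v : E3, ⟪v, p⟫ = 0 → iteratedFDeriv ℝ 2 u p ![v, v] = c * ‖v‖ ^ 2

/-- `z` is an eigenvector of the Hessian `D²u(q)` viewed as a symmetric bilinear
form on the tangent plane `q^⊥`. -/
def HessEigen (u : E3 → ℝ) (q z : E3) : Prop :=
  ∃ lam : ℝ, ∀ v : E3, ⟪v, q⟫ = 0 → iteratedFDeriv ℝ 2 u q ![z, v] = lam * ⟪z, v⟫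

/-- Cross product on `ℝ³`. -/
def cross (a b : E3) : E3 :=
  (WithLp.equiv 2 (Fin 3 → ℝ)).symm
    (crossProduct ((WithLp.equiv 2 (Fin 3 → ℝ)) a) ((WithLp.equiv 2 (Fin 3 → ℝ)) b))

/-- `Ω` is a nodal domain of `w` on the sphere: a connected component of
`S² \ w⁻¹(0)` (in the subspace topology of `S²`). -/
def IsNodalDomain (w : E3 → ℝ) (Ω : Set E3) : Prop :=
  ∃ x ∈ S2, w x ≠ 0 ∧ Ω = connectedComponentIn {z ∈ S2 | w z ≠ 0} x

end

noncomputable section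

namespace SphereMFE

section Planar

variable {E : Type*} [NormedAddCommGroup E] [NormedSpace ℝ E]

/-- Partial derivative in the direction of the real axis. -/
def px (f : ℂ → E) (z : ℂ) : E := fderiv ℝ f z 1

/-- Partial derivative in the direction of the imaginary axis. -/
def py (f : ℂ → E) (z : ℂ) : E := fderiv ℝ f z Complex.I

/-- The planar Laplacian. -/
def plap (f : ℂ → E) (z : ℂ) : E := px (px f) z + py (py f) z

lemma fderiv_eq_px_py (f : ℂ → E) (z v : ℂ) :
    fderiv ℝ f z v = v.re • px f z + v.im • py f z := by
  have h : v = v.re • (1 : ℂ) + v.im • Complex.I := by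
    simp [Complex.re_add_im]
  conv_lhs => rw [h]
  rw [map_add, map_smul, map_smul, px, py]

lemma contDiff_px {f : ℂ → E} (hf : ContDiff ℝ ∞ f) : ContDiff ℝ ∞ (px f) :=
  (hf.fderiv_right (m := ∞) (by simp)).clm_apply contDiff_const

lemma contDiff_py {f : ℂ → E} (hf : ContDiff ℝ ∞ f) : ContDiff ℝ ∞ (py f) :=
  (hf.fderiv_right (m := ∞) (by simp)).clm_apply contDiff_const

lemma contDiff_plap {f : ℂ → E} (hf : ContDiff ℝ ∞ f) : ContDiff ℝ ∞ (plap f) :=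
  (contDiff_px (contDiff_px hf)).add (contDiff_py (contDiff_py hf))

lemma hasFDerivAt_of_smooth {f : ℂ → E} (hf : ContDiff ℝ ∞ f) (z : ℂ) :
    HasFDerivAt f (fderiv ℝ f z) z :=
  (hf.differentiable (by simp) z).hasFDerivAt

lemma tsupport_px_subset (f : ℂ → E) : tsupport (px f) ⊆ tsupport f :=
  tsupport_fderiv_apply_subset ℝ 1

lemma tsupport_py_subset (f : ℂ → E) : tsupport (py f) ⊆ tsupport f :=
  tsupport_fderiv_apply_subset ℝ Complex.I

lemma hasCompactSupport_px {f : ℂ → E} (hf : HasCompactSupport f) : HasCompactSupport (px f) :=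
  hf.fderiv_apply (𝕜 := ℝ) 1

lemma hasCompactSupport_py {f : ℂ → E} (hf : HasCompactSupport f) : HasCompactSupport (py f) :=
  hf.fderiv_apply (𝕜 := ℝ) Complex.I

lemma px_congr {f g : ℂ → E} {z : ℂ} (h : f =ᶠ[nhds z] g) : px f z = px g z := by
  simp [px, h.fderiv_eq]

lemma py_congr {f g : ℂ → E} {z : ℂ} (h : f =ᶠ[nhds z] g) : py f z = py g z := by
  simp [py, h.fderiv_eq]

lemma px_congr_eventually {f g : ℂ → E} {z : ℂ} (h : f =ᶠ[nhds z] g) :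
    px f =ᶠ[nhds z] px g := by
  filter_upwards [h.eventually_nhds] with x hx using px_congr hx

lemma py_congr_eventually {f g : ℂ → E} {z : ℂ} (h : f =ᶠ[nhds z] g) :
    py f =ᶠ[nhds z] py g := by
  filter_upwards [h.eventually_nhds] with x hx using py_congr hx

lemma plap_congr {f g : ℂ → E} {z : ℂ} (h : f =ᶠ[nhds z] g) : plap f z = plap g z := by
  simp only [plap, px_congr (px_congr_eventually h), py_congr (py_congr_eventually h)]

lemma px_eq_zero_of_notMem {f : ℂ → E} {z : ℂ} (h : z ∉ tsupport f) : px f z = 0 :=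
  image_eq_zero_of_notMem_tsupport fun h' => h (tsupport_px_subset f h')

lemma py_eq_zero_of_notMem {f : ℂ → E} {z : ℂ} (h : z ∉ tsupport f) : py f z = 0 :=
  image_eq_zero_of_notMem_tsupport fun h' => h (tsupport_py_subset f h')

lemma plap_eq_zero_of_notMem {f : ℂ → E} {z : ℂ} (h : z ∉ tsupport f) : plap f z = 0 := by
  rw [plap, px_eq_zero_of_notMem fun h' => h (tsupport_px_subset f h'),
    py_eq_zero_of_notMem fun h' => h (tsupport_py_subset f h'), add_zero]

lemma hasCompactSupport_plap {f : ℂ → E} (hf : HasCompactSupport f) :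
    HasCompactSupport (plap f) :=
  (hasCompactSupport_px (hasCompactSupport_px hf)).add
    (hasCompactSupport_py (hasCompactSupport_py hf))

lemma px_add {f g : ℂ → E} (hf : ContDiff ℝ ∞ f) (hg : ContDiff ℝ ∞ g) :
    px (f + g) = px f + px g := by
  ext z; simp [px, ((hasFDerivAt_of_smooth hf z).add (hasFDerivAt_of_smooth hg z)).fderiv]

lemma py_add {f g : ℂ → E} (hf : ContDiff ℝ ∞ f) (hg : ContDiff ℝ ∞ g) :
    py (f + g) = py f + py g := by
  ext z; simp [py, ((hasFDerivAt_of_smooth hf z).add (hasFDerivAt_of_smooth hg z)).fderiv]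

lemma plap_add {f g : ℂ → E} (hf : ContDiff ℝ ∞ f) (hg : ContDiff ℝ ∞ g) :
    plap (f + g) = plap f + plap g := by
  ext z
  simp only [plap, px_add hf hg, py_add hf hg, px_add (contDiff_px hf) (contDiff_px hg),
    py_add (contDiff_py hf) (contDiff_py hg), Pi.add_apply]
  abel

lemma px_sub {f g : ℂ → E} (hf : ContDiff ℝ ∞ f) (hg : ContDiff ℝ ∞ g) :
    px (f - g) = px f - px g := by
  ext z; simp [px, ((hasFDerivAt_of_smooth hf z).sub (hasFDerivAt_of_smooth hg z)).fderiv]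

lemma py_sub {f g : ℂ → E} (hf : ContDiff ℝ ∞ f) (hg : ContDiff ℝ ∞ g) :
    py (f - g) = py f - py g := by
  ext z; simp [py, ((hasFDerivAt_of_smooth hf z).sub (hasFDerivAt_of_smooth hg z)).fderiv]

lemma plap_sub {f g : ℂ → E} (hf : ContDiff ℝ ∞ f) (hg : ContDiff ℝ ∞ g) :
    plap (f - g) = plap f - plap g := by
  ext z
  simp only [plap, px_sub hf hg, py_sub hf hg, px_sub (contDiff_px hf) (contDiff_px hg),
    py_sub (contDiff_py hf) (contDiff_py hg), Pi.sub_apply]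
  abel

@[simp] lemma px_const (c : E) : px (fun _ : ℂ => c) = 0 := by ext z; simp [px]

@[simp] lemma py_const (c : E) : py (fun _ : ℂ => c) = 0 := by ext z; simp [py]

@[simp] lemma plap_const (c : E) : plap (fun _ : ℂ => c) = 0 := by
  ext z
  rw [plap, px_const, py_const]
  simp [px, py]

lemma integral_px_eq_zero {f : ℂ → E} (hf : ContDiff ℝ ∞ f)
    (hc : HasCompactSupport f) : ∫ z, px f z = 0 := by
  have h := integral_bilinear_fderiv_right_eq_neg_left_of_integrable (μ := (volume : Measure ℂ))
    (f := fun _ : ℂ => (1 : ℝ)) (g := f) (v := 1) (B := ContinuousLinearMap.lsmul ℝ ℝ)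
    (by simp) ?_ ?_ (by fun_prop) (fun x _ => hf.differentiable (by simp) x)
  · simpa [px] using h
  · have := (contDiff_px hf).continuous.integrable_of_hasCompactSupport (μ := volume)
      (hasCompactSupport_px hc)
    simp only [ContinuousLinearMap.lsmul_apply, one_smul]
    exact this
  · simpa using hf.continuous.integrable_of_hasCompactSupport hc

lemma integral_py_eq_zero {f : ℂ → E} (hf : ContDiff ℝ ∞ f)
    (hc : HasCompactSupport f) : ∫ z, py f z = 0 := by
  have h := integral_bilinear_fderiv_right_eq_neg_left_of_integrable (μ := (volume : Measure ℂ))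
    (f := fun _ : ℂ => (1 : ℝ)) (g := f) (v := Complex.I) (B := ContinuousLinearMap.lsmul ℝ ℝ)
    (by simp) ?_ ?_ (by fun_prop) (fun x _ => hf.differentiable (by simp) x)
  · simpa [py] using h
  · have := (contDiff_py hf).continuous.integrable_of_hasCompactSupport (μ := volume)
      (hasCompactSupport_py hc)
    simp only [ContinuousLinearMap.lsmul_apply, one_smul]
    exact this
  · simpa using hf.continuous.integrable_of_hasCompactSupport hc

end Planar

section Algebra

variable {𝕜 : Type*} [NormedField 𝕜] [NormedAlgebra ℝ 𝕜]

lemma cdMul {f g : ℂ → 𝕜} (hf : ContDiff ℝ ∞ f) (hg : ContDiff ℝ ∞ g) : ContDiff ℝ ∞ (f * g) :=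
  hf.mul hg

lemma cdAdd {f g : ℂ → 𝕜} (hf : ContDiff ℝ ∞ f) (hg : ContDiff ℝ ∞ g) : ContDiff ℝ ∞ (f + g) :=
  hf.add hg

lemma cdSub {f g : ℂ → 𝕜} (hf : ContDiff ℝ ∞ f) (hg : ContDiff ℝ ∞ g) : ContDiff ℝ ∞ (f - g) :=
  hf.sub hg

lemma px_mul {f g : ℂ → 𝕜} (hf : ContDiff ℝ ∞ f) (hg : ContDiff ℝ ∞ g) :
    px (f * g) = px f * g + f * px g := by
  ext z
  simp [px, ((hasFDerivAt_of_smooth hf z).mul (hasFDerivAt_of_smooth hg z)).fderiv]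
  ring

lemma py_mul {f g : ℂ → 𝕜} (hf : ContDiff ℝ ∞ f) (hg : ContDiff ℝ ∞ g) :
    py (f * g) = py f * g + f * py g := by
  ext z
  simp [py, ((hasFDerivAt_of_smooth hf z).mul (hasFDerivAt_of_smooth hg z)).fderiv]
  ring

lemma plap_mul {f g : ℂ → 𝕜} (hf : ContDiff ℝ ∞ f) (hg : ContDiff ℝ ∞ g) :
    plap (f * g) = plap f * g + 2 * (px f * px g + py f * py g) + f * plap g := by
  ext z
  have h1 := contDiff_px hf
  have h2 := contDiff_px hg
  have h3 := contDiff_py hf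
  have h4 := contDiff_py hg
  have e1 : px (px f * g + f * px g) = px (px f * g) + px (f * px g) :=
    px_add (h1.mul hg) (hf.mul h2)
  have e2 : py (py f * g + f * py g) = py (py f * g) + py (f * py g) :=
    py_add (h3.mul hg) (hf.mul h4)
  simp only [plap, px_mul hf hg, py_mul hf hg, e1, e2, px_mul h1 hg, px_mul hf h2,
    py_mul h3 hg, py_mul hf h4, Pi.add_apply, Pi.mul_apply, Pi.ofNat_apply]
  ring

end Algebra

section Scalar

lemma px_comp {χ : ℝ → ℝ} {f : ℂ → ℝ} (hχ : ContDiff ℝ ∞ χ) (hf : ContDiff ℝ ∞ f) :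
    px (fun z => χ (f z)) = fun z => deriv χ (f z) * px f z := by
  ext z
  have h := ((hχ.differentiable (by simp) (f z)).hasDerivAt).comp_hasFDerivAt z
    (hasFDerivAt_of_smooth hf z)
  rw [px, show (fun z => χ (f z)) = χ ∘ f from rfl, h.fderiv]
  simp [px]

lemma py_comp {χ : ℝ → ℝ} {f : ℂ → ℝ} (hχ : ContDiff ℝ ∞ χ) (hf : ContDiff ℝ ∞ f) :
    py (fun z => χ (f z)) = fun z => deriv χ (f z) * py f z := by
  ext z
  have h := ((hχ.differentiable (by simp) (f z)).hasDerivAt).comp_hasFDerivAt z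
    (hasFDerivAt_of_smooth hf z)
  rw [py, show (fun z => χ (f z)) = χ ∘ f from rfl, h.fderiv]
  simp [py]

lemma contDiff_deriv {χ : ℝ → ℝ} (hχ : ContDiff ℝ ∞ χ) : ContDiff ℝ ∞ (deriv χ) :=
  hχ.deriv' (n := ∞)

lemma plap_comp {χ : ℝ → ℝ} {f : ℂ → ℝ} (hχ : ContDiff ℝ ∞ χ) (hf : ContDiff ℝ ∞ f) (z : ℂ) :
    plap (fun z => χ (f z)) z =
      deriv (deriv χ) (f z) * (px f z ^ 2 + py f z ^ 2) + deriv χ (f z) * plap f z := by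
  have h1 := contDiff_deriv hχ
  have e1 : (fun z => deriv χ (f z) * px f z) = (fun z => deriv χ (f z)) * px f := rfl
  have e2 : (fun z => deriv χ (f z) * py f z) = (fun z => deriv χ (f z)) * py f := rfl
  have h2 : ContDiff ℝ ∞ fun z => deriv χ (f z) := h1.comp hf
  rw [plap, px_comp hχ hf, py_comp hχ hf, e1, e2, px_mul h2 (contDiff_px hf),
    py_mul h2 (contDiff_py hf), px_comp h1 hf, py_comp h1 hf]
  simp only [Pi.add_apply, Pi.mul_apply, plap]
  ring

/-- Green's identity for a compactly supported factor. -/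
lemma green {f g : ℂ → ℝ} (hf : ContDiff ℝ ∞ f) (hg : ContDiff ℝ ∞ g)
    (hc : HasCompactSupport f) :
    ∫ z, f z * plap g z = -∫ z, (px f z * px g z + py f z * py g z) := by
  have h1 := integral_px_eq_zero (hf.mul (contDiff_px hg)) (hc.mul_right (f' := px g))
  have h2 := integral_py_eq_zero (hf.mul (contDiff_py hg)) (hc.mul_right (f' := py g))
  have i1 : Integrable (px (fun z => f z * px g z)) :=
    (contDiff_px (hf.mul (contDiff_px hg))).continuous.integrable_of_hasCompactSupport
      (hasCompactSupport_px (hc.mul_right (f' := px g)))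
  have i2 : Integrable (py (fun z => f z * py g z)) :=
    (contDiff_py (hf.mul (contDiff_py hg))).continuous.integrable_of_hasCompactSupport
      (hasCompactSupport_py (hc.mul_right (f' := py g)))
  have i3 : Integrable (fun z => f z * plap g z) :=
    (hf.mul (contDiff_plap hg)).continuous.integrable_of_hasCompactSupport
      (hc.mul_right (f' := plap g))
  have key : ∀ z, px (fun z => f z * px g z) z + py (fun z => f z * py g z) z - f z * plap g z
      = px f z * px g z + py f z * py g z := by
    intro z
    have e1 : (fun z => f z * px g z) = f * px g := rfl
    have e2 : (fun z => f z * py g z) = f * py g := rfl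
    rw [e1, e2, px_mul hf (contDiff_px hg), py_mul hf (contDiff_py hg)]
    simp only [Pi.add_apply, Pi.mul_apply, plap]
    ring
  have h3 : ∫ z, (px f z * px g z + py f z * py g z) =
      ∫ z, (px (fun z => f z * px g z) z + py (fun z => f z * py g z) z - f z * plap g z) :=
    integral_congr_ae (Filter.Eventually.of_forall fun z => (key z).symm)
  have h4 := integral_sub (i1.add i2) i3
  have h5 := integral_add i1 i2
  simp only [Pi.add_apply] at h4
  rw [h3, h4, h5, h1, h2]
  simp

lemma green_symm {f g : ℂ → ℝ} (hf : ContDiff ℝ ∞ f) (hg : ContDiff ℝ ∞ g)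
    (hc : HasCompactSupport f) :
    ∫ z, f z * plap g z = ∫ z, plap f z * g z := by
  have i1 : Integrable (px (fun z => px f z * g z)) :=
    (contDiff_px ((contDiff_px hf).mul hg)).continuous.integrable_of_hasCompactSupport
      (hasCompactSupport_px ((hasCompactSupport_px hc).mul_right (f' := g)))
  have i2 : Integrable (py (fun z => py f z * g z)) :=
    (contDiff_py ((contDiff_py hf).mul hg)).continuous.integrable_of_hasCompactSupport
      (hasCompactSupport_py ((hasCompactSupport_py hc).mul_right (f' := g)))
  have i3 : Integrable (fun z => plap f z * g z) :=
    ((contDiff_plap hf).mul hg).continuous.integrable_of_hasCompactSupport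
      ((hasCompactSupport_plap hc).mul_right (f' := g))
  have h1 := integral_px_eq_zero ((contDiff_px hf).mul hg)
    ((hasCompactSupport_px hc).mul_right (f' := g))
  have h2 := integral_py_eq_zero ((contDiff_py hf).mul hg)
    ((hasCompactSupport_py hc).mul_right (f' := g))
  rw [green hf hg hc]
  have h3 : ∫ z, (px f z * px g z + py f z * py g z) =
      ∫ z, (px (fun z => px f z * g z) z + py (fun z => py f z * g z) z - plap f z * g z) := by
    refine integral_congr_ae (Filter.Eventually.of_forall fun z => ?_)
    have e1 : (fun z => px f z * g z) = px f * g := rfl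
    have e2 : (fun z => py f z * g z) = py f * g := rfl
    simp only [e1, e2]
    rw [px_mul (contDiff_px hf) hg, py_mul (contDiff_py hf) hg]
    simp only [Pi.add_apply, Pi.mul_apply, plap]
    ring
  have h4 := integral_sub (i1.add i2) i3
  have h5 := integral_add i1 i2
  simp only [Pi.add_apply] at h4
  rw [h3, h4, h5, h1, h2]
  simp

end Scalar

section Wirtinger

/-- The Wirtinger derivative `∂/∂z`. -/
def dz (f : ℂ → ℂ) (z : ℂ) : ℂ := (px f z - Complex.I * py f z) / 2

lemma contDiff_dz {f : ℂ → ℂ} (hf : ContDiff ℝ ∞ f) : ContDiff ℝ ∞ (dz f) :=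
  ((contDiff_px hf).sub (contDiff_const.mul (contDiff_py hf))).div_const 2

lemma hasCompactSupport_dz {f : ℂ → ℂ} (hf : HasCompactSupport f) : HasCompactSupport (dz f) := by
  refine hf.mono' fun z hz => ?_
  by_contra h
  exact hz (by simp [dz, px_eq_zero_of_notMem h, py_eq_zero_of_notMem h])

lemma integral_dz_eq_zero {f : ℂ → ℂ} (hf : ContDiff ℝ ∞ f) (hc : HasCompactSupport f) :
    ∫ z, dz f z = 0 := by
  have i1 := (contDiff_px hf).continuous.integrable_of_hasCompactSupport (μ := volume)
    (hasCompactSupport_px hc)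
  have i2 := (contDiff_py hf).continuous.integrable_of_hasCompactSupport (μ := volume)
    (hasCompactSupport_py hc)
  simp only [dz]
  rw [integral_div, integral_sub i1 (i2.const_mul _), integral_const_mul,
    integral_px_eq_zero hf hc, integral_py_eq_zero hf hc]
  simp

lemma dz_mul {f g : ℂ → ℂ} (hf : ContDiff ℝ ∞ f) (hg : ContDiff ℝ ∞ g) (z : ℂ) :
    dz (f * g) z = dz f z * g z + f z * dz g z := by
  simp only [dz, px_mul hf hg, py_mul hf hg, Pi.add_apply, Pi.mul_apply]
  ring

lemma dz_sub {f g : ℂ → ℂ} (hf : ContDiff ℝ ∞ f) (hg : ContDiff ℝ ∞ g) (z : ℂ) :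
    dz (f - g) z = dz f z - dz g z := by
  simp only [dz, px_sub hf hg, py_sub hf hg, Pi.sub_apply]
  ring

lemma dz_add {f g : ℂ → ℂ} (hf : ContDiff ℝ ∞ f) (hg : ContDiff ℝ ∞ g) (z : ℂ) :
    dz (f + g) z = dz f z + dz g z := by
  simp only [dz, px_add hf hg, py_add hf hg, Pi.add_apply]
  ring

@[simp] lemma dz_const (c : ℂ) (z : ℂ) : dz (fun _ => c) z = 0 := by simp [dz]

lemma dz_id (z : ℂ) : dz (fun z => z) z = 1 := by
  simp [dz, px, py]

lemma fderiv_of_differentiableAt {f : ℂ → ℂ} {z : ℂ} (hf : DifferentiableAt ℂ f z) (v : ℂ) :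
    fderiv ℝ f z v = v * deriv f z := by
  rw [(hf.hasDerivAt.complexToReal_fderiv).fderiv]
  simp [mul_comm]

lemma px_of_differentiableAt {f : ℂ → ℂ} {z : ℂ} (hf : DifferentiableAt ℂ f z) :
    px f z = deriv f z := by
  rw [px, fderiv_of_differentiableAt hf, one_mul]

lemma py_of_differentiableAt {f : ℂ → ℂ} {z : ℂ} (hf : DifferentiableAt ℂ f z) :
    py f z = Complex.I * deriv f z := by
  rw [py, fderiv_of_differentiableAt hf]

lemma dz_conj_comp {f : ℂ → ℂ} {z : ℂ} (hf : DifferentiableAt ℂ f z) :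
    dz (fun z => (starRingEnd ℂ) (f z)) z = 0 := by
  have h := (Complex.conjCLE.toContinuousLinearMap.hasFDerivAt (x := f z)).comp z
    (hf.restrictScalars ℝ).hasFDerivAt
  have e : (fun z => (starRingEnd ℂ) (f z)) = ⇑(Complex.conjCLE.toContinuousLinearMap) ∘ f := rfl
  simp only [dz, px, py]
  rw [e, h.fderiv]
  simp only [ContinuousLinearMap.comp_apply, fderiv_of_differentiableAt hf]
  simp only [ContinuousLinearEquiv.coe_coe, Complex.conjCLE_apply, map_mul, Complex.conj_I, map_one]
  linear_combination ((starRingEnd ℂ) (deriv f z) / 2) * Complex.I_mul_I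

lemma dz_comp {g f : ℂ → ℂ} {z : ℂ} (hg : ContDiff ℝ ∞ g) (hf : DifferentiableAt ℂ f z) :
    dz (fun z => g (f z)) z = deriv f z * dz g (f z) := by
  have h := (hasFDerivAt_of_smooth hg (f z)).comp z (hf.restrictScalars ℝ).hasFDerivAt
  have e : (fun z => g (f z)) = g ∘ f := rfl
  simp only [dz]
  rw [px, py, e, h.fderiv]
  simp only [ContinuousLinearMap.comp_apply, fderiv_of_differentiableAt hf, one_mul]
  rw [fderiv_eq_px_py g (f z) (deriv f z), fderiv_eq_px_py g (f z) (Complex.I * deriv f z)]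
  simp only [Complex.real_smul, Complex.mul_re, Complex.mul_im, Complex.I_re, Complex.I_im]
  have := Complex.re_add_im (deriv f z)
  simp only [zero_mul, one_mul, zero_add, zero_sub, Complex.ofReal_neg]
  linear_combination (px g (f z) / 2 - Complex.I * py g (f z) / 2) * this
    + ((deriv f z).im * py g (f z) / 2) * Complex.I_mul_I

lemma contDiff_conj : ContDiff ℝ ∞ (fun z : ℂ => (starRingEnd ℂ) z) :=
  Complex.conjCLE.contDiff

end Wirtinger

section Kernel

/-- The auxiliary function `1 / (|a|² + δ)`. -/
def kerN (δ : ℝ) (a : ℂ) : ℂ := (a * (starRingEnd ℂ) a + δ)⁻¹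

def kerG (δ : ℝ) (a : ℂ) : ℂ := a * a * kerN δ a

def kerG1 (δ : ℝ) (a : ℂ) : ℂ :=
  2 * a * kerN δ a - a * a * (starRingEnd ℂ) a * kerN δ a * kerN δ a

variable {δ : ℝ}

lemma kerN_eq (δ : ℝ) (a : ℂ) : kerN δ a = (((‖a‖ ^ 2 + δ)⁻¹ : ℝ) : ℂ) := by
  rw [kerN, Complex.mul_conj, Complex.normSq_eq_norm_sq]; push_cast; rfl

lemma kerN_denom_ne (hδ : 0 < δ) (a : ℂ) : a * (starRingEnd ℂ) a + δ ≠ 0 := by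
  rw [Complex.mul_conj, Complex.normSq_eq_norm_sq]
  norm_cast
  positivity

lemma contDiff_kerN (hδ : 0 < δ) : ContDiff ℝ ∞ (kerN δ) :=
  ((contDiff_id.mul contDiff_conj).add contDiff_const).inv fun a => kerN_denom_ne hδ a

lemma contDiff_kerG (hδ : 0 < δ) : ContDiff ℝ ∞ (kerG δ) :=
  (contDiff_id.mul contDiff_id).mul (contDiff_kerN hδ)

lemma contDiff_kerG1 (hδ : 0 < δ) : ContDiff ℝ ∞ (kerG1 δ) :=
  ((contDiff_const.mul contDiff_id).mul (contDiff_kerN hδ)).sub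
    ((((contDiff_id.mul contDiff_id).mul contDiff_conj).mul (contDiff_kerN hδ)).mul
      (contDiff_kerN hδ))

lemma dz_conj (z : ℂ) : dz (fun z => (starRingEnd ℂ) z) z = 0 :=
  dz_conj_comp differentiableAt_fun_id

lemma dz_kerN (hδ : 0 < δ) (a : ℂ) :
    dz (kerN δ) a = -((starRingEnd ℂ) a * kerN δ a * kerN δ a) := by
  have hid : ContDiff ℝ ∞ (fun z : ℂ => z) := contDiff_id
  have h : kerN δ * ((fun z => z) * (fun z => (starRingEnd ℂ) z) + fun _ => (δ : ℂ)) =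
      fun _ => 1 := by
    ext a; exact inv_mul_cancel₀ (kerN_denom_ne hδ a)
  have h1 := congrArg (fun F => dz F a) h
  simp only [dz_const] at h1
  rw [dz_mul (contDiff_kerN hδ) (cdAdd (cdMul hid contDiff_conj) contDiff_const),
    dz_add (cdMul hid contDiff_conj) contDiff_const, dz_mul hid contDiff_conj, dz_id, dz_conj,
    dz_const] at h1
  have h2 := congrFun h a
  simp only [Pi.mul_apply, Pi.add_apply] at h1 h2
  linear_combination kerN δ a * h1 - dz (kerN δ) a * h2

lemma dz_kerG (hδ : 0 < δ) (a : ℂ) : dz (kerG δ) a = kerG1 δ a := by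
  have hid : ContDiff ℝ ∞ (fun z : ℂ => z) := contDiff_id
  have e : kerG δ = (fun z => z) * (fun z => z) * kerN δ := rfl
  rw [e, dz_mul (cdMul hid hid) (contDiff_kerN hδ), dz_mul hid hid, dz_id, dz_kerN hδ, kerG1]
  simp only [Pi.mul_apply]
  ring

lemma dz_kerG1 (hδ : 0 < δ) (a : ℂ) : dz (kerG1 δ) a = 2 * δ ^ 2 * kerN δ a ^ 3 := by
  have hid : ContDiff ℝ ∞ (fun z : ℂ => z) := contDiff_id
  have hN := contDiff_kerN hδ
  have e : kerG1 δ = (fun _ => 2) * (fun z => z) * kerN δ -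
    (fun z => z) * (fun z => z) * (fun z => (starRingEnd ℂ) z) * kerN δ * kerN δ := rfl
  rw [e, dz_sub (cdMul (cdMul contDiff_const hid) hN)
    (cdMul (cdMul (cdMul (cdMul hid hid) contDiff_conj) hN) hN),
    dz_mul (cdMul contDiff_const hid) hN, dz_mul contDiff_const hid,
    dz_mul (cdMul (cdMul (cdMul hid hid) contDiff_conj) hN) hN,
    dz_mul (cdMul (cdMul hid hid) contDiff_conj) hN, dz_mul (cdMul hid hid) contDiff_conj,
    dz_mul hid hid, dz_id, dz_conj, dz_const, dz_kerN hδ]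
  simp only [Pi.mul_apply]
  have h : kerN δ a * (a * (starRingEnd ℂ) a + δ) = 1 := inv_mul_cancel₀ (kerN_denom_ne hδ a)
  have h' : a * (starRingEnd ℂ) a * kerN δ a = 1 - δ * kerN δ a := by linear_combination h
  linear_combination (-4 * kerN δ a + 2 * kerN δ a *
    (a * (starRingEnd ℂ) a * kerN δ a + 1 - δ * kerN δ a)) * h'

lemma norm_kerG_le (hδ : 0 < δ) (a : ℂ) : ‖kerG δ a‖ ≤ 1 := by
  rw [kerG, kerN_eq, norm_mul, norm_mul, Complex.norm_real, Real.norm_of_nonneg (by positivity),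
    ← sq, ← div_eq_mul_inv, div_le_one (by positivity)]
  linarith

end Kernel

/-- The length of the planar gradient. -/
def gradNorm (f : ℂ → ℝ) (z : ℂ) : ℝ := √(px f z ^ 2 + py f z ^ 2)

lemma continuous_gradNorm {f : ℂ → ℝ} (hf : ContDiff ℝ ∞ f) : Continuous (gradNorm f) :=
  (((contDiff_px hf).continuous.pow 2).add ((contDiff_py hf).continuous.pow 2)).sqrt

lemma gradNorm_sq (f : ℂ → ℝ) (z : ℂ) : gradNorm f z ^ 2 = px f z ^ 2 + py f z ^ 2 :=
  Real.sq_sqrt (by positivity)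

section Kernel

variable {f : ℂ → ℝ} {Φ : ℂ → ℂ} {δ : ℝ}

lemma px_ofReal (hf : ContDiff ℝ ∞ f) (z : ℂ) : px (fun z => (f z : ℂ)) z = px f z := by
  have h := (Complex.ofRealCLM.hasFDerivAt (x := f z)).comp z (hasFDerivAt_of_smooth hf z)
  have e : (fun z => (f z : ℂ)) = ⇑Complex.ofRealCLM ∘ f := rfl
  rw [px, e, h.fderiv]; rfl

lemma py_ofReal (hf : ContDiff ℝ ∞ f) (z : ℂ) : py (fun z => (f z : ℂ)) z = py f z := by
  have h := (Complex.ofRealCLM.hasFDerivAt (x := f z)).comp z (hasFDerivAt_of_smooth hf z)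
  have e : (fun z => (f z : ℂ)) = ⇑Complex.ofRealCLM ∘ f := rfl
  rw [py, e, h.fderiv]; rfl

lemma contDiff_ofReal (hf : ContDiff ℝ ∞ f) : ContDiff ℝ ∞ (fun z => (f z : ℂ)) :=
  Complex.ofRealCLM.contDiff.comp hf

lemma norm_dz_ofReal (hf : ContDiff ℝ ∞ f) (z : ℂ) :
    ‖dz (fun z => (f z : ℂ)) z‖ = gradNorm f z / 2 := by
  rw [dz, px_ofReal hf, py_ofReal hf, norm_div, gradNorm, Complex.norm_def, Complex.normSq_apply]
  congr 2
  · simp; ring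
  · simp

/-- The density `f |Φ'|²`. -/
def isoA (f : ℂ → ℝ) (Φ : ℂ → ℂ) (z : ℂ) : ℂ := f z * (starRingEnd ℂ) (px Φ z) * px Φ z

def isoB (f : ℂ → ℝ) (Φ : ℂ → ℂ) (z : ℂ) : ℂ :=
  dz (fun z => (f z : ℂ)) z * (starRingEnd ℂ) (px Φ z)

lemma integral_kernel_parts (hf : ContDiff ℝ ∞ f) (hc : HasCompactSupport f)
    (hΦ : ContDiff ℝ ∞ Φ) (hol : ∀ z ∈ tsupport f, ∀ᶠ z' in nhds z, DifferentiableAt ℂ Φ z')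
    {g g' : ℂ → ℂ} (hg : ContDiff ℝ ∞ g) (hg' : Continuous g') (hgg : ∀ a, dz g a = g' a) (c : ℂ) :
    ∫ z, isoA f Φ z * g' (Φ z - c) = -∫ z, isoB f Φ z * g (Φ z - c) := by
  have hfc := contDiff_ofReal hf
  have hP := contDiff_px hΦ
  have hPc : ContDiff ℝ ∞ (fun z => (starRingEnd ℂ) (px Φ z)) := contDiff_conj.comp hP
  have hG : ContDiff ℝ ∞ (fun z => g (Φ z - c)) := hg.comp (hΦ.sub contDiff_const)
  have hfcc : HasCompactSupport (fun z => (f z : ℂ)) :=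
    hc.comp_left (g := fun x : ℝ => (x : ℂ)) (by simp)
  set F : ℂ → ℂ := (fun z => (f z : ℂ)) * (fun z => (starRingEnd ℂ) (px Φ z)) *
    (fun z => g (Φ z - c)) with hF
  have hFs : ContDiff ℝ ∞ F := cdMul (cdMul hfc hPc) hG
  have hFc : HasCompactSupport F := (hfcc.mul_right).mul_right
  have hAc : HasCompactSupport (fun z => isoA f Φ z * g' (Φ z - c)) :=
    ((hfcc.mul_right).mul_right).mul_right
  have hBc : HasCompactSupport (fun z => isoB f Φ z * g (Φ z - c)) :=
    ((hasCompactSupport_dz hfcc).mul_right).mul_right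
  have hA : Integrable (fun z => isoA f Φ z * g' (Φ z - c)) :=
    Continuous.integrable_of_hasCompactSupport
      (((hfc.continuous.mul hPc.continuous).mul hP.continuous).mul
        (hg'.comp (hΦ.continuous.sub continuous_const))) hAc
  have hB : Integrable (fun z => isoB f Φ z * g (Φ z - c)) :=
    Continuous.integrable_of_hasCompactSupport
      (((contDiff_dz hfc).continuous.mul hPc.continuous).mul hG.continuous) hBc
  have key : ∀ z, dz F z = isoB f Φ z * g (Φ z - c) + isoA f Φ z * g' (Φ z - c) := by
    intro z
    by_cases hz : z ∈ tsupport f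
    · have h1 := (hol z hz).self_of_nhds
      have h2 : px Φ =ᶠ[nhds z] deriv Φ := by
        filter_upwards [hol z hz] with x hx using px_of_differentiableAt hx
      have h3 : DifferentiableAt ℂ (px Φ) z := by
        refine DifferentiableAt.congr_of_eventuallyEq ?_ h2
        have : AnalyticAt ℂ Φ z := Complex.analyticAt_iff_eventually_differentiableAt.2 (hol z hz)
        exact this.deriv.differentiableAt
      have h4 : DifferentiableAt ℂ (fun z => Φ z - c) z := h1.sub_const c
      rw [hF, dz_mul (cdMul hfc hPc) hG, dz_mul hfc hPc, dz_conj_comp h3,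
        dz_comp (f := fun z => Φ z - c) hg h4, hgg, deriv_sub_const, ← h2.self_of_nhds]
      simp only [Pi.mul_apply, isoA, isoB]
      ring
    · have hz' : z ∉ tsupport (fun z => (f z : ℂ)) := fun h => hz
        (closure_mono (fun x hx => by simpa using hx) h)
      have hz'' : z ∉ tsupport F := fun h => hz' (closure_mono (fun x hx => by
        intro h0; apply hx; simp only [hF, Pi.mul_apply, h0, zero_mul]) h)
      have h0 : (f z : ℂ) = 0 := image_eq_zero_of_notMem_tsupport (f := fun z => (f z : ℂ)) hz'
      simp [dz, isoA, isoB, px_eq_zero_of_notMem hz', py_eq_zero_of_notMem hz',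
        px_eq_zero_of_notMem hz'', py_eq_zero_of_notMem hz'', h0]
  have h := integral_dz_eq_zero hFs hFc
  simp only [key] at h
  rw [integral_add hB hA] at h
  linear_combination h

lemma continuous_isoA (hf : ContDiff ℝ ∞ f) (hΦ : ContDiff ℝ ∞ Φ) : Continuous (isoA f Φ) :=
  ((contDiff_ofReal hf).continuous.mul (contDiff_conj.comp (contDiff_px hΦ)).continuous).mul
    (contDiff_px hΦ).continuous

lemma continuous_isoB (hf : ContDiff ℝ ∞ f) (hΦ : ContDiff ℝ ∞ Φ) : Continuous (isoB f Φ) :=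
  (contDiff_dz (contDiff_ofReal hf)).continuous.mul
    (contDiff_conj.comp (contDiff_px hΦ)).continuous

lemma hasCompactSupport_isoA (hc : HasCompactSupport f) : HasCompactSupport (isoA f Φ) :=
  ((hc.comp_left (g := fun x : ℝ => (x : ℂ)) (by simp)).mul_right).mul_right

lemma hasCompactSupport_isoB (hc : HasCompactSupport f) : HasCompactSupport (isoB f Φ) :=
  (hasCompactSupport_dz (hc.comp_left (g := fun x : ℝ => (x : ℂ)) (by simp))).mul_right

lemma hasCompactSupport_uncurry {A B : ℂ → ℂ} {k : ℂ → ℂ → ℂ} (hA : HasCompactSupport A)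
    (hB : HasCompactSupport B) :
    HasCompactSupport (Function.uncurry fun z ζ => A z * B ζ * k z ζ) := by
  refine HasCompactSupport.intro (IsCompact.prod hA hB) fun p hp => ?_
  rw [Set.mem_prod, not_and_or] at hp
  rcases hp with h | h
  · simp [Function.uncurry, image_eq_zero_of_notMem_tsupport h]
  · simp [Function.uncurry, image_eq_zero_of_notMem_tsupport h]

lemma integral_kernel_eq (hf : ContDiff ℝ ∞ f) (hc : HasCompactSupport f)
    (hΦ : ContDiff ℝ ∞ Φ) (hol : ∀ z ∈ tsupport f, ∀ᶠ z' in nhds z, DifferentiableAt ℂ Φ z')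
    (hδ : 0 < δ) :
    ∫ z, ∫ ζ, isoA f Φ z * isoA f Φ ζ * (2 * δ ^ 2 * kerN δ (Φ ζ - Φ z) ^ 3) =
      -∫ ζ, ∫ z, isoB f Φ z * isoB f Φ ζ * kerG δ (Φ ζ - Φ z) := by
  have hA := continuous_isoA hf hΦ
  have hB := continuous_isoB hf hΦ
  have hG1 := (contDiff_kerG1 hδ).continuous
  have hN := (contDiff_kerN hδ).continuous
  have odd1 : ∀ a, kerG1 δ (-a) = -kerG1 δ a := by
    intro a; simp only [kerG1, kerN, map_neg, neg_mul_neg]; ring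
  have even1 : ∀ a, kerG δ (-a) = kerG δ a := by
    intro a; simp only [kerG, kerN, map_neg, neg_mul_neg]
  have s1 : ∀ z, ∫ ζ, isoA f Φ z * isoA f Φ ζ * (2 * δ ^ 2 * kerN δ (Φ ζ - Φ z) ^ 3) =
      ∫ ζ, isoA f Φ z * isoB f Φ ζ * (-kerG1 δ (Φ ζ - Φ z)) := by
    intro z
    have := integral_kernel_parts hf hc hΦ hol (contDiff_kerG1 hδ)
      (g' := fun a => 2 * δ ^ 2 * kerN δ a ^ 3) (by fun_prop) (dz_kerG1 hδ) (Φ z)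
    simp only [mul_assoc, integral_const_mul] at this ⊢
    rw [this]
    simp only [mul_neg, integral_neg]
  have s2 : ∀ ζ, ∫ z, isoA f Φ z * isoB f Φ ζ * (-kerG1 δ (Φ ζ - Φ z)) =
      -∫ z, isoB f Φ z * isoB f Φ ζ * kerG δ (Φ ζ - Φ z) := by
    intro ζ
    have := integral_kernel_parts hf hc hΦ hol (contDiff_kerG hδ)
      (g' := kerG1 δ) hG1 (dz_kerG hδ) (Φ ζ)
    have e1 : ∀ z, isoA f Φ z * isoB f Φ ζ * (-kerG1 δ (Φ ζ - Φ z)) =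
        isoB f Φ ζ * (isoA f Φ z * kerG1 δ (Φ z - Φ ζ)) := by
      intro z; rw [← odd1, neg_sub]; ring
    have e2 : ∀ z, isoB f Φ z * isoB f Φ ζ * kerG δ (Φ ζ - Φ z) =
        isoB f Φ ζ * (isoB f Φ z * kerG δ (Φ z - Φ ζ)) := by
      intro z; rw [← even1, neg_sub]; ring
    simp only [e1, e2, integral_const_mul]
    rw [this]; ring
  simp only [s1]
  rw [integral_integral_swap_of_hasCompactSupport]
  · simp only [s2, integral_neg]
  · have h1 : Continuous fun p : ℂ × ℂ => Φ p.2 - Φ p.1 :=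
      (hΦ.continuous.comp continuous_snd).sub (hΦ.continuous.comp continuous_fst)
    exact ((hA.comp continuous_fst).mul (hB.comp continuous_snd)).mul (hG1.comp h1).neg
  · exact hasCompactSupport_uncurry (hasCompactSupport_isoA hc) (hasCompactSupport_isoB hc)

lemma norm_isoB (hf : ContDiff ℝ ∞ f) (z : ℂ) :
    ‖isoB f Φ z‖ = gradNorm f z * ‖px Φ z‖ / 2 := by
  rw [isoB, norm_mul, norm_dz_ofReal hf, RCLike.norm_conj]; ring

lemma norm_integral_kernel_le (hf : ContDiff ℝ ∞ f) (hc : HasCompactSupport f)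
    (hΦ : ContDiff ℝ ∞ Φ) (hol : ∀ z ∈ tsupport f, ∀ᶠ z' in nhds z, DifferentiableAt ℂ Φ z')
    (hδ : 0 < δ) :
    ‖∫ z, ∫ ζ, isoA f Φ z * isoA f Φ ζ * (2 * δ ^ 2 * kerN δ (Φ ζ - Φ z) ^ 3)‖ ≤
      (∫ z, gradNorm f z * ‖px Φ z‖) ^ 2 / 4 := by
  rw [integral_kernel_eq hf hc hΦ hol hδ, norm_neg]
  have hBi : Integrable (fun z => ‖isoB f Φ z‖) :=
    ((continuous_isoB hf hΦ).integrable_of_hasCompactSupport (hasCompactSupport_isoB hc)).norm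
  have inner : ∀ ζ, ‖∫ z, isoB f Φ z * isoB f Φ ζ * kerG δ (Φ ζ - Φ z)‖ ≤
      ‖isoB f Φ ζ‖ * ∫ z, ‖isoB f Φ z‖ := by
    intro ζ
    rw [← integral_const_mul]
    refine norm_integral_le_of_norm_le (hBi.const_mul _) (Filter.Eventually.of_forall fun z => ?_)
    rw [norm_mul, norm_mul, mul_comm ‖isoB f Φ z‖]
    exact mul_le_of_le_one_right (by positivity) (norm_kerG_le hδ _)
  refine (norm_integral_le_of_norm_le (hBi.mul_const _)
    (Filter.Eventually.of_forall inner)).trans (le_of_eq ?_)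
  rw [integral_mul_const]
  simp only [norm_isoB hf]
  rw [integral_div]; ring

end Kernel

lemma integral_radial_bubble {c : ℝ} (hc : 0 < c) :
    ∫ η : ℂ, 2 / (c * ‖η‖ ^ 2 + 1) ^ 3 = π / c := by
  have h1 := integral_fun_norm_addHaar (volume : Measure ℂ) (fun r : ℝ => 2 / (c * r ^ 2 + 1) ^ 3)
  have h2 : ∫ r in Set.Ioi (0 : ℝ), r * (2 / (c * r ^ 2 + 1) ^ 3) = 1 / (2 * c) := by
    have hd : ∀ r : ℝ, HasDerivAt (fun r : ℝ => -(1 / (2 * c)) * ((c * r ^ 2 + 1) ^ 2)⁻¹)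
        (r * (2 / (c * r ^ 2 + 1) ^ 3)) r := by
      intro r
      have hp : (c * r ^ 2 + 1) ≠ 0 := by positivity
      have h := ((((hasDerivAt_id r).pow 2).const_mul c).add_const 1).pow 2 |>.inv
        (pow_ne_zero 2 hp) |>.const_mul (-(1 / (2 * c)))
      refine h.congr_deriv ?_
      simp
      field_simp
    have hlim : Filter.Tendsto (fun r : ℝ => -(1 / (2 * c)) * ((c * r ^ 2 + 1) ^ 2)⁻¹)
        Filter.atTop (nhds (-(1 / (2 * c)) * 0)) := by
      refine Filter.Tendsto.const_mul _ (Filter.Tendsto.comp tendsto_inv_atTop_zero ?_)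
      refine (Filter.tendsto_pow_atTop two_ne_zero).comp ?_
      exact Filter.tendsto_atTop_add_const_right _ _
        ((Filter.tendsto_pow_atTop two_ne_zero).const_mul_atTop hc)
    have h := integral_Ioi_of_hasDerivAt_of_nonneg' (a := 0) (fun r _ => hd r)
      (fun r hr => by have : (0 : ℝ) < r := hr; positivity) hlim
    rw [h]; simp
  rw [h1]
  simp only [Complex.finrank_real_complex, Measure.real, Complex.volume_ball]
  simp only [smul_eq_mul, nsmul_eq_mul, Nat.add_one_sub_one, pow_one, h2]
  simp
  field_simp

lemma lintegral_radial_bubble {c : ℝ} (hc : 0 < c) :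
    ∫⁻ η : ℂ, ENNReal.ofReal (2 / (c * ‖η‖ ^ 2 + 1) ^ 3) = ENNReal.ofReal (π / c) := by
  rw [← integral_radial_bubble hc, ofReal_integral_eq_lintegral_ofReal]
  · refine Integrable.of_integral_ne_zero ?_
    rw [integral_radial_bubble hc]; positivity
  · exact Filter.Eventually.of_forall fun η => by positivity

variable {f : ℂ → ℝ} {Φ : ℂ → ℂ}

/-- Real form of the density. -/
lemma isoA_eq (z : ℂ) : isoA f Φ z = ((f z * ‖px Φ z‖ ^ 2 : ℝ) : ℂ) := by
  rw [isoA, mul_assoc, mul_comm ((starRingEnd ℂ) _), Complex.mul_conj, Complex.normSq_eq_norm_sq]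
  push_cast; rfl

/-- The rescaled kernel integrand. -/
def isoK (f : ℂ → ℝ) (Φ : ℂ → ℂ) (ε : ℝ) (z η : ℂ) : ℝ :=
  f z * ‖px Φ z‖ ^ 2 * (f (z + ε • η) * ‖px Φ (z + ε • η)‖ ^ 2) *
    (2 / (‖(Φ (z + ε • η) - Φ z)‖ ^ 2 / ε ^ 2 + 1) ^ 3)

lemma isoK_scale {ε : ℝ} (hε : 0 < ε) (z : ℂ) :
    ∫ η, isoK f Φ ε z η = (∫ ζ, isoA f Φ z * isoA f Φ ζ *
      (2 * ((ε ^ 2 : ℝ) : ℂ) ^ 2 * kerN (ε ^ 2) (Φ ζ - Φ z) ^ 3)).re := by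
  have e : ∀ ζ, isoA f Φ z * isoA f Φ ζ *
      (2 * ((ε ^ 2 : ℝ) : ℂ) ^ 2 * kerN (ε ^ 2) (Φ ζ - Φ z) ^ 3) =
      ((f z * ‖px Φ z‖ ^ 2 * (f ζ * ‖px Φ ζ‖ ^ 2) *
        (2 * (ε ^ 2) ^ 2 * ((‖Φ ζ - Φ z‖ ^ 2 + ε ^ 2)⁻¹) ^ 3) : ℝ) : ℂ) := by
    intro ζ; rw [isoA_eq, isoA_eq, kerN_eq]; push_cast; ring
  simp only [e]
  rw [integral_complex_ofReal, Complex.ofReal_re]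
  set G : ℂ → ℝ := fun ζ => f z * ‖px Φ z‖ ^ 2 * (f ζ * ‖px Φ ζ‖ ^ 2) *
        (2 * (ε ^ 2) ^ 2 * ((‖Φ ζ - Φ z‖ ^ 2 + ε ^ 2)⁻¹) ^ 3) with hG
  have h1 : ∀ η, isoK f Φ ε z η = ε ^ 2 * G (z + ε • η) := by
    intro η
    simp only [isoK, hG]
    field_simp
  simp only [h1]
  rw [integral_const_mul, Measure.integral_comp_smul_of_nonneg volume (fun ξ => G (z + ξ)) ε (hR := hε.le),
    integral_add_left_eq_self G z]
  simp [Complex.finrank_real_complex]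
  field_simp

lemma isoK_nonneg (hf0 : ∀ z, 0 ≤ f z) (ε : ℝ) (z η : ℂ) : 0 ≤ isoK f Φ ε z η := by
  have := hf0 z; have := hf0 (z + ε • η)
  unfold isoK; positivity

lemma tendsto_isoK (hf : ContDiff ℝ ∞ f) (hΦ : ContDiff ℝ ∞ Φ)
    (hol : ∀ z ∈ tsupport f, ∀ᶠ z' in nhds z, DifferentiableAt ℂ Φ z') {ε : ℕ → ℝ}
    (hε : ∀ n, 0 < ε n) (hε0 : Filter.Tendsto ε Filter.atTop (nhds 0)) (z η : ℂ) :
    Filter.Tendsto (fun n => isoK f Φ (ε n) z η) Filter.atTop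
      (nhds ((f z * ‖px Φ z‖ ^ 2) ^ 2 * (2 / (‖px Φ z‖ ^ 2 * ‖η‖ ^ 2 + 1) ^ 3))) := by
  by_cases hz : z ∈ tsupport f
  swap
  · simp [isoK, image_eq_zero_of_notMem_tsupport hz]
  have hεη : Filter.Tendsto (fun n => z + ε n • η) Filter.atTop (nhds z) := by
    simpa using (hε0.smul_const η).const_add z
  have h1 := (hf.continuous.tendsto z).comp hεη
  have h2 := ((contDiff_px hΦ).continuous.norm.tendsto z).comp hεη
  have hd := (hol z hz).self_of_nhds
  have h3 : Filter.Tendsto (fun n => ‖Φ (z + ε n • η) - Φ z‖ ^ 2 / (ε n) ^ 2) Filter.atTop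
      (nhds (‖px Φ z‖ ^ 2 * ‖η‖ ^ 2)) := by
    have hl : HasLineDerivAt ℝ Φ (η * deriv Φ z) z η := by
      have := (hasFDerivAt_of_smooth hΦ z).hasLineDerivAt η
      rwa [fderiv_of_differentiableAt hd] at this
    have h4 := (hl.tendsto_slope_zero).comp (tendsto_nhdsWithin_iff.2
      ⟨hε0, Filter.Eventually.of_forall fun n => (hε n).ne'⟩)
    have h5 := (h4.norm).pow 2
    rw [px_of_differentiableAt hd, ← mul_pow, mul_comm ‖deriv Φ z‖, ← norm_mul]
    refine h5.congr fun n => ?_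
    simp only [Function.comp, norm_smul, norm_inv, Real.norm_of_nonneg (hε n).le]
    have := (hε n).ne'
    field_simp
  have h6 := ((h1.mul (h2.pow 2)).const_mul (f z * ‖px Φ z‖ ^ 2)).mul
    ((tendsto_const_nhds (x := (2 : ℝ))).div ((h3.add_const 1).pow 3) (by positivity))
  rw [sq (f z * ‖px Φ z‖ ^ 2)]
  exact h6

/-- The planar isoperimetric inequality, in functional form, for the flat metric `|Φ'|²|dz|²`. -/
theorem isoperimetric (hf : ContDiff ℝ ∞ f) (hc : HasCompactSupport f) (hf0 : ∀ z, 0 ≤ f z)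
    (hΦ : ContDiff ℝ ∞ Φ) (hol : ∀ z ∈ tsupport f, ∀ᶠ z' in nhds z, DifferentiableAt ℂ Φ z') :
    4 * π * ∫ z, f z ^ 2 * ‖px Φ z‖ ^ 2 ≤ (∫ z, gradNorm f z * ‖px Φ z‖) ^ 2 := by
  set M := (∫ z, gradNorm f z * ‖px Φ z‖) ^ 2 / 4 with hM
  have hPc := (contDiff_px hΦ).continuous
  have hfi : Integrable (fun z => π * (f z ^ 2 * ‖px Φ z‖ ^ 2)) := by
    refine Continuous.integrable_of_hasCompactSupport
      (continuous_const.mul ((hf.continuous.pow 2).mul (hPc.norm.pow 2))) ?_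
    refine hc.mono fun z hz h => hz ?_
    simp [h]
  set ε : ℕ → ℝ := fun n => 1 / ((n : ℝ) + 1)
  have hε : ∀ n, 0 < ε n := fun n => by positivity
  have hε0 : Filter.Tendsto ε Filter.atTop (nhds 0) := tendsto_one_div_add_atTop_nhds_zero_nat
  have contK : ∀ n, Continuous (Function.uncurry (isoK f Φ (ε n))) := by
    intro n
    have a1 : Continuous fun p : ℂ × ℂ => p.1 + ε n • p.2 := by fun_prop
    have b1 := hf.continuous.comp a1
    have b2 := hPc.comp a1
    have b3 := hΦ.continuous.comp a1
    refine (((hf.continuous.comp continuous_fst).mul ((hPc.comp continuous_fst).norm.pow 2)).mul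
      (b1.mul (b2.norm.pow 2))).mul (continuous_const.div
      (((((b3.sub (hΦ.continuous.comp continuous_fst)).norm.pow 2).div_const _).add
        continuous_const).pow 3) fun p => ?_)
    positivity
  have upper : ∀ n, ∫⁻ z, ∫⁻ η, ENNReal.ofReal (isoK f Φ (ε n) z η) ≤ ENNReal.ofReal M := by
    intro n
    have hcs : HasCompactSupport (Function.uncurry (isoK f Φ (ε n))) := by
      have hcl : Topology.IsClosedEmbedding (fun p : ℂ × ℂ => (p.1, p.1 + ε n • p.2)) := by
        refine ((LinearEquiv.toContinuousLinearEquiv (LinearEquiv.ofBijective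
          ((LinearMap.fst ℝ ℂ ℂ).prod (LinearMap.fst ℝ ℂ ℂ + ε n • LinearMap.snd ℝ ℂ ℂ)) ⟨?_, ?_⟩)
          ).toHomeomorph.isClosedEmbedding)
        · intro p p' h
          simp only [LinearMap.prod_apply, Function.prod, LinearMap.fst_apply, LinearMap.add_apply,
            LinearMap.smul_apply, LinearMap.snd_apply, Prod.mk.injEq] at h
          refine Prod.ext h.1 ?_
          have h2 := h.2
          rw [h.1, add_right_inj] at h2
          exact smul_right_injective ℂ (hε n).ne' h2
        · intro p
          refine ⟨(p.1, (ε n)⁻¹ • (p.2 - p.1)), ?_⟩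
          simp [(hε n).ne']
      have h0 : HasCompactSupport (fun p : ℂ × ℂ => f p.1 * f p.2) := by
        refine HasCompactSupport.intro (IsCompact.prod hc hc) fun p hp => ?_
        rw [Set.mem_prod, not_and_or] at hp
        rcases hp with h | h
        · simp [image_eq_zero_of_notMem_tsupport h]
        · simp [image_eq_zero_of_notMem_tsupport h]
      refine (h0.comp_isClosedEmbedding hcl).mono fun p hp h => hp ?_
      simp only [Function.comp] at h
      simp only [Function.uncurry, isoK]
      rcases mul_eq_zero.1 h with h | h <;> rw [h] <;> simp
    have hint := (contK n).integrable_of_hasCompactSupport (μ := volume.prod volume) hcs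
    have e1 : ∀ᵐ z : ℂ, ∫⁻ η, ENNReal.ofReal (isoK f Φ (ε n) z η) =
        ENNReal.ofReal (∫ η, isoK f Φ (ε n) z η) := by
      filter_upwards [hint.prod_right_ae] with z hz
      have hz' : Integrable (isoK f Φ (ε n) z) := hz
      rw [ofReal_integral_eq_lintegral_ofReal hz'
        (Filter.Eventually.of_forall fun η => isoK_nonneg hf0 _ _ _)]
    have hint' : Integrable (fun z => ∫ η, isoK f Φ (ε n) z η) := hint.integral_prod_left
    rw [lintegral_congr_ae e1, ← ofReal_integral_eq_lintegral_ofReal hint'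
      (Filter.Eventually.of_forall fun z => integral_nonneg fun η => isoK_nonneg hf0 _ _ _)]
    refine ENNReal.ofReal_le_ofReal ?_
    have hb := norm_integral_kernel_le hf hc hΦ hol (sq_pos_of_pos (hε n))
    refine le_trans ?_ hb
    refine le_trans (le_of_eq ?_) (Complex.re_le_norm _)
    simp only [isoK_scale (hε n)]
    have hreal : ∀ z, ∫ ζ, isoA f Φ z * isoA f Φ ζ *
      (2 * ((ε n ^ 2 : ℝ) : ℂ) ^ 2 * kerN (ε n ^ 2) (Φ ζ - Φ z) ^ 3) =
      ((∫ η, isoK f Φ (ε n) z η : ℝ) : ℂ) := by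
      intro z
      rw [isoK_scale (hε n)]
      have e : ∀ ζ, isoA f Φ z * isoA f Φ ζ *
          (2 * ((ε n ^ 2 : ℝ) : ℂ) ^ 2 * kerN (ε n ^ 2) (Φ ζ - Φ z) ^ 3) =
          ((f z * ‖px Φ z‖ ^ 2 * (f ζ * ‖px Φ ζ‖ ^ 2) *
            (2 * (ε n ^ 2) ^ 2 * ((‖Φ ζ - Φ z‖ ^ 2 + ε n ^ 2)⁻¹) ^ 3) : ℝ) : ℂ) := by
        intro ζ; rw [isoA_eq, isoA_eq, kerN_eq]; push_cast; ring
      simp only [e]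
      rw [integral_complex_ofReal, Complex.ofReal_re]
    simp only [hreal, Complex.ofReal_re]
    rw [integral_complex_ofReal, Complex.ofReal_re]
  have inner : ∀ z, ENNReal.ofReal (π * (f z ^ 2 * ‖px Φ z‖ ^ 2)) ≤
      Filter.liminf (fun n => ∫⁻ η, ENNReal.ofReal (isoK f Φ (ε n) z η)) Filter.atTop := by
    intro z
    refine le_trans ?_ (lintegral_liminf_le fun n =>
      ((contK n).comp (Continuous.prodMk_right z)).measurable.ennreal_ofReal)
    have e1 : ∀ η, Filter.liminf (fun n => ENNReal.ofReal (isoK f Φ (ε n) z η)) Filter.atTop =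
        ENNReal.ofReal ((f z * ‖px Φ z‖ ^ 2) ^ 2) *
          ENNReal.ofReal (2 / (‖px Φ z‖ ^ 2 * ‖η‖ ^ 2 + 1) ^ 3) := by
      intro η
      rw [← ENNReal.ofReal_mul (by positivity)]
      exact (ENNReal.tendsto_ofReal (tendsto_isoK hf hΦ hol hε hε0 z η)).liminf_eq
    rw [lintegral_congr e1, lintegral_const_mul' _ _ ENNReal.ofReal_ne_top]
    by_cases hP : px Φ z = 0
    · simp [hP]
    have hP' : 0 < ‖px Φ z‖ ^ 2 := by positivity
    rw [lintegral_radial_bubble hP', ← ENNReal.ofReal_mul (by positivity)]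
    refine ENNReal.ofReal_le_ofReal (le_of_eq ?_)
    field_simp
  have fin : ENNReal.ofReal (∫ z, π * (f z ^ 2 * ‖px Φ z‖ ^ 2)) ≤ ENNReal.ofReal M := by
    rw [ofReal_integral_eq_lintegral_ofReal hfi (Filter.Eventually.of_forall fun z => by positivity)]
    refine (lintegral_mono inner).trans ((lintegral_liminf_le fun n => ?_).trans ?_)
    · exact Measurable.lintegral_prod_right' (f := fun p : ℂ × ℂ =>
        ENNReal.ofReal (isoK f Φ (ε n) p.1 p.2)) (contK n).measurable.ennreal_ofReal
    · exact Filter.liminf_le_of_frequently_le' (Filter.Frequently.of_forall upper)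
  have hM0 : 0 ≤ M := by positivity
  have := (ENNReal.ofReal_le_ofReal_iff hM0).1 fin
  rw [integral_const_mul] at this
  linarith

section Kernel

lemma contDiff_normSq : ContDiff ℝ ∞ (fun z : ℂ => ‖z‖ ^ 2) := contDiff_norm_sq ℝ

lemma normSq_eq (z : ℂ) : ‖z‖ ^ 2 = z.re ^ 2 + z.im ^ 2 := by
  rw [Complex.sq_norm, Complex.normSq_apply]; ring

lemma px_normSq (z : ℂ) : px (fun z : ℂ => ‖z‖ ^ 2) z = 2 * z.re := by
  unfold px
  rw [((hasStrictFDerivAt_norm_sq z).hasFDerivAt).fderiv]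
  simp [Complex.inner]

lemma py_normSq (z : ℂ) : py (fun z : ℂ => ‖z‖ ^ 2) z = 2 * z.im := by
  unfold py
  rw [((hasStrictFDerivAt_norm_sq z).hasFDerivAt).fderiv]
  simp [Complex.inner]

lemma plap_normSq (z : ℂ) : plap (fun z : ℂ => ‖z‖ ^ 2) z = 4 := by
  unfold plap
  have h1 : px (fun z : ℂ => ‖z‖ ^ 2) = fun z => 2 * z.re := funext px_normSq
  have h2 : py (fun z : ℂ => ‖z‖ ^ 2) = fun z => 2 * z.im := funext py_normSq
  rw [h1, h2]
  unfold px py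
  have e1 : HasFDerivAt (fun z : ℂ => 2 * z.re) ((2 : ℝ) • Complex.reCLM) z :=
    Complex.reCLM.hasFDerivAt.const_mul 2
  have e2 : HasFDerivAt (fun z : ℂ => 2 * z.im) ((2 : ℝ) • Complex.imCLM) z :=
    Complex.imCLM.hasFDerivAt.const_mul 2
  rw [e1.fderiv, e2.fderiv]
  simp; norm_num

/-- A smooth function on the line that is constant near the origin, equals the logarithm beyond
`b`, and whose radial lift is subharmonic. -/
lemma exists_smooth_log {b : ℝ} (hb : 0 < b) : ∃ H : ℝ → ℝ, ContDiff ℝ ∞ H ∧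
    (∀ s, b ≤ s → H s = log s) ∧
    (∀ s, 0 ≤ s * deriv (deriv H) s + deriv H s) ∧
    (∃ s, 0 < s ∧ 0 < s * deriv (deriv H) s + deriv H s) := by
  set ψ : ℝ → ℝ := fun t => smoothTransition (2 * t / b - 1) with hψ
  have hψs : ContDiff ℝ ∞ ψ := by
    refine smoothTransition.contDiff.comp ?_
    fun_prop
  have hψ0 : ∀ t, t ≤ b / 2 → ψ t = 0 := fun t ht => by
    refine smoothTransition.zero_of_nonpos ?_
    rw [sub_nonpos, div_le_one hb]; linarith
  have hψ1 : ∀ t, b ≤ t → ψ t = 1 := fun t ht => by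
    refine smoothTransition.one_of_one_le ?_
    rw [le_sub_iff_add_le, le_div_iff₀ hb]; linarith
  have hmono : Monotone ψ := by
    intro s t hst
    refine smoothTransition.monotone ?_
    gcongr
  set φ : ℝ → ℝ := fun t => ψ t / t with hφ
  have hφs : ContDiff ℝ ∞ φ := by
    rw [contDiff_iff_contDiffAt]
    intro t
    by_cases ht : t < b / 2
    · have : φ =ᶠ[nhds t] fun _ => 0 := by
        filter_upwards [Iio_mem_nhds ht] with s hs
        simp [φ, hψ0 s (le_of_lt hs)]
      exact contDiffAt_const.congr_of_eventuallyEq this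
    · exact hψs.contDiffAt.div contDiffAt_id (fun h => ht (by rw [h]; positivity))
  have hder : ∀ s, HasDerivAt (fun s => log b + ∫ t in b..s, φ t) (φ s) s := fun s =>
    (intervalIntegral.integral_hasDerivAt_right (hφs.continuous.intervalIntegrable _ _)
      (hφs.continuous.stronglyMeasurableAtFilter _ _) hφs.continuous.continuousAt).const_add _
  have hd : deriv (fun s => log b + ∫ t in b..s, φ t) = φ := funext fun s => (hder s).deriv
  have hkey : ∀ s, s * deriv φ s + φ s = deriv ψ s := by
    intro s
    have h1 : HasDerivAt (fun t => t * φ t) (1 * φ s + s * deriv φ s) s :=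
      (hasDerivAt_id s).mul (hφs.differentiable (by simp) s).hasDerivAt
    have h2 : (fun t => t * φ t) = ψ := by
      funext t
      by_cases ht : t = 0
      · rw [ht, hψ0 0 (by positivity)]; simp
      · simp only [φ]; field_simp
    rw [h2] at h1
    rw [h1.deriv]; ring
  refine ⟨fun s => log b + ∫ t in b..s, φ t, ?_, ?_, ?_, ?_⟩
  · rw [contDiff_infty_iff_deriv]
    exact ⟨fun s => (hder s).differentiableAt, by rw [hd]; exact hφs⟩
  · intro s hs
    have : ∫ t in b..s, φ t = ∫ t in b..s, t⁻¹ := by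
      refine intervalIntegral.integral_congr fun t ht => ?_
      rw [Set.uIcc_of_le hs] at ht
      simp [φ, hψ1 t ht.1]
    simp only
    rw [this, integral_inv_of_pos hb (hb.trans_le hs), Real.log_div (hb.trans_le hs).ne' hb.ne']
    ring
  · intro s
    rw [hd, hkey]
    exact hmono.deriv_nonneg
  · obtain ⟨s, hs, hs'⟩ := exists_deriv_eq_slope ψ (show b / 2 < b by linarith)
      hψs.continuous.continuousOn ((hψs.differentiable (by simp)).differentiableOn)
    refine ⟨s, by linarith [hs.1], ?_⟩
    rw [hd, hkey, hs', hψ1 b le_rfl, hψ0 (b / 2) le_rfl]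
    have : 0 < b - b / 2 := by linarith
    positivity

lemma exists_log_kernel {δ R : ℝ} (hδ : 0 < δ) (hR : δ < R) : ∃ g : ℂ → ℝ, ContDiff ℝ ∞ g ∧
    HasCompactSupport g ∧ (∀ z, ‖z‖ < R → 0 ≤ -plap g z) ∧
    (∀ z, δ < ‖z‖ → ‖z‖ < R → plap g z = 0) ∧
    (∀ z, δ ≤ ‖z‖ → ‖z‖ < R → g z = -log ‖z‖) ∧
    ∃ z, ‖z‖ < R ∧ 0 < -plap g z := by
  obtain ⟨H, hH, hlog, hnn, s₀, hs₀, hpos⟩ := exists_smooth_log (b := δ ^ 2) (by positivity)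
  have hR0 : 0 < R := hδ.trans hR
  let χ : ContDiffBump (0 : ℂ) := ⟨R, R + 1, hR0, by linarith⟩
  have hc : ContDiff ℝ ∞ (fun z : ℂ => -(1 / 2) * H (‖z‖ ^ 2)) :=
    contDiff_const.mul (hH.comp contDiff_normSq)
  have hpl : ∀ z, plap (fun z : ℂ => -(1 / 2) * H (‖z‖ ^ 2)) z =
      -2 * (‖z‖ ^ 2 * deriv (deriv H) (‖z‖ ^ 2) + deriv H (‖z‖ ^ 2)) := by
    intro z
    have := plap_comp (χ := fun s => -(1 / 2) * H s) (contDiff_const.mul hH) contDiff_normSq z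
    rw [this, px_normSq, py_normSq, plap_normSq]
    have e1 : deriv (fun s => -(1 / 2 : ℝ) * H s) = fun s => -(1 / 2) * deriv H s := by
      funext s; rw [deriv_const_mul _ (hH.differentiable (by simp) s)]
    rw [e1, deriv_const_mul _ ((contDiff_deriv hH).differentiable (by simp) _), normSq_eq z]
    ring
  have heq : ∀ z, ‖z‖ < R → (fun z : ℂ => χ z * (-(1 / 2) * H (‖z‖ ^ 2))) =ᶠ[nhds z]
      fun z : ℂ => -(1 / 2) * H (‖z‖ ^ 2) := by
    intro z hz
    filter_upwards [(isOpen_lt continuous_norm continuous_const).mem_nhds hz] with z' hz'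
    rw [χ.one_of_mem_closedBall (by simpa [χ] using (le_of_lt hz')), one_mul]
  have hplR : ∀ z, ‖z‖ < R → plap (fun z : ℂ => χ z * (-(1 / 2) * H (‖z‖ ^ 2))) z =
      -2 * (‖z‖ ^ 2 * deriv (deriv H) (‖z‖ ^ 2) + deriv H (‖z‖ ^ 2)) := fun z hz => by
    rw [plap_congr (heq z hz), hpl]
  have hlogH : ∀ s, δ ^ 2 < s → deriv H =ᶠ[nhds s] fun s => s⁻¹ := by
    intro s hs
    filter_upwards [Ioi_mem_nhds hs] with t ht
    have : H =ᶠ[nhds t] log := by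
      filter_upwards [Ioi_mem_nhds ht] with t' ht' using hlog t' (le_of_lt ht')
    rw [this.deriv_eq, Real.deriv_log]
  have hzero : ∀ s, δ ^ 2 < s → s * deriv (deriv H) s + deriv H s = 0 := by
    intro s hs
    have hs0 : s ≠ 0 := by have := sq_nonneg δ; intro h; linarith
    rw [(hlogH s hs).deriv_eq, (hlogH s hs).eq_of_nhds, deriv_inv]
    field_simp
    ring
  refine ⟨fun z => χ z * (-(1 / 2) * H (‖z‖ ^ 2)), χ.contDiff.mul hc,
    χ.hasCompactSupport.mul_right, ?_, ?_, ?_, ?_⟩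
  · intro z hz
    rw [hplR z hz]
    nlinarith [hnn (‖z‖ ^ 2)]
  · intro z hz hz'
    rw [hplR z hz', hzero _ (by gcongr), mul_zero]
  · intro z hz hz'
    have := (heq z hz').eq_of_nhds
    simp only at this ⊢
    rw [this, hlog _ (by gcongr), Real.log_pow]
    push_cast; ring
  · have hs1 : s₀ ≤ δ ^ 2 := by
      by_contra h
      rw [hzero s₀ (not_le.1 h)] at hpos
      exact hpos.false
    have hn : ‖((√s₀ : ℝ) : ℂ)‖ = √s₀ := by
      rw [Complex.norm_real, norm_of_nonneg (Real.sqrt_nonneg _)]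
    have hlt : ‖((√s₀ : ℝ) : ℂ)‖ < R := by
      rw [hn]
      refine lt_of_le_of_lt ?_ hR
      rw [Real.sqrt_le_left hδ.le]; exact hs1
    refine ⟨(√s₀ : ℝ), hlt, ?_⟩
    rw [hplR _ hlt, hn, Real.sq_sqrt hs₀.le]
    linarith

end Kernel

section Potential

/-- The potential of a measure with respect to a translation invariant kernel. -/
def pot (μ : Measure ℂ) (g : ℂ → ℝ) (x : ℂ) : ℝ := ∫ y, g (x - y) ∂μ

variable {μ : Measure ℂ} [IsFiniteMeasure μ] {g : ℂ → ℝ}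

open ContinuousLinearMap Convolution in
lemma pot_eq_convolution (μ : Measure ℂ) (g : ℂ → ℝ) :
    pot μ g = ((fun _ => (1 : ℝ)) ⋆[lsmul ℝ ℝ, μ] g) := by
  funext x
  simp [pot, convolution]

lemma contDiff_pot (hg : ContDiff ℝ ∞ g) (hc : HasCompactSupport g) : ContDiff ℝ ∞ (pot μ g) := by
  rw [pot_eq_convolution]
  exact hc.contDiff_convolution_right _ ((integrable_const _).locallyIntegrable) hg

lemma fderiv_pot (hg : ContDiff ℝ ∞ g) (hc : HasCompactSupport g) (x v : ℂ) :
    fderiv ℝ (pot μ g) x v = pot μ (fun z => fderiv ℝ g z v) x := by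
  have hcont : Continuous (fderiv ℝ g) := hg.continuous_fderiv (by simp)
  obtain ⟨C, hC⟩ := hcont.bounded_above_of_compact_support (hc.fderiv ℝ)
  obtain ⟨C', hC'⟩ := hg.continuous.bounded_above_of_compact_support hc
  have hgc := hg.continuous
  have hi : ∀ x, Integrable (fun y => g (x - y)) μ := fun x =>
    Integrable.of_bound (by fun_prop) C' (Filter.Eventually.of_forall fun y => hC' _)
  have hi' : Integrable (fun y => fderiv ℝ g (x - y)) μ :=
    Integrable.of_bound (Continuous.aestronglyMeasurable (by fun_prop)) C
      (Filter.Eventually.of_forall fun y => hC _)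
  have h := hasFDerivAt_integral_of_dominated_of_fderiv_le (μ := μ) (𝕜 := ℝ)
    (F := fun x y => g (x - y)) (F' := fun x y => fderiv ℝ g (x - y)) (x₀ := x) (s := Set.univ)
    (bound := fun _ => C) Filter.univ_mem
    (Filter.Eventually.of_forall fun x => (hi x).aestronglyMeasurable) (hi x)
    hi'.aestronglyMeasurable (Filter.Eventually.of_forall fun y x _ => hC _) (integrable_const _)
    (Filter.Eventually.of_forall fun y x _ => by
      have := ((hg.differentiable (by simp)) (x - y)).hasFDerivAt
      exact this.comp x ((hasFDerivAt_id x).sub_const y))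
  have h' : fderiv ℝ (pot μ g) x = ∫ y, fderiv ℝ g (x - y) ∂μ := h.fderiv
  rw [h', ContinuousLinearMap.integral_apply hi']
  rfl

lemma plap_pot (hg : ContDiff ℝ ∞ g) (hc : HasCompactSupport g) (x : ℂ) :
    plap (pot μ g) x = pot μ (plap g) x := by
  have h1 : px (pot μ g) = pot μ (px g) := funext fun x => fderiv_pot hg hc x 1
  have h2 : py (pot μ g) = pot μ (py g) := funext fun x => fderiv_pot hg hc x Complex.I
  unfold plap
  rw [h1, h2]
  have h3 := fderiv_pot (μ := μ) (contDiff_px hg) (hasCompactSupport_px hc) x 1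
  have h4 := fderiv_pot (μ := μ) (contDiff_py hg) (hasCompactSupport_py hc) x Complex.I
  have hi : ∀ f : ℂ → ℝ, ContDiff ℝ ∞ f → HasCompactSupport f →
      Integrable (fun y => f (x - y)) μ := by
    intro f hf hcf
    obtain ⟨C, hC⟩ := hf.continuous.bounded_above_of_compact_support hcf
    exact Integrable.of_bound (by have := hf.continuous; fun_prop) C
      (Filter.Eventually.of_forall fun y => hC _)
  unfold px py at *
  rw [h3, h4]
  unfold pot
  rw [integral_add]
  · exact hi _ (contDiff_px (contDiff_px hg)) (hasCompactSupport_px (hasCompactSupport_px hc))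
  · exact hi _ (contDiff_py (contDiff_py hg)) (hasCompactSupport_py (hasCompactSupport_py hc))

/-- Integrating a test function against a smeared measure. -/
lemma abs_integral_mul_pot_sub_le {K : Set ℂ} {B k : ℂ → ℝ} (hk : Continuous k)
    (hkc : HasCompactSupport k) (hB : Continuous B) (hBc : HasCompactSupport B)
    (hμ : μ Kᶜ = 0) {δ R₂ : ℝ} (h0 : ∀ z, ‖z‖ < R₂ → 0 ≤ k z)
    (h1 : ∀ z, δ < ‖z‖ → ‖z‖ < R₂ → k z = 0)
    (hR : ∀ y ∈ K, ∀ x, R₂ ≤ ‖x - y‖ → B x = 0) {ϖ : ℝ}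
    (hϖ : ∀ x y, ‖x - y‖ ≤ δ → |B x - B y| ≤ ϖ) :
    |(∫ x, B x * pot μ k x) - (∫ z in Metric.ball 0 R₂, k z) * ∫ y, B y ∂μ| ≤
      (∫ z in Metric.ball 0 R₂, k z) * ϖ * μ.real Set.univ := by
  set c := ∫ z in Metric.ball 0 R₂, k z with hcdef
  set k' : ℂ → ℝ := (Metric.ball 0 R₂).indicator k with hk'
  have hki : Integrable k := hk.integrable_of_hasCompactSupport hkc
  have hk'i : Integrable k' := hki.indicator measurableSet_ball
  have hc' : ∫ z, k' z = c := integral_indicator measurableSet_ball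
  have hk'0 : ∀ z, 0 ≤ k' z := fun z => by
    refine Set.indicator_nonneg (fun z hz => h0 z (by simpa using hz)) z
  obtain ⟨C, hC⟩ := hk.bounded_above_of_compact_support hkc
  have hBi : Integrable B := hB.integrable_of_hasCompactSupport hBc
  have hprod : Integrable (Function.uncurry fun x y => B x * k (x - y)) (volume.prod μ) := by
    have a1 : Integrable (fun p : ℂ × ℂ => B p.1) (volume.prod μ) := hBi.comp_fst μ
    refine a1.mul_bdd (c := C) ?_ ?_
    · exact (hk.comp (continuous_fst.sub continuous_snd)).aestronglyMeasurable
    · exact Filter.Eventually.of_forall fun p => hC _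
  have e1 : ∫ x, B x * pot μ k x = ∫ y, (∫ x, B x * k (x - y)) ∂μ := by
    rw [← integral_integral_swap hprod]
    simp only [pot, integral_const_mul]
  have hBμ : Integrable B μ := by
    obtain ⟨C, hC⟩ := hB.bounded_above_of_compact_support hBc
    exact Integrable.of_bound hB.aestronglyMeasurable C (Filter.Eventually.of_forall hC)
  have hIr : Integrable (fun y => ∫ x, B x * k (x - y)) μ := hprod.integral_prod_right
  rw [e1, ← integral_const_mul, ← integral_sub hIr (hBμ.const_mul c)]
  have hb : ∀ᵐ y ∂μ, ‖(∫ x, B x * k (x - y)) - c * B y‖ ≤ c * ϖ := by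
    have : ∀ᵐ y ∂μ, y ∈ K := by rw [ae_iff]; exact hμ
    filter_upwards [this] with y hy
    have e2 : ∀ x, B x * k (x - y) = B x * k' (x - y) := by
      intro x
      by_cases hx : ‖x - y‖ < R₂
      · rw [hk', Set.indicator_of_mem (by simpa using hx)]
      · rw [hR y hy x (not_lt.1 hx), zero_mul, zero_mul]
    have hkt : Integrable (fun x => k' (x - y)) := hk'i.comp_sub_right y
    have e3 : c * B y = ∫ x, B y * k' (x - y) := by
      rw [integral_const_mul, integral_sub_right_eq_self (fun x => k' x) y, hc', mul_comm]
    have hint : Integrable (fun x => B x * k' (x - y)) := by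
      obtain ⟨C, hC⟩ := hB.bounded_above_of_compact_support hBc
      exact hkt.bdd_mul (c := C) hB.aestronglyMeasurable (Filter.Eventually.of_forall hC)
    simp_rw [e2]
    rw [e3, ← integral_sub hint (hkt.const_mul _)]
    refine (norm_integral_le_of_norm_le (hkt.const_mul ϖ) (Filter.Eventually.of_forall fun x => ?_)
      ).trans_eq ?_
    · rw [← sub_mul, norm_mul, Real.norm_eq_abs, Real.norm_of_nonneg (hk'0 _)]
      by_cases hx : ‖x - y‖ ≤ δ
      · exact mul_le_mul_of_nonneg_right (hϖ x y hx) (hk'0 _)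
      · have : k' (x - y) = 0 := by
          rw [hk', Set.indicator_apply_eq_zero]
          exact fun h => h1 _ (not_le.1 hx) (by simpa using h)
        rw [this, mul_zero, mul_zero]
    · rw [integral_const_mul, integral_sub_right_eq_self (fun x => k' x) y, hc', mul_comm]
  have := norm_integral_le_of_norm_le_const hb
  rwa [Real.norm_eq_abs] at this

lemma exists_smooth_posPart {τ : ℝ} (hτ : 0 < τ) : ∃ β : ℝ → ℝ, ContDiff ℝ ∞ β ∧ β 0 = 0 ∧
    (∀ t, 0 ≤ deriv β t) ∧ (∀ t, deriv β t ≤ 1) ∧ (∀ t, 0 ≤ deriv (deriv β) t) ∧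
    (∀ t, -τ ≤ β t) ∧ ∀ t, -τ ≤ β t - t := by
  have hpos : ∀ t : ℝ, 0 < t ^ 2 + τ ^ 2 := fun t => by positivity
  have hsq : ∀ t : ℝ, √(t ^ 2 + τ ^ 2) ^ 2 = t ^ 2 + τ ^ 2 := fun t => Real.sq_sqrt (hpos t).le
  have hs0 : ∀ t : ℝ, 0 < √(t ^ 2 + τ ^ 2) := fun t => Real.sqrt_pos.2 (hpos t)
  have habs : ∀ t : ℝ, |t| ≤ √(t ^ 2 + τ ^ 2) := fun t => by
    rw [← Real.sqrt_sq_eq_abs]; exact Real.sqrt_le_sqrt (by nlinarith)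
  have hds : ∀ t : ℝ, HasDerivAt (fun t => √(t ^ 2 + τ ^ 2)) (t / √(t ^ 2 + τ ^ 2)) t := by
    intro t
    have h1 : HasDerivAt (fun t : ℝ => t ^ 2 + τ ^ 2) (2 * t) t := by
      simpa using (hasDerivAt_pow 2 t).add_const (τ ^ 2)
    convert h1.sqrt (hpos t).ne' using 1
    field_simp
  have hβ : ∀ t, HasDerivAt (fun t => (t + √(t ^ 2 + τ ^ 2) - τ) / 2)
      ((1 + t / √(t ^ 2 + τ ^ 2)) / 2) t := fun t =>
    (((hasDerivAt_id t).add (hds t)).sub_const τ).div_const 2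
  have hd : deriv (fun t => (t + √(t ^ 2 + τ ^ 2) - τ) / 2) =
      fun t => (1 + t / √(t ^ 2 + τ ^ 2)) / 2 := funext fun t => (hβ t).deriv
  have hq : ∀ t : ℝ, |t / √(t ^ 2 + τ ^ 2)| ≤ 1 := fun t => by
    rw [abs_div, abs_of_pos (hs0 t), div_le_one (hs0 t)]; exact habs t
  refine ⟨fun t => (t + √(t ^ 2 + τ ^ 2) - τ) / 2, ?_, ?_, ?_, ?_, ?_, ?_, ?_⟩
  · refine ((contDiff_id.add (ContDiff.sqrt (by fun_prop) fun t => (hpos t).ne')).sub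
      contDiff_const).div_const 2
  · simp [Real.sqrt_sq hτ.le]
  · intro t; rw [hd]; have := (abs_le.1 (hq t)).1; simp only; linarith
  · intro t; rw [hd]; have := (abs_le.1 (hq t)).2; simp only; linarith
  · intro t
    rw [hd]
    have h1 := (((hasDerivAt_id t).div (hds t) (hs0 t).ne').const_add 1).div_const 2
    have h2 : deriv (fun t => (1 + t / √(t ^ 2 + τ ^ 2)) / 2) t = _ := h1.deriv
    rw [h2]
    simp only [id]
    have h3 : t * (t / √(t ^ 2 + τ ^ 2)) ≤ √(t ^ 2 + τ ^ 2) := by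
      rw [← mul_div_assoc, div_le_iff₀ (hs0 t)]
      nlinarith [hsq t]
    have : 0 ≤ 1 * √(t ^ 2 + τ ^ 2) - t * (t / √(t ^ 2 + τ ^ 2)) := by linarith
    positivity
  · intro t
    have := (abs_le.1 (habs t)).1
    simp only; linarith
  · intro t
    have := (abs_le.1 (habs t)).2
    simp only; linarith

end Potential

section Compare

variable {μ₁ μ₂ : Measure ℂ} [IsFiniteMeasure μ₁] [IsFiniteMeasure μ₂] {K N : Set ℂ}
  {B₁ B₂ : ℂ → ℝ}

lemma plap_nonneg_comp_mul {β : ℝ → ℝ} (hβ : ContDiff ℝ ∞ β) (h2 : ∀ t, 0 ≤ deriv (deriv β) t)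
    {D : ℂ → ℝ} (hD : ContDiff ℝ ∞ D) (z : ℂ) :
    deriv β (D z) * plap D z ≤ plap (fun z => β (D z)) z := by
  rw [plap_comp hβ hD]
  nlinarith [mul_nonneg (h2 (D z)) (add_nonneg (sq_nonneg (px D z)) (sq_nonneg (py D z)))]

/-- Comparison for smeared measures whose kernel potentials agree away from `K`. -/
lemma integral_mul_pot_le {g : ℂ → ℝ} (hg : ContDiff ℝ ∞ g) (hgc : HasCompactSupport g)
    {D : ℂ → ℝ} (hD : ContDiff ℝ ∞ D) {Kδ : Set ℂ} (hDK : ∀ z, z ∉ Kδ → D z = 0) (hKδ : Kδ ⊆ N)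
    {W : Set ℂ} (hW : IsOpen W) (hDP : ∀ z ∈ W, D z = pot μ₁ g z - pot μ₂ g z)
    (h1 : ∀ z ∈ W, 0 ≤ -plap (pot μ₁ g) z) (h2 : ∀ z ∈ W, 0 ≤ -plap (pot μ₂ g) z)
    (hB₁ : ContDiff ℝ ∞ B₁) (hB₂ : ContDiff ℝ ∞ B₂) (hc₁ : HasCompactSupport B₁)
    (hc₂ : HasCompactSupport B₂) (hW₁ : ∀ z, z ∉ W → B₁ z = 0) (hW₂ : ∀ z, z ∉ W → B₂ z = 0)
    (hle : ∀ z, B₁ z ≤ B₂ z) (hsub : ∀ z ∈ N, 0 ≤ plap B₁ z) (hsup : ∀ z ∈ N, plap B₂ z ≤ 0) :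
    ∫ z, B₁ z * -plap (pot μ₁ g) z ≤ ∫ z, B₂ z * -plap (pot μ₂ g) z := by
  have hP₁ : ContDiff ℝ ∞ (pot μ₁ g) := contDiff_pot hg hgc
  have hP₂ : ContDiff ℝ ∞ (pot μ₂ g) := contDiff_pot hg hgc
  have hint : ∀ {B f : ℂ → ℝ}, ContDiff ℝ ∞ B → HasCompactSupport B → Continuous f →
      Integrable (fun z => B z * f z) := fun hB hBc hf =>
    (hB.continuous.mul hf).integrable_of_hasCompactSupport hBc.mul_right
  have hpD : ∀ z ∈ W, plap D z = plap (pot μ₁ g) z - plap (pot μ₂ g) z := by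
    intro z hz
    have : D =ᶠ[nhds z] pot μ₁ g - pot μ₂ g := by
      filter_upwards [hW.mem_nhds hz] with z' hz' using hDP z' hz'
    rw [plap_congr this, plap_sub hP₁ hP₂]; rfl
  set C := (∫ z, |plap B₁ z|) + ∫ z, |plap B₂ z| with hC
  have hA₁ : Integrable fun z => |plap B₁ z| :=
    ((contDiff_plap hB₁).continuous.integrable_of_hasCompactSupport (hasCompactSupport_plap hc₁)).abs
  have hA₂ : Integrable fun z => |plap B₂ z| :=
    ((contDiff_plap hB₂).continuous.integrable_of_hasCompactSupport (hasCompactSupport_plap hc₂)).abs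
  have key : ∀ τ : ℝ, 0 < τ → ∫ z, B₁ z * -plap (pot μ₁ g) z ≤
      (∫ z, B₂ z * -plap (pot μ₂ g) z) + τ * C := by
    intro τ hτ
    obtain ⟨β, hβ, hβ0, hβ1, hβ2, hβ3, hβ4, hβ5⟩ := exists_smooth_posPart hτ
    set b : ℂ → ℝ := fun z => β (D z) with hb
    have hbs : ContDiff ℝ ∞ b := hβ.comp hD
    have cP₁ := (contDiff_plap hP₁).continuous
    have cP₂ := (contDiff_plap hP₂).continuous
    have cb := (contDiff_plap hbs).continuous
    have cD := (contDiff_plap hD).continuous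
    -- subharmonic barrier against the first potential
    have i1 : -(τ * ∫ z, |plap B₁ z|) ≤ ∫ z, B₁ z * plap b z := by
      rw [green_symm hB₁ hbs hc₁, ← integral_const_mul, ← integral_neg]
      refine integral_mono (hA₁.const_mul τ).neg ?_ fun z => ?_
      · exact ((contDiff_plap hB₁).continuous.mul hbs.continuous).integrable_of_hasCompactSupport
          (hasCompactSupport_plap hc₁).mul_right
      · by_cases hz : z ∈ Kδ
        · have e1 := hsub z (hKδ hz)
          have e2 := hβ4 (D z)
          simp only [abs_of_nonneg e1, hb]
          nlinarith
        · simp only [hb, hDK z hz, hβ0, mul_zero]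
          have := mul_nonneg hτ.le (abs_nonneg (plap B₁ z))
          linarith
    have i2 : ∫ z, B₂ z * (plap b z - plap D z) ≤ τ * ∫ z, |plap B₂ z| := by
      have e : ∀ z, plap b z - plap D z = plap (b - D) z := fun z => by
        rw [plap_sub hbs hD]; rfl
      simp_rw [e]
      rw [green_symm hB₂ (cdSub hbs hD) hc₂, ← integral_const_mul]
      refine integral_mono ?_ (hA₂.const_mul τ) fun z => ?_
      · exact ((contDiff_plap hB₂).continuous.mul (cdSub hbs hD).continuous
          ).integrable_of_hasCompactSupport (hasCompactSupport_plap hc₂).mul_right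
      · by_cases hz : z ∈ Kδ
        · have e1 := hsup z (hKδ hz)
          have e2 := hβ5 (D z)
          simp only [abs_of_nonpos e1, hb, Pi.sub_apply]
          nlinarith
        · simp only [hb, Pi.sub_apply, hDK z hz, hβ0, sub_zero, mul_zero]
          exact mul_nonneg hτ.le (abs_nonneg (plap B₂ z))
    have i3 : ∫ z, B₁ z * (-plap (pot μ₁ g) z + plap b z) ≤
        ∫ z, B₂ z * (-plap (pot μ₁ g) z + plap b z) := by
      refine integral_mono (hint hB₁ hc₁ (cP₁.neg.add cb)) (hint hB₂ hc₂ (cP₁.neg.add cb))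
        fun z => ?_
      by_cases hz : z ∈ W
      · have e1 := plap_nonneg_comp_mul hβ hβ3 hD z
        rw [hpD z hz] at e1
        have e2 : 0 ≤ -plap (pot μ₁ g) z + plap b z := by
          nlinarith [mul_nonneg (hβ1 (D z)) (h2 z hz), mul_nonneg (sub_nonneg.2 (hβ2 (D z))) (h1 z hz)]
        exact mul_le_mul_of_nonneg_right (hle z) e2
      · simp [hW₁ z hz, hW₂ z hz]
    have i4 : ∫ z, B₂ z * (-plap (pot μ₁ g) z + plap b z) =
        (∫ z, B₂ z * -plap (pot μ₂ g) z) + ∫ z, B₂ z * (plap b z - plap D z) := by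
      rw [← integral_add (hint (f := fun z => -plap (pot μ₂ g) z) hB₂ hc₂ cP₂.neg)
        (hint (f := fun z => plap b z - plap D z) hB₂ hc₂ (cb.sub cD))]
      refine integral_congr_ae (Filter.Eventually.of_forall fun z => ?_)
      by_cases hz : z ∈ W
      · simp only [hpD z hz]; ring
      · simp [hW₂ z hz]
    have i5 : ∫ z, B₁ z * (-plap (pot μ₁ g) z + plap b z) =
        (∫ z, B₁ z * -plap (pot μ₁ g) z) + ∫ z, B₁ z * plap b z := by
      rw [← integral_add (hint (f := fun z => -plap (pot μ₁ g) z) hB₁ hc₁ cP₁.neg) (hint hB₁ hc₁ cb)]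
      simp only [mul_add]
    rw [hC, mul_add]
    linarith
  have hCnn : 0 ≤ C := add_nonneg (integral_nonneg fun _ => abs_nonneg _)
    (integral_nonneg fun _ => abs_nonneg _)
  refine le_of_forall_pos_le_add fun ε hε => (key (ε / (C + 1)) (by positivity)).trans ?_
  have : ε / (C + 1) * C ≤ ε := by
    rw [div_mul_eq_mul_div, div_le_iff₀ (by positivity)]; nlinarith
  linarith

/-- If two measures on `K` have equal logarithmic potentials off `K`, then subharmonic functions
below superharmonic functions have ordered integrals. -/
theorem integral_le_of_log_potential_eq (hK : IsCompact K) (hμ₁ : μ₁ Kᶜ = 0) (hμ₂ : μ₂ Kᶜ = 0)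
    (hlog : ∀ s ∉ K, ∫ y, log ‖s - y‖ ∂μ₁ = ∫ y, log ‖s - y‖ ∂μ₂) (hN : IsOpen N) (hKN : K ⊆ N)
    (hB₁ : ContDiff ℝ ∞ B₁) (hB₂ : ContDiff ℝ ∞ B₂) (hc₁ : HasCompactSupport B₁)
    (hc₂ : HasCompactSupport B₂)
    (hle : ∀ z, B₁ z ≤ B₂ z) (hsub : ∀ z ∈ N, 0 ≤ plap B₁ z) (hsup : ∀ z ∈ N, plap B₂ z ≤ 0) :
    ∫ z, B₁ z ∂μ₁ ≤ ∫ z, B₂ z ∂μ₂ := by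
  obtain ⟨ε, hε, hεN⟩ := hK.exists_cthickening_subset_open hN hKN
  have hKε : IsCompact (Metric.cthickening ε K) := hK.cthickening
  obtain ⟨R, hR⟩ := ((hKε.union hc₁).union hc₂).isBounded.subset_ball 0
  have hRK : Metric.cthickening ε K ⊆ Metric.ball 0 R := fun z hz => hR (Or.inl (Or.inl hz))
  have hR₁ : ∀ z, z ∉ Metric.ball (0 : ℂ) R → B₁ z = 0 := fun z hz =>
    image_eq_zero_of_notMem_tsupport fun h => hz (hR (Or.inl (Or.inr h)))
  have hR₂ : ∀ z, z ∉ Metric.ball (0 : ℂ) R → B₂ z = 0 := fun z hz =>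
    image_eq_zero_of_notMem_tsupport fun h => hz (hR (Or.inr h))
  have hKR : ∀ y ∈ K, ‖y‖ < R := fun y hy => by
    simpa using hRK (Metric.self_subset_cthickening K hy)
  by_cases hKe : K = ∅
  · have z1 : μ₁ = 0 := by rw [← Measure.measure_univ_eq_zero]; simpa [hKe] using hμ₁
    have z2 : μ₂ = 0 := by rw [← Measure.measure_univ_eq_zero]; simpa [hKe] using hμ₂
    simp [z1, z2]
  obtain ⟨y₀, hy₀⟩ := Set.nonempty_iff_ne_empty.2 hKe
  have hR0 : 0 < R := (norm_nonneg _).trans_lt (hKR y₀ hy₀)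
  have u₁ := hc₁.uniformContinuous_of_continuous hB₁.continuous
  have u₂ := hc₂.uniformContinuous_of_continuous hB₂.continuous
  set m := μ₁.real Set.univ + μ₂.real Set.univ with hm
  have hm0 : 0 ≤ m := add_nonneg measureReal_nonneg measureReal_nonneg
  have key : ∀ ϖ : ℝ, 0 < ϖ → ∫ z, B₁ z ∂μ₁ ≤ (∫ z, B₂ z ∂μ₂) + ϖ * m := by
    intro ϖ hϖ
    obtain ⟨d₁, hd₁, hd₁'⟩ := Metric.uniformContinuous_iff.1 u₁ ϖ hϖ
    obtain ⟨d₂, hd₂, hd₂'⟩ := Metric.uniformContinuous_iff.1 u₂ ϖ hϖ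
    obtain ⟨δ, hδ, hδε, hδ1, hδ2, hδR⟩ : ∃ δ : ℝ, 0 < δ ∧ δ < ε ∧ δ < d₁ ∧ δ < d₂ ∧
        δ < 3 * R := by
      obtain ⟨δ, h1, h2⟩ := exists_between (show 0 < min (min ε d₁) (min d₂ (3 * R)) by
        simp only [lt_min_iff]; exact ⟨⟨hε, hd₁⟩, hd₂, by positivity⟩)
      simp only [lt_min_iff] at h2
      exact ⟨δ, h1, h2.1.1, h2.1.2, h2.2.1, h2.2.2⟩
    obtain ⟨g, hg, hgc, hg1, hg2, hg3, z₀, hz₀, hz₀'⟩ := exists_log_kernel hδ hδR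
    have hKs : ∀ {μ : Measure ℂ}, μ Kᶜ = 0 → ∀ᵐ y ∂μ, y ∈ K := fun h => by rw [ae_iff]; exact h
    have hlt : ∀ {x y : ℂ}, x ∈ Metric.ball 0 (2 * R) → y ∈ K → ‖x - y‖ < 3 * R := by
      intro x y hx hy
      have := hKR y hy
      have h2 : ‖x‖ < 2 * R := by simpa using hx
      exact (norm_sub_le _ _).trans_lt (by linarith)
    have hpot : ∀ z ∈ Metric.ball (0 : ℂ) (2 * R), z ∉ Metric.cthickening δ K →
        pot μ₁ g z = pot μ₂ g z := by
      intro z hz hzK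
      have hzK' : z ∉ K := fun h => hzK (Metric.self_subset_cthickening K h)
      have e : ∀ {μ : Measure ℂ}, μ Kᶜ = 0 → pot μ g z = -∫ y, log ‖z - y‖ ∂μ := by
        intro μ hμ
        rw [← integral_neg]
        refine integral_congr_ae ?_
        filter_upwards [hKs hμ] with y hy
        refine hg3 _ ?_ (hlt hz hy)
        by_contra hcon
        exact hzK (Metric.mem_cthickening_of_dist_le z y δ K hy
          (by rw [dist_eq_norm]; exact (not_le.1 hcon).le))
      rw [e hμ₁, e hμ₂, hlog z hzK']
    let χ : ContDiffBump (0 : ℂ) := ⟨R, 2 * R, hR0, by linarith⟩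
    have hP₁ : ContDiff ℝ ∞ (pot μ₁ g) := contDiff_pot hg hgc
    have hP₂ : ContDiff ℝ ∞ (pot μ₂ g) := contDiff_pot hg hgc
    have hnn : ∀ {μ : Measure ℂ} [IsFiniteMeasure μ], μ Kᶜ = 0 → ∀ z ∈ Metric.ball (0 : ℂ) R,
        0 ≤ -plap (pot μ g) z := by
      intro μ _ hμ z hz
      rw [plap_pot hg hgc, pot, ← integral_neg]
      refine integral_nonneg_of_ae ?_
      filter_upwards [hKs hμ] with y hy
      exact hg1 _ (hlt (Metric.ball_subset_ball (by linarith) hz) hy)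
    have main := integral_mul_pot_le (μ₁ := μ₁) (μ₂ := μ₂) (N := N) (W := Metric.ball 0 R)
      (Kδ := Metric.cthickening δ K) hg hgc
      (D := fun z => χ z * (pot μ₁ g z - pot μ₂ g z)) (χ.contDiff.mul (hP₁.sub hP₂)) ?_
      ((Metric.cthickening_mono hδε.le K).trans hεN) Metric.isOpen_ball ?_ (hnn hμ₁) (hnn hμ₂)
      hB₁ hB₂ hc₁ hc₂ hR₁ hR₂ hle hsub hsup
    rotate_left
    · intro z hz
      by_cases hz2 : z ∈ Metric.ball (0 : ℂ) (2 * R)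
      · simp only [hpot z hz2 hz, sub_self, mul_zero]
      · have : χ z = 0 := χ.zero_of_le_dist (by simpa [χ] using hz2)
        simp [this]
    · intro z hz
      have : χ z = 1 := χ.one_of_mem_closedBall (Metric.ball_subset_closedBall hz)
      simp [this]
    set c := ∫ z in Metric.ball 0 (3 * R), -plap g z with hc
    have hcpos : 0 < c := by
      have hcont : Continuous fun z => -plap g z := (contDiff_plap hg).continuous.neg
      have hint : Integrable (fun z => -plap g z) :=
        ((contDiff_plap hg).continuous.integrable_of_hasCompactSupport
          (hasCompactSupport_plap hgc)).neg
      rw [hc, setIntegral_pos_iff_support_of_nonneg_ae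
        ((ae_restrict_iff' measurableSet_ball).2 (Filter.Eventually.of_forall fun z hz =>
          hg1 z (by simpa using hz))) hint.integrableOn]
      refine IsOpen.measure_pos _ (hcont.isOpen_support.inter Metric.isOpen_ball)
        ⟨z₀, hz₀'.ne', by simpa using hz₀⟩
    have smear : ∀ {μ : Measure ℂ} [IsFiniteMeasure μ] {B : ℂ → ℝ}, μ Kᶜ = 0 → ContDiff ℝ ∞ B →
        HasCompactSupport B → (∀ z, z ∉ Metric.ball (0 : ℂ) R → B z = 0) →
        (∀ x y, ‖x - y‖ ≤ δ → |B x - B y| ≤ ϖ) →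
        |(∫ x, B x * -plap (pot μ g) x) - c * ∫ y, B y ∂μ| ≤ c * ϖ * μ.real Set.univ := by
      intro μ _ B hμ hB hBc hBR hBω
      have e : ∀ x, -plap (pot μ g) x = pot μ (fun z => -plap g z) x := fun x => by
        rw [plap_pot hg hgc, pot, pot, integral_neg]
      simp_rw [e]
      refine abs_integral_mul_pot_sub_le (K := K) (δ := δ) (contDiff_plap hg).continuous.neg
        (hasCompactSupport_plap hgc).neg hB.continuous hBc hμ hg1
        (fun z h h' => neg_eq_zero.2 (hg2 z h h')) ?_ hBω
      intro y hy x hx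
      refine hBR x fun hxR => ?_
      exact absurd (hlt (Metric.ball_subset_ball (by linarith) hxR) hy) (not_lt.2 hx)
    have s₁ := smear hμ₁ hB₁ hc₁ hR₁ fun x y h => by
      have := hd₁' (a := x) (b := y) (by rw [dist_eq_norm]; linarith)
      rw [Real.dist_eq] at this; exact this.le
    have s₂ := smear hμ₂ hB₂ hc₂ hR₂ fun x y h => by
      have := hd₂' (a := x) (b := y) (by rw [dist_eq_norm]; linarith)
      rw [Real.dist_eq] at this; exact this.le
    have t₁ := (abs_le.1 s₁).1
    have t₂ := (abs_le.1 s₂).2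
    have : c * ∫ z, B₁ z ∂μ₁ ≤ c * ((∫ z, B₂ z ∂μ₂) + ϖ * m) := by
      rw [hm]; nlinarith
    exact le_of_mul_le_mul_left this hcpos
  refine le_of_forall_pos_le_add fun ε hε => (key (ε / (m + 1)) (by positivity)).trans ?_
  have : ε / (m + 1) * m ≤ ε := by
    rw [div_mul_eq_mul_div, div_le_iff₀ (by positivity)]; nlinarith
  linarith

end Compare

section LogPotential

variable {K : Set ℂ}

lemma hasFDerivAt_log_norm {w : ℂ} (hw : w ≠ 0) : HasFDerivAt (fun w : ℂ => log ‖w‖)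
    ((‖w‖ ^ 2)⁻¹ • innerSL ℝ w) w := by
  have h0 : ‖w‖ ^ 2 ≠ 0 := by positivity
  have h1 := ((hasStrictFDerivAt_norm_sq w).hasFDerivAt.log h0).const_mul (1 / 2)
  have e : (fun w : ℂ => log ‖w‖) = fun w => 1 / 2 * log (‖w‖ ^ 2) := by
    funext w; rw [Real.log_pow]; push_cast; ring
  rw [e]
  refine h1.congr_fderiv ?_
  ext v
  simp; ring

lemma inner_div_normSq (w v : ℂ) : (‖w‖ ^ 2)⁻¹ * ⟪w, v⟫ = (w⁻¹ * v).re := by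
  rw [Complex.inner, Complex.inv_def, Complex.normSq_eq_norm_sq, mul_comm _ (((_ : ℝ) : ℂ)),
    mul_assoc, Complex.re_ofReal_mul, mul_comm v]

variable {μ : Measure ℂ}

lemma exists_ball_dist (hK : IsCompact K) {s : ℂ} (hs : s ∉ K) :
    ∃ r, 0 < r ∧ ∀ t ∈ Metric.ball s r, ∀ y ∈ K, r ≤ ‖t - y‖ := by
  obtain ⟨ρ, hρ, h⟩ := Metric.isOpen_iff.1 hK.isClosed.isOpen_compl s hs
  refine ⟨ρ / 2, by positivity, fun t ht y hy => ?_⟩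
  by_contra hcon
  refine h (a := y) ?_ hy
  rw [Metric.mem_ball, dist_eq_norm] at ht ⊢
  have : y - s = (t - s) - (t - y) := by ring
  rw [this]
  exact (norm_sub_le _ _).trans_lt (by linarith)

lemma aestronglyMeasurable_inv (s : ℂ) : AEStronglyMeasurable (fun y : ℂ => (s - y)⁻¹) μ :=
  ((measurable_const.sub measurable_id).inv).aestronglyMeasurable

lemma ae_mem (hμ : μ Kᶜ = 0) : ∀ᵐ y ∂μ, y ∈ K := by rw [ae_iff]; exact hμ

variable [IsFiniteMeasure μ]

lemma integrable_cauchy (hK : IsCompact K) (hμ : μ Kᶜ = 0) {s : ℂ} (hs : s ∉ K) :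
    Integrable (fun y => (s - y)⁻¹) μ := by
  obtain ⟨r, hr, h⟩ := exists_ball_dist hK hs
  refine Integrable.of_bound (aestronglyMeasurable_inv s) r⁻¹ ?_
  filter_upwards [ae_mem hμ] with y hy
  rw [norm_inv]
  exact inv_anti₀ hr (h s (Metric.mem_ball_self hr) y hy)

lemma hasDerivAt_cauchy (hK : IsCompact K) (hμ : μ Kᶜ = 0) {s : ℂ} (hs : s ∉ K) :
    HasDerivAt (fun s => ∫ y, (s - y)⁻¹ ∂μ) (∫ y, -((s - y) ^ 2)⁻¹ ∂μ) s := by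
  obtain ⟨r, hr, h⟩ := exists_ball_dist hK hs
  refine (hasDerivAt_integral_of_dominated_loc_of_deriv_le (μ := μ) (𝕜 := ℂ)
    (F := fun s y => (s - y)⁻¹) (F' := fun s y => -((s - y) ^ 2)⁻¹) (x₀ := s)
    (s := Metric.ball s r) (bound := fun _ => (r ^ 2)⁻¹) (Metric.ball_mem_nhds s hr)
    (Filter.Eventually.of_forall fun t => aestronglyMeasurable_inv t)
    (integrable_cauchy hK hμ hs) ?_ ?_ (integrable_const _) ?_).2
  · exact ((measurable_const.sub measurable_id).pow_const 2).inv.neg.aestronglyMeasurable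
  · filter_upwards [ae_mem hμ] with y hy t ht
    rw [norm_neg, norm_inv, norm_pow]
    have := h t ht y hy
    gcongr
  · filter_upwards [ae_mem hμ] with y hy t ht
    have h0 : t - y ≠ 0 := norm_pos_iff.1 (hr.trans_le (h t ht y hy))
    have := ((hasDerivAt_id t).sub_const y).inv h0
    simp only [id] at this
    refine this.congr_deriv ?_
    rw [neg_div, one_div]

lemma integrable_log_norm (hK : IsCompact K) (hμ : μ Kᶜ = 0) {s : ℂ} (hs : s ∉ K) :
    Integrable (fun y => log ‖s - y‖) μ := by
  have hc : ContinuousOn (fun y => log ‖s - y‖) K := by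
    refine ContinuousOn.log (by fun_prop) fun y hy => ?_
    rw [norm_ne_zero_iff, sub_ne_zero]
    exact fun h => hs (h ▸ hy)
  obtain ⟨C, hC⟩ := hK.exists_bound_of_continuousOn hc
  refine Integrable.of_bound (Measurable.aestronglyMeasurable (by fun_prop)) C ?_
  filter_upwards [ae_mem hμ] with y hy using hC y hy

lemma hasFDerivAt_logPotential (hK : IsCompact K) (hμ : μ Kᶜ = 0) {s : ℂ} (hs : s ∉ K) :
    ∃ L : ℂ →L[ℝ] ℝ, HasFDerivAt (fun s => ∫ y, log ‖s - y‖ ∂μ) L s ∧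
      ∀ v, L v = ((∫ y, (s - y)⁻¹ ∂μ) * v).re := by
  obtain ⟨r, hr, h⟩ := exists_ball_dist hK hs
  have hi := integrable_cauchy hK hμ hs
  have hm : AEStronglyMeasurable (fun y => (‖s - y‖ ^ 2)⁻¹ • innerSL ℝ (s - y)) μ := by
    have m1 : AEStronglyMeasurable (fun y : ℂ => (‖s - y‖ ^ 2)⁻¹) μ :=
      Measurable.aestronglyMeasurable (by fun_prop)
    have m2 : AEStronglyMeasurable (fun y : ℂ => innerSL ℝ (s - y)) μ :=
      Continuous.aestronglyMeasurable ((innerSL ℝ).continuous.comp (by fun_prop))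
    exact m1.smul m2
  have hb : ∀ t ∈ Metric.ball s r, ∀ y ∈ K, ‖(‖t - y‖ ^ 2)⁻¹ • innerSL ℝ (t - y)‖ ≤ r⁻¹ := by
    intro t ht y hy
    have h1 := h t ht y hy
    have h2 : 0 < ‖t - y‖ := hr.trans_le h1
    rw [norm_smul, innerSL_apply_norm, norm_inv, norm_pow, norm_norm, ← div_eq_inv_mul, sq,
      div_mul_cancel_left₀ h2.ne']
    exact inv_anti₀ hr h1
  have hint : Integrable (fun y => (‖s - y‖ ^ 2)⁻¹ • innerSL ℝ (s - y)) μ := by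
    refine Integrable.of_bound hm r⁻¹ ?_
    filter_upwards [ae_mem hμ] with y hy using hb s (Metric.mem_ball_self hr) y hy
  refine ⟨∫ y, (‖s - y‖ ^ 2)⁻¹ • innerSL ℝ (s - y) ∂μ, ?_, fun v => ?_⟩
  · refine hasFDerivAt_integral_of_dominated_of_fderiv_le (μ := μ) (𝕜 := ℝ)
      (F := fun s y => log ‖s - y‖) (F' := fun s y => (‖s - y‖ ^ 2)⁻¹ • innerSL ℝ (s - y))
      (s := Metric.ball s r) (bound := fun _ => r⁻¹) (Metric.ball_mem_nhds s hr)
      (Filter.Eventually.of_forall fun t => Measurable.aestronglyMeasurable (by fun_prop))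
      (integrable_log_norm hK hμ hs) hm ?_ (integrable_const _) ?_
    · filter_upwards [ae_mem hμ] with y hy t ht using hb t ht y hy
    · filter_upwards [ae_mem hμ] with y hy t ht
      have h0 : t - y ≠ 0 := norm_pos_iff.1 (hr.trans_le (h t ht y hy))
      exact (hasFDerivAt_log_norm h0).comp t ((hasFDerivAt_id t).sub_const y)
  · rw [ContinuousLinearMap.integral_apply hint]
    simp only [smul_apply, innerSL_apply_apply, smul_eq_mul, inner_div_normSq]
    rw [← integral_mul_const]
    exact integral_re (𝕜 := ℂ) (hi.mul_const v)

variable {μ₁ μ₂ : Measure ℂ} [IsFiniteMeasure μ₁] [IsFiniteMeasure μ₂]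

lemma integrable_eval (hK : IsCompact K) (hμ : μ Kᶜ = 0) (p : Polynomial ℂ) :
    Integrable (fun y => p.eval y) μ := by
  obtain ⟨C, hC⟩ := hK.exists_bound_of_continuousOn p.continuous.continuousOn
  refine Integrable.of_bound p.continuous.aestronglyMeasurable C ?_
  filter_upwards [ae_mem hμ] with y hy using hC y hy

lemma cauchy_eq_of_large (hK : IsCompact K) (hμ₁ : μ₁ Kᶜ = 0) (hμ₂ : μ₂ Kᶜ = 0)
    (hp : ∀ p : Polynomial ℂ, ∫ y, p.eval y ∂μ₁ = ∫ y, p.eval y ∂μ₂) {R : ℝ} (hR : 0 < R)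
    (hKR : ∀ y ∈ K, ‖y‖ ≤ R) {s : ℂ} (hs : 2 * R < ‖s‖) :
    ∫ y, (s - y)⁻¹ ∂μ₁ = ∫ y, (s - y)⁻¹ ∂μ₂ := by
  have hsK : s ∉ K := fun h => by have := hKR s h; linarith
  have hs0 : s ≠ 0 := by rw [← norm_pos_iff]; linarith
  have key : ∀ n : ℕ, ∃ p : Polynomial ℂ, ∀ y ∈ K, ‖(s - y)⁻¹ - p.eval y‖ ≤ R⁻¹ * (1 / 2) ^ n := by
    intro n
    refine ⟨∑ i ∈ Finset.range n, Polynomial.C ((s⁻¹) ^ (i + 1)) * Polynomial.X ^ i, fun y hy => ?_⟩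
    have hy' := hKR y hy
    have hsy : s - y ≠ 0 := sub_ne_zero.2 fun h => hsK (h ▸ hy)
    have e : (s - y)⁻¹ - (∑ i ∈ Finset.range n, Polynomial.C ((s⁻¹) ^ (i + 1)) *
        Polynomial.X ^ i).eval y = (y / s) ^ n * (s - y)⁻¹ := by
      rw [Polynomial.eval_finsetSum]
      simp only [Polynomial.eval_mul, Polynomial.eval_C, Polynomial.eval_pow, Polynomial.eval_X]
      have hys : y / s ≠ 1 := fun h => hsy (by rw [div_eq_one_iff_eq hs0] at h; rw [h, sub_self])
      have := geom_sum_eq hys n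
      have e2 : ∑ i ∈ Finset.range n, s⁻¹ ^ (i + 1) * y ^ i =
          s⁻¹ * ∑ i ∈ Finset.range n, (y / s) ^ i := by
        rw [Finset.mul_sum]
        refine Finset.sum_congr rfl fun i _ => ?_
        rw [div_pow, pow_succ, inv_pow]; field_simp
      rw [e2, this]
      have : y / s - 1 = -((s - y) / s) := by field_simp; ring
      rw [this]
      field_simp
      ring
    rw [e, norm_mul, norm_pow, norm_inv, norm_div, mul_comm]
    have h1 : R ≤ ‖s - y‖ := by
      have := norm_sub_norm_le s y
      linarith
    have h2 : ‖y‖ / ‖s‖ ≤ 1 / 2 := by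
      rw [div_le_iff₀ (by positivity)]; linarith
    gcongr
  have hbd : ∀ n : ℕ, ‖(∫ y, (s - y)⁻¹ ∂μ₁) - ∫ y, (s - y)⁻¹ ∂μ₂‖ ≤
      R⁻¹ * (1 / 2) ^ n * (μ₁.real Set.univ + μ₂.real Set.univ) := by
    intro n
    obtain ⟨p, hpn⟩ := key n
    have hb : ∀ {μ : Measure ℂ} [IsFiniteMeasure μ], μ Kᶜ = 0 →
        ‖(∫ y, (s - y)⁻¹ ∂μ) - ∫ y, p.eval y ∂μ‖ ≤ R⁻¹ * (1 / 2) ^ n * μ.real Set.univ := by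
      intro μ _ hμ
      rw [← integral_sub (integrable_cauchy hK hμ hsK) (integrable_eval hK hμ p)]
      refine norm_integral_le_of_norm_le_const ?_
      filter_upwards [ae_mem hμ] with y hy using hpn y hy
    have e : (∫ y, (s - y)⁻¹ ∂μ₁) - ∫ y, (s - y)⁻¹ ∂μ₂ =
        ((∫ y, (s - y)⁻¹ ∂μ₁) - ∫ y, p.eval y ∂μ₁) -
          ((∫ y, (s - y)⁻¹ ∂μ₂) - ∫ y, p.eval y ∂μ₂) := by rw [hp p]; ring
    rw [e, mul_add]
    exact (norm_sub_le _ _).trans (add_le_add (hb hμ₁) (hb hμ₂))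
  have hlim : Filter.Tendsto (fun n : ℕ => R⁻¹ * (1 / 2 : ℝ) ^ n *
      (μ₁.real Set.univ + μ₂.real Set.univ)) Filter.atTop (nhds 0) := by
    have := (tendsto_pow_atTop_nhds_zero_of_lt_one (by norm_num : (0 : ℝ) ≤ 1 / 2)
      (by norm_num)).const_mul R⁻¹ |>.mul_const (μ₁.real Set.univ + μ₂.real Set.univ)
    simpa using this
  have := ge_of_tendsto' hlim hbd
  rw [← sub_eq_zero, ← norm_le_zero_iff]
  exact this

lemma abs_log_norm_sub_le {s y : ℂ} {R : ℝ} (hy : ‖y‖ ≤ R) (hs : 2 * R < ‖s‖) (hR : 0 < R) :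
    |log ‖s - y‖ - log ‖s‖| ≤ 2 * R / ‖s‖ := by
  have h1 := norm_sub_norm_le s y
  have h2 := norm_sub_le s y
  have h3 : ‖s‖ / 2 < ‖s - y‖ := by linarith
  have h4 : 0 < ‖s‖ := by linarith
  have h5 : 0 < ‖s - y‖ := by linarith
  rw [← Real.log_div h5.ne' h4.ne', abs_le]
  constructor
  · have := Real.one_sub_inv_le_log_of_pos (div_pos h5 h4)
    refine le_trans ?_ this
    rw [inv_div, ← sub_nonneg]
    have : 1 - ‖s‖ / ‖s - y‖ - -(2 * R / ‖s‖) =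
        (‖s‖ * (‖s - y‖ - ‖s‖) + 2 * R * ‖s - y‖) / (‖s - y‖ * ‖s‖) := by field_simp; ring
    rw [this]
    refine div_nonneg ?_ (by positivity)
    nlinarith
  · have := Real.log_le_sub_one_of_pos (div_pos h5 h4)
    refine this.trans ?_
    rw [← sub_nonneg]
    have : 2 * R / ‖s‖ - (‖s - y‖ / ‖s‖ - 1) = (2 * R - ‖s - y‖ + ‖s‖) / ‖s‖ := by field_simp; ring
    rw [this]
    refine div_nonneg ?_ (by positivity)
    linarith

/-- Measures with the same complex moments have the same logarithmic potential on the complement of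
a compact set that does not separate the plane. -/
theorem logPotential_eq_of_moments (hK : IsCompact K) (hKc : IsPreconnected Kᶜ) (hμ₁ : μ₁ Kᶜ = 0)
    (hμ₂ : μ₂ Kᶜ = 0) (hp : ∀ p : Polynomial ℂ, ∫ y, p.eval y ∂μ₁ = ∫ y, p.eval y ∂μ₂)
    {s : ℂ} (hs : s ∉ K) : ∫ y, log ‖s - y‖ ∂μ₁ = ∫ y, log ‖s - y‖ ∂μ₂ := by
  obtain ⟨R, hR, hKR⟩ : ∃ R : ℝ, 0 < R ∧ ∀ y ∈ K, ‖y‖ ≤ R := by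
    obtain ⟨R, hR, h⟩ := hK.isBounded.exists_pos_norm_le
    exact ⟨R, hR, h⟩
  have hopen : IsOpen Kᶜ := hK.isClosed.isOpen_compl
  have hlarge : ∀ s : ℂ, 2 * R < ‖s‖ → s ∈ Kᶜ := fun s hs h => by have := hKR s h; linarith
  have hG : Set.EqOn (fun s => ∫ y, (s - y)⁻¹ ∂μ₁) (fun s => ∫ y, (s - y)⁻¹ ∂μ₂) Kᶜ := by
    have hd : ∀ {μ : Measure ℂ} [IsFiniteMeasure μ], μ Kᶜ = 0 →
        AnalyticOnNhd ℂ (fun s => ∫ y, (s - y)⁻¹ ∂μ) Kᶜ := fun hμ =>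
      DifferentiableOn.analyticOnNhd (fun s hs =>
        (hasDerivAt_cauchy hK hμ hs).differentiableAt.differentiableWithinAt) hopen
    refine (hd hμ₁).eqOn_of_preconnected_of_eventuallyEq (hd hμ₂) hKc
      (z₀ := ((3 * R : ℝ) : ℂ)) ?_ ?_
    · refine hlarge _ ?_
      rw [Complex.norm_real, Real.norm_of_nonneg (by positivity)]; linarith
    · have : {s : ℂ | 2 * R < ‖s‖} ∈ nhds ((3 * R : ℝ) : ℂ) := by
        refine (isOpen_lt continuous_const continuous_norm).mem_nhds ?_
        simp only [Set.mem_ofPred_eq]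
        rw [Complex.norm_real, Real.norm_of_nonneg (by positivity)]; linarith
      filter_upwards [this] with s hs using cauchy_eq_of_large hK hμ₁ hμ₂ hp hR hKR hs
  have hmass : μ₁.real Set.univ = μ₂.real Set.univ := by
    have := hp 1
    simp only [Polynomial.eval_one, integral_const, Complex.real_smul, mul_one] at this
    exact_mod_cast this
  set L : ℂ → ℝ := fun s => (∫ y, log ‖s - y‖ ∂μ₁) - ∫ y, log ‖s - y‖ ∂μ₂ with hL
  have hLd : ∀ s ∈ Kᶜ, HasFDerivAt L (0 : ℂ →L[ℝ] ℝ) s := by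
    intro s hs
    obtain ⟨L₁, h1, h1'⟩ := hasFDerivAt_logPotential hK hμ₁ hs
    obtain ⟨L₂, h2, h2'⟩ := hasFDerivAt_logPotential hK hμ₂ hs
    refine (h1.sub h2).congr_fderiv ?_
    refine ContinuousLinearMap.ext fun v => ?_
    have := hG hs
    simp only at this
    rw [sub_apply, h1', h2', this, sub_self]; rfl
  have hconst : ∀ t ∈ Kᶜ, L s = L t := fun t ht =>
    hopen.is_const_of_fderiv_eq_zero hKc
      (fun s hs => (hLd s hs).differentiableAt.differentiableWithinAt)
      (fun s hs => (hLd s hs).fderiv) hs ht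
  have hbound : ∀ t : ℝ, 2 * R < t → |L s| ≤ 2 * R / t * (μ₁.real Set.univ + μ₂.real Set.univ) := by
    intro t ht
    have ht0 : 0 < t := by linarith
    have hn : ‖((t : ℝ) : ℂ)‖ = t := by rw [Complex.norm_real, Real.norm_of_nonneg ht0.le]
    have htK := hlarge (t : ℂ) (by rw [hn]; exact ht)
    have hb : ∀ {μ : Measure ℂ} [IsFiniteMeasure μ], μ Kᶜ = 0 →
        |(∫ y, log ‖(t : ℂ) - y‖ ∂μ) - log t * μ.real Set.univ| ≤ 2 * R / t * μ.real Set.univ := by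
      intro μ _ hμ
      have e : log t * μ.real Set.univ = ∫ _, log t ∂μ := by
        rw [integral_const, smul_eq_mul, mul_comm]
      rw [e, ← integral_sub (integrable_log_norm hK hμ htK) (integrable_const _), ← Real.norm_eq_abs]
      refine norm_integral_le_of_norm_le_const ?_
      filter_upwards [ae_mem hμ] with y hy
      have := abs_log_norm_sub_le (s := (t : ℂ)) (hKR y hy) (by rw [hn]; exact ht) hR
      rwa [hn] at this
    rw [hconst t htK, hL, mul_add]
    have b1 := abs_le.1 (hb hμ₁)
    have b2 := abs_le.1 (hb hμ₂)
    rw [hmass] at b1 ⊢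
    simp only
    rw [abs_le]
    constructor <;> linarith [b1.1, b1.2, b2.1, b2.2]
  have hlim : Filter.Tendsto (fun t : ℝ => 2 * R / t * (μ₁.real Set.univ + μ₂.real Set.univ))
      Filter.atTop (nhds 0) := by
    have := (tendsto_const_nhds (x := 2 * R)).div_atTop Filter.tendsto_id |>.mul_const
      (μ₁.real Set.univ + μ₂.real Set.univ)
    simpa using this
  have h0 : |L s| ≤ 0 := by
    refine ge_of_tendsto hlim ?_
    filter_upwards [Filter.eventually_gt_atTop (2 * R)] with t ht using hbound t ht
  have := abs_nonpos_iff.1 h0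
  simp only [hL] at this
  linarith

end LogPotential

section Sandwich

variable {K N : Set ℂ}

lemma exists_measure_of_positive (hK : IsCompact K) (l : C(K, ℝ) →ₗ[ℝ] ℝ)
    (hl : ∀ a, 0 ≤ a → 0 ≤ l a) : ∃ μ : Measure ℂ, IsFiniteMeasure μ ∧ μ Kᶜ = 0 ∧
      ∀ f : C(ℂ, ℝ), ∫ x, f x ∂μ = l (f.restrict K) := by
  have : CompactSpace K := isCompact_iff_compactSpace.1 hK
  let T : CompactlySupportedContinuousMap K ℝ →ₗ[ℝ] ℝ :=
    { toFun := fun f => l f.toContinuousMap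
      map_add' := fun f g => l.map_add _ _
      map_smul' := fun c f => l.map_smul c _ }
  let Λ : CompactlySupportedContinuousMap K ℝ →ₚ[ℝ] ℝ :=
    PositiveLinearMap.mk₀ T (fun f hf => hl _ hf)
  let ν := RealRMK.rieszMeasure Λ
  have hν : IsFiniteMeasure ν := ⟨isCompact_univ.measure_lt_top⟩
  refine ⟨ν.map Subtype.val, inferInstance, ?_, fun f => ?_⟩
  · rw [Measure.map_apply measurable_subtype_coe hK.isClosed.measurableSet.compl]
    simp
  · rw [integral_map measurable_subtype_coe.aemeasurable f.continuous.aestronglyMeasurable]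
    exact RealRMK.integral_rieszMeasure Λ
      ⟨f.restrict K, HasCompactSupport.of_compactSpace _⟩

/-- Real part of a polynomial, as a continuous function. -/
def rePoly : Polynomial ℂ →ₗ[ℝ] C(ℂ, ℝ) where
  toFun p := ⟨fun z => (p.eval z).re, Complex.continuous_re.comp p.continuous⟩
  map_add' p q := by ext z; simp
  map_smul' c p := by ext z; simp

lemma isOpen_forall_lt (hK : IsCompact K) (f : C(K, ℝ)) : IsOpen {a : C(K, ℝ) | ∀ y, f y < a y} := by
  have : CompactSpace K := isCompact_iff_compactSpace.1 hK
  have h := (ContinuousMap.isOpen_setOfPred_mapsTo (X := K) (Y := ℝ) isCompact_univ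
    (isOpen_Ioi (a := (0 : ℝ)))).preimage (f := fun a : C(K, ℝ) => a - f) (by fun_prop)
  convert h using 1
  ext a
  simp [Set.MapsTo]

/-- Harmonic polynomials between a subharmonic and a superharmonic function on a compact set which
does not separate the plane. -/
theorem exists_polynomial_between {B₁ B₂ : ℂ → ℝ} (hK : IsCompact K) (hKc : IsPreconnected Kᶜ)
    (hN : IsOpen N) (hKN : K ⊆ N) (hB₁ : ContDiff ℝ ∞ B₁) (hB₂ : ContDiff ℝ ∞ B₂)
    (hc₁ : HasCompactSupport B₁) (hc₂ : HasCompactSupport B₂) (hle : ∀ z, B₁ z ≤ B₂ z)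
    (hsub : ∀ z ∈ N, 0 ≤ plap B₁ z) (hsup : ∀ z ∈ N, plap B₂ z ≤ 0) {η : ℝ} (hη : 0 < η) :
    ∃ p : Polynomial ℂ, ∀ y ∈ K, B₁ y - η < (p.eval y).re ∧ (p.eval y).re < B₂ y + η := by
  by_contra! hcon
  have : CompactSpace K := isCompact_iff_compactSpace.1 hK
  let b₁ : C(ℂ, ℝ) := ⟨B₁, hB₁.continuous⟩
  let b₂ : C(ℂ, ℝ) := ⟨B₂, hB₂.continuous⟩
  let c : C(ℂ, ℝ) := ContinuousMap.const ℂ η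
  let O : Set (C(K, ℝ) × C(K, ℝ)) :=
    {a | ∀ y, ((b₁ - c).restrict K) y < a y} ×ˢ {b | ∀ y, ((-b₂ - c).restrict K) y < b y}
  have hconv : ∀ f : C(K, ℝ), Convex ℝ {a : C(K, ℝ) | ∀ y, f y < a y} := by
    intro f a ha b hb s t hs ht hst y
    have h1 := ha y
    have h2 := hb y
    have e : f y = s * f y + t * f y := by rw [← add_mul, hst, one_mul]
    rw [e]
    simp only [ContinuousMap.add_apply, ContinuousMap.smul_apply, smul_eq_mul]
    rcases hs.eq_or_lt with h | h
    · have : t = 1 := by rw [← h] at hst; linarith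
      rw [← h, this]; linarith
    · nlinarith
  let ρ : Polynomial ℂ →ₗ[ℝ] C(K, ℝ) × C(K, ℝ) :=
    { toFun := fun p => ((rePoly p).restrict K, -(rePoly p).restrict K)
      map_add' := fun p q => by ext <;> simp <;> ring
      map_smul' := fun c p => by ext <;> simp }
  obtain ⟨f, u, hfO, hfS⟩ := geometric_hahn_banach_open (s := O) (t := Set.range ρ)
    ((hconv _).prod (hconv _)) ((isOpen_forall_lt hK _).prod (isOpen_forall_lt hK _))
    (by rw [← LinearMap.coe_range]; exact (LinearMap.range ρ).convex) (by
      rw [Set.disjoint_left]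
      rintro _ ⟨h1, h2⟩ ⟨p, rfl⟩
      obtain ⟨y, hy, h3⟩ := hcon p
      have h1' : B₁ y - η < (p.eval y).re := h1 ⟨y, hy⟩
      have h2' : -B₂ y - η < -(p.eval y).re := h2 ⟨y, hy⟩
      have := h3 h1'
      linarith)
  have hu : u ≤ 0 := by simpa using hfS 0 ⟨0, map_zero ρ⟩
  have hf0 : ∀ p, f (ρ p) = 0 := by
    intro p
    have h1 : ∀ t : ℝ, u ≤ t * f (ρ p) := fun t => by
      have := hfS (ρ (t • p)) ⟨_, rfl⟩
      rwa [map_smul, map_smul, smul_eq_mul] at this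
    by_contra h
    have := h1 ((u - 1) / f (ρ p))
    rw [div_mul_cancel₀ _ h] at this
    linarith
  let l₁ : C(K, ℝ) →ₗ[ℝ] ℝ := -(f.toLinearMap.comp (LinearMap.inl ℝ _ _))
  let l₂ : C(K, ℝ) →ₗ[ℝ] ℝ := -(f.toLinearMap.comp (LinearMap.inr ℝ _ _))
  have hl : ∀ a b, l₁ a + l₂ b = -f (a, b) := by
    intro a b
    have : ((a, b) : C(K, ℝ) × C(K, ℝ)) = (a, 0) + (0, b) := by simp
    rw [this, map_add]
    simp [l₁, l₂]
    ring
  have hpos : ∀ a b, (a, b) ∈ O → 0 < l₁ a + l₂ b := fun a b h => by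
    rw [hl]; have := hfO _ h; linarith
  have hmem : ∀ a b : C(K, ℝ), 0 ≤ a → 0 ≤ b →
      (b₁.restrict K + a, (-b₂).restrict K + b) ∈ O := by
    intro a b ha hb
    constructor
    · intro y
      have h1 : 0 ≤ a y := ha y
      simp [c]
      linarith
    · intro y
      have h1 : 0 ≤ b y := hb y
      simp [c]
      linarith
  have hl₁ : ∀ a, 0 ≤ a → 0 ≤ l₁ a := by
    intro a ha
    by_contra! h
    set k := l₁ (b₁.restrict K) + l₂ ((-b₂).restrict K) with hk
    have hk0 : 0 < k := by simpa [hk] using hpos _ _ (hmem 0 0 le_rfl le_rfl)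
    have := hpos _ _ (hmem ((k / -(l₁ a)) • a) 0
      (smul_nonneg (div_nonneg hk0.le (by linarith)) ha) le_rfl)
    rw [map_add, map_smul, smul_eq_mul, add_zero, div_mul_eq_mul_div, mul_div_assoc, div_neg,
      div_self h.ne] at this
    linarith
  have hl₂ : ∀ a, 0 ≤ a → 0 ≤ l₂ a := by
    intro a ha
    by_contra! h
    set k := l₁ (b₁.restrict K) + l₂ ((-b₂).restrict K) with hk
    have hk0 : 0 < k := by simpa [hk] using hpos _ _ (hmem 0 0 le_rfl le_rfl)
    have := hpos _ _ (hmem 0 ((k / -(l₂ a)) • a) le_rfl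
      (smul_nonneg (div_nonneg hk0.le (by linarith)) ha))
    rw [map_add l₂, map_smul l₂, smul_eq_mul, add_zero, div_mul_eq_mul_div, mul_div_assoc, div_neg,
      div_self h.ne] at this
    linarith
  obtain ⟨μ₁, i₁, hμ₁, hint₁⟩ := exists_measure_of_positive hK l₁ hl₁
  obtain ⟨μ₂, i₂, hμ₂, hint₂⟩ := exists_measure_of_positive hK l₂ hl₂
  have hre : ∀ p : Polynomial ℂ, ∫ y, (p.eval y).re ∂μ₁ = ∫ y, (p.eval y).re ∂μ₂ := by
    intro p
    have e1 : ∫ y, (p.eval y).re ∂μ₁ = l₁ ((rePoly p).restrict K) := hint₁ (rePoly p)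
    have e2 : ∫ y, (p.eval y).re ∂μ₂ = l₂ ((rePoly p).restrict K) := hint₂ (rePoly p)
    have := hl ((rePoly p).restrict K) (-(rePoly p).restrict K)
    rw [show f ((rePoly p).restrict K, -(rePoly p).restrict K) = f (ρ p) from rfl, hf0 p,
      map_neg] at this
    rw [e1, e2]; linarith
  have hmom : ∀ p : Polynomial ℂ, ∫ y, p.eval y ∂μ₁ = ∫ y, p.eval y ∂μ₂ := by
    intro p
    have r1 : ∀ {μ : Measure ℂ} [IsFiniteMeasure μ], μ Kᶜ = 0 →
        (∫ y, p.eval y ∂μ).re = ∫ y, (p.eval y).re ∂μ := fun hμ =>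
      (integral_re (𝕜 := ℂ) (integrable_eval hK hμ p)).symm
    have r2 : ∀ {μ : Measure ℂ} [IsFiniteMeasure μ], μ Kᶜ = 0 →
        (∫ y, p.eval y ∂μ).im = ∫ y, (p.eval y).im ∂μ := fun hμ =>
      (integral_im (𝕜 := ℂ) (integrable_eval hK hμ p)).symm
    have h2 := hre (Polynomial.C (-Complex.I) * p)
    simp only [Polynomial.eval_mul, Polynomial.eval_C, Complex.mul_re, Complex.neg_re,
      Complex.I_re, Complex.I_im, zero_mul, zero_sub, neg_mul, one_mul,
      neg_neg] at h2
    refine Complex.ext ?_ ?_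
    · rw [r1 hμ₁, r1 hμ₂, hre p]
    · rw [r2 hμ₁, r2 hμ₂, h2]
  have h1 := integral_le_of_log_potential_eq hK hμ₁ hμ₂
    (fun s hs => logPotential_eq_of_moments hK hKc hμ₁ hμ₂ hmom hs) hN hKN hB₁ hB₂ hc₁ hc₂ hle
    hsub hsup
  have h2 := hpos _ _ (hmem 0 0 le_rfl le_rfl)
  have e1 : ∫ z, B₁ z ∂μ₁ = l₁ (b₁.restrict K) := hint₁ b₁
  have e2 : ∫ z, B₂ z ∂μ₂ = l₂ (b₂.restrict K) := hint₂ b₂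
  have e3 : (-b₂).restrict K = -(b₂.restrict K) := rfl
  rw [add_zero, add_zero, e3, map_neg] at h2
  linarith

end Sandwich

section Layer

/-- A conformal factor of the form `exp (Re p)` is the modulus of the derivative of an entire
function. -/
lemma exists_entire_norm_px_eq_exp (p : Polynomial ℂ) : ∃ Φ : ℂ → ℂ, ContDiff ℝ ∞ Φ ∧
    Differentiable ℂ Φ ∧ ∀ z, ‖px Φ z‖ = Real.exp (p.eval z).re := by
  have hd : Differentiable ℂ fun z => Complex.exp (p.eval z) :=
    Complex.differentiable_exp.comp p.differentiable
  obtain ⟨Φ, hΦ⟩ := hd.isExactOn_univ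
  have hΦd : Differentiable ℂ Φ := fun z => (hΦ z (Set.mem_univ z)).differentiableAt
  refine ⟨Φ, (hΦd.contDiff (n := ∞)).restrict_scalars ℝ, hΦd, fun z => ?_⟩
  rw [px_of_differentiableAt (hΦd z), (hΦ z (Set.mem_univ z)).deriv, Complex.norm_exp]

lemma exists_smooth_step {s s' c : ℝ} (hs : s < s') (hc : 1 < c) : ∃ χ : ℝ → ℝ,
    ContDiff ℝ ∞ χ ∧ (∀ t ≤ s, χ t = 0) ∧ (∀ t, s' ≤ t → χ t = 1) ∧ (∀ t, 0 ≤ χ t) ∧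
    (∀ t, χ t ≤ 1) ∧ (∀ t, 0 ≤ deriv χ t) ∧ (∀ t, deriv χ t ≤ c / (s' - s)) ∧
    (∀ t ≤ s, deriv χ t = 0) ∧ ∀ t, s' ≤ t → deriv χ t = 0 := by
  have h0 : 0 < s' - s := by linarith
  let b : ContDiffBump ((s + s') / 2) := ⟨(s' - s) / (2 * c), (s' - s) / 2, by positivity, by
    rw [div_lt_div_iff₀ (by positivity) (by norm_num)]; nlinarith⟩
  set ψ : ℝ → ℝ := b.normed volume with hψ
  have hψc : Continuous ψ := b.continuous_normed
  have hψ0 : ∀ t, 0 ≤ ψ t := fun t => b.nonneg_normed t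
  have hψs : ∀ t, t ∉ Set.Ioo s s' → ψ t = 0 := by
    intro t ht
    by_contra h
    have : t ∈ Function.support ψ := h
    rw [hψ, b.support_normed_eq, Real.ball_eq_Ioo] at this
    refine ht ?_
    convert this using 2 <;> simp [b] <;> ring
  have hψi : Integrable ψ := b.integrable_normed
  set χ : ℝ → ℝ := fun t => ∫ x in s..t, ψ x with hχ
  have hd : ∀ t, HasDerivAt χ (ψ t) t := fun t => hψc.integral_hasStrictDerivAt s t |>.hasDerivAt
  have hdχ : deriv χ = ψ := funext fun t => (hd t).deriv
  have hmono : Monotone χ := monotone_of_deriv_nonneg (fun t => (hd t).differentiableAt)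
    (fun t => by rw [hdχ]; exact hψ0 t)
  have hlow : ∀ t ≤ s, χ t = 0 := by
    intro t ht
    refine intervalIntegral.integral_zero_ae ?_
    refine Filter.Eventually.of_forall fun x hx => hψs x fun hx' => ?_
    rw [Set.uIoc_of_ge ht] at hx
    exact absurd hx.2 (not_le.2 hx'.1)
  have hhigh : ∀ t, s' ≤ t → χ t = 1 := by
    intro t ht
    have hst : s ≤ t := by linarith
    rw [← b.integral_normed (μ := volume)]
    change (∫ x in s..t, ψ x) = ∫ x, ψ x
    rw [intervalIntegral.integral_of_le hst, setIntegral_eq_integral_of_forall_compl_eq_zero]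
    intro x hx
    refine hψs x fun hx' => hx ⟨hx'.1, by linarith [hx'.2]⟩
  refine ⟨χ, ?_, hlow, hhigh, ?_, ?_, ?_, ?_, ?_, ?_⟩
  · rw [contDiff_infty_iff_deriv]
    exact ⟨fun t => (hd t).differentiableAt, by rw [hdχ]; exact b.contDiff_normed⟩
  · intro t
    rcases le_total t s with h | h
    · rw [hlow t h]
    · rw [← hlow s le_rfl]; exact hmono h
  · intro t
    rcases le_total t s' with h | h
    · rw [← hhigh s' le_rfl]; exact hmono h
    · rw [hhigh t h]
  · intro t; rw [hdχ]; exact hψ0 t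
  · intro t; rw [hdχ]
    refine (b.normed_le_div_measure_closedBall_rIn volume t).trans (le_of_eq ?_)
    rw [Real.closedBall_eq_Icc, Real.volume_real_Icc]
    simp only [b]
    rw [max_eq_left]
    · have h1 : s' - s ≠ 0 := h0.ne'
      have h2 : c ≠ 0 := by positivity
      rw [show (s + s') / 2 + (s' - s) / (2 * c) - ((s + s') / 2 - (s' - s) / (2 * c)) =
        (s' - s) / c by field_simp; ring, one_div_div]
    · have : 0 < (s' - s) / (2 * c) := by positivity
      linarith
  · intro t ht; rw [hdχ]; exact hψs t fun h => absurd h.1 (not_lt.2 ht)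
  · intro t ht; rw [hdχ]; exact hψs t fun h => absurd h.2 (not_lt.2 ht)

variable {D : Set ℂ} {φ : ℂ → ℝ} {s s' : ℝ}

/-- Truncating a smooth function of `φ` to `D` keeps it smooth when the relevant superlevel set
inside `D` is closed. -/
lemma contDiff_indicator_comp {χ : ℝ → ℝ} (hD : IsOpen D) (hφ : ContDiff ℝ ∞ φ)
    (hK : IsClosed {z | z ∈ D ∧ s ≤ φ z}) (hχ : ContDiff ℝ ∞ χ) (h0 : ∀ t ≤ s, χ t = 0) :
    ContDiff ℝ ∞ (D.indicator fun z => χ (φ z)) := by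
  rw [contDiff_iff_contDiffAt]
  intro z
  by_cases hz : z ∈ D
  · refine (hχ.comp hφ).contDiffAt.congr_of_eventuallyEq ?_
    filter_upwards [hD.mem_nhds hz] with x hx
    simp [hx]
  · refine (contDiffAt_const (c := (0 : ℝ))).congr_of_eventuallyEq ?_
    filter_upwards [hK.isOpen_compl.mem_nhds (show z ∈ {z | z ∈ D ∧ s ≤ φ z}ᶜ from
      fun h => hz h.1)] with x hx
    by_cases hxD : x ∈ D
    · have : φ x < s := not_le.1 fun h => hx ⟨hxD, h⟩
      simp [hxD, h0 _ this.le]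
    · simp [hxD]

lemma indicator_comp_eq_zero {χ : ℝ → ℝ} (h0 : ∀ t ≤ s, χ t = 0) {z : ℂ}
    (hz : z ∉ {z | z ∈ D ∧ s ≤ φ z}) : D.indicator (fun z => χ (φ z)) z = 0 := by
  by_cases hzD : z ∈ D
  · have : φ z < s := not_le.1 fun h => hz ⟨hzD, h⟩
    simp [hzD, h0 _ this.le]
  · simp [hzD]

lemma hasCompactSupport_indicator_comp {χ : ℝ → ℝ} (hK : IsCompact {z | z ∈ D ∧ s ≤ φ z})
    (h0 : ∀ t ≤ s, χ t = 0) : HasCompactSupport (D.indicator fun z => χ (φ z)) :=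
  HasCompactSupport.intro hK fun _ hz => indicator_comp_eq_zero h0 hz

lemma px_indicator_comp {χ : ℝ → ℝ} (hD : IsOpen D) (hφ : ContDiff ℝ ∞ φ)
    (hK : IsClosed {z | z ∈ D ∧ s ≤ φ z}) (hχ : ContDiff ℝ ∞ χ) (h0 : ∀ t ≤ s, χ t = 0) (z : ℂ) :
    px (D.indicator fun z => χ (φ z)) z = D.indicator (fun z => deriv χ (φ z)) z * px φ z ∧
    py (D.indicator fun z => χ (φ z)) z = D.indicator (fun z => deriv χ (φ z)) z * py φ z := by
  by_cases hz : z ∈ D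
  · have h : (D.indicator fun z => χ (φ z)) =ᶠ[nhds z] fun z => χ (φ z) := by
      filter_upwards [hD.mem_nhds hz] with x hx
      simp [hx]
    rw [px_congr h, py_congr h, px_comp hχ hφ, py_comp hχ hφ]
    simp [hz]
  · have h : (D.indicator fun z => χ (φ z)) =ᶠ[nhds z] fun _ => 0 := by
      filter_upwards [hK.isOpen_compl.mem_nhds (show z ∈ {z | z ∈ D ∧ s ≤ φ z}ᶜ from
        fun h => hz h.1)] with x hx
      exact indicator_comp_eq_zero h0 hx
    rw [px_congr h, py_congr h]
    simp [hz]

lemma sq_integral_mul_le {k g e : ℂ → ℝ} (hk : ∀ z, 0 ≤ k z)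
    (h1 : Integrable fun z => k z * g z ^ 2) (h2 : Integrable fun z => k z * e z ^ 2)
    (h3 : Integrable fun z => k z * g z * e z) :
    (∫ z, k z * g z * e z) ^ 2 ≤ (∫ z, k z * g z ^ 2) * ∫ z, k z * e z ^ 2 := by
  have h : ∀ x : ℝ, 0 ≤ (∫ z, k z * g z ^ 2) * (x * x) + (2 * ∫ z, k z * g z * e z) * x +
      ∫ z, k z * e z ^ 2 := by
    intro x
    have e1 : (∫ z, k z * g z ^ 2) * (x * x) + (2 * ∫ z, k z * g z * e z) * x +
        ∫ z, k z * e z ^ 2 = ∫ z, k z * (x * g z + e z) ^ 2 := by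
      rw [show (fun z => k z * (x * g z + e z) ^ 2) = fun z => (k z * g z ^ 2) * (x * x) +
        (k z * g z * e z) * (2 * x) + k z * e z ^ 2 by ext z; ring]
      have i1 := h1.mul_const (x * x)
      have i3 := h3.mul_const (2 * x)
      have i4 : Integrable fun z => k z * g z ^ 2 * (x * x) + k z * g z * e z * (2 * x) := i1.add i3
      rw [integral_add i4 h2, integral_add i1 i3, integral_mul_const, integral_mul_const]
      ring
    rw [e1]
    exact integral_nonneg fun z => mul_nonneg (hk z) (sq_nonneg _)
  have := discrim_le_zero h
  rw [discrim] at this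
  nlinarith

/-- The isoperimetric inequality applied to the layers of a function with a Laplacian bound. -/
theorem layer_isoperimetric {Φ : ℂ → ℂ} {g : ℂ → ℝ} (hD : IsOpen D) (hφ : ContDiff ℝ ∞ φ)
    (hs : s < s') (hK : IsCompact {z | z ∈ D ∧ s ≤ φ z}) (hΦ : ContDiff ℝ ∞ Φ)
    (hol : ∀ z ∈ D, DifferentiableAt ℂ Φ z) (hg0 : ∀ z ∈ D, s < φ z → 0 ≤ g z)
    (hg : ∀ z ∈ D, s < φ z → -plap φ z ≤ g z)
    (hgi : IntegrableOn g {z | z ∈ D ∧ s < φ z}) :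
    4 * π * (s' - s) * (∫ z in {z | z ∈ D ∧ s' < φ z}, ‖px Φ z‖ ^ 2) ≤
      (∫ z in {z | z ∈ D ∧ s < φ z}, g z) * ((∫ z in {z | z ∈ D ∧ s < φ z}, ‖px Φ z‖ ^ 2) -
        ∫ z in {z | z ∈ D ∧ s' < φ z}, ‖px Φ z‖ ^ 2) := by
  have hφc := hφ.continuous
  have hPc : Continuous fun z => ‖px Φ z‖ ^ 2 := (contDiff_px hΦ).continuous.norm.pow 2
  have hmeas : ∀ t, MeasurableSet {z | z ∈ D ∧ t < φ z} := fun t =>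
    (hD.inter (isOpen_lt continuous_const hφc)).measurableSet
  have hi : ∀ t, s ≤ t → IntegrableOn (fun z => ‖px Φ z‖ ^ 2) {z | z ∈ D ∧ t < φ z} := fun t ht =>
    (hPc.continuousOn.integrableOn_compact hK).mono_set fun z hz => ⟨hz.1, ht.trans hz.2.le⟩
  set m := ∫ z in {z | z ∈ D ∧ s < φ z}, ‖px Φ z‖ ^ 2 with hm
  set m' := ∫ z in {z | z ∈ D ∧ s' < φ z}, ‖px Φ z‖ ^ 2 with hm'
  set F := ∫ z in {z | z ∈ D ∧ s < φ z}, g z with hF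
  have hF0 : 0 ≤ F := setIntegral_nonneg (hmeas s) fun z hz => hg0 z hz.1 hz.2
  have hsub : {z | z ∈ D ∧ s' < φ z} ⊆ {z | z ∈ D ∧ s < φ z} := fun z hz =>
    ⟨hz.1, hs.trans hz.2⟩
  have hmm : 0 ≤ m - m' := by
    rw [sub_nonneg]
    exact setIntegral_mono_set (hi s le_rfl) (Filter.Eventually.of_forall fun z => by positivity)
      hsub.eventuallyLE
  have key : ∀ c : ℝ, 1 < c → 4 * π * m' ≤ F * (c / (s' - s) * (m - m')) := by
    intro c hc
    obtain ⟨χ, hχ, hχ0, hχ1, hχn, hχle, hχd0, hχd, hχds, hχds'⟩ := exists_smooth_step hs hc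
    set f := D.indicator fun z => χ (φ z) with hf
    set k := D.indicator fun z => deriv χ (φ z) with hk
    have hfs : ContDiff ℝ ∞ f := contDiff_indicator_comp hD hφ hK.isClosed hχ hχ0
    have hks : ContDiff ℝ ∞ k := contDiff_indicator_comp hD hφ hK.isClosed (contDiff_deriv hχ) hχds
    have hfc : HasCompactSupport f := hasCompactSupport_indicator_comp hK hχ0
    have hkc : HasCompactSupport k := hasCompactSupport_indicator_comp hK hχds
    have hf0 : ∀ z, 0 ≤ f z := Set.indicator_nonneg fun z _ => hχn _
    have hk0 : ∀ z, 0 ≤ k z := Set.indicator_nonneg fun z _ => hχd0 _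
    have hgr : ∀ z, gradNorm f z = k z * gradNorm φ z := by
      intro z
      obtain ⟨e1, e2⟩ := px_indicator_comp hD hφ hK.isClosed hχ hχ0 z
      rw [gradNorm, gradNorm, e1, e2, mul_pow, mul_pow, ← mul_add,
        Real.sqrt_mul (sq_nonneg _), Real.sqrt_sq (hk0 z)]
    have hts : tsupport f ⊆ {z | z ∈ D ∧ s ≤ φ z} := by
      refine closure_minimal (fun z hz => ?_) hK.isClosed
      by_contra h
      refine hz ?_
      by_cases hzD : z ∈ D
      · have : φ z ≤ s := not_lt.1 fun h' => h ⟨hzD, h'.le⟩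
        simp [hf, hzD, hχ0 _ this]
      · simp [hf, hzD]
    have hiso := isoperimetric hfs hfc hf0 hΦ fun z hz =>
      (hD.eventually_mem (hts hz).1).mono fun z' hz' => hol z' hz'
    have hgc := continuous_gradNorm hφ
    have hkcont := hks.continuous
    have hec : Continuous fun z => ‖px Φ z‖ := (contDiff_px hΦ).continuous.norm
    have hint : ∀ q : ℂ → ℝ, Continuous q → Integrable fun z => k z * q z := fun q hq =>
      (hkcont.mul hq).integrable_of_hasCompactSupport hkc.mul_right
    have hCS := sq_integral_mul_le hk0 (g := gradNorm φ) (e := fun z => ‖px Φ z‖)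
      (hint _ (hgc.pow 2)) (hint _ (hec.pow 2)) (by
        have := hint (fun z => gradNorm φ z * ‖px Φ z‖) (hgc.mul hec)
        simpa only [mul_assoc] using this)
    have h1 : ∫ z, k z * gradNorm φ z ^ 2 ≤ F := by
      have e1 : ∫ z, k z * gradNorm φ z ^ 2 = ∫ z, f z * -plap φ z := by
        have := green hfs hφ hfc
        simp only [mul_neg, integral_neg]
        rw [this, neg_neg]
        congr 1
        ext z
        obtain ⟨e1, e2⟩ := px_indicator_comp hD hφ hK.isClosed hχ hχ0 z
        rw [gradNorm_sq, e1, e2]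
        ring
      rw [e1, hF, ← integral_indicator (hmeas s)]
      refine integral_mono ?_ (hgi.integrable_indicator (hmeas s)) ?_
      · exact (hfs.continuous.mul (contDiff_plap hφ).continuous.neg).integrable_of_hasCompactSupport
          hfc.mul_right
      · intro z
        by_cases hz : z ∈ D ∧ s < φ z
        · rw [Set.indicator_of_mem (show z ∈ {z | z ∈ D ∧ s < φ z} from hz)]
          have h2 := hg z hz.1 hz.2
          have h3 := hg0 z hz.1 hz.2
          have h4 : f z ≤ 1 := by simp [hf, hz.1, hχle]
          have h5 := hf0 z
          calc f z * -plap φ z ≤ f z * g z := mul_le_mul_of_nonneg_left h2 h5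
            _ ≤ g z := mul_le_of_le_one_left h3 h4
        · rw [Set.indicator_of_notMem (show z ∉ {z | z ∈ D ∧ s < φ z} from hz)]
          have : f z = 0 := by
            by_cases hzD : z ∈ D
            · have : φ z ≤ s := not_lt.1 fun h => hz ⟨hzD, h⟩
              simp [hf, hzD, hχ0 _ this]
            · simp [hf, hzD]
          simp [this]
    have h2 : ∫ z, k z * ‖px Φ z‖ ^ 2 ≤ c / (s' - s) * (m - m') := by
      have e1 : m - m' = ∫ z, ({z | z ∈ D ∧ s < φ z} \ {z | z ∈ D ∧ s' < φ z}).indicator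
          (fun z => ‖px Φ z‖ ^ 2) z := by
        rw [integral_indicator ((hmeas s).diff (hmeas s')), setIntegral_sdiff (hmeas s') (hi s le_rfl) hsub]
      rw [e1, ← integral_const_mul]
      refine integral_mono (hint _ hPc) (((hi s le_rfl).mono_set
        Set.sdiff_subset).integrable_indicator ((hmeas s).diff (hmeas s')) |>.const_mul _) ?_
      intro z
      have hcs : 0 ≤ c / (s' - s) := div_nonneg (by linarith) (by linarith)
      by_cases hz : z ∈ {z | z ∈ D ∧ s < φ z} \ {z | z ∈ D ∧ s' < φ z}
      · simp only [Set.indicator_of_mem hz]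
        refine mul_le_mul_of_nonneg_right ?_ (by positivity)
        simp [hk, hz.1.1, hχd]
      · simp only [Set.indicator_of_notMem hz, mul_zero]
        have : k z = 0 := by
          by_cases hzD : z ∈ D
          · rcases le_or_gt (φ z) s with h | h
            · simp [hk, hzD, hχds _ h]
            · have : s' < φ z := by
                by_contra h'
                exact hz ⟨⟨hzD, h⟩, fun h'' => h' h''.2⟩
              simp [hk, hzD, hχds' _ this.le]
          · simp [hk, hzD]
        simp [this]
    have h3 : m' ≤ ∫ z, f z ^ 2 * ‖px Φ z‖ ^ 2 := by
      rw [hm', ← integral_indicator (hmeas s')]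
      refine integral_mono ((hi s' hs.le).integrable_indicator (hmeas s')) ?_ ?_
      · refine ((hfs.continuous.pow 2).mul hPc).integrable_of_hasCompactSupport ?_
        refine hfc.mono fun z hz h => hz ?_
        simp [h]
      · intro z
        by_cases hz : z ∈ {z | z ∈ D ∧ s' < φ z}
        · simp [Set.indicator_of_mem hz, hf, hz.1, hχ1 _ hz.2.le]
        · simp only [Set.indicator_of_notMem hz]; positivity
    have h4 : 0 ≤ ∫ z, k z * ‖px Φ z‖ ^ 2 :=
      integral_nonneg fun z => mul_nonneg (hk0 z) (by positivity)
    calc 4 * π * m' ≤ 4 * π * ∫ z, f z ^ 2 * ‖px Φ z‖ ^ 2 := by gcongr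
      _ ≤ (∫ z, gradNorm f z * ‖px Φ z‖) ^ 2 := hiso
      _ = (∫ z, k z * gradNorm φ z * ‖px Φ z‖) ^ 2 := by simp only [hgr]
      _ ≤ _ := hCS
      _ ≤ _ := mul_le_mul h1 h2 h4 hF0
  have h0 : 0 < s' - s := by linarith
  have key' : ∀ c : ℝ, 1 < c → 4 * π * (s' - s) * m' ≤ F * (m - m') * c := by
    intro c hc
    have := mul_le_mul_of_nonneg_left (key c hc) h0.le
    calc 4 * π * (s' - s) * m' = (s' - s) * (4 * π * m') := by ring
      _ ≤ (s' - s) * (F * (c / (s' - s) * (m - m'))) := this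
      _ = _ := by field_simp
  have : Filter.Tendsto (fun c : ℝ => F * (m - m') * c) (nhdsWithin 1 (Set.Ioi 1))
      (nhds (F * (m - m') * 1)) :=
    ((continuous_const.mul continuous_id).tendsto 1).mono_left nhdsWithin_le_nhds
  rw [mul_one] at this
  exact ge_of_tendsto this (by filter_upwards [self_mem_nhdsWithin] with c hc using key' c hc)

end Layer

section Monotone

open Filter Topology

/-- A real function which is locally nondecreasing to the right and does not jump down from the
left is nondecreasing. -/
lemma le_of_local_le {R : ℝ → ℝ} {a b : ℝ} (hab : a ≤ b)
    (hr : ∀ x ∈ Set.Ico a b, ∀ᶠ y in 𝓝[>] x, R x ≤ R y)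
    (hl : ∀ x ∈ Set.Ioc a b, ∀ c, (∀ y ∈ Set.Ico a x, c ≤ R y) → c ≤ R x) : R a ≤ R b := by
  set S := {x | x ∈ Set.Icc a b ∧ ∀ y ∈ Set.Icc a x, R a ≤ R y} with hS
  have haS : a ∈ S := ⟨⟨le_rfl, hab⟩, fun y hy => by rw [le_antisymm hy.2 hy.1]⟩
  have hbd : BddAbove S := ⟨b, fun x hx => hx.1.2⟩
  set x := sSup S with hx
  have hax : a ≤ x := le_csSup hbd haS
  have hxb : x ≤ b := csSup_le ⟨a, haS⟩ fun y hy => hy.1.2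
  have hlt : ∀ y ∈ Set.Ico a x, R a ≤ R y := by
    intro y hy
    obtain ⟨s, hs, hys⟩ := exists_lt_of_lt_csSup ⟨a, haS⟩ hy.2
    exact hs.2 y ⟨hy.1, hys.le⟩
  have hRx : R a ≤ R x := by
    rcases hax.eq_or_lt with h | h
    · rw [← h]
    · exact hl x ⟨h, hxb⟩ _ hlt
  rcases hxb.eq_or_lt with h | h
  · rwa [h] at hRx
  · exfalso
    obtain ⟨u, hu, hxu⟩ := (mem_nhdsGT_iff_exists_Ioo_subset).1 (hr x ⟨hax, h⟩)
    have hu' : x < u := hu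
    set v := min b ((x + u) / 2) with hv
    have hxv : x < v := lt_min h (by linarith)
    have hvS : v ∈ S := by
      refine ⟨⟨hax.trans hxv.le, min_le_left _ _⟩, fun y hy => ?_⟩
      rcases lt_trichotomy y x with h1 | h1 | h1
      · exact hlt y ⟨hy.1, h1⟩
      · rwa [h1]
      · refine hRx.trans (hxu ⟨h1, ?_⟩)
        have := hy.2.trans (min_le_right b _)
        linarith
    exact absurd (le_csSup hbd hvS) (not_le.2 hxv)

lemma quadratic_step {θ₀ a b c θ m G Δ ΔG E E' E₀ ε : ℝ} (ha : 0 ≤ a) (hb : 0 ≤ b) (hc : 0 ≤ c)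
    (hθ₀ : 0 ≤ θ₀) (hε : 0 ≤ ε) (hΔ : 0 ≤ Δ) (hE₀ : E₀ ≤ E) (hE : 0 < E)
    (hEE : E ≤ E') (hl : E * Δ ≤ ΔG) (hu : ΔG ≤ E' * Δ) (hG : 0 ≤ a * G) (hG' : 0 ≤ a * (G - ΔG))
    (h1 : θ₀ * (E' - E) + a * E * E' * Δ + 2 * b * m * (E' - E) + θ / 2 ≤ θ)
    (h2 : (θ₀ * m - b * m ^ 2) * (E' - E - ε * (2 * E)) ≤ θ * ε)
    (h3 : ε * (θ₀ * m - b * m ^ 2 + c) ≤ Δ * (a * G - b * m + θ / (4 * E))) :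
    (θ₀ * G - a * G ^ 2 - E * (θ₀ * m - b * m ^ 2)) -
      (θ₀ * (G - ΔG) - a * (G - ΔG) ^ 2 - E' * (θ₀ * (m - Δ) - b * (m - Δ) ^ 2)) ≤
      θ * (Δ + ε) - 2 * E₀ * c * ε := by
  have h5 := mul_le_mul_of_nonneg_left h3 (show 0 ≤ 2 * E by positivity)
  have h6 : 2 * E * (Δ * (a * G - b * m + θ / (4 * E))) =
      2 * E * Δ * (a * G - b * m) + Δ * (θ / 2) := by field_simp; ring
  rw [h6] at h5
  have h7 := mul_le_mul_of_nonneg_left h1 hΔ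
  have t1 := mul_le_mul_of_nonneg_left hu hθ₀
  have q1 := mul_le_mul_of_nonneg_left hu (show 0 ≤ a * (E * Δ) by positivity)
  have q3 : 0 ≤ a * G * (ΔG - E * Δ) := mul_nonneg hG (by linarith)
  have q4 : 0 ≤ a * (G - ΔG) * (ΔG - E * Δ) := mul_nonneg hG' (by linarith)
  have hEE' : 0 ≤ E' - E := by linarith
  have t3 : 0 ≤ (E' - E) * (θ₀ * Δ + b * Δ ^ 2) := by positivity
  have t4 : 0 ≤ E * (b * Δ ^ 2) := by positivity
  have t5 : E₀ * (c * ε) ≤ E * (c * ε) := mul_le_mul_of_nonneg_right hE₀ (by positivity)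
  linarith

/-- The differential inequality behind Bandle's isoperimetric inequality and the sphere covering
inequality, for monotone functions which may jump. -/
theorem quadratic_mono {m G : ℝ → ℝ} {a b c θ₀ s₀ s₁ : ℝ} (ha : 0 ≤ a) (hb : 0 ≤ b) (hc : 0 ≤ c)
    (h01 : s₀ ≤ s₁) (hm0 : ∀ s, 0 ≤ m s) (hm : Antitone m)
    (hmr : ∀ s, ContinuousWithinAt m (Set.Ioi s) s)
    (hlow : ∀ s s', s ≤ s' → Real.exp (2 * s) * (m s - m s') ≤ G s - G s')
    (hupp : ∀ s s', s ≤ s' → G s - G s' ≤ Real.exp (2 * s') * (m s - m s'))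
    (hle : ∀ s ∈ Set.Icc s₀ s₁, b * m s ≤ a * G s)
    (hstep : ∀ s ∈ Set.Ico s₀ s₁, ∀ θ > 0, ∀ᶠ s' in 𝓝[>] s,
      (s' - s) * (θ₀ * m s - b * m s ^ 2 + c) ≤ (m s - m s') * (a * G s - b * m s + θ))
    (hθ₀ : 0 ≤ θ₀) :
    θ₀ * G s₀ - a * G s₀ ^ 2 - Real.exp (2 * s₀) * (θ₀ * m s₀ - b * m s₀ ^ 2) +
      2 * Real.exp (2 * s₀) * c * (s₁ - s₀) ≤
    θ₀ * G s₁ - a * G s₁ ^ 2 - Real.exp (2 * s₁) * (θ₀ * m s₁ - b * m s₁ ^ 2) := by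
  have hG : Antitone G := by
    intro s s' h
    have h1 := hlow s s' h
    have h2 := mul_nonneg (Real.exp_pos (2 * s)).le (sub_nonneg.2 (hm h))
    linarith
  set Q : ℝ → ℝ := fun s => θ₀ * G s - a * G s ^ 2 - Real.exp (2 * s) * (θ₀ * m s - b * m s ^ 2)
    with hQ
  suffices H : ∀ θ > 0, Q s₀ - θ * (m s₀ - s₀) - 2 * Real.exp (2 * s₀) * c * s₀ ≤
      Q s₁ - θ * (m s₁ - s₁) - 2 * Real.exp (2 * s₀) * c * s₁ by
    have h1 : Tendsto (fun θ : ℝ => Q s₀ - θ * (m s₀ - s₀) - 2 * Real.exp (2 * s₀) * c * s₀)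
        (𝓝[>] 0) (𝓝 (Q s₀ - 0 * (m s₀ - s₀) - 2 * Real.exp (2 * s₀) * c * s₀)) :=
      (Continuous.tendsto (by fun_prop) _).mono_left nhdsWithin_le_nhds
    have h2 : Tendsto (fun θ : ℝ => Q s₁ - θ * (m s₁ - s₁) - 2 * Real.exp (2 * s₀) * c * s₁)
        (𝓝[>] 0) (𝓝 (Q s₁ - 0 * (m s₁ - s₁) - 2 * Real.exp (2 * s₀) * c * s₁)) :=
      (Continuous.tendsto (by fun_prop) _).mono_left nhdsWithin_le_nhds
    have := le_of_tendsto_of_tendsto h1 h2 (by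
      filter_upwards [self_mem_nhdsWithin] with θ hθ using H θ hθ)
    simp only [hQ] at this ⊢
    linarith
  intro θ hθ
  refine le_of_local_le (R := fun s => Q s - θ * (m s - s) - 2 * Real.exp (2 * s₀) * c * s) h01
    ?_ ?_
  · intro s hs
    set E := Real.exp (2 * s) with hE
    have hE0 : 0 < E := Real.exp_pos _
    have hm' : Tendsto m (𝓝[>] s) (𝓝 (m s)) := hmr s
    have hE' : Tendsto (fun s' => Real.exp (2 * s')) (𝓝[>] s) (𝓝 E) :=
      (Continuous.tendsto (by fun_prop) s).mono_left nhdsWithin_le_nhds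
    have hbr : Tendsto (fun s' => θ₀ * (Real.exp (2 * s') - E) + a * E * Real.exp (2 * s') *
        (m s - m s') + 2 * b * m s * (Real.exp (2 * s') - E) + θ / 2) (𝓝[>] s) (𝓝 (θ / 2)) := by
      have h1 := (hE'.sub_const E).const_mul θ₀
      have h2 := ((hE'.const_mul (a * E)).mul (hm'.const_sub (m s)))
      have h3 := (hE'.sub_const E).const_mul (2 * b * m s)
      simpa using ((h1.add h2).add h3).add_const (θ / 2)
    have hder : ∀ᶠ s' in 𝓝[>] s, |θ₀ * m s - b * m s ^ 2| * |Real.exp (2 * s') - E -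
        (s' - s) * (2 * E)| ≤ θ * |s' - s| := by
      have hd : HasDerivAt (fun s' => Real.exp (2 * s')) (2 * E) s := by
        have := (Real.hasDerivAt_exp (2 * s)).comp s ((hasDerivAt_id s).const_mul 2)
        simpa [hE, mul_comm, Function.comp_def] using this
      have h1 := (hasDerivAt_iff_isLittleO.1 hd).const_mul_left |θ₀ * m s - b * m s ^ 2|
      filter_upwards [nhdsWithin_le_nhds (h1.def hθ)] with s' h
      simpa [abs_mul, smul_eq_mul] using h
    filter_upwards [Ioc_mem_nhdsGT hs.2, hbr.eventually_le_const (show θ / 2 < θ by linarith), hder,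
      hstep s hs (θ / (4 * E)) (by positivity)] with s' hs1 h1 h2 h3
    have hss : s < s' := hs1.1
    set E' := Real.exp (2 * s') with hE'
    have hEE : E ≤ E' := Real.exp_le_exp.2 (by linarith)
    have hΔ : 0 ≤ m s - m s' := sub_nonneg.2 (hm hss.le)
    have hl := hlow s s' hss.le
    have hu := hupp s s' hss.le
    have hE₀ : Real.exp (2 * s₀) ≤ E := Real.exp_le_exp.2 (by linarith [hs.1])
    rw [abs_of_pos (show 0 < s' - s by linarith)] at h2
    have h4 : (θ₀ * m s - b * m s ^ 2) * (E' - E - (s' - s) * (2 * E)) ≤ θ * (s' - s) :=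
      (le_abs_self _).trans ((abs_mul _ _).le.trans h2)
    have key := quadratic_step (E₀ := Real.exp (2 * s₀)) ha hb hc hθ₀ (by linarith) hΔ hE₀
      hE0 hEE hl hu ((mul_nonneg hb (hm0 s)).trans (hle s ⟨hs.1, hs.2.le⟩)) (by
        rw [sub_sub_cancel]
        exact (mul_nonneg hb (hm0 s')).trans (hle s' ⟨hs.1.trans hss.le, hs1.2⟩)) h1 h4 h3
    simp only [sub_sub_cancel] at key
    simp only [hQ, ← hE, ← hE']
    linarith
  · intro x hx c' hc'
    have hml := hm.tendsto_leftLim x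
    have hGl := hG.tendsto_leftLim x
    set M := Function.leftLim m x with hM
    set H := Function.leftLim G x with hH
    set E := Real.exp (2 * x) with hE
    have hE' : Tendsto (fun s' => Real.exp (2 * s')) (𝓝[<] x) (𝓝 E) :=
      (Continuous.tendsto (by fun_prop) x).mono_left nhdsWithin_le_nhds
    have hid : Tendsto (fun s' : ℝ => s') (𝓝[<] x) (𝓝 x) := nhdsWithin_le_nhds
    have hlim : Tendsto (fun s => Q s - θ * (m s - s) - 2 * Real.exp (2 * s₀) * c * s) (𝓝[<] x)
        (𝓝 (θ₀ * H - a * H ^ 2 - E * (θ₀ * M - b * M ^ 2) - θ * (M - x) -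
          2 * Real.exp (2 * s₀) * c * x)) :=
      ((((hGl.const_mul _).sub ((hGl.pow 2).const_mul _)).sub (hE'.mul ((hml.const_mul _).sub
        ((hml.pow 2).const_mul _)))).sub ((hml.sub hid).const_mul _)).sub (hid.const_mul _)
    have h1 : c' ≤ θ₀ * H - a * H ^ 2 - E * (θ₀ * M - b * M ^ 2) - θ * (M - x) -
          2 * Real.exp (2 * s₀) * c * x :=
      ge_of_tendsto hlim (by
        filter_upwards [Ico_mem_nhdsLT hx.1] with y hy using hc' y hy)
    have h2 : H - G x = E * (M - m x) := by
      refine le_antisymm ?_ ?_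
      · exact le_of_tendsto_of_tendsto (hGl.sub_const (G x)) ((hml.sub_const (m x)).const_mul E) (by
          filter_upwards [self_mem_nhdsWithin] with y hy using hupp y x (le_of_lt hy))
      · exact le_of_tendsto_of_tendsto (hE'.mul (hml.sub_const (m x))) (hGl.sub_const (G x)) (by
          filter_upwards [self_mem_nhdsWithin] with y hy using hlow y x (le_of_lt hy))
    have h3 : m x ≤ M := hm.le_leftLim le_rfl
    have h4 : b * M ≤ a * H := le_of_tendsto_of_tendsto (hml.const_mul b) (hGl.const_mul a) (by
      filter_upwards [Ico_mem_nhdsLT hx.1] with y hy using hle y ⟨hy.1, hy.2.le.trans hx.2⟩)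
    have h5 := hle x ⟨hx.1.le, hx.2⟩
    refine h1.trans ?_
    have h6 : H = G x + E * (M - m x) := by linarith
    have h7 : 0 ≤ E * (M - m x) * (a * (H + G x) - b * (M + m x)) :=
      mul_nonneg (mul_nonneg (Real.exp_pos _).le (by linarith)) (by linarith)
    have h8 : 0 ≤ θ * (M - m x) := mul_nonneg hθ.le (by linarith)
    simp only [hQ, ← hE]
    rw [h6] at h7 ⊢
    nlinarith

end Monotone

section Bandle

open Filter Topology

lemma contDiff_re_eval (p : Polynomial ℂ) : ContDiff ℝ ∞ fun z : ℂ => (p.eval z).re :=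
  Complex.reCLM.contDiff.comp ((p.differentiable.contDiff (n := ∞)).restrict_scalars ℝ)

lemma plap_re_eval (p : Polynomial ℂ) (z : ℂ) : plap (fun z : ℂ => (p.eval z).re) z = 0 := by
  have h : ∀ (q : Polynomial ℂ) (z v : ℂ), fderiv ℝ (fun z : ℂ => (q.eval z).re) z v =
      (v * q.derivative.eval z).re := by
    intro q z v
    have h1 : HasFDerivAt (fun z : ℂ => q.eval z) (fderiv ℝ (fun z : ℂ => q.eval z) z) z :=
      ((q.differentiable z).restrictScalars ℝ).hasFDerivAt
    have h2 : HasFDerivAt (fun z : ℂ => (q.eval z).re) _ z := Complex.reCLM.hasFDerivAt.comp z h1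
    rw [h2.fderiv, ContinuousLinearMap.comp_apply, fderiv_of_differentiableAt (q.differentiable z),
      q.deriv]
    rfl
  have e1 : px (fun z : ℂ => (p.eval z).re) = fun z => (p.derivative.eval z).re := by
    ext z; rw [px, h, one_mul]
  have e2 : py (fun z : ℂ => (p.eval z).re) =
      fun z => ((Polynomial.C Complex.I * p.derivative).eval z).re := by
    ext z; rw [py, h]; simp
  rw [plap, e1, e2, px, py, h, h]
  simp

/-- The integral of `f` over the part of `D` where `φ > t`. -/
def tail (D : Set ℂ) (φ f : ℂ → ℝ) (t : ℝ) : ℝ := ∫ z in {z | z ∈ D ∧ t < φ z}, f z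

variable {D : Set ℂ} {φ f g : ℂ → ℝ}

lemma measurableSet_layer (hD : IsOpen D) (hφ : Continuous φ) (t : ℝ) :
    MeasurableSet {z | z ∈ D ∧ t < φ z} :=
  (hD.inter (isOpen_lt continuous_const hφ)).measurableSet

lemma layer_subset (t : ℝ) : {z | z ∈ D ∧ t < φ z} ⊆ D := fun _ hz => hz.1

lemma layer_anti {s t : ℝ} (h : s ≤ t) :
    {z | z ∈ D ∧ t < φ z} ⊆ {z | z ∈ D ∧ s < φ z} := fun _ hz => ⟨hz.1, h.trans_lt hz.2⟩

lemma tail_nonneg (hf : ∀ z, 0 ≤ f z) (t : ℝ) : 0 ≤ tail D φ f t := integral_nonneg hf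

lemma tail_anti (hf : ∀ z, 0 ≤ f z) (hfi : IntegrableOn f D) : Antitone (tail D φ f) :=
  fun _ _ h => setIntegral_mono_set (hfi.mono_set (layer_subset _)) (Eventually.of_forall hf)
    (layer_anti h).eventuallyLE

lemma tail_le (hf : ∀ z, 0 ≤ f z) (hfi : IntegrableOn f D) (t : ℝ) :
    tail D φ f t ≤ ∫ z in D, f z :=
  setIntegral_mono_set hfi (Eventually.of_forall hf) (layer_subset _).eventuallyLE

lemma tail_sub (hD : IsOpen D) (hφ : Continuous φ) (hfi : IntegrableOn f D) {s s' : ℝ}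
    (h : s ≤ s') : tail D φ f s - tail D φ f s' =
      ∫ z in {z | z ∈ D ∧ s < φ z} \ {z | z ∈ D ∧ s' < φ z}, f z :=
  (setIntegral_sdiff (measurableSet_layer hD hφ s') (hfi.mono_set (layer_subset _))
    (layer_anti h)).symm

lemma tail_sub_le (hD : IsOpen D) (hφ : Continuous φ) (hfi : IntegrableOn f D)
    (hgi : IntegrableOn g D) {s s' c : ℝ} (h : s ≤ s')
    (hfg : ∀ z ∈ D, s < φ z → φ z ≤ s' → f z ≤ c * g z) :
    tail D φ f s - tail D φ f s' ≤ c * (tail D φ g s - tail D φ g s') := by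
  rw [tail_sub hD hφ hfi h, tail_sub hD hφ hgi h, ← integral_const_mul]
  have hs : {z | z ∈ D ∧ s < φ z} \ {z | z ∈ D ∧ s' < φ z} ⊆ D := fun z hz => hz.1.1
  exact setIntegral_mono_on (hfi.mono_set hs) ((hgi.mono_set hs).const_mul c)
    ((measurableSet_layer hD hφ s).diff (measurableSet_layer hD hφ s'))
    fun z hz => hfg z hz.1.1 hz.1.2 (not_lt.1 fun h' => hz.2 ⟨hz.1.1, h'⟩)

lemma tail_right_continuous (hφ : Continuous φ) (hfi : IntegrableOn f D) (s : ℝ) :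
    ContinuousWithinAt (tail D φ f) (Set.Ioi s) s := by
  have e : ∀ t, tail D φ f t = ∫ z in D, {z | t < φ z}.indicator f z := by
    intro t
    rw [tail, setIntegral_indicator (isOpen_lt continuous_const hφ).measurableSet]
    rfl
  rw [ContinuousWithinAt, e s]
  refine Tendsto.congr (fun t => (e t).symm) ?_
  refine tendsto_integral_filter_of_dominated_convergence (fun z => ‖f z‖) ?_ ?_ hfi.norm ?_
  · exact Eventually.of_forall fun t =>
      hfi.aestronglyMeasurable.indicator (isOpen_lt continuous_const hφ).measurableSet
  · exact Eventually.of_forall fun t => Eventually.of_forall fun z => norm_indicator_le_norm_self _ _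
  · refine Eventually.of_forall fun z => ?_
    by_cases hz : s < φ z
    · refine tendsto_const_nhds.congr' ?_
      filter_upwards [Ioo_mem_nhdsGT hz] with t ht
      rw [Set.indicator_of_mem (show z ∈ {z | s < φ z} from hz),
        Set.indicator_of_mem (show z ∈ {z | t < φ z} from ht.2)]
    · refine tendsto_const_nhds.congr' ?_
      filter_upwards [self_mem_nhdsWithin] with t ht
      rw [Set.indicator_of_notMem (show z ∉ {z | s < φ z} from hz),
        Set.indicator_of_notMem (show z ∉ {z | t < φ z} from fun h => hz ((show s < t from ht).trans h))]

lemma tail_eq_zero {B t : ℝ} (hB : ∀ z ∈ D, φ z ≤ B) (ht : B ≤ t) : tail D φ f t = 0 := by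
  have : {z | z ∈ D ∧ t < φ z} = ∅ := by
    ext z
    simp only [Set.mem_ofPred_eq, Set.mem_empty_iff_false, iff_false, not_and, not_lt]
    exact fun hz => (hB z hz).trans ht
  rw [tail, this, setIntegral_empty]

/-- Bandle's isoperimetric inequality for the metric `e^{2V}`, comparing with a flat metric. -/
theorem bandle {V : ℂ → ℝ} {κ η : ℝ} {K : Set ℂ} (hD : IsOpen D) (hV : ContDiff ℝ ∞ V)
    (hκ : 0 ≤ κ) (hK : IsCompact K) (hDK : D ⊆ K)
    (hsub : ∀ z ∈ D, -plap V z ≤ κ * Real.exp (2 * V z)) (p : Polynomial ℂ)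
    (hc : ∀ s, η < s → IsCompact {z | z ∈ D ∧ s ≤ V z - (p.eval z).re}) :
    (∫ z in D, Real.exp (2 * V z)) * (4 * π - κ * ∫ z in D, Real.exp (2 * V z)) ≤
      4 * π * Real.exp (2 * η) * ∫ z in D, Real.exp (2 * (p.eval z).re) := by
  set h : ℂ → ℝ := fun z => (p.eval z).re with hh
  have hhs : ContDiff ℝ ∞ h := contDiff_re_eval p
  set φ : ℂ → ℝ := V - h with hφdef
  have hφ : ContDiff ℝ ∞ φ := cdSub hV hhs
  have hlapφ : ∀ z, plap φ z = plap V z := fun z => by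
    rw [hφdef, plap_sub hV hhs, Pi.sub_apply, plap_re_eval, sub_zero]
  obtain ⟨Φ, hΦ, hΦd, hΦn⟩ := exists_entire_norm_px_eq_exp p
  have hΦ2 : ∀ z, ‖px Φ z‖ ^ 2 = Real.exp (2 * h z) := fun z => by
    rw [hΦn, ← Real.exp_nat_mul, Nat.cast_ofNat]
  set f : ℂ → ℝ := fun z => Real.exp (2 * h z) with hf
  set g : ℂ → ℝ := fun z => Real.exp (2 * V z) with hg
  have hf0 : ∀ z, 0 ≤ f z := fun z => (Real.exp_pos _).le
  have hg0 : ∀ z, 0 ≤ g z := fun z => (Real.exp_pos _).le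
  have hfc : Continuous f := Real.continuous_exp.comp (continuous_const.mul hhs.continuous)
  have hgc : Continuous g := Real.continuous_exp.comp (continuous_const.mul hV.continuous)
  have hfi : IntegrableOn f D := (hfc.continuousOn.integrableOn_compact hK).mono_set hDK
  have hgi : IntegrableOn g D := (hgc.continuousOn.integrableOn_compact hK).mono_set hDK
  have hgf : ∀ z, g z = Real.exp (2 * φ z) * f z := fun z => by
    rw [hf, hg, ← Real.exp_add]; simp only [hφdef, Pi.sub_apply]; ring_nf
  obtain ⟨B, hB⟩ : ∃ B, ∀ z ∈ D, φ z ≤ B := by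
    obtain ⟨B, hB⟩ := hK.bddAbove_image hφ.continuous.continuousOn
    exact ⟨B, fun z hz => hB ⟨z, hDK hz, rfl⟩⟩
  set m := tail D φ f with hm
  set G := tail D φ g with hG
  have hlow : ∀ s s', s ≤ s' → Real.exp (2 * s) * (m s - m s') ≤ G s - G s' := by
    intro s s' hs
    have := tail_sub_le (s := s) (s' := s') (c := Real.exp (-(2 * s))) hD hφ.continuous hfi hgi hs
      (fun z _ h1 _ => by
        rw [hgf, ← mul_assoc, ← Real.exp_add]
        refine le_mul_of_one_le_left (hf0 z) (Real.one_le_exp (by linarith)))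
    have h2 := mul_le_mul_of_nonneg_left this (Real.exp_pos (2 * s)).le
    rwa [← mul_assoc, ← Real.exp_add, add_neg_cancel, Real.exp_zero, one_mul] at h2
  have hupp : ∀ s s', s ≤ s' → G s - G s' ≤ Real.exp (2 * s') * (m s - m s') := by
    intro s s' hs
    refine tail_sub_le hD hφ.continuous hgi hfi hs (fun z _ _ h1 => ?_)
    rw [hgf]
    refine mul_le_mul_of_nonneg_right (Real.exp_le_exp.2 (by linarith)) (hf0 z)
  have hmain : ∀ s, η < s → G s * (4 * π - κ * G s) ≤ 4 * π * Real.exp (2 * s) * m s := by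
    intro s hs
    have := quadratic_mono (m := m) (G := G) (a := κ) (b := 0) (c := 0) (θ₀ := 4 * π) (s₀ := s)
      (s₁ := max s B) hκ le_rfl le_rfl (le_max_left _ _) (fun s => tail_nonneg hf0 s)
      (tail_anti hf0 hfi) (tail_right_continuous hφ.continuous hfi) hlow hupp
      (fun s _ => by rw [zero_mul]; exact mul_nonneg hκ (tail_nonneg hg0 s)) (by
        intro t ht θ hθ
        have h1 : Tendsto (fun s' => 4 * π * (s' - t)) (𝓝[>] t) (𝓝 (4 * π * (t - t))) :=
          (Continuous.tendsto (by fun_prop) t).mono_left nhdsWithin_le_nhds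
        rw [sub_self, mul_zero] at h1
        filter_upwards [self_mem_nhdsWithin, h1.eventually_le_const hθ] with s' hs' hθ'
        have hts : t < s' := hs'
        have h2 := layer_isoperimetric (D := D) (φ := φ) (s := t) (s' := s') (g := fun z => κ * g z)
          hD hφ hts (hc t (hs.trans_le ht.1)) hΦ (fun z _ => hΦd z) (fun z _ _ => mul_nonneg hκ (hg0 z))
          (fun z hz _ => by rw [hlapφ]; exact hsub z hz)
          ((hgi.mono_set (layer_subset _)).const_mul κ)
        simp only [hΦ2] at h2
        rw [integral_const_mul] at h2
        have h2' : 4 * π * (s' - t) * m s' ≤ κ * G t * (m t - m s') := h2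
        have h3 : 0 ≤ m t - m s' := sub_nonneg.2 (tail_anti hf0 hfi hts.le)
        have h4 := mul_le_mul_of_nonneg_left hθ' h3
        linarith) (by positivity)
    have e1 : m (max s B) = 0 := tail_eq_zero hB (le_max_right _ _)
    have e2 : G (max s B) = 0 := tail_eq_zero hB (le_max_right _ _)
    rw [e1, e2] at this
    linarith
  have hη : G η * (4 * π - κ * G η) ≤ 4 * π * Real.exp (2 * η) * m η := by
    have h1 := tail_right_continuous (f := g) hφ.continuous hgi η
    have h2 := tail_right_continuous (f := f) hφ.continuous hfi η
    have h3 : Tendsto (fun s => Real.exp (2 * s)) (𝓝[>] η) (𝓝 (Real.exp (2 * η))) :=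
      (Continuous.tendsto (by fun_prop) η).mono_left nhdsWithin_le_nhds
    exact le_of_tendsto_of_tendsto (Tendsto.mul h1 ((Tendsto.const_mul κ h1).const_sub (4 * π)))
      (Tendsto.mul (h3.const_mul (4 * π)) h2) (by
        filter_upwards [self_mem_nhdsWithin] with s hs using hmain s hs)
  have hmeas := measurableSet_layer hD hφ.continuous η
  have hr : (∫ z in D, g z) - G η ≤ Real.exp (2 * η) * ((∫ z in D, f z) - m η) := by
    rw [hG, hm, tail, tail, ← setIntegral_sdiff hmeas hgi (layer_subset _),
      ← setIntegral_sdiff hmeas hfi (layer_subset _), ← integral_const_mul]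
    refine setIntegral_mono_on (hgi.mono_set Set.sdiff_subset)
      ((hfi.mono_set Set.sdiff_subset).const_mul _) (hD.measurableSet.diff hmeas) fun z hz => ?_
    have : φ z ≤ η := not_lt.1 fun h' => hz.2 ⟨hz.1, h'⟩
    rw [hgf]
    exact mul_le_mul_of_nonneg_right (Real.exp_le_exp.2 (by linarith)) (hf0 z)
  have hGμ : G η ≤ ∫ z in D, g z := tail_le hg0 hgi η
  have hG0 : 0 ≤ G η := tail_nonneg hg0 η
  set μ := ∫ z in D, g z
  have h1 := mul_le_mul_of_nonneg_left hr (show 0 ≤ 4 * π by positivity)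
  have h2 : 0 ≤ κ * ((μ - G η) * (μ + G η)) :=
    mul_nonneg hκ (mul_nonneg (by linarith) (by linarith))
  linarith

end Bandle

section Layers

open Filter Topology

lemma closure_connectedComponentIn_inter_subset {X : Type*} [TopologicalSpace X] (F : Set X)
    (x : X) : closure (connectedComponentIn F x) ∩ F ⊆ connectedComponentIn F x := by
  by_cases hx : x ∈ F
  · refine IsPreconnected.subset_connectedComponentIn (x := x) ?_
      ⟨subset_closure (mem_connectedComponentIn hx), hx⟩ Set.inter_subset_right
    exact isPreconnected_connectedComponentIn.subset_closure
      (Set.subset_inter subset_closure (connectedComponentIn_subset F x)) Set.inter_subset_left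
  · simp [connectedComponentIn_eq_empty hx]

lemma isPreconnected_norm_gt (R : ℝ) : IsPreconnected {z : ℂ | R < ‖z‖} := by
  have h : {z : ℂ | R < ‖z‖} =
      (fun q : ℝ × ℝ => (q.1 : ℂ) * Complex.exp (q.2 * Complex.I)) '' (Set.Ioi R ×ˢ Set.univ) := by
    ext z
    constructor
    · intro hz
      exact ⟨(‖z‖, z.arg), ⟨hz, trivial⟩, Complex.norm_mul_exp_arg_mul_I z⟩
    · rintro ⟨⟨r, θ⟩, ⟨hr, -⟩, rfl⟩
      have hr' : R < r := hr
      simp only [Set.mem_ofPred_eq, norm_mul, Complex.norm_exp_ofReal_mul_I, mul_one,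
        Complex.norm_real, Real.norm_eq_abs]
      exact hr'.trans_le (le_abs_self r)
  rw [h]
  exact (isPreconnected_Ioi.prod isPreconnected_univ).image _ (by fun_prop)

lemma deriv_deriv_nonneg_of_isLocalMin {f : ℝ → ℝ} {x : ℝ} (hf : IsLocalMin f x)
    (hc : ContinuousAt f x) : 0 ≤ deriv (deriv f) x := by
  by_contra h
  rw [not_le] at h
  have h1 := isLocalMax_of_deriv_deriv_neg h hf.deriv_eq_zero hc
  have h2 : f =ᶠ[𝓝 x] fun _ => f x := by
    filter_upwards [hf, h1] with y hy hy' using le_antisymm hy' hy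
  have h3 : deriv f =ᶠ[𝓝 x] fun _ => 0 := by simpa using h2.deriv
  rw [h3.deriv_eq] at h
  simp at h

lemma plap_nonneg_of_isLocalMin {f : ℂ → ℝ} (hf : ContDiff ℝ ∞ f) {z : ℂ} (h : IsLocalMin f z) :
    0 ≤ plap f z := by
  have key : ∀ {f : ℂ → ℝ}, ContDiff ℝ ∞ f → ∀ (v : ℂ) (t : ℝ),
      HasDerivAt (fun t : ℝ => f (z + t * v)) (fderiv ℝ f (z + t * v) v) t := by
    intro f hf v t
    have h1 : HasDerivAt (fun t : ℝ => z + t * v) v t := by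
      have := ((Complex.ofRealCLM.hasDerivAt (x := t)).mul_const v).const_add z
      simpa using this
    exact (hasFDerivAt_of_smooth hf _).comp_hasDerivAt t h1
  have main : ∀ v : ℂ, 0 ≤ fderiv ℝ (fun z => fderiv ℝ f z v) z v := by
    intro v
    have h2 : ContDiff ℝ ∞ (fun z => fderiv ℝ f z v) :=
      (hf.fderiv_right (m := ∞) (by simp)).clm_apply contDiff_const
    have hc : ContinuousAt (fun t : ℝ => z + t * v) 0 := by fun_prop
    have hmin : IsLocalMin (fun t : ℝ => f (z + t * v)) 0 := by
      have : Tendsto (fun t : ℝ => z + t * v) (𝓝 0) (𝓝 z) := by simpa using hc.tendsto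
      filter_upwards [this.eventually h] with t ht
      simpa using ht
    have h3 := deriv_deriv_nonneg_of_isLocalMin hmin (key hf v 0).continuousAt
    have e1 : deriv (fun t : ℝ => f (z + t * v)) = fun t : ℝ => fderiv ℝ f (z + t * v) v :=
      funext fun t => (key hf v t).deriv
    rw [e1, (key h2 v 0).deriv] at h3
    simpa using h3
  exact add_nonneg (main 1) (main Complex.I)

variable {D : Set ℂ} {w : ℂ → ℝ}

/-- If `w` is superharmonic on `D`, the superlevel sets of `w` in `D` have no holes other than
those of `D`. -/
lemma isPreconnected_compl_layer (hDc : IsPreconnected Dᶜ)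
    (hL : {z : ℂ | z.im ≤ 0} ⊆ Dᶜ) (hw : ContDiff ℝ ∞ w) {t : ℝ}
    (hK : IsCompact {z | z ∈ D ∧ t ≤ w z}) (hneg : ∀ z ∈ D, plap w z < 0) :
    IsPreconnected {z | z ∈ D ∧ t ≤ w z}ᶜ := by
  set F : Set ℂ := {z | z ∈ D ∧ t ≤ w z}ᶜ with hF
  have hFo : IsOpen F := hK.isClosed.isOpen_compl
  have hDF : Dᶜ ⊆ F := fun z hz h => hz h.1
  refine isPreconnected_of_forall (0 : ℂ) fun x hx => ?_
  have h0 : (0 : ℂ) ∈ Dᶜ := hL (by simp)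
  set C := connectedComponentIn F x with hC
  have hxC : x ∈ C := mem_connectedComponentIn hx
  by_cases hCD : (C ∩ Dᶜ).Nonempty
  · obtain ⟨a, haC, haD⟩ := hCD
    exact ⟨C ∪ Dᶜ, Set.union_subset (connectedComponentIn_subset F x) hDF, Or.inr h0, Or.inl hxC,
      isPreconnected_connectedComponentIn.union a haC haD hDc⟩
  exfalso
  have hCD' : C ⊆ D := fun a ha => by
    by_contra h
    exact hCD ⟨a, ha, h⟩
  obtain ⟨R, hR⟩ := hK.isBounded.exists_norm_le
  set R' := max R 0
  have hR0 : 0 ≤ R' := le_max_right _ _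
  have hout : {z : ℂ | R' < ‖z‖} ⊆ F := fun z hz h =>
    absurd (hR z h) (not_le.2 ((le_max_left _ _).trans_lt hz))
  have hb : ∀ a ∈ C, ‖a‖ ≤ R' := by
    intro a ha
    by_contra h
    have h1 : {z : ℂ | R' < ‖z‖} ⊆ connectedComponentIn F a :=
      (isPreconnected_norm_gt R').subset_connectedComponentIn (not_le.1 h) hout
    rw [← connectedComponentIn_eq ha] at h1
    have h2 : (-(R' + 1) * Complex.I : ℂ) ∈ {z : ℂ | R' < ‖z‖} := by
      have : ‖(-(R' + 1) * Complex.I : ℂ)‖ = R' + 1 := by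
        rw [norm_mul, Complex.norm_I, mul_one, norm_neg, ← Complex.ofReal_one,
          ← Complex.ofReal_add, Complex.norm_real, Real.norm_of_nonneg (by linarith)]
      rw [Set.mem_ofPred_eq, this]; linarith
    refine hL (a := (-(R' + 1) * Complex.I : ℂ)) ?_ (hCD' (h1 h2))
    simp only [Set.mem_ofPred_eq, Complex.mul_im, Complex.neg_re, Complex.add_re,
      Complex.ofReal_re, Complex.one_re, Complex.I_im, mul_one, Complex.I_re, mul_zero, add_zero]
    linarith
  have hcpt : IsCompact (closure C) :=
    (Metric.isBounded_iff_subset_closedBall 0 |>.2 ⟨R', fun a ha => by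
      simpa using hb a ha⟩).isCompact_closure
  obtain ⟨z₀, hz₀, hmin⟩ := hcpt.exists_isMinOn ⟨x, subset_closure hxC⟩ hw.continuous.continuousOn
  have hxt : w x < t := not_le.1 fun h => hx ⟨hCD' hxC, h⟩
  have hz₀t : w z₀ < t := (hmin (subset_closure hxC)).trans_lt hxt
  have hz₀F : z₀ ∈ F := fun h => absurd h.2 (not_le.2 hz₀t)
  have hz₀C : z₀ ∈ C := closure_connectedComponentIn_inter_subset F x ⟨hz₀, hz₀F⟩
  have hloc : IsLocalMin w z₀ := by
    filter_upwards [hFo.connectedComponentIn.mem_nhds hz₀C] with a ha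
    exact hmin (subset_closure ha)
  exact absurd (plap_nonneg_of_isLocalMin hw hloc) (not_le.2 (hneg z₀ (hCD' hz₀C)))

/-- On a superlevel set of `w` in `D`, a smooth `V` is approximated by harmonic polynomials up to
an error controlled by `w`. -/
lemma exists_polynomial_near {V : ℂ → ℝ} (hD : IsOpen D) (hDc : IsPreconnected Dᶜ)
    (hL : {z : ℂ | z.im ≤ 0} ⊆ Dᶜ) (hV : ContDiff ℝ ∞ V) (hw : ContDiff ℝ ∞ w)
    (hcomp : ∀ t > 0, IsCompact {z | z ∈ D ∧ t ≤ w z}) (hneg : ∀ z ∈ D, plap w z < 0)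
    {t : ℝ} (ht : 0 < t) : ∃ C : ℝ, 0 ≤ C ∧ ∀ η > 0, ∃ p : Polynomial ℂ, ∀ z ∈ D, t ≤ w z →
      |(p.eval z).re - V z| ≤ C * (w z - t) + η := by
  obtain ⟨C, hC0, hC⟩ : ∃ C : ℝ, 0 ≤ C ∧ ∀ z ∈ D, t / 2 ≤ w z → |plap V z| ≤ C * -plap w z := by
    have hc : ContinuousOn (fun z => |plap V z| / -plap w z) {z | z ∈ D ∧ t / 2 ≤ w z} :=
      ContinuousOn.div (contDiff_plap hV).continuous.abs.continuousOn
        (contDiff_plap hw).continuous.neg.continuousOn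
        fun z hz => by have := hneg z hz.1; linarith
    obtain ⟨C, hC⟩ := (hcomp _ (half_pos ht)).bddAbove_image hc
    refine ⟨max C 0, le_max_right _ _, fun z hz hz' => ?_⟩
    have h1 : |plap V z| / -plap w z ≤ C := hC ⟨z, ⟨hz, hz'⟩, rfl⟩
    have h2 : 0 < -plap w z := by have := hneg z hz; linarith
    exact (div_le_iff₀ h2).1 (h1.trans (le_max_left _ _))
  refine ⟨C, hC0, fun η hη => ?_⟩
  obtain ⟨a, ha, hat, haC⟩ : ∃ a : ℝ, 0 < a ∧ a ≤ t / 4 ∧ 2 * a * C ≤ η / 2 := by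
    refine ⟨min (t / 4) (η / (4 * (C + 1))), by positivity, min_le_left _ _, ?_⟩
    have h1 : min (t / 4) (η / (4 * (C + 1))) * (4 * (C + 1)) ≤ η := by
      rw [← le_div_iff₀ (by positivity)]; exact min_le_right _ _
    have h2 : 0 < min (t / 4) (η / (4 * (C + 1))) := by positivity
    nlinarith
  obtain ⟨χ, hχ, hχ0, hχ1, hχn, -, -, -, -, -⟩ :=
    exists_smooth_step (s := t - 2 * a) (s' := t - a) (c := 2) (by linarith) (by norm_num)
  have hK2 : IsCompact {z | z ∈ D ∧ t - 2 * a ≤ w z} := hcomp _ (by linarith)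
  set ζ : ℂ → ℝ := D.indicator fun z => χ (w z) with hζ
  have hζs : ContDiff ℝ ∞ ζ := contDiff_indicator_comp hD hw hK2.isClosed hχ hχ0
  have hζc : HasCompactSupport ζ := hasCompactSupport_indicator_comp hK2 hχ0
  have hζn : ∀ z, 0 ≤ ζ z := fun z => Set.indicator_nonneg (fun z _ => hχn _) z
  have hζz : ∀ z, z ∉ {z | z ∈ D ∧ t - 2 * a ≤ w z} → ζ z = 0 := fun z hz =>
    indicator_comp_eq_zero hχ0 hz
  have hζ1 : ∀ z ∈ D, t - a ≤ w z → ζ z = 1 := fun z hz hz' => by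
    rw [hζ, Set.indicator_of_mem hz, hχ1 _ hz']
  set N : Set ℂ := {z | z ∈ D ∧ t - a < w z} with hN
  have hNo : IsOpen N := hD.inter (isOpen_lt continuous_const hw.continuous)
  have hB : ∀ c d : ℝ, ContDiff ℝ ∞ fun z => V z + (c * w z + d) := fun c d =>
    hV.add ((contDiff_const.mul hw).add contDiff_const)
  have hlap : ∀ c d : ℝ, ∀ z ∈ N, plap (fun z => ζ z * (V z + (c * w z + d))) z =
      plap V z + c * plap w z := by
    intro c d z hz
    have h1 : (fun z => ζ z * (V z + (c * w z + d))) =ᶠ[𝓝 z] fun z => V z + (c * w z + d) := by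
      filter_upwards [hNo.mem_nhds hz] with x hx
      rw [hζ1 x hx.1 hx.2.le, one_mul]
    rw [plap_congr h1]
    have e : (fun z => V z + (c * w z + d)) = V + ((fun _ => c) * w + fun _ => d) := rfl
    rw [e, plap_add hV (cdAdd (cdMul contDiff_const hw) contDiff_const),
      plap_add (cdMul contDiff_const hw) contDiff_const, plap_mul contDiff_const hw]
    simp [plap, px, py]
  have hmem : ∀ z ∈ N, |plap V z| ≤ C * -plap w z := fun z hz =>
    hC z hz.1 (by have := hz.2; linarith)
  obtain ⟨p, hp⟩ := exists_polynomial_between (hcomp t ht)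
    (isPreconnected_compl_layer hDc hL hw (hcomp t ht) hneg) hNo
    (fun z hz => ⟨hz.1, by have := hz.2; linarith⟩)
    (B₁ := fun z => ζ z * (V z + (-C * w z + (C * t - η / 2))))
    (B₂ := fun z => ζ z * (V z + (C * w z + (η / 2 - C * t))))
    (hζs.mul (hB _ _)) (hζs.mul (hB _ _)) hζc.mul_right hζc.mul_right (fun z => by
      by_cases hz : z ∈ {z | z ∈ D ∧ t - 2 * a ≤ w z}
      · refine mul_le_mul_of_nonneg_left ?_ (hζn z)
        have h1 := mul_le_mul_of_nonneg_left hz.2 hC0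
        linarith
      · simp [hζz z hz])
    (fun z hz => by
      rw [hlap _ _ z hz]
      have := neg_le_of_abs_le (hmem z hz); linarith)
    (fun z hz => by
      rw [hlap _ _ z hz]
      have := le_of_abs_le (hmem z hz); linarith) (half_pos hη)
  refine ⟨p, fun z hz hz' => ?_⟩
  obtain ⟨h1, h2⟩ := hp z ⟨hz, hz'⟩
  simp only [hζ1 z hz (by linarith), one_mul] at h1 h2
  rw [abs_le]
  constructor <;> linarith

end Layers

section Covering

open Filter Topology

variable {D : Set ℂ} {w V : ℂ → ℝ} {κ : ℝ}

lemma tail_step (hD : IsOpen D) (hDc : IsPreconnected Dᶜ)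
    (hL : {z : ℂ | z.im ≤ 0} ⊆ Dᶜ) (hV : ContDiff ℝ ∞ V) (hw : ContDiff ℝ ∞ w) (hκ : 0 ≤ κ)
    (hpos : ∀ z ∈ D, 0 < w z) (hcomp : ∀ t > 0, IsCompact {z | z ∈ D ∧ t ≤ w z})
    (heq : ∀ z ∈ D, -plap w z = Real.exp (2 * V z) * (Real.exp (2 * w z) - 1))
    (hsub : ∀ z ∈ D, -plap V z ≤ κ * Real.exp (2 * V z))
    (hi1 : IntegrableOn (fun z => Real.exp (2 * V z)) D)
    (hi2 : IntegrableOn (fun z => Real.exp (2 * V z + 2 * w z)) D) {t : ℝ} (ht : 0 < t) :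
    ∃ C : ℝ, ∀ ε > 0, ε * (tail D w (fun z => Real.exp (2 * V z)) t *
        (4 * π - κ * tail D w (fun z => Real.exp (2 * V z)) t)) ≤
      Real.exp (2 * (C * ε)) * (tail D w (fun z => Real.exp (2 * V z + 2 * w z)) t -
        tail D w (fun z => Real.exp (2 * V z)) t + 4 * π * ε) *
        (tail D w (fun z => Real.exp (2 * V z)) t -
          tail D w (fun z => Real.exp (2 * V z)) (t + ε)) := by
  have hneg : ∀ z ∈ D, plap w z < 0 := fun z hz => by
    have h1 : 0 < Real.exp (2 * V z) * (Real.exp (2 * w z) - 1) :=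
      mul_pos (Real.exp_pos _) (by
        have := Real.add_one_lt_exp (x := 2 * w z) (by have := hpos z hz; positivity)
        have := hpos z hz; linarith)
    have := heq z hz; linarith
  obtain ⟨C, hC0, hC⟩ := exists_polynomial_near hD hDc hL hV hw hcomp hneg ht
  refine ⟨C, fun ε hε => ?_⟩
  set μ := tail D w (fun z => Real.exp (2 * V z)) with hμ
  set G := tail D w (fun z => Real.exp (2 * V z + 2 * w z)) with hG
  have hVe : Continuous fun z => Real.exp (2 * V z) :=
    Real.continuous_exp.comp (continuous_const.mul hV.continuous)
  have hμanti : Antitone μ := tail_anti (fun z => (Real.exp_pos _).le) hi1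
  have hΔ : 0 ≤ μ t - μ (t + ε) := sub_nonneg.2 (hμanti (by linarith))
  have hF : G t - μ t = ∫ z in {z | z ∈ D ∧ t < w z},
      Real.exp (2 * V z) * (Real.exp (2 * w z) - 1) := by
    rw [hG, hμ, tail, tail, ← integral_sub (hi2.mono_set (layer_subset _))
      (hi1.mono_set (layer_subset _))]
    refine integral_congr_ae (Eventually.of_forall fun z => ?_)
    simp only [Real.exp_add]; ring
  have hFi : IntegrableOn (fun z => Real.exp (2 * V z) * (Real.exp (2 * w z) - 1))
      {z | z ∈ D ∧ t < w z} := by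
    refine ((hi2.mono_set (layer_subset _)).sub (hi1.mono_set (layer_subset _))).congr
      (Eventually.of_forall fun z => ?_)
    simp only [Pi.sub_apply, Real.exp_add]; ring
  have hg0 : ∀ z ∈ D, 0 ≤ Real.exp (2 * V z) * (Real.exp (2 * w z) - 1) := fun z hz =>
    mul_nonneg (Real.exp_pos _).le (by
      have := Real.one_le_exp (x := 2 * w z) (by have := hpos z hz; linarith); linarith)
  have hF0 : 0 ≤ G t - μ t := by
    rw [hF]
    exact setIntegral_nonneg (measurableSet_layer hD hw.continuous t) fun z hz => hg0 z hz.1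
  have key : ∀ η > 0, ε * (μ t * (4 * π - κ * μ t)) ≤
      Real.exp (2 * η) * ((G t - μ t + 4 * π * ε) *
        (Real.exp (2 * (C * ε + η)) * (μ t - μ (t + ε)))) := by
    intro η hη
    obtain ⟨p, hp⟩ := hC η hη
    obtain ⟨Φ, hΦ, hΦd, hΦn⟩ := exists_entire_norm_px_eq_exp p
    have hΦ2 : ∀ z, ‖px Φ z‖ ^ 2 = Real.exp (2 * (p.eval z).re) := fun z => by
      rw [hΦn, ← Real.exp_nat_mul, Nat.cast_ofNat]
    have hpc : Continuous fun z : ℂ => (p.eval z).re := (contDiff_re_eval p).continuous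
    have hfc : Continuous fun z : ℂ => Real.exp (2 * (p.eval z).re) := by fun_prop
    have hE : IsOpen {z | z ∈ D ∧ t < w z} := hD.inter (isOpen_lt continuous_const hw.continuous)
    have hEK : {z | z ∈ D ∧ t < w z} ⊆ {z | z ∈ D ∧ t ≤ w z} := fun z hz => ⟨hz.1, hz.2.le⟩
    set A := ∫ z in {z | z ∈ D ∧ t < w z}, Real.exp (2 * (p.eval z).re) with hA
    set A' := ∫ z in {z | z ∈ D ∧ t + ε < w z}, Real.exp (2 * (p.eval z).re) with hA'
    have h1 := layer_isoperimetric (D := D) (φ := w) (s := t) (s' := t + ε) hD hw (by linarith)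
      (hcomp t ht) hΦ (fun z _ => hΦd z) (fun z hz _ => hg0 z hz) (fun z hz _ => (heq z hz).le) hFi
    simp only [hΦ2] at h1
    rw [← hF, ← hA, ← hA', add_sub_cancel_left] at h1
    have h2 : μ t * (4 * π - κ * μ t) ≤ 4 * π * Real.exp (2 * η) * A := by
      refine bandle hE hV hκ (hcomp t ht) hEK (fun z hz => hsub z hz.1) p fun s hs => ?_
      have : {z | z ∈ {z | z ∈ D ∧ t < w z} ∧ s ≤ V z - (p.eval z).re} =
          {z | z ∈ D ∧ t ≤ w z} ∩ {z | s ≤ V z - (p.eval z).re} := by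
        ext z
        constructor
        · rintro ⟨hz, hz'⟩; exact ⟨hEK hz, hz'⟩
        · rintro ⟨hz, hz'⟩
          refine ⟨⟨hz.1, lt_of_le_of_ne hz.2 fun h => ?_⟩, hz'⟩
          have h3 := neg_le_of_abs_le (hp z hz.1 hz.2)
          rw [← h, sub_self, mul_zero, zero_add] at h3
          have h4 : s ≤ V z - (p.eval z).re := hz'
          linarith
      rw [this]
      exact (hcomp t ht).inter_right (isClosed_le continuous_const (hV.continuous.sub hpc))
    have h3 : A - A' ≤ Real.exp (2 * (C * ε + η)) * (μ t - μ (t + ε)) := by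
      have hfi : IntegrableOn (fun z : ℂ => Real.exp (2 * (p.eval z).re)) {z | z ∈ D ∧ t < w z} :=
        (hfc.continuousOn.integrableOn_compact (hcomp t ht)).mono_set hEK
      have hsub' : {z | z ∈ D ∧ t + ε < w z} ⊆ {z | z ∈ D ∧ t < w z} := layer_anti (by linarith)
      have hm := measurableSet_layer hD hw.continuous (t + ε)
      have hm' := measurableSet_layer hD hw.continuous t
      rw [hA, hA', hμ, tail_sub hD hw.continuous hi1 (by linarith),
        ← setIntegral_sdiff hm hfi hsub', ← integral_const_mul]
      refine setIntegral_mono_on (hfi.mono_set Set.sdiff_subset)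
        ((hi1.mono_set (Set.sdiff_subset.trans (layer_subset _))).const_mul _)
        (hm'.diff hm) fun z hz => ?_
      have h4 : w z ≤ t + ε := not_lt.1 fun h => hz.2 ⟨hz.1.1, h⟩
      have h5 := le_of_abs_le (hp z hz.1.1 hz.1.2.le)
      have h6 : C * (w z - t) ≤ C * ε := mul_le_mul_of_nonneg_left (by linarith) hC0
      rw [← Real.exp_add]
      exact Real.exp_le_exp.2 (by linarith)
    calc ε * (μ t * (4 * π - κ * μ t)) ≤ ε * (4 * π * Real.exp (2 * η) * A) :=
          mul_le_mul_of_nonneg_left h2 hε.le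
      _ = Real.exp (2 * η) * (4 * π * ε * A) := by ring
      _ ≤ Real.exp (2 * η) * ((G t - μ t + 4 * π * ε) * (A - A')) :=
          mul_le_mul_of_nonneg_left (by linarith) (Real.exp_pos _).le
      _ ≤ _ := by
          refine mul_le_mul_of_nonneg_left (mul_le_mul_of_nonneg_left h3 ?_) (Real.exp_pos _).le
          have := pi_pos; positivity
  have hlim : Tendsto (fun η : ℝ => Real.exp (2 * η) * ((G t - μ t + 4 * π * ε) *
        (Real.exp (2 * (C * ε + η)) * (μ t - μ (t + ε))))) (𝓝[>] 0)
      (𝓝 (Real.exp (2 * 0) * ((G t - μ t + 4 * π * ε) *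
        (Real.exp (2 * (C * ε + 0)) * (μ t - μ (t + ε)))))) :=
    (Continuous.tendsto (by fun_prop) 0).mono_left nhdsWithin_le_nhds
  have := ge_of_tendsto hlim (by filter_upwards [self_mem_nhdsWithin] with η hη using key η hη)
  refine this.trans (le_of_eq ?_)
  rw [mul_zero, Real.exp_zero, add_zero]
  ring

/-- The sphere covering inequality. -/
theorem sphere_covering (hD : IsOpen D) (hne : D.Nonempty) (hDc : IsPreconnected Dᶜ)
    (hL : {z : ℂ | z.im ≤ 0} ⊆ Dᶜ) (hV : ContDiff ℝ ∞ V) (hw : ContDiff ℝ ∞ w) (hκ : 0 ≤ κ)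
    (hκ1 : κ < 1)
    (hpos : ∀ z ∈ D, 0 < w z) (hcomp : ∀ t > 0, IsCompact {z | z ∈ D ∧ t ≤ w z})
    (heq : ∀ z ∈ D, -plap w z = Real.exp (2 * V z) * (Real.exp (2 * w z) - 1))
    (hsub : ∀ z ∈ D, -plap V z ≤ κ * Real.exp (2 * V z))
    (hi1 : IntegrableOn (fun z => Real.exp (2 * V z)) D)
    (hi2 : IntegrableOn (fun z => Real.exp (2 * V z + 2 * w z)) D) :
    4 * π < (∫ z in D, Real.exp (2 * V z)) + ∫ z in D, Real.exp (2 * V z + 2 * w z) := by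
  set μ := tail D w (fun z => Real.exp (2 * V z)) with hμ
  set G := tail D w (fun z => Real.exp (2 * V z + 2 * w z)) with hG
  have hp1 : ∀ z : ℂ, 0 ≤ Real.exp (2 * V z) := fun z => (Real.exp_pos _).le
  have hp2 : ∀ z : ℂ, 0 ≤ Real.exp (2 * V z + 2 * w z) := fun z => (Real.exp_pos _).le
  have hμanti : Antitone μ := tail_anti hp1 hi1
  have hμ0 : ∀ s, 0 ≤ μ s := fun s => tail_nonneg hp1 s
  have hμG : ∀ s, μ s ≤ G s := fun s =>
    setIntegral_mono_on (hi1.mono_set (layer_subset _)) (hi2.mono_set (layer_subset _))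
      (measurableSet_layer hD hw.continuous s)
      fun z hz => Real.exp_le_exp.2 (by have := hpos z hz.1; linarith)
  obtain ⟨T, hT⟩ : ∃ T, ∀ z ∈ D, w z ≤ T := by
    obtain ⟨B, hB⟩ := (hcomp 1 one_pos).bddAbove_image hw.continuous.continuousOn
    refine ⟨max B 1, fun z hz => ?_⟩
    rcases le_total 1 (w z) with h | h
    · exact (hB ⟨z, ⟨hz, h⟩, rfl⟩).trans (le_max_left _ _)
    · exact h.trans (le_max_right _ _)
  obtain ⟨t₁, ht₁, hμt₁⟩ : ∃ t₁, 0 < t₁ ∧ 0 < μ t₁ := by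
    obtain ⟨z₀, hz₀⟩ := hne
    refine ⟨w z₀ / 2, half_pos (hpos z₀ hz₀), ?_⟩
    have hE : IsOpen {z | z ∈ D ∧ w z₀ / 2 < w z} :=
      hD.inter (isOpen_lt continuous_const hw.continuous)
    rw [hμ, tail, setIntegral_pos_iff_support_of_nonneg_ae (Eventually.of_forall hp1)
      (hi1.mono_set (layer_subset _))]
    have hs : Function.support (fun z : ℂ => Real.exp (2 * V z)) = Set.univ := by
      ext z; simp [Real.exp_ne_zero]
    rw [hs, Set.univ_inter]
    exact hE.measure_pos _ ⟨z₀, hz₀, half_lt_self (hpos z₀ hz₀)⟩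
  have mono : ∀ s₀ s₁ c : ℝ, 0 < s₀ → s₀ ≤ s₁ → 0 ≤ c →
      (∀ s ∈ Set.Ico s₀ s₁, c ≤ (1 - κ) * μ s ^ 2) →
      4 * π * G s₀ - 1 * G s₀ ^ 2 - Real.exp (2 * s₀) * (4 * π * μ s₀ - 1 * μ s₀ ^ 2) +
        2 * Real.exp (2 * s₀) * c * (s₁ - s₀) ≤
      4 * π * G s₁ - 1 * G s₁ ^ 2 - Real.exp (2 * s₁) * (4 * π * μ s₁ - 1 * μ s₁ ^ 2) := by
    intro s₀ s₁ c hs₀ h01 hc0 hc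
    refine quadratic_mono zero_le_one zero_le_one hc0 h01 hμ0 hμanti
      (tail_right_continuous hw.continuous hi1) ?_ ?_ (fun s _ => by simpa using hμG s) ?_
      (by positivity)
    · intro s s' hs
      have := tail_sub_le (s := s) (s' := s') (c := Real.exp (-(2 * s))) hD hw.continuous hi1 hi2 hs
        (fun z _ h1 _ => by
          rw [← Real.exp_add]
          exact Real.exp_le_exp.2 (by linarith))
      have h2 := mul_le_mul_of_nonneg_left this (Real.exp_pos (2 * s)).le
      rwa [← mul_assoc, ← Real.exp_add, add_neg_cancel, Real.exp_zero, one_mul] at h2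
    · intro s s' hs
      refine tail_sub_le hD hw.continuous hi2 hi1 hs (fun z _ _ h1 => ?_)
      rw [← Real.exp_add]
      exact Real.exp_le_exp.2 (by linarith)
    · intro s hs θ hθ
      obtain ⟨C, hC⟩ := tail_step hD hDc hL hV hw hκ hpos hcomp heq hsub hi1 hi2
        (hs₀.trans_le hs.1)
      have hlim : Tendsto (fun s' : ℝ => Real.exp (2 * (C * (s' - s))) *
          (G s - μ s + 4 * π * (s' - s))) (𝓝[>] s)
          (𝓝 (Real.exp (2 * (C * (s - s))) * (G s - μ s + 4 * π * (s - s)))) :=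
        (Continuous.tendsto (by fun_prop) s).mono_left nhdsWithin_le_nhds
      rw [sub_self, mul_zero, mul_zero, mul_zero, Real.exp_zero, one_mul, add_zero] at hlim
      filter_upwards [self_mem_nhdsWithin,
        hlim.eventually_le_const (show G s - μ s < G s - μ s + θ by linarith)] with s' hs' hθ'
      have hss : s < s' := hs'
      have h1 := hC (s' - s) (by linarith)
      rw [add_sub_cancel] at h1
      have h2 : 0 ≤ μ s - μ s' := sub_nonneg.2 (hμanti hss.le)
      have h3 := mul_le_mul_of_nonneg_right hθ' h2
      have h4 := mul_le_mul_of_nonneg_left (hc s hs) (sub_pos.2 hss).le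
      rw [one_mul, one_mul]
      linarith
  set P : ℝ → ℝ := fun s => 4 * π * G s - 1 * G s ^ 2 -
    Real.exp (2 * s) * (4 * π * μ s - 1 * μ s ^ 2) with hP
  have hP1 : P t₁ ≤ 0 := by
    have h1 := mono t₁ (max t₁ T) 0 ht₁ (le_max_left _ _) le_rfl fun s _ =>
      mul_nonneg (by linarith) (sq_nonneg _)
    have e1 : μ (max t₁ T) = 0 := tail_eq_zero hT (le_max_right _ _)
    have e2 : G (max t₁ T) = 0 := tail_eq_zero hT (le_max_right _ _)
    rw [e1, e2] at h1
    simp only [hP]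
    linarith
  set c := (1 - κ) * μ t₁ ^ 2 with hc
  have hc0 : 0 < c := mul_pos (by linarith) (by positivity)
  have hP2 : ∀ t, 0 < t → t ≤ t₁ / 2 → P t ≤ -(c * t₁) := by
    intro t ht0 ht
    have h1 := mono t t₁ c ht0 (by linarith) hc0.le fun s hs =>
      mul_le_mul_of_nonneg_left (pow_le_pow_left₀ hμt₁.le (hμanti hs.2.le) 2) (by linarith)
    have h2 : c * t₁ ≤ 2 * Real.exp (2 * t) * c * (t₁ - t) := by
      have h3 : 1 ≤ Real.exp (2 * t) := Real.one_le_exp (by linarith)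
      have h4 : 0 ≤ (Real.exp (2 * t) - 1) * (2 * c * (t₁ - t)) :=
        mul_nonneg (by linarith) (mul_nonneg (by linarith) (by linarith))
      have h5 : 0 ≤ c * (t₁ - 2 * t) := mul_nonneg hc0.le (by linarith)
      linarith
    simp only [hP] at hP1 ⊢
    linarith
  have hP0 : P 0 ≤ -(c * t₁) := by
    have h1 := tail_right_continuous (f := fun z => Real.exp (2 * V z)) hw.continuous hi1 0
    have h2 := tail_right_continuous (f := fun z => Real.exp (2 * V z + 2 * w z)) hw.continuous
      hi2 0
    have h3 : Tendsto (fun s => Real.exp (2 * s)) (𝓝[>] 0) (𝓝 (Real.exp (2 * 0))) :=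
      (Continuous.tendsto (by fun_prop) 0).mono_left nhdsWithin_le_nhds
    have h4 : Tendsto P (𝓝[>] 0) (𝓝 (P 0)) :=
      Tendsto.sub (Tendsto.sub (h2.const_mul _) ((h2.pow 2).const_mul _))
        (h3.mul (Tendsto.sub (h1.const_mul _) ((h1.pow 2).const_mul _)))
    refine le_of_tendsto h4 ?_
    filter_upwards [Ioc_mem_nhdsGT (half_pos ht₁)] with t ht using hP2 t ht.1 ht.2
  have hD0 : {z | z ∈ D ∧ 0 < w z} = D := by
    ext z; exact ⟨fun h => h.1, fun h => ⟨h, hpos z h⟩⟩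
  have e1 : μ 0 = ∫ z in D, Real.exp (2 * V z) := by rw [hμ, tail, hD0]
  have e2 : G 0 = ∫ z in D, Real.exp (2 * V z + 2 * w z) := by rw [hG, tail, hD0]
  rw [← e1, ← e2]
  simp only [hP, mul_zero, Real.exp_zero, one_mul] at hP0
  have h5 : (G 0 - μ 0) * (4 * π - (μ 0 + G 0)) < 0 := by
    have : 0 < c * t₁ := mul_pos hc0 ht₁
    linarith
  by_contra h
  exact absurd h5 (not_lt.2 (mul_nonneg (sub_nonneg.2 (hμG 0)) (by linarith)))

end Covering

section Vanishing

open Filter Topology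

variable {E F : Type*} [NormedAddCommGroup E] [NormedSpace ℝ E] [NormedAddCommGroup F]
  [NormedSpace ℝ F]

/-- All partial derivatives of `f` of order less than `n` vanish at `x`. -/
def Van : ℕ → (ℂ → E) → ℂ → Prop
  | 0, _, _ => True
  | n + 1, f, x => f x = 0 ∧ Van n (px f) x ∧ Van n (py f) x

lemma Van.of_succ {n : ℕ} {f : ℂ → E} {x : ℂ} (h : Van (n + 1) f x) : Van n f x := by
  induction n generalizing f with
  | zero => trivial
  | succ n ih => exact ⟨h.1, ih h.2.1, ih h.2.2⟩

lemma Van.mono {n m : ℕ} (hnm : n ≤ m) {f : ℂ → E} {x : ℂ} (h : Van m f x) : Van n f x := by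
  induction hnm with
  | refl => exact h
  | step _ ih => exact ih h.of_succ

lemma Van.congr {n : ℕ} {f g : ℂ → E} {x : ℂ} (hfg : f =ᶠ[𝓝 x] g) (h : Van n f x) :
    Van n g x := by
  induction n generalizing f g with
  | zero => trivial
  | succ n ih =>
    exact ⟨hfg.eq_of_nhds ▸ h.1, ih (px_congr_eventually hfg) h.2.1,
      ih (py_congr_eventually hfg) h.2.2⟩

lemma van_const_zero (n : ℕ) (x : ℂ) : Van n (fun _ => (0 : E)) x := by
  induction n with
  | zero => trivial
  | succ n ih =>
    refine ⟨rfl, ?_, ?_⟩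
    · rw [px_const]; exact ih
    · rw [py_const]; exact ih

lemma Van.add {n : ℕ} {f g : ℂ → E} {x : ℂ} (hf : ContDiff ℝ ∞ f) (hg : ContDiff ℝ ∞ g)
    (h : Van n f x) (h' : Van n g x) : Van n (f + g) x := by
  induction n generalizing f g with
  | zero => trivial
  | succ n ih =>
    refine ⟨by simp [h.1, h'.1], ?_, ?_⟩
    · rw [px_add hf hg]; exact ih (contDiff_px hf) (contDiff_px hg) h.2.1 h'.2.1
    · rw [py_add hf hg]; exact ih (contDiff_py hf) (contDiff_py hg) h.2.2 h'.2.2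

lemma px_clm (L : E →L[ℝ] F) {f : ℂ → E} (hf : ContDiff ℝ ∞ f) :
    px (fun z => L (f z)) = fun z => L (px f z) := by
  ext z
  have : HasFDerivAt (fun z => L (f z)) _ z := L.hasFDerivAt.comp z (hasFDerivAt_of_smooth hf z)
  rw [px, this.fderiv]
  rfl

lemma py_clm (L : E →L[ℝ] F) {f : ℂ → E} (hf : ContDiff ℝ ∞ f) :
    py (fun z => L (f z)) = fun z => L (py f z) := by
  ext z
  have : HasFDerivAt (fun z => L (f z)) _ z := L.hasFDerivAt.comp z (hasFDerivAt_of_smooth hf z)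
  rw [py, this.fderiv]
  rfl

lemma Van.clm {n : ℕ} {f : ℂ → E} {x : ℂ} (L : E →L[ℝ] F) (hf : ContDiff ℝ ∞ f) (h : Van n f x) :
    Van n (fun z => L (f z)) x := by
  induction n generalizing f with
  | zero => trivial
  | succ n ih =>
    refine ⟨by simp [h.1], ?_, ?_⟩
    · rw [px_clm L hf]; exact ih (contDiff_px hf) h.2.1
    · rw [py_clm L hf]; exact ih (contDiff_py hf) h.2.2

lemma Van.mul {𝕜 : Type*} [NormedField 𝕜] [NormedAlgebra ℝ 𝕜] {n : ℕ} {f g : ℂ → 𝕜} {x : ℂ}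
    (hf : ContDiff ℝ ∞ f) (hg : ContDiff ℝ ∞ g) (h : Van n f x) : Van n (f * g) x := by
  induction n generalizing f g with
  | zero => trivial
  | succ n ih =>
    refine ⟨by simp [h.1], ?_, ?_⟩
    · rw [px_mul hf hg]
      exact (ih (contDiff_px hf) hg h.2.1).add ((contDiff_px hf).mul hg) (hf.mul (contDiff_px hg))
        (ih hf (contDiff_px hg) h.of_succ)
    · rw [py_mul hf hg]
      exact (ih (contDiff_py hf) hg h.2.2).add ((contDiff_py hf).mul hg) (hf.mul (contDiff_py hg))
        (ih hf (contDiff_py hg) h.of_succ)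

lemma py_px_comm {f : ℂ → E} (hf : ContDiff ℝ ∞ f) : py (px f) = px (py f) := by
  ext z
  have hs : IsSymmSndFDerivAt ℝ f z := hf.contDiffAt.isSymmSndFDerivAt
    (by rw [minSmoothness_of_isRCLikeNormedField]; exact WithTop.coe_le_coe.2 le_top)
  have hd : HasFDerivAt (fderiv ℝ f) (fderiv ℝ (fderiv ℝ f) z) z :=
    ((hf.fderiv_right (m := ∞) (by simp)).differentiable (by simp) z).hasFDerivAt
  have key : ∀ v v' : ℂ, fderiv ℝ (fun z => fderiv ℝ f z v) z v' =
      fderiv ℝ (fderiv ℝ f) z v' v := by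
    intro v v'
    have h1 : HasFDerivAt (fun z => fderiv ℝ f z v) _ z := hd.clm_apply (hasFDerivAt_const v z)
    rw [h1.fderiv]
    simp
  have e1 := key 1 Complex.I
  have e2 := key Complex.I 1
  rw [hs.eq] at e1
  exact e1.trans e2.symm

lemma Van.isClosed {n : ℕ} {f : ℂ → E} (hf : ContDiff ℝ ∞ f) : IsClosed {x | Van n f x} := by
  induction n generalizing f with
  | zero => simp [Van]
  | succ n ih =>
    exact (isClosed_singleton.preimage hf.continuous).inter
      ((ih (contDiff_px hf)).inter (ih (contDiff_py hf)))

/-- A function vanishing to order `n` at `x` is `O(|z - x|ⁿ)`. -/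
lemma Van.bound {n : ℕ} {f : ℂ → E} {x : ℂ} (hf : ContDiff ℝ ∞ f) (h : Van n f x) :
    ∃ C : ℝ, 0 ≤ C ∧ ∀ z, ‖z - x‖ ≤ 1 → ‖f z‖ ≤ C * ‖z - x‖ ^ n := by
  induction n generalizing f with
  | zero =>
    obtain ⟨C, hC⟩ := (isCompact_closedBall x 1).exists_bound_of_continuousOn
      hf.continuous.continuousOn
    refine ⟨max C 0, le_max_right _ _, fun z hz => ?_⟩
    rw [pow_zero, mul_one]
    exact (hC z (by simpa [dist_eq_norm] using hz)).trans (le_max_left _ _)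
  | succ n ih =>
    obtain ⟨C₁, h₁, hC₁⟩ := ih (contDiff_px hf) h.2.1
    obtain ⟨C₂, h₂, hC₂⟩ := ih (contDiff_py hf) h.2.2
    refine ⟨C₁ + C₂, by positivity, fun z hz => ?_⟩
    have hb : ∀ y ∈ segment ℝ x z, ‖fderiv ℝ f y‖ ≤ (C₁ + C₂) * ‖z - x‖ ^ n := by
      intro y hy
      have hyn : ‖y - x‖ ≤ ‖z - x‖ := by
        obtain ⟨t, ht, rfl⟩ := (segment_eq_image' ℝ x z) ▸ hy
        rw [add_sub_cancel_left, norm_smul, Real.norm_of_nonneg ht.1]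
        exact mul_le_of_le_one_left (norm_nonneg _) ht.2
      have hp : ‖y - x‖ ^ n ≤ ‖z - x‖ ^ n := pow_le_pow_left₀ (norm_nonneg _) hyn n
      refine ContinuousLinearMap.opNorm_le_bound _ (by positivity) fun v => ?_
      rw [fderiv_eq_px_py]
      have b1 : ‖v.re • px f y‖ ≤ ‖v‖ * (C₁ * ‖z - x‖ ^ n) := by
        rw [norm_smul]
        exact mul_le_mul (Complex.abs_re_le_norm v) ((hC₁ y (hyn.trans hz)).trans
          (mul_le_mul_of_nonneg_left hp h₁)) (norm_nonneg _) (norm_nonneg _)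
      have b2 : ‖v.im • py f y‖ ≤ ‖v‖ * (C₂ * ‖z - x‖ ^ n) := by
        rw [norm_smul]
        exact mul_le_mul (Complex.abs_im_le_norm v) ((hC₂ y (hyn.trans hz)).trans
          (mul_le_mul_of_nonneg_left hp h₂)) (norm_nonneg _) (norm_nonneg _)
      refine (norm_add_le _ _).trans ?_
      linarith
    have := (convex_segment x z).norm_image_sub_le_of_norm_fderiv_le (𝕜 := ℝ)
      (fun y _ => hf.differentiable (by simp) y) hb (left_mem_segment ℝ x z)
      (right_mem_segment ℝ x z)
    rw [h.1, sub_zero] at this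
    rw [pow_succ, ← mul_assoc]
    exact this

/-- The Cauchy-Riemann operator, twice `∂/∂z̄`. -/
def dbar (f : ℂ → ℂ) : ℂ → ℂ := fun z => px f z + Complex.I * py f z

lemma contDiff_dbar {f : ℂ → ℂ} (hf : ContDiff ℝ ∞ f) : ContDiff ℝ ∞ (dbar f) :=
  (contDiff_px hf).add (contDiff_const.mul (contDiff_py hf))

lemma contDiff_monomial (β x : ℂ) (k : ℕ) : ContDiff ℝ ∞ fun z : ℂ => β * (z - x) ^ k :=
  contDiff_const.mul ((contDiff_id.sub contDiff_const).pow k)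

lemma px_dbar {f : ℂ → ℂ} (hf : ContDiff ℝ ∞ f) : px (dbar f) = dbar (px f) := by
  have e : dbar f = px f + (fun _ => Complex.I) * py f := rfl
  rw [e, px_add (contDiff_px hf) (cdMul contDiff_const (contDiff_py hf)),
    px_mul contDiff_const (contDiff_py hf), px_const, ← py_px_comm hf]
  ext z
  simp [dbar]

lemma hasDerivAt_monomial (β x : ℂ) (k : ℕ) (z : ℂ) :
    HasDerivAt (fun z : ℂ => β / (k + 1) * (z - x) ^ (k + 1)) (β * (z - x) ^ k) z := by
  have h := (((hasDerivAt_id z).sub_const x).pow (k + 1)).const_mul (β / (k + 1))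
  convert! h using 1
  have : (k + 1 : ℂ) ≠ 0 := Nat.cast_add_one_ne_zero k
  simp
  field_simp

lemma px_monomial (β x : ℂ) (k : ℕ) :
    px (fun z : ℂ => β / (k + 1) * (z - x) ^ (k + 1)) = fun z => β * (z - x) ^ k := by
  ext z
  rw [px_of_differentiableAt (hasDerivAt_monomial β x k z).differentiableAt,
    (hasDerivAt_monomial β x k z).deriv]

lemma py_monomial (β x : ℂ) (k : ℕ) :
    py (fun z : ℂ => β / (k + 1) * (z - x) ^ (k + 1)) =
      fun z => Complex.I * (β * (z - x) ^ k) := by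
  ext z
  rw [py_of_differentiableAt (hasDerivAt_monomial β x k z).differentiableAt,
    (hasDerivAt_monomial β x k z).deriv]

/-- Leading term of a function whose `∂̄`-derivative vanishes to the same order. -/
lemma Van.exists_leading_complex {k : ℕ} {f : ℂ → ℂ} {x : ℂ} (hf : ContDiff ℝ ∞ f)
    (h : Van k f x) (h' : Van k (dbar f) x) :
    ∃ β : ℂ, Van (k + 1) (f - fun z => β * (z - x) ^ k) x := by
  induction k generalizing f with
  | zero => exact ⟨f x, by simp [Van]⟩
  | succ k ih =>
    obtain ⟨β, hβ⟩ := ih (contDiff_px hf) h.2.1 (by rw [← px_dbar hf]; exact h'.2.1)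
    have hm := contDiff_monomial (β / (k + 1)) x (k + 1)
    refine ⟨β / (k + 1), by simp [h.1], ?_, ?_⟩
    · rw [px_sub hf hm, px_monomial]; exact hβ
    · rw [py_sub hf hm, py_monomial]
      have e : (py f - fun z => Complex.I * (β * (z - x) ^ k)) =
          (fun z => (Complex.I • (1 : ℂ →L[ℝ] ℂ)) ((px f - fun z => β * (z - x) ^ k) z)) +
            fun z => (-Complex.I • (1 : ℂ →L[ℝ] ℂ)) (dbar f z) := by
        ext z
        simp only [Pi.sub_apply, Pi.add_apply, smul_apply,
          one_apply_eq_self, smul_eq_mul, dbar]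
        linear_combination (py f z) * Complex.I_mul_I
      have s1 : ContDiff ℝ ∞ (px f - fun z => β * (z - x) ^ k) :=
        cdSub (contDiff_px hf) (contDiff_monomial β x k)
      rw [e]
      exact (hβ.clm _ s1).add ((ContinuousLinearMap.contDiff _).comp s1)
        ((ContinuousLinearMap.contDiff _).comp (contDiff_dbar hf))
        (h'.clm _ (contDiff_dbar hf))

/-- The complex gradient, twice `∂w/∂z`. -/
def cgrad (w : ℂ → ℝ) : ℂ → ℂ :=
  fun z => ((px w z : ℝ) : ℂ) - Complex.I * ((py w z : ℝ) : ℂ)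

lemma contDiff_cgrad {w : ℂ → ℝ} (hw : ContDiff ℝ ∞ w) : ContDiff ℝ ∞ (cgrad w) :=
  (contDiff_ofReal (contDiff_px hw)).sub (contDiff_const.mul (contDiff_ofReal (contDiff_py hw)))

lemma cgrad_eq (w : ℂ → ℝ) : cgrad w = (fun z => Complex.ofRealCLM (px w z)) +
    fun z => ((-Complex.I) • Complex.ofRealCLM) (py w z) := by
  ext z; simp [cgrad, sub_eq_add_neg]

lemma Van.complexGradient {m : ℕ} {w : ℂ → ℝ} {x : ℂ} (hw : ContDiff ℝ ∞ w) (hm : Van (m + 1) w x) :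
    Van m (cgrad w) x := by
  rw [cgrad_eq]
  exact (hm.2.1.clm _ (contDiff_px hw)).add (contDiff_ofReal (contDiff_px hw))
    ((ContinuousLinearMap.contDiff _).comp (contDiff_py hw)) (hm.2.2.clm _ (contDiff_py hw))

lemma dbar_cgrad {w : ℂ → ℝ} (hw : ContDiff ℝ ∞ w) :
    dbar (cgrad w) = fun z => Complex.ofRealCLM (plap w z) := by
  have c1 : ContDiff ℝ ∞ fun z => Complex.ofRealCLM (px w z) := contDiff_ofReal (contDiff_px hw)
  have c2 : ContDiff ℝ ∞ fun z => ((-Complex.I) • Complex.ofRealCLM) (py w z) :=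
    (ContinuousLinearMap.contDiff _).comp (contDiff_py hw)
  ext z
  have ex : px (cgrad w) z = ((px (px w) z : ℝ) : ℂ) - Complex.I * ((px (py w) z : ℝ) : ℂ) := by
    rw [cgrad_eq, px_add c1 c2, px_clm _ (contDiff_px hw), px_clm _ (contDiff_py hw)]
    simp [sub_eq_add_neg]
  have ey : py (cgrad w) z = ((py (px w) z : ℝ) : ℂ) - Complex.I * ((py (py w) z : ℝ) : ℂ) := by
    rw [cgrad_eq, py_add c1 c2, py_clm _ (contDiff_px hw), py_clm _ (contDiff_py hw)]
    simp [sub_eq_add_neg]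
  simp only [dbar]
  rw [ex, ey, py_px_comm hw]
  simp only [Complex.ofRealCLM_apply, plap]
  push_cast
  linear_combination (-((py (py w) z : ℝ) : ℂ)) * Complex.I_mul_I

/-- Leading term of a function whose Laplacian vanishes to the same order. -/
lemma Van.exists_leading {m : ℕ} {w : ℂ → ℝ} {x : ℂ} (hw : ContDiff ℝ ∞ w) (hm : Van (m + 1) w x)
    (hm' : ¬ Van (m + 2) w x) (hl : Van m (plap w) x) :
    ∃ γ : ℂ, γ ≠ 0 ∧ ∃ C : ℝ, 0 ≤ C ∧ ∀ z, ‖z - x‖ ≤ 1 →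
      |w z - (γ * (z - x) ^ (m + 1)).re| ≤ C * ‖z - x‖ ^ (m + 2) := by
  have hfs := contDiff_cgrad hw
  obtain ⟨β, hβ⟩ := (hm.complexGradient hw).exists_leading_complex hfs (by
    rw [dbar_cgrad hw]; exact hl.clm _ (contDiff_plap hw))
  have hsub : ContDiff ℝ ∞ (cgrad w - fun z => β * (z - x) ^ m) :=
    cdSub hfs (contDiff_monomial β x m)
  set P : ℂ → ℝ := fun z => Complex.reCLM (β / (m + 1) * (z - x) ^ (m + 1)) with hP
  have hPs : ContDiff ℝ ∞ P := Complex.reCLM.contDiff.comp (contDiff_monomial _ x (m + 1))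
  have hPx : px P = fun z => (β * (z - x) ^ m).re := by
    rw [hP, px_clm _ (contDiff_monomial _ x (m + 1)), px_monomial]; rfl
  have hPy : py P = fun z => -(β * (z - x) ^ m).im := by
    rw [hP, py_clm _ (contDiff_monomial _ x (m + 1)), py_monomial]
    ext z; simp
  have hV : Van (m + 2) (w - P) x := by
    refine ⟨by simp [hm.1, hP], ?_, ?_⟩
    · have : px (w - P) = fun z => Complex.reCLM ((cgrad w - fun z => β * (z - x) ^ m) z) := by
        rw [px_sub hw hPs, hPx]
        ext z; simp [cgrad]
      rw [this]
      exact hβ.clm _ hsub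
    · have : py (w - P) = fun z => (-Complex.imCLM) ((cgrad w - fun z => β * (z - x) ^ m) z) := by
        rw [py_sub hw hPs, hPy]
        ext z; simp [cgrad]; ring
      rw [this]
      exact hβ.clm _ hsub
  refine ⟨β / (m + 1), fun h0 => hm' ?_, ?_⟩
  · have : w - P = w := by
      ext z; simp only [hP, h0, zero_mul, map_zero, Pi.sub_apply, sub_zero]
    rwa [this] at hV
  · obtain ⟨C, hC0, hC⟩ := hV.bound (cdSub hw hPs)
    exact ⟨C, hC0, fun z hz => hC z hz⟩

end Vanishing

section UniqueContinuation

open Filter Topology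

/-- A function vanishing to infinite order at a point. -/
def Flat {E : Type*} [NormedAddCommGroup E] [NormedSpace ℝ E] (f : ℂ → E) (x : ℂ) : Prop :=
  ∀ n, Van n f x

lemma Flat.derivX {f : ℂ → ℂ} {x : ℂ} (h : Flat f x) : Flat (px f) x := fun n => (h (n + 1)).2.1

lemma Flat.derivY {f : ℂ → ℂ} {x : ℂ} (h : Flat f x) : Flat (py f) x := fun n => (h (n + 1)).2.2

lemma Flat.hasFDerivAt_div {f : ℂ → ℂ} {x : ℂ} (hf : ContDiff ℝ ∞ f) (h : Flat f x) (n : ℕ)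
    (z : ℂ) :
    HasFDerivAt (fun z => f z / (z - x) ^ n)
      (Complex.reCLM.smulRight (px f z / (z - x) ^ n) +
        Complex.imCLM.smulRight (py f z / (z - x) ^ n) -
        (n * (f z / (z - x) ^ (n + 1))) • (1 : ℂ →L[ℝ] ℂ)) z := by
  rcases eq_or_ne z x with rfl | hz
  · have e1 : px f z = 0 := (h 2).2.1.1
    have e2 : py f z = 0 := (h 2).2.2.1
    have e3 : f z = 0 := (h 1).1
    rw [e1, e2, e3]
    simp only [zero_div, mul_zero]
    have e4 : Complex.reCLM.smulRight (0 : ℂ) + Complex.imCLM.smulRight (0 : ℂ) -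
        (0 : ℂ) • (1 : ℂ →L[ℝ] ℂ) = 0 := by
      refine ContinuousLinearMap.ext fun v => ?_
      simp
    rw [e4]
    obtain ⟨C, hC0, hC⟩ := (h (n + 2)).bound hf
    refine HasFDerivAt.of_isLittleO ?_
    have hO : (fun y => f y / (y - z) ^ n - f z / (z - z) ^ n - (0 : ℂ →L[ℝ] ℂ) (y - z)) =O[𝓝 z]
        fun y => ‖y - z‖ ^ 2 := by
      refine Asymptotics.IsBigO.of_bound C ?_
      filter_upwards [Metric.closedBall_mem_nhds z one_pos] with y hy
      have hy1 : ‖y - z‖ ≤ 1 := by simpa [dist_eq_norm] using hy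
      simp only [e3, zero_div, sub_zero, zero_apply, norm_div, norm_pow,
        norm_norm]
      rcases eq_or_ne y z with rfl | hne
      · simp [e3]
      · rw [div_le_iff₀ (pow_pos (norm_pos_iff.2 (sub_ne_zero.2 hne)) n), mul_assoc, ← pow_add,
          add_comm 2 n]
        exact hC y hy1
    have : (fun y : ℂ => ‖y - z‖ ^ 2) =o[𝓝 z] fun y : ℂ => ‖y - z‖ ^ 1 := by
      refine (Asymptotics.isLittleO_pow_pow (𝕜 := ℝ) one_lt_two).comp_tendsto ?_
      have hc : Continuous fun y : ℂ => ‖y - z‖ := by fun_prop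
      simpa using hc.tendsto z
    have h2 : (fun y : ℂ => ‖y - z‖ ^ 2) =o[𝓝 z] fun y => y - z := by simpa using this
    exact hO.trans_isLittleO h2
  · have hne : z - x ≠ 0 := sub_ne_zero.2 hz
    have hd : HasDerivAt (fun z : ℂ => ((z - x) ^ n)⁻¹) (-(n * (z - x) ^ (n - 1)) / ((z - x) ^ n) ^ 2)
        z := by
      have := ((((hasDerivAt_id z).sub_const x).pow n).inv (pow_ne_zero n hne))
      convert! this using 1
      simp
    have hm := (hasFDerivAt_of_smooth hf z).mul hd.complexToReal_fderiv
    have e0 : (fun z => f z / (z - x) ^ n) = fun z => f z * ((z - x) ^ n)⁻¹ := by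
      ext z; rw [div_eq_mul_inv]
    rw [e0]
    refine hm.congr_fderiv ?_
    have e1 : (z - x) ^ n ≠ 0 := pow_ne_zero n hne
    refine ContinuousLinearMap.ext fun v => ?_
    simp only [add_apply, sub_apply, smul_apply, ContinuousLinearMap.smulRight_apply,
      one_apply_eq_self, smul_eq_mul, Complex.real_smul, Complex.reCLM_apply, Complex.imCLM_apply,
      fderiv_eq_px_py f z v]
    rcases n with _ | n
    · simp
    simp only [Nat.add_sub_cancel]
    field_simp
    ring

lemma Flat.contDiff_div {f : ℂ → ℂ} {x : ℂ} (hf : ContDiff ℝ ∞ f) (h : Flat f x) (n : ℕ) :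
    ContDiff ℝ ∞ fun z => f z / (z - x) ^ n := by
  refine contDiff_infty.2 fun k => ?_
  induction k generalizing f n with
  | zero =>
    exact contDiff_zero.2 (continuous_iff_continuousAt.2 fun z =>
      (h.hasFDerivAt_div hf n z).continuousAt)
  | succ k ih =>
    push_cast
    rw [contDiff_succ_iff_fderiv]
    refine ⟨fun z => (h.hasFDerivAt_div hf n z).differentiableAt, by simp, ?_⟩
    have e : fderiv ℝ (fun z => f z / (z - x) ^ n) = _ :=
      funext fun z => (h.hasFDerivAt_div hf n z).fderiv
    rw [e]
    refine ((contDiff_const.smulRight (ih (contDiff_px hf) h.derivX n)).add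
      (contDiff_const.smulRight (ih (contDiff_py hf) h.derivY n))).sub ?_
    exact (contDiff_const.mul (ih hf h (n + 1))).smul contDiff_const

lemma Flat.dbar_div {f : ℂ → ℂ} {x : ℂ} (hf : ContDiff ℝ ∞ f) (h : Flat f x) (n : ℕ) :
    dbar (fun z => f z / (z - x) ^ n) = fun z => dbar f z / (z - x) ^ n := by
  ext z
  simp only [dbar]
  rw [px, py, (h.hasFDerivAt_div hf n z).fderiv]
  simp only [add_apply, sub_apply, smul_apply, ContinuousLinearMap.smulRight_apply,
    one_apply_eq_self, smul_eq_mul, Complex.real_smul, Complex.reCLM_apply, Complex.imCLM_apply,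
    Complex.one_re, Complex.one_im, Complex.I_re, Complex.I_im]
  push_cast
  linear_combination (-(n * (f z / (z - x) ^ (n + 1)))) * Complex.I_mul_I

lemma integral_sq_le_px {g : ℂ → ℝ} {x : ℂ} {r : ℝ} (hg : ContDiff ℝ ∞ g)
    (hc : HasCompactSupport g) (hr : ∀ z, g z ≠ 0 → ‖z - x‖ ≤ r) :
    ∫ z, g z ^ 2 ≤ 4 * r ^ 2 * ∫ z, px g z ^ 2 := by
  obtain ⟨l, hl_def⟩ : ∃ l : ℂ → ℝ, l = fun z => (z - x).re := ⟨_, rfl⟩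
  have hl : ContDiff ℝ ∞ l := by
    rw [hl_def]; exact Complex.reCLM.contDiff.comp (contDiff_id.sub contDiff_const)
  have hlx : px l = fun _ => 1 := by
    ext z
    rw [hl_def]
    have h1 : HasFDerivAt (fun z => (z - x).re) (Complex.reCLM : ℂ →L[ℝ] ℝ) z :=
      Complex.reCLM.hasFDerivAt.comp z ((hasFDerivAt_id z).sub_const x)
    rw [px, h1.fderiv]; simp
  have e : px (l * (g * g)) = fun z => g z ^ 2 + 2 * (l z * g z * px g z) := by
    rw [px_mul hl (cdMul hg hg), px_mul hg hg, hlx]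
    ext z; simp; ring
  have i0 : Integrable fun z => g z ^ 2 :=
    (hg.continuous.pow 2).integrable_of_hasCompactSupport (hc.mono fun z hz => by
      simpa using hz)
  have i1 : Integrable fun z => px g z ^ 2 :=
    ((contDiff_px hg).continuous.pow 2).integrable_of_hasCompactSupport
      ((hasCompactSupport_px hc).mono fun z hz => by simpa using hz)
  have h0 : ∫ z, px (l * (g * g)) z = 0 :=
    integral_px_eq_zero (cdMul hl (cdMul hg hg)) ((hc.mul_left (f := g)).mul_left (f := l))
  have i2 : Integrable fun z => 2 * (l z * g z * px g z) :=
    (continuous_const.mul ((hl.continuous.mul hg.continuous).mul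
      (contDiff_px hg).continuous)).integrable_of_hasCompactSupport
      (((hasCompactSupport_px hc).mul_left (f := fun z => l z * g z)).mul_left
        (f := fun _ => (2 : ℝ)))
  rw [e, integral_add i0 i2] at h0
  have hle : -∫ z, 2 * (l z * g z * px g z) ≤ ∫ z, (1 / 2 * g z ^ 2 + 2 * r ^ 2 * px g z ^ 2) := by
    rw [← integral_neg]
    refine integral_mono i2.neg ((i0.const_mul _).add (i1.const_mul _)) fun z => ?_
    show -(2 * (l z * g z * px g z)) ≤ 1 / 2 * g z ^ 2 + 2 * r ^ 2 * px g z ^ 2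
    by_cases hz : g z = 0
    · rw [hz]; nlinarith [mul_nonneg (sq_nonneg r) (sq_nonneg (px g z))]
    · have hlr : l z ^ 2 ≤ r ^ 2 := by
        have h1 : |l z| ≤ r := by
          rw [hl_def]; exact (Complex.abs_re_le_norm (z - x)).trans (hr z hz)
        exact sq_le_sq' (abs_le.1 h1).1 (abs_le.1 h1).2
      nlinarith [sq_nonneg (g z + 2 * (l z * px g z)),
        mul_le_mul_of_nonneg_right hlr (sq_nonneg (px g z))]
  rw [integral_add (i0.const_mul _) (i1.const_mul _), integral_const_mul (1 / 2 : ℝ),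
    integral_const_mul (2 * r ^ 2)] at hle
  linarith

lemma integral_norm_sq_le_dbar {g : ℂ → ℂ} {x : ℂ} {r : ℝ} (hg : ContDiff ℝ ∞ g)
    (hc : HasCompactSupport g) (hr : ∀ z, g z ≠ 0 → ‖z - x‖ ≤ r) :
    ∫ z, ‖g z‖ ^ 2 ≤ 4 * r ^ 2 * ∫ z, ‖dbar g z‖ ^ 2 := by
  set a : ℂ → ℝ := fun z => Complex.reCLM (g z) with ha
  set b : ℂ → ℝ := fun z => Complex.imCLM (g z) with hb
  have sa : ContDiff ℝ ∞ a := Complex.reCLM.contDiff.comp hg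
  have sb : ContDiff ℝ ∞ b := Complex.imCLM.contDiff.comp hg
  have ca : HasCompactSupport a := hc.mono fun z hz hz' => hz (by simp [ha, hz'])
  have cb : HasCompactSupport b := hc.mono fun z hz hz' => hz (by simp [hb, hz'])
  have ra := integral_sq_le_px sa ca fun z hz => hr z fun hz' => hz (by simp [ha, hz'])
  have rb := integral_sq_le_px sb cb fun z hz => hr z fun hz' => hz (by simp [hb, hz'])
  have int : ∀ {f : ℂ → ℝ}, ContDiff ℝ ∞ f → HasCompactSupport f → Integrable fun z => f z ^ 2 :=
    fun hf hfc => (hf.continuous.pow 2).integrable_of_hasCompactSupport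
      (hfc.mono fun z hz => by simpa using hz)
  have iax := int (contDiff_px sa) (hasCompactSupport_px ca)
  have ibx := int (contDiff_px sb) (hasCompactSupport_px cb)
  have iay := int (contDiff_py sa) (hasCompactSupport_py ca)
  have iby := int (contDiff_py sb) (hasCompactSupport_py cb)
  have hax : px a = fun z => (px g z).re := px_clm _ hg
  have hay : py a = fun z => (py g z).re := py_clm _ hg
  have hbx : px b = fun z => (px g z).im := px_clm _ hg
  have hby : py b = fun z => (py g z).im := py_clm _ hg
  have c1 := integral_py_eq_zero (cdMul sa (contDiff_px sb)) (ca.mul_right (f' := px b))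
  have c2 := integral_px_eq_zero (cdMul sa (contDiff_py sb)) (ca.mul_right (f' := py b))
  have j1 : Integrable (py (a * px b)) :=
    (contDiff_py (cdMul sa (contDiff_px sb))).continuous.integrable_of_hasCompactSupport
      (hasCompactSupport_py (ca.mul_right (f' := px b)))
  have j2 : Integrable (px (a * py b)) :=
    (contDiff_px (cdMul sa (contDiff_py sb))).continuous.integrable_of_hasCompactSupport
      (hasCompactSupport_px (ca.mul_right (f' := py b)))
  have key : ∀ z, ‖dbar g z‖ ^ 2 = px a z ^ 2 + px b z ^ 2 + (py a z ^ 2 + py b z ^ 2) +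
      (2 * py (a * px b) z - 2 * px (a * py b) z) := by
    intro z
    rw [px_mul sa (contDiff_py sb), py_mul sa (contDiff_px sb), py_px_comm sb,
      ← Complex.normSq_eq_norm_sq, Complex.normSq_apply]
    simp only [Pi.add_apply, Pi.mul_apply, hax, hay, hbx, hby, dbar, Complex.add_re,
      Complex.add_im, Complex.mul_re, Complex.mul_im, Complex.I_re, Complex.I_im]
    ring
  have hd : ∫ z, ‖dbar g z‖ ^ 2 = (∫ z, px a z ^ 2) + (∫ z, px b z ^ 2) +
      ((∫ z, py a z ^ 2) + ∫ z, py b z ^ 2) := by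
    simp only [key]
    have k1 : Integrable fun z => px a z ^ 2 + px b z ^ 2 := iax.add ibx
    have k2 : Integrable fun z => py a z ^ 2 + py b z ^ 2 := iay.add iby
    have k3 : Integrable fun z => px a z ^ 2 + px b z ^ 2 + (py a z ^ 2 + py b z ^ 2) := k1.add k2
    have k4 : Integrable fun z => 2 * py (a * px b) z - 2 * px (a * py b) z :=
      (j1.const_mul 2).sub (j2.const_mul 2)
    rw [integral_add k3 k4,
      integral_sub (j1.const_mul 2) (j2.const_mul 2), integral_const_mul, integral_const_mul,
      c1, c2, integral_add k1 k2, integral_add iax ibx,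
      integral_add iay iby]
    ring
  have hn : ∫ z, ‖g z‖ ^ 2 = (∫ z, a z ^ 2) + ∫ z, b z ^ 2 := by
    rw [← integral_add (int sa ca) (int sb cb)]
    refine integral_congr_ae (.of_forall fun z => ?_)
    simp only [ha, hb, Complex.reCLM_apply, Complex.imCLM_apply]
    rw [← Complex.normSq_eq_norm_sq, Complex.normSq_apply]
    ring
  have p1 : 0 ≤ ∫ z, py a z ^ 2 := integral_nonneg fun z => sq_nonneg _
  have p2 : 0 ≤ ∫ z, py b z ^ 2 := integral_nonneg fun z => sq_nonneg _
  rw [hd, hn]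
  nlinarith [mul_nonneg (sq_nonneg r) p1, mul_nonneg (sq_nonneg r) p2]

lemma Flat.carleman {f : ℂ → ℂ} {x : ℂ} {r : ℝ} (hf : ContDiff ℝ ∞ f) (h : Flat f x)
    (hc : HasCompactSupport f) (hr : ∀ z, f z ≠ 0 → ‖z - x‖ ≤ r) (n : ℕ) :
    ∫ z, ‖f z / (z - x) ^ n‖ ^ 2 ≤ 4 * r ^ 2 * ∫ z, ‖dbar f z / (z - x) ^ n‖ ^ 2 := by
  have := integral_norm_sq_le_dbar (x := x) (r := r) (h.contDiff_div hf n)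
    (hc.mono fun z hz hz' => hz (by simp [hz'])) fun z hz => hr z fun hz' => hz (by simp [hz'])
  rwa [h.dbar_div hf n] at this

/-- Strong unique continuation at a zero of infinite order. -/
lemma Flat.eventually_eq_zero {w : ℂ → ℝ} {x : ℂ} {K : ℝ} (hw : ContDiff ℝ ∞ w)
    (h : ∀ n, Van n w x) (hK : ∀ z, ‖z - x‖ ≤ 1 → |plap w z| ≤ K * |w z|) :
    ∀ᶠ z in 𝓝 x, w z = 0 := by
  obtain ⟨r, hr0, hr1, hrK⟩ : ∃ r : ℝ, 0 < r ∧ r ≤ 1 ∧ 16 * r ^ 4 * K ^ 2 ≤ 1 / 2 := by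
    have hp : 0 < 1 + |K| := by positivity
    refine ⟨(8 * (1 + |K|))⁻¹, by positivity, inv_le_one_of_one_le₀ (by nlinarith [abs_nonneg K]), ?_⟩
    set s := (8 * (1 + |K|))⁻¹ with hs
    have h1 : s * (1 + |K|) = 1 / 8 := by rw [hs]; field_simp
    have hs0 : 0 < s := by positivity
    have h2 : s * |K| ≤ 1 / 8 := by nlinarith
    have h3 : s ≤ 1 / 8 := by nlinarith [abs_nonneg K, mul_nonneg hs0.le (abs_nonneg K)]
    have h4 : (s * |K|) ^ 2 ≤ (1 / 8) ^ 2 := pow_le_pow_left₀ (by positivity) h2 2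
    have h5 : s ^ 2 ≤ (1 / 8) ^ 2 := pow_le_pow_left₀ hs0.le h3 2
    have h6 := mul_le_mul h4 h5 (by positivity) (by positivity)
    rw [mul_pow, sq_abs] at h6
    nlinarith
  let χ : ContDiffBump x := ⟨r / 2, r, by positivity, by linarith⟩
  obtain ⟨ψ, hψ⟩ : ∃ ψ : ℂ → ℝ, ψ = w * χ := ⟨_, rfl⟩
  have sψ : ContDiff ℝ ∞ ψ := by rw [hψ]; exact cdMul hw χ.contDiff
  have vψ : Flat ψ x := fun n => by rw [hψ]; exact (h n).mul hw χ.contDiff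
  have cψ : HasCompactSupport ψ := by rw [hψ]; exact χ.hasCompactSupport.mul_left
  have zψ : ∀ z, ψ z ≠ 0 → ‖z - x‖ ≤ r := by
    intro z hz
    by_contra hlt
    refine hz ?_
    rw [hψ, Pi.mul_apply, χ.zero_of_le_dist (by rw [dist_eq_norm]; exact (not_le.1 hlt).le), mul_zero]
  have tψ : ∀ z, r < ‖z - x‖ → z ∉ tsupport ψ := by
    intro z hz hz'
    have : tsupport ψ ⊆ Metric.closedBall x r := closure_minimal
      (fun y hy => by rw [mem_closedBall_iff_norm]; exact zψ y hy) Metric.isClosed_closedBall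
    exact absurd (mem_closedBall_iff_norm.1 (this hz')) (not_le.2 hz)
  obtain ⟨Ψ, hΨ⟩ : ∃ Ψ : ℂ → ℂ, Ψ = fun z => Complex.ofRealCLM (ψ z) := ⟨_, rfl⟩
  have sΨ : ContDiff ℝ ∞ Ψ := by rw [hΨ]; exact Complex.ofRealCLM.contDiff.comp sψ
  have vΨ : Flat Ψ x := fun n => by rw [hΨ]; exact (vψ n).clm _ sψ
  have cΨ : HasCompactSupport Ψ := cψ.mono fun z hz hz' => hz (by simp [hΨ, hz'])
  have sL := contDiff_plap sψ
  obtain ⟨L, hL⟩ : ∃ L : ℂ → ℂ, L = fun z => Complex.ofRealCLM (plap ψ z) := ⟨_, rfl⟩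
  have sL' : ContDiff ℝ ∞ L := by rw [hL]; exact Complex.ofRealCLM.contDiff.comp sL
  have vL : Flat L x := fun n => by
    rw [hL]
    exact (((vψ (n + 2)).2.1.2.1).add (contDiff_px (contDiff_px sψ)) (contDiff_py (contDiff_py sψ))
      (vψ (n + 2)).2.2.2.2).clm _ sL
  have cL : HasCompactSupport L := (hasCompactSupport_plap cψ).mono
    fun z hz hz' => hz (by simp [hL, hz'])
  have dΨ : ∀ z, ‖dbar Ψ z‖ = ‖cgrad ψ z‖ := by
    intro z
    have e1 : px Ψ z = ((px ψ z : ℝ) : ℂ) := by rw [hΨ, px_clm _ sψ]; rfl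
    have e2 : py Ψ z = ((py ψ z : ℝ) : ℂ) := by rw [hΨ, py_clm _ sψ]; rfl
    rw [dbar, cgrad, e1, e2, ← Complex.norm_conj]
    simp [sub_eq_add_neg]
  have carl : ∀ n : ℕ, ∫ z, ‖Ψ z / (z - x) ^ n‖ ^ 2 ≤
      16 * r ^ 4 * ∫ z, ‖L z / (z - x) ^ n‖ ^ 2 := by
    intro n
    have s1 := vΨ.carleman sΨ cΨ (r := r) (fun z hz => zψ z fun h0 => hz (by simp [hΨ, h0])) n
    have s2 := Flat.carleman (f := cgrad ψ) (x := x) (r := r) (contDiff_cgrad sψ)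
      (fun k => (vψ (k + 1)).complexGradient sψ) (cψ.mono' fun z hz => by
        by_contra hz'
        exact hz (by simp [cgrad, px_eq_zero_of_notMem hz', py_eq_zero_of_notMem hz']))
      (fun z hz => by
        by_contra hz'
        have := tψ z (not_le.1 hz')
        exact hz (by simp [cgrad, px_eq_zero_of_notMem this, py_eq_zero_of_notMem this])) n
    rw [dbar_cgrad sψ] at s2
    have e : ∀ z, ‖dbar Ψ z / (z - x) ^ n‖ = ‖cgrad ψ z / (z - x) ^ n‖ := fun z => by
      rw [norm_div, norm_div, dΨ]
    simp only [e] at s1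
    rw [hL]
    nlinarith [mul_le_mul_of_nonneg_left s2 (by positivity : 0 ≤ 4 * r ^ 2)]
  obtain ⟨M, hM⟩ := sL.continuous.bounded_above_of_compact_support (hasCompactSupport_plap cψ)
  have int : ∀ {f : ℂ → ℂ}, ContDiff ℝ ∞ f → Flat f x → HasCompactSupport f → ∀ n : ℕ,
      Integrable fun z => ‖f z / (z - x) ^ n‖ ^ 2 := fun hf hv hc n =>
    ((hv.contDiff_div hf n).continuous.norm.pow 2).integrable_of_hasCompactSupport
      (hc.mono fun z hz hz' => hz (by simp [hz']))
  set V := volume.real (Metric.closedBall x r) with hV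
  have hball : volume (Metric.closedBall x r) ≠ ⊤ := measure_closedBall_lt_top.ne
  have est : ∀ n : ℕ, ∫ z, ‖L z / (z - x) ^ n‖ ^ 2 ≤
      K ^ 2 * (∫ z, ‖Ψ z / (z - x) ^ n‖ ^ 2) + M ^ 2 * ((2 / r) ^ n) ^ 2 * V := by
    intro n
    have iind : Integrable ((Metric.closedBall x r).indicator
        fun _ => M ^ 2 * ((2 / r) ^ n) ^ 2) :=
      (integrable_indicator_iff Metric.isClosed_closedBall.measurableSet).2
        (integrableOn_const hball)
    have hle := integral_mono (int sL' vL cL n)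
      (((int sΨ vΨ cΨ n).const_mul (K ^ 2)).add iind) fun z => ?_
    · refine hle.trans (le_of_eq ?_)
      simp only [Pi.add_apply]
      rw [integral_add ((int sΨ vΨ cΨ n).const_mul (K ^ 2)) iind, integral_const_mul,
        integral_indicator Metric.isClosed_closedBall.measurableSet, setIntegral_const,
        smul_eq_mul, ← hV]
      ring
    · simp only [Pi.add_apply, hL, hΨ, norm_div, Complex.ofRealCLM_apply, Complex.norm_real,
        norm_pow, Real.norm_eq_abs, div_pow, sq_abs]
      rcases lt_or_ge ‖z - x‖ (r / 2) with hz | hz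
      · have e : w =ᶠ[𝓝 z] ψ := by
          filter_upwards [Metric.isOpen_ball.mem_nhds (mem_ball_iff_norm.2 hz)] with y hy
          rw [hψ, Pi.mul_apply, χ.one_of_mem_closedBall (Metric.ball_subset_closedBall hy), mul_one]
        have h1 := hK z (by linarith)
        rw [plap_congr e, e.eq_of_nhds] at h1
        have h2 : plap ψ z ^ 2 ≤ K ^ 2 * ψ z ^ 2 := by
          rw [← sq_abs (plap ψ z), ← sq_abs (ψ z), ← mul_pow]
          exact pow_le_pow_left₀ (abs_nonneg _) h1 2
        have h3 : 0 ≤ (Metric.closedBall x r).indicator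
            (fun _ => M ^ 2 * ((2 : ℝ) ^ n / r ^ n) ^ 2) z :=
          Set.indicator_nonneg (fun _ _ => by positivity) z
        have h4 : plap ψ z ^ 2 / (‖z - x‖ ^ n) ^ 2 ≤ K ^ 2 * (ψ z ^ 2 / (‖z - x‖ ^ n) ^ 2) := by
          rw [← mul_div_assoc]
          gcongr
        simp only [div_pow] at h3 h4 ⊢
        linarith
      · have h0 : 0 ≤ K ^ 2 * (ψ z ^ 2 / (‖z - x‖ ^ n) ^ 2) := by positivity
        refine le_add_of_nonneg_of_le h0 ?_
        by_cases hzr : ‖z - x‖ ≤ r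
        · rw [Set.indicator_of_mem (mem_closedBall_iff_norm.2 hzr), div_eq_mul_inv]
          have h5 : plap ψ z ^ 2 ≤ M ^ 2 := by
            rw [← sq_abs]; exact pow_le_pow_left₀ (abs_nonneg _) (hM z) 2
          have h6 : ((‖z - x‖ ^ n) ^ 2)⁻¹ ≤ (2 ^ n / r ^ n) ^ 2 := by
            have : (2 ^ n / r ^ n) ^ 2 = (((r / 2) ^ n) ^ 2)⁻¹ := by
              rw [div_pow r]; field_simp
            rw [this]
            gcongr
          simp only [div_pow] at h6 ⊢
          exact mul_le_mul h5 h6 (by positivity) (by positivity)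
        · rw [plap_eq_zero_of_notMem (tψ z (not_le.1 hzr))]
          simp only [ne_eq, OfNat.ofNat_ne_zero, not_false_eq_true, zero_pow, zero_div]
          exact Set.indicator_nonneg (fun _ _ => by positivity) z
  have hbd : ∀ n : ℕ, ∫ z in Metric.ball x (r / 4), w z ^ 2 ≤
      32 * r ^ 4 * M ^ 2 * V * ((1 / 4 : ℝ) ^ n) := by
    intro n
    have h1 := carl n
    have h2 := est n
    set I := ∫ z, ‖Ψ z / (z - x) ^ n‖ ^ 2 with hI
    have hI0 : 0 ≤ I := integral_nonneg fun z => by positivity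
    have h3 : I ≤ 32 * r ^ 4 * M ^ 2 * V * ((2 / r) ^ n) ^ 2 := by
      nlinarith [mul_le_mul_of_nonneg_left h2 (by positivity : 0 ≤ 16 * r ^ 4),
        mul_le_mul_of_nonneg_right hrK hI0]
    have hwi : IntegrableOn (fun z => w z ^ 2) (Metric.ball x (r / 4)) :=
      ((hw.continuous.pow 2).continuousOn.integrableOn_compact
        (isCompact_closedBall x (r / 4))).mono_set Metric.ball_subset_closedBall
    have h4 : ((4 / r) ^ n) ^ 2 * ∫ z in Metric.ball x (r / 4), w z ^ 2 ≤ I := by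
      rw [← integral_const_mul]
      refine (setIntegral_mono_on (hwi.const_mul _) (int sΨ vΨ cΨ n).integrableOn
        Metric.isOpen_ball.measurableSet fun z hz => ?_).trans
        (setIntegral_le_integral (int sΨ vΨ cΨ n) (.of_forall fun z => by positivity))
      have hz' : ‖z - x‖ < r / 4 := mem_ball_iff_norm.1 hz
      have e : ψ z = w z := by
        rw [hψ, Pi.mul_apply, χ.one_of_mem_closedBall (mem_closedBall_iff_norm.2 (by
          show ‖z - x‖ ≤ r / 2; linarith)), mul_one]
      simp only [hΨ, norm_div, Complex.ofRealCLM_apply, Complex.norm_real, norm_pow,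
        Real.norm_eq_abs, div_pow, sq_abs, e]
      rcases eq_or_ne z x with rfl | hne
      · rw [(h 1).1]; simp
      · rw [mul_comm, div_eq_mul_inv (w z ^ 2)]
        refine mul_le_mul_of_nonneg_left ?_ (sq_nonneg _)
        have : ((4 : ℝ) ^ n) ^ 2 / (r ^ n) ^ 2 = (((r / 4) ^ n) ^ 2)⁻¹ := by
          rw [div_pow r]; field_simp
        rw [this]
        have hp : 0 < ‖z - x‖ := norm_pos_iff.2 (sub_ne_zero.2 hne)
        gcongr
    have h5 : ((4 / r) ^ n) ^ 2 * (1 / 4 : ℝ) ^ n = ((2 / r) ^ n) ^ 2 := by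
      rw [← pow_mul, ← pow_mul, mul_comm n 2, pow_mul, pow_mul, ← mul_pow]
      congr 1
      ring
    have hp : 0 < ((4 / r) ^ n) ^ 2 := by positivity
    refine le_of_mul_le_mul_left ?_ hp
    calc _ ≤ I := h4
      _ ≤ _ := h3
      _ = _ := by rw [← h5]; ring
  have hlim : ∫ z in Metric.ball x (r / 4), w z ^ 2 ≤ 0 := by
    have := (tendsto_pow_atTop_nhds_zero_of_lt_one (by norm_num : (0 : ℝ) ≤ 1 / 4)
      (by norm_num)).const_mul (32 * r ^ 4 * M ^ 2 * V)
    rw [mul_zero] at this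
    exact ge_of_tendsto' this hbd
  have hwi : IntegrableOn (fun z => w z ^ 2) (Metric.ball x (r / 4)) :=
    ((hw.continuous.pow 2).continuousOn.integrableOn_compact
      (isCompact_closedBall x (r / 4))).mono_set Metric.ball_subset_closedBall
  have h0 := (setIntegral_eq_zero_iff_of_nonneg_ae (.of_forall fun z => sq_nonneg (w z)) hwi).1
    (le_antisymm hlim (integral_nonneg fun z => sq_nonneg _))
  have heq := Measure.eqOn_open_of_ae_eq h0 Metric.isOpen_ball (hw.continuous.pow 2).continuousOn
    continuousOn_const
  filter_upwards [Metric.ball_mem_nhds x (by positivity : 0 < r / 4)] with z hz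
  exact pow_eq_zero_iff two_ne_zero |>.1 (heq hz)

/-- A solution of a linear differential inequality with a zero of infinite order vanishes. -/
theorem eq_zero_of_flat {w : ℂ → ℝ} (hw : ContDiff ℝ ∞ w)
    (hK : ∀ x, ∃ K : ℝ, ∀ z, ‖z - x‖ ≤ 1 → |plap w z| ≤ K * |w z|) {x : ℂ}
    (h : ∀ n, Van n w x) : w = 0 := by
  have hc : IsClopen {x | ∀ n, Van n w x} := by
    constructor
    · rw [Set.ofPred_forall]
      exact isClosed_iInter fun n => Van.isClosed hw
    · refine isOpen_iff_mem_nhds.2 fun y hy => ?_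
      obtain ⟨K, hK⟩ := hK y
      filter_upwards [(Flat.eventually_eq_zero hw hy hK).eventually_nhds] with z hz n
      exact (van_const_zero n z).congr (hz.mono fun _ h => h.symm)
  ext y
  have hy : y ∈ {x | ∀ n, Van n w x} := by rw [hc.eq_univ ⟨x, h⟩]; trivial
  exact (hy 1).1

end UniqueContinuation

section ZeroSet

open Filter Topology

lemma contDiff_exp_sub_one {w : ℂ → ℝ} (hw : ContDiff ℝ ∞ w) :
    ContDiff ℝ ∞ fun z => rexp (2 * w z) - 1 :=
  ((contDiff_const.mul hw).exp).sub contDiff_const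

lemma Van.exp_sub_one {n : ℕ} {w : ℂ → ℝ} {x : ℂ} (hw : ContDiff ℝ ∞ w) (h : Van n w x) :
    Van n (fun z => rexp (2 * w z) - 1) x := by
  cases n with
  | zero => trivial
  | succ n =>
    have hd : ∀ z, HasFDerivAt (fun z => rexp (2 * w z) - 1)
        (rexp (2 * w z) • ((2 : ℝ) • fderiv ℝ w z)) z := fun z =>
      (((hasFDerivAt_of_smooth hw z).const_mul 2).exp).sub_const 1
    have hg : ContDiff ℝ ∞ fun z => 2 * rexp (2 * w z) :=
      contDiff_const.mul (contDiff_const.mul hw).exp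
    refine ⟨by simp [h.1], ?_, ?_⟩
    · have : px (fun z => rexp (2 * w z) - 1) = px w * fun z => 2 * rexp (2 * w z) := by
        ext z; rw [px, (hd z).fderiv]; simp [px]; ring
      rw [this]
      exact h.2.1.mul (contDiff_px hw) hg
    · have : py (fun z => rexp (2 * w z) - 1) = py w * fun z => 2 * rexp (2 * w z) := by
        ext z; rw [py, (hd z).fderiv]; simp [py]; ring
      rw [this]
      exact h.2.2.mul (contDiff_py hw) hg

lemma abs_exp_sub_one_le_of_abs_le {t B : ℝ} (h : |t| ≤ B) : |rexp t - 1| ≤ rexp B * |t| := by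
  have h1 := add_one_le_exp t
  have h2 := add_one_le_exp (-t)
  have h3 : rexp t * rexp (-t) = 1 := by rw [← exp_add]; simp
  have hB : 1 ≤ rexp B := one_le_exp ((abs_nonneg t).trans h)
  have hb : rexp t ≤ rexp B := exp_le_exp.2 ((le_abs_self t).trans h)
  rcases le_total 0 t with ht | ht
  · rw [abs_of_nonneg (by linarith), abs_of_nonneg ht]
    nlinarith [exp_pos t]
  · rw [abs_of_nonpos (by linarith [exp_le_one_iff.2 ht]), abs_of_nonpos ht]
    nlinarith

variable {V w : ℂ → ℝ}

lemma exists_leading_of_zero (hV : ContDiff ℝ ∞ V) (hw : ContDiff ℝ ∞ w) (hne : w ≠ 0)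
    (heq : ∀ z, -plap w z = rexp (2 * V z) * (rexp (2 * w z) - 1)) {x : ℂ} {k : ℕ}
    (hx : Van k w x) (hk : 1 ≤ k) :
    ∃ N ≥ k, ∃ γ : ℂ, γ ≠ 0 ∧ ∃ C : ℝ, 0 ≤ C ∧ ∀ z, ‖z - x‖ ≤ 1 →
      |w z - (γ * (z - x) ^ N).re| ≤ C * ‖z - x‖ ^ (N + 1) := by
  have hplap : plap w = (fun z => rexp (2 * w z) - 1) * fun z => -rexp (2 * V z) := by
    ext z; rw [Pi.mul_apply]; linarith [heq z]
  have hnf : ∃ n, ¬ Van n w x := by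
    by_contra! hcon
    refine hne (eq_zero_of_flat hw (fun y => ?_) hcon)
    obtain ⟨A, hA⟩ := (isCompact_closedBall y 1).exists_bound_of_continuousOn
      hV.continuous.continuousOn
    obtain ⟨B, hB⟩ := (isCompact_closedBall y 1).exists_bound_of_continuousOn
      hw.continuous.continuousOn
    refine ⟨rexp (2 * A) * (rexp (2 * B) * 2), fun z hz => ?_⟩
    have hz' : z ∈ Metric.closedBall y 1 := mem_closedBall_iff_norm.2 hz
    have h1 : V z ≤ A := (le_abs_self _).trans (hA z hz')
    have h2 : |2 * w z| ≤ 2 * B := by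
      rw [abs_mul, abs_two]; exact mul_le_mul_of_nonneg_left (hB z hz') zero_le_two
    have h3 := abs_exp_sub_one_le_of_abs_le h2
    rw [abs_mul, abs_two] at h3
    rw [hplap, Pi.mul_apply, abs_mul, abs_neg, abs_exp, mul_comm, mul_assoc]
    have h4 : rexp (2 * V z) ≤ rexp (2 * A) := exp_le_exp.2 (by linarith)
    refine mul_le_mul h4 ?_ (abs_nonneg _) (exp_pos _).le
    linarith
  classical
  have hn := Nat.find_spec hnf
  have hmin : ∀ m < Nat.find hnf, Van m w x := fun m hm => not_not.1 (Nat.find_min hnf hm)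
  have hlt : k < Nat.find hnf := by
    by_contra! hle
    exact hn (hx.mono hle)
  obtain ⟨m, hm⟩ : ∃ m, Nat.find hnf = m + 2 := ⟨Nat.find hnf - 2, by omega⟩
  rw [hm] at hn hmin hlt
  have hV1 : Van (m + 1) w x := hmin _ (by omega)
  obtain ⟨γ, h0, C, hC0, hC⟩ := Van.exists_leading hw hV1 hn (by
    rw [hplap]
    exact (hV1.of_succ.exp_sub_one hw).mul (contDiff_exp_sub_one hw)
      (contDiff_const.mul hV).exp.neg)
  exact ⟨m + 1, by omega, γ, h0, C, hC0, hC⟩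

lemma eventually_pos_on_ray {x γ e : ℂ} {N : ℕ} {C : ℝ}
    (h : ∀ z, ‖z - x‖ ≤ 1 → |w z - (γ * (z - x) ^ N).re| ≤ C * ‖z - x‖ ^ (N + 1))
    (he : 0 < (γ * e ^ N).re) : ∀ᶠ t : ℝ in 𝓝[>] 0, 0 < w (x + t * e) := by
  have c1 : Tendsto (fun t : ℝ => |t| * ‖e‖) (𝓝[>] 0) (𝓝 0) := by
    have : Continuous fun t : ℝ => |t| * ‖e‖ := by fun_prop
    simpa using (this.tendsto 0).mono_left nhdsWithin_le_nhds
  have c2 : Tendsto (fun t : ℝ => C * ‖e‖ ^ (N + 1) * |t|) (𝓝[>] 0) (𝓝 0) := by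
    have : Continuous fun t : ℝ => C * ‖e‖ ^ (N + 1) * |t| := by fun_prop
    simpa using (this.tendsto 0).mono_left nhdsWithin_le_nhds
  filter_upwards [self_mem_nhdsWithin, c1.eventually (gt_mem_nhds one_pos),
    c2.eventually (gt_mem_nhds he)] with t ht h1 h2
  have ht' : 0 < t := ht
  have hn : ‖x + t * e - x‖ = |t| * ‖e‖ := by simp
  have := h (x + t * e) (by rw [hn]; exact h1.le)
  rw [hn, add_sub_cancel_left, mul_pow, mul_left_comm, ← Complex.ofReal_pow, Complex.re_ofReal_mul,
    abs_of_pos ht'] at this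
  rw [abs_of_pos ht'] at h2
  have h3 : C * (t * ‖e‖) ^ (N + 1) = t ^ N * (C * ‖e‖ ^ (N + 1) * t) := by ring
  have h4 := mul_lt_mul_of_pos_left h2 (pow_pos ht' N)
  linarith [(abs_le.1 this).1]

lemma eventually_neg_on_ray {x γ e : ℂ} {N : ℕ} {C : ℝ}
    (h : ∀ z, ‖z - x‖ ≤ 1 → |w z - (γ * (z - x) ^ N).re| ≤ C * ‖z - x‖ ^ (N + 1))
    (he : (γ * e ^ N).re < 0) : ∀ᶠ t : ℝ in 𝓝[>] 0, w (x + t * e) < 0 := by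
  have := eventually_pos_on_ray (w := -w) (x := x) (γ := -γ) (e := e) (N := N) (C := C)
    (fun z hz => by
      have := h z hz
      rw [← abs_neg] at this
      convert! this using 2
      simp [neg_mul]; ring) (by rw [neg_mul, Complex.neg_re]; linarith)
  filter_upwards [this] with t ht
  simpa using ht

/-- Near each of its zeros a nontrivial solution takes both signs. -/
lemma exists_pos_neg_near_zero (hV : ContDiff ℝ ∞ V) (hw : ContDiff ℝ ∞ w) (hne : w ≠ 0)
    (heq : ∀ z, -plap w z = rexp (2 * V z) * (rexp (2 * w z) - 1)) {x : ℂ} (hx : w x = 0)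
    {s : Set ℂ} (hs : s ∈ 𝓝 x) : (∃ z ∈ s, 0 < w z) ∧ ∃ z ∈ s, w z < 0 := by
  obtain ⟨N, hN, γ, h0, C, -, hC⟩ := exists_leading_of_zero hV hw hne heq (k := 1)
    ⟨hx, trivial, trivial⟩ le_rfl
  have hray : ∀ e : ℂ, ∀ᶠ t : ℝ in 𝓝[>] 0, x + t * e ∈ s := fun e => by
    have : Continuous fun t : ℝ => x + t * e := by fun_prop
    exact ((by simpa using this.tendsto 0 : Tendsto (fun t : ℝ => x + t * e) (𝓝 0)
      (𝓝 x)).mono_left nhdsWithin_le_nhds).eventually hs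
  obtain ⟨e, he⟩ := IsAlgClosed.exists_pow_nat_eq (γ⁻¹) (by omega : 0 < N)
  obtain ⟨e', he'⟩ := IsAlgClosed.exists_pow_nat_eq (-γ⁻¹) (by omega : 0 < N)
  constructor
  · obtain ⟨t, h1, h2⟩ := ((hray e).and (eventually_pos_on_ray hC (e := e) (by
      rw [he, mul_inv_cancel₀ h0]; simp))).exists
    exact ⟨_, h1, h2⟩
  · obtain ⟨t, h1, h2⟩ := ((hray e').and (eventually_neg_on_ray hC (e := e') (by
      rw [he', mul_neg, mul_inv_cancel₀ h0]; simp))).exists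
    exact ⟨_, h1, h2⟩

/-- At a real zero of an odd solution the sign alternates along `N` rays in the upper half-plane,
where `N` is at least the order of vanishing. -/
lemma exists_alternating_rays (hV : ContDiff ℝ ∞ V) (hw : ContDiff ℝ ∞ w) (hne : w ≠ 0)
    (heq : ∀ z, -plap w z = rexp (2 * V z) * (rexp (2 * w z) - 1))
    (hodd : ∀ z, w ((starRingEnd ℂ) z) = -w z) {x : ℝ} {k : ℕ} (hx : Van k w x) (hk : 1 ≤ k) :
    ∃ N ≥ k, ∃ b : ℝ, b ≠ 0 ∧ ∀ θ : ℝ,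
      (0 < b * sin (N * θ) → ∀ᶠ t : ℝ in 𝓝[>] 0, 0 < w (x + t * Complex.exp (θ * Complex.I))) ∧
      (b * sin (N * θ) < 0 → ∀ᶠ t : ℝ in 𝓝[>] 0, w (x + t * Complex.exp (θ * Complex.I)) < 0) := by
  obtain ⟨N, hN, γ, h0, C, -, hC⟩ := exists_leading_of_zero hV hw hne heq hx hk
  have hax : ∀ t : ℝ, w (x + t * (1 : ℂ)) = 0 := fun t => by
    have := hodd (x + t * (1 : ℂ))
    simp only [map_add, map_mul, Complex.conj_ofReal, map_one] at this
    linarith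
  have hre : γ.re = 0 := by
    rcases lt_trichotomy γ.re 0 with h | h | h
    · obtain ⟨t, ht⟩ := (eventually_neg_on_ray hC (e := 1) (by simpa using h)).exists
      exact absurd (hax t) ht.ne
    · exact h
    · obtain ⟨t, ht⟩ := (eventually_pos_on_ray hC (e := 1) (by simpa using h)).exists
      exact absurd (hax t) ht.ne'
  have hform : ∀ θ : ℝ, (γ * Complex.exp (θ * Complex.I) ^ N).re = -γ.im * sin (N * θ) := fun θ => by
    rw [← Complex.exp_nat_mul, ← mul_assoc]
    have : (N : ℂ) * θ = ((N * θ : ℝ) : ℂ) := by push_cast; ring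
    rw [this, Complex.mul_re, hre, Complex.exp_ofReal_mul_I_im]
    ring
  refine ⟨N, hN, -γ.im, fun h => h0 (Complex.ext hre (by simpa using h)), fun θ => ⟨fun h => ?_,
    fun h => ?_⟩⟩
  · exact eventually_pos_on_ray hC (by rw [hform]; exact h)
  · exact eventually_neg_on_ray hC (by rw [hform]; exact h)

end ZeroSet

section Mass

open Filter Topology

variable {D : Set ℂ} {w : ℂ → ℝ} {Φ : ℂ → ℂ}

/-- A positive solution of `-Δw ≤ c |Φ'|² w` vanishing on the boundary of `D` needs a definite
amount of `|Φ'|²`-area. -/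
theorem mass_lower_bound {c B : ℝ} (hD : IsOpen D) (hne : D.Nonempty) (hw : ContDiff ℝ ∞ w)
    (hpos : ∀ z ∈ D, 0 < w z) (hcomp : ∀ t > 0, IsCompact {z | z ∈ D ∧ t ≤ w z})
    (hB : ∀ z ∈ D, w z ≤ B) (hΦ : ContDiff ℝ ∞ Φ) (hol : ∀ z ∈ D, DifferentiableAt ℂ Φ z)
    (hΦ0 : ∀ z ∈ D, px Φ z ≠ 0) (hΦi : IntegrableOn (fun z => ‖px Φ z‖ ^ 2) D) (hc : 0 ≤ c)
    (hsub : ∀ z ∈ D, -plap w z ≤ c * w z * ‖px Φ z‖ ^ 2) :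
    4 * π ≤ c * ∫ z in D, ‖px Φ z‖ ^ 2 := by
  set P : ℂ → ℝ := fun z => ‖px Φ z‖ ^ 2 with hP
  have hP0 : ∀ z, 0 ≤ P z := fun z => by positivity
  set A := tail D w P with hA
  set T := sSup (w '' D) with hT
  have hbd : BddAbove (w '' D) := ⟨B, by rintro _ ⟨z, hz, rfl⟩; exact hB z hz⟩
  have hwT : ∀ z ∈ D, w z ≤ T := fun z hz => le_csSup hbd ⟨z, hz, rfl⟩
  obtain ⟨z₀, hz₀⟩ := hne
  have hT0 : 0 < T := (hpos z₀ hz₀).trans_le (hwT z₀ hz₀)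
  have hAanti : Antitone A := tail_anti hP0 hΦi
  have hApos : ∀ s < T, 0 < A s := by
    intro s hs
    obtain ⟨_, ⟨z₁, hz₁, rfl⟩, hlt⟩ := exists_lt_of_lt_csSup (s := w '' D) ⟨_, z₀, hz₀, rfl⟩ hs
    have hopen : IsOpen {z | z ∈ D ∧ s < w z} :=
      hD.inter (isOpen_lt continuous_const hw.continuous)
    rw [hA, tail, setIntegral_pos_iff_support_of_nonneg_ae (Eventually.of_forall hP0)
      (hΦi.mono_set (layer_subset _))]
    refine lt_of_lt_of_le (hopen.measure_pos volume ⟨z₁, hz₁, hlt⟩) (measure_mono fun z hz => ?_)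
    refine ⟨?_, hz⟩
    have := hΦ0 z hz.1
    rw [Function.mem_support, hP]
    positivity
  have hiso : ∀ s s', 0 < s → s < s' → 4 * π * (s' - s) * A s' ≤ c * T * A s * (A s - A s') := by
    intro s s' hs hs'
    have h := layer_isoperimetric (D := D) (φ := w) (s := s) (s' := s')
      (g := fun z => c * T * P z) hD hw hs' (hcomp s hs) hΦ hol
      (fun z _ _ => mul_nonneg (mul_nonneg hc hT0.le) (hP0 z))
      (fun z hz _ => (hsub z hz).trans (mul_le_mul_of_nonneg_right
        (mul_le_mul_of_nonneg_left (hwT z hz) hc) (hP0 z)))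
      ((hΦi.mono_set (layer_subset _)).const_mul (c * T))
    rw [integral_const_mul] at h
    exact h
  have key : ∀ s₀, 0 < s₀ → s₀ < T → ∀ θ > 0, (4 * π - θ) * (T - s₀) ≤ c * T * A s₀ := by
    intro s₀ hs₀ hs₀T θ hθ
    have hAT : A T = 0 := tail_eq_zero hwT le_rfl
    have := le_of_local_le (R := fun s => -(c * T * A s) - (4 * π - θ) * s) hs₀T.le ?_ ?_
    · simp only [hAT] at this
      linarith
    · intro s hs
      have hs0 : 0 < s := hs₀.trans_le hs.1
      have hAs := hApos s hs.2
      have h1 : Tendsto A (𝓝[>] s) (𝓝 (A s)) := tail_right_continuous hw.continuous hΦi s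
      have h2 : Tendsto (fun s' => 4 * π * A s') (𝓝[>] s) (𝓝 (4 * π * A s)) := h1.const_mul _
      have h3 : (4 * π - θ) * A s < 4 * π * A s :=
        mul_lt_mul_of_pos_right (by linarith) hAs
      filter_upwards [self_mem_nhdsWithin, h2.eventually_const_le h3] with s' hs' h4
      have hss' : s < s' := hs'
      have h5 := hiso s s' hs0 hss'
      have h6 := mul_le_mul_of_nonneg_left h4 (sub_nonneg.2 hss'.le)
      have h7 : (4 * π - θ) * (s' - s) * A s ≤ c * T * (A s - A s') * A s := by linarith
      have h8 := le_of_mul_le_mul_right h7 hAs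
      linarith
    · intro x hx d hd
      have h1 : Tendsto (fun y => -(c * T * A x) - (4 * π - θ) * y) (𝓝[<] x)
          (𝓝 (-(c * T * A x) - (4 * π - θ) * x)) :=
        (Continuous.tendsto (by fun_prop) x).mono_left nhdsWithin_le_nhds
      refine ge_of_tendsto h1 ?_
      filter_upwards [Ico_mem_nhdsLT hx.1] with y hy
      have h2 := hd y hy
      have h3 := mul_le_mul_of_nonneg_left (hAanti hy.2.le) (mul_nonneg hc hT0.le)
      linarith
  have h1 : ∀ s₀, 0 < s₀ → s₀ < T → ∀ θ > 0,
      (4 * π - θ) * (T - s₀) ≤ c * T * ∫ z in D, P z := fun s₀ h h' θ hθ =>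
    (key s₀ h h' θ hθ).trans
      (mul_le_mul_of_nonneg_left (tail_le hP0 hΦi s₀) (mul_nonneg hc hT0.le))
  have h2 : Tendsto (fun θ => (4 * π - θ) * (T - θ)) (𝓝[>] 0) (𝓝 ((4 * π - 0) * (T - 0))) :=
    (Continuous.tendsto (by fun_prop) 0).mono_left nhdsWithin_le_nhds
  have h3 := le_of_tendsto h2 (by
    filter_upwards [Ioo_mem_nhdsGT hT0] with θ hθ using h1 θ hθ.1 hθ.2 θ hθ.1)
  have h4 : 4 * π * T ≤ (c * ∫ z in D, P z) * T := by linarith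
  exact le_of_mul_le_mul_right h4 hT0

end Mass

section PlaneData

open Filter Topology

/-- The open upper half-plane. -/
def upper : Set ℂ := {z | 0 < z.im}

lemma isOpen_upper : IsOpen upper := isOpen_lt continuous_const Complex.continuous_im

lemma integrable_one_add_sq : Integrable fun z : ℂ => (1 + ‖z‖ ^ 2) ^ (-2 : ℝ) := by
  have := integrable_rpow_neg_one_add_norm_sq (E := ℂ) (μ := volume) (r := 4)
    (by rw [Complex.finrank_real_complex]; norm_num)
  norm_num at this ⊢
  exact this

/-- A solution of the mean field equation and its reflection in stereographic coordinates,
written as conformal factors `e^{2U}` and `e^{2V}` on the plane. -/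
structure PlaneData (U V w : ℂ → ℝ) : Prop where
  smoothU : ContDiff ℝ ∞ U
  smoothV : ContDiff ℝ ∞ V
  smooth : ContDiff ℝ ∞ w
  diff : ∀ z, w z = U z - V z
  refl : ∀ z, V z = U (starRingEnd ℂ z)
  eqn : ∀ z, -plap w z = Real.exp (2 * U z) - Real.exp (2 * V z)
  curvature : ∃ κ, 0 ≤ κ ∧ κ < 1 ∧ (∀ z, -plap U z ≤ κ * Real.exp (2 * U z)) ∧
    ∀ z, -plap V z ≤ κ * Real.exp (2 * V z)
  decay : ∃ C, ∀ z, Real.exp (2 * U z) ≤ C * (1 + ‖z‖ ^ 2) ^ (-2 : ℝ)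
  lim : Tendsto w (cocompact ℂ) (𝓝 0)
  mass : (∫ z in upper, Real.exp (2 * U z)) + ∫ z in upper, Real.exp (2 * V z) ≤ 12 * π
  ne : w ≠ 0

/-- The part of the upper half-plane where `w` does not vanish. -/
def nodalComplement (w : ℂ → ℝ) : Set ℂ := {z | z ∈ upper ∧ w z ≠ 0}

/-- The nodal domains of `w` in the upper half-plane. -/
def nodal (w : ℂ → ℝ) : Set (Set ℂ) :=
  {D | ∃ x ∈ nodalComplement w, D = connectedComponentIn (nodalComplement w) x}

variable {U V w : ℂ → ℝ} {D D' : Set ℂ}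

lemma nodalComplement_neg : nodalComplement (-w) = nodalComplement w := by
  ext z; simp [nodalComplement]

lemma nodal_neg : nodal (-w) = nodal w := by rw [nodal, nodal, nodalComplement_neg]

lemma isOpen_nodalComplement (hw : Continuous w) : IsOpen (nodalComplement w) :=
  isOpen_upper.inter (isOpen_ne_fun hw continuous_const)

lemma nodal_eq (hD : D ∈ nodal w) {x : ℂ} (hx : x ∈ D) :
    D = connectedComponentIn (nodalComplement w) x := by
  obtain ⟨y, -, rfl⟩ := hD
  exact connectedComponentIn_eq hx

lemma nodal_subset (hD : D ∈ nodal w) : D ⊆ nodalComplement w := by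
  obtain ⟨y, -, rfl⟩ := hD
  exact connectedComponentIn_subset _ _

lemma nodal_subset_upper (hD : D ∈ nodal w) : D ⊆ upper := fun _ hz => (nodal_subset hD hz).1

lemma nodal_nonempty (hD : D ∈ nodal w) : D.Nonempty := by
  obtain ⟨y, hy, rfl⟩ := hD
  exact ⟨y, mem_connectedComponentIn hy⟩

lemma nodal_isPreconnected (hD : D ∈ nodal w) : IsPreconnected D := by
  obtain ⟨y, -, rfl⟩ := hD
  exact isPreconnected_connectedComponentIn

lemma nodal_isOpen (hw : Continuous w) (hD : D ∈ nodal w) : IsOpen D := by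
  obtain ⟨y, -, rfl⟩ := hD
  exact (isOpen_nodalComplement hw).connectedComponentIn

lemma nodal_eq_or_disjoint (hD : D ∈ nodal w) (hD' : D' ∈ nodal w) : D = D' ∨ Disjoint D D' := by
  rw [or_iff_not_imp_right, Set.not_disjoint_iff]
  rintro ⟨x, hx, hx'⟩
  rw [nodal_eq hD hx, nodal_eq hD' hx']

lemma subset_nodal (hD : D ∈ nodal w) {s : Set ℂ} (hs : IsPreconnected s)
    (hsub : s ⊆ nodalComplement w) (h : (s ∩ D).Nonempty) : s ⊆ D := by
  obtain ⟨x, hx, hxD⟩ := h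
  rw [nodal_eq hD hxD]
  exact hs.subset_connectedComponentIn hx hsub

lemma exists_nodal {x : ℂ} (hx : x ∈ nodalComplement w) : ∃ D ∈ nodal w, x ∈ D :=
  ⟨_, ⟨x, hx, rfl⟩, mem_connectedComponentIn hx⟩

lemma nodal_pos (hw : Continuous w) (hD : D ∈ nodal w) {x : ℂ} (hx : x ∈ D) (hwx : 0 < w x) :
    ∀ z ∈ D, 0 < w z := by
  intro z hz
  by_contra h
  obtain ⟨y, hy, hy0⟩ := (nodal_isPreconnected hD).intermediate_value hz hx hw.continuousOn
    ⟨not_lt.1 h, hwx.le⟩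
  exact (nodal_subset hD hy).2 hy0

lemma nodal_neg_of_neg (hw : Continuous w) (hD : D ∈ nodal w) {x : ℂ} (hx : x ∈ D)
    (hwx : w x < 0) : ∀ z ∈ D, w z < 0 := by
  have := nodal_pos (w := -w) hw.neg (by rwa [nodal_neg]) hx (by simpa using hwx)
  exact fun z hz => by simpa using this z hz

lemma nodal_pos_or_neg (hw : Continuous w) (hD : D ∈ nodal w) :
    (∀ z ∈ D, 0 < w z) ∨ ∀ z ∈ D, w z < 0 := by
  obtain ⟨x, hx⟩ := nodal_nonempty hD
  rcases (nodal_subset hD hx).2.lt_or_gt with h | h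
  · exact Or.inr (nodal_neg_of_neg hw hD hx h)
  · exact Or.inl (nodal_pos hw hD hx h)

namespace PlaneData

lemma odd (h : PlaneData U V w) (z : ℂ) : w (starRingEnd ℂ z) = -w z := by
  rw [h.diff, h.diff, h.refl, h.refl, Complex.conj_conj]; ring

lemma swap (h : PlaneData U V w) : PlaneData V U (-w) where
  smoothU := h.smoothV
  smoothV := h.smoothU
  smooth := h.smooth.neg
  diff z := by rw [Pi.neg_apply, h.diff]; ring
  refl z := by rw [h.refl, Complex.conj_conj]
  eqn z := by
    have e : (-w) = (fun _ => (0 : ℝ)) - w := by ext; simp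
    rw [e, plap_sub contDiff_const h.smooth, Pi.sub_apply, neg_sub, plap_const]
    have := h.eqn z
    simp only [Pi.zero_apply, sub_zero]
    linarith
  curvature := by
    obtain ⟨κ, h0, h1, h2, h3⟩ := h.curvature
    exact ⟨κ, h0, h1, h3, h2⟩
  decay := by
    obtain ⟨C, hC⟩ := h.decay
    exact ⟨C, fun z => by rw [h.refl]; simpa using hC (starRingEnd ℂ z)⟩
  lim := by
    have := h.lim.neg
    rwa [neg_zero] at this
  mass := by rw [add_comm]; exact h.mass
  ne := neg_ne_zero.2 h.ne

lemma eqn' (h : PlaneData U V w) (z : ℂ) :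
    -plap w z = Real.exp (2 * V z) * (Real.exp (2 * w z) - 1) := by
  rw [h.eqn, h.diff, mul_sub, ← Real.exp_add, mul_one]
  ring_nf

lemma eq_zero_of_real (h : PlaneData U V w) {z : ℂ} (hz : z.im = 0) : w z = 0 := by
  have h1 := h.odd z
  rw [Complex.conj_eq_iff_im.2 hz] at h1
  linarith

lemma bounded (h : PlaneData U V w) : ∃ B, 0 ≤ B ∧ ∀ z, |w z| ≤ B := by
  obtain ⟨K, hK, hKc⟩ := mem_cocompact.1 (h.lim.eventually (Metric.ball_mem_nhds (0 : ℝ) one_pos))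
  obtain ⟨B, hB⟩ := hK.bddAbove_image h.smooth.continuous.abs.continuousOn
  refine ⟨max B 1, by positivity, fun z => ?_⟩
  by_cases hz : z ∈ K
  · exact (hB ⟨z, hz, rfl⟩).trans (le_max_left _ _)
  · have := hKc hz
    simp only [Set.mem_ofPred_eq, dist_zero_right, Real.norm_eq_abs] at this
    exact this.le.trans (le_max_right _ _)

lemma integrableU (h : PlaneData U V w) : Integrable fun z => Real.exp (2 * U z) := by
  obtain ⟨C, hC⟩ := h.decay
  refine (integrable_one_add_sq.const_mul C).mono'
    (Real.continuous_exp.comp (continuous_const.mul h.smoothU.continuous)).aestronglyMeasurable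
    (Eventually.of_forall fun z => ?_)
  rw [Real.norm_of_nonneg (Real.exp_pos _).le]
  exact hC z

lemma integrableV (h : PlaneData U V w) : Integrable fun z => Real.exp (2 * V z) :=
  h.swap.integrableU

/-- The closure of a nodal domain only adds zeros of `w`. -/
lemma closure_nodal (h : PlaneData U V w) (hD : D ∈ nodal w) {z : ℂ} (hz : z ∈ closure D) :
    z ∈ D ∨ w z = 0 := by
  by_cases hwz : w z = 0
  · exact Or.inr hwz
  left
  have h1 : closure D ⊆ {z | 0 ≤ z.im} :=
    closure_minimal (fun x hx => show 0 ≤ x.im from le_of_lt (nodal_subset_upper hD hx))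
      (isClosed_le continuous_const Complex.continuous_im)
  have h2 : z.im ≠ 0 := fun h3 => hwz (h.eq_zero_of_real h3)
  have h3 : z ∈ nodalComplement w := ⟨lt_of_le_of_ne (h1 hz) h2.symm, hwz⟩
  obtain ⟨x, -, rfl⟩ := hD
  exact closure_connectedComponentIn_inter_subset _ _ ⟨hz, h3⟩

lemma isCompact_layer (h : PlaneData U V w) (hD : D ∈ nodal w) {t : ℝ} (ht : 0 < t) :
    IsCompact {z | z ∈ D ∧ t ≤ w z} := by
  have e : {z | z ∈ D ∧ t ≤ w z} = closure D ∩ {z | t ≤ w z} := by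
    ext z
    refine ⟨fun hz => ⟨subset_closure hz.1, hz.2⟩, fun hz => ⟨?_, hz.2⟩⟩
    refine (h.closure_nodal hD hz.1).resolve_right fun h0 => ?_
    have : t ≤ w z := hz.2
    linarith
  obtain ⟨K, hK, hKc⟩ := mem_cocompact.1 (h.lim.eventually (Metric.ball_mem_nhds (0 : ℝ) ht))
  rw [e]
  refine hK.of_isClosed_subset
    (isClosed_closure.inter (isClosed_le continuous_const h.smooth.continuous)) fun z hz => ?_
  by_contra hzK
  have := hKc hzK
  simp only [Set.mem_ofPred_eq, dist_zero_right, Real.norm_eq_abs] at this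
  have h2 : t ≤ w z := hz.2
  linarith [le_abs_self (w z)]

/-- A nodal domain without holes carries more than a third of the maximal total mass. -/
lemma mass_gt (h : PlaneData U V w) (hD : D ∈ nodal w) (hDc : IsPreconnected Dᶜ) :
    4 * π < (∫ z in D, Real.exp (2 * U z)) + ∫ z in D, Real.exp (2 * V z) := by
  have hLs : ∀ {w : ℂ → ℝ} {D}, D ∈ nodal w → {z : ℂ | z.im ≤ 0} ⊆ Dᶜ := fun hD z hz hzD =>
    not_lt.2 (show z.im ≤ 0 from hz) (nodal_subset_upper hD hzD)
  have main : ∀ {U V w : ℂ → ℝ} (h : PlaneData U V w), D ∈ nodal w → (∀ z ∈ D, 0 < w z) →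
      4 * π < (∫ z in D, Real.exp (2 * V z)) + ∫ z in D, Real.exp (2 * U z) := by
    intro U V w h hD hpos
    obtain ⟨κ, h0, h1, -, h3⟩ := h.curvature
    have e : ∀ z, 2 * V z + 2 * w z = 2 * U z := fun z => by rw [h.diff]; ring
    have := sphere_covering (nodal_isOpen h.smooth.continuous hD) (nodal_nonempty hD) hDc (hLs hD)
      h.smoothV h.smooth h0 h1 hpos (fun t ht => h.isCompact_layer hD ht) (fun z _ => h.eqn' z)
      (fun z _ => h3 z) h.integrableV.integrableOn (by simp only [e]; exact h.integrableU.integrableOn)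
    simpa only [e] using this
  rcases nodal_pos_or_neg h.smooth.continuous hD with hs | hs
  · rw [add_comm]; exact main h hD hs
  · exact main h.swap (by rwa [nodal_neg]) fun z hz => by simpa using hs z hz

end PlaneData

end PlaneData

section Finite

open Filter Topology

/-- A smooth map of the plane which on the upper half-plane is the Möbius map `1 / (z + i)`. -/
lemma exists_smooth_cayley : ∃ Φ : ℂ → ℂ, ContDiff ℝ ∞ Φ ∧
    ∀ z ∈ upper, DifferentiableAt ℂ Φ z ∧ ‖px Φ z‖ = (‖z + Complex.I‖ ^ 2)⁻¹ := by
  obtain ⟨χ, hχ, hχ0, hχ1, -⟩ := exists_smooth_step (s := -(2/3)) (s' := -(1/3)) (c := 2)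
    (by norm_num) (by norm_num)
  refine ⟨fun z => (χ z.im : ℂ) * (z + Complex.I)⁻¹, ?_, fun z hz => ?_⟩
  · rw [contDiff_iff_contDiffAt]
    intro z
    rcases lt_or_ge z.im (-(2/3)) with h | h
    · refine contDiffAt_const (c := (0 : ℂ)) |>.congr_of_eventuallyEq ?_
      filter_upwards [(isOpen_lt Complex.continuous_im continuous_const).mem_nhds h] with x hx
      have : x.im < -(2/3) := hx
      simp [hχ0 _ this.le]
    · have h1 : ContDiff ℝ ∞ fun z : ℂ => (χ z.im : ℂ) :=
        contDiff_ofReal (hχ.comp Complex.imCLM.contDiff)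
      refine h1.contDiffAt.mul (ContDiffAt.inv (by fun_prop) fun h0 => ?_)
      have := congrArg Complex.im h0
      simp at this
      linarith
  · have hz' : 0 < z.im := hz
    have h0 : z + Complex.I ≠ 0 := fun h0 => by
      have := congrArg Complex.im h0
      simp at this
      linarith
    have h1 : HasDerivAt (fun z : ℂ => (z + Complex.I)⁻¹) (-1 / (z + Complex.I) ^ 2) z := by
      exact ((hasDerivAt_id z).add_const Complex.I).inv h0
    have h2 : (fun z => (χ z.im : ℂ) * (z + Complex.I)⁻¹) =ᶠ[𝓝 z]
        fun z : ℂ => (z + Complex.I)⁻¹ := by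
      filter_upwards [isOpen_upper.mem_nhds hz] with x hx
      have : 0 < x.im := hx
      simp [hχ1 x.im (by linarith)]
    have h3 := h1.congr_of_eventuallyEq h2
    refine ⟨h3.differentiableAt, ?_⟩
    rw [px_of_differentiableAt h3.differentiableAt, h3.deriv]
    simp

lemma cayley_bounds {z : ℂ} (hz : z ∈ upper) :
    ((‖z + Complex.I‖ ^ 2) ^ 2)⁻¹ ≤ (1 + ‖z‖ ^ 2) ^ (-2 : ℝ) ∧
    (1 + ‖z‖ ^ 2) ^ (-2 : ℝ) ≤ 4 * ((‖z + Complex.I‖ ^ 2) ^ 2)⁻¹ ∧ 0 < ‖z + Complex.I‖ ^ 2 := by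
  have hR : (1 + ‖z‖ ^ 2) ^ (-2 : ℝ) = ((1 + ‖z‖ ^ 2) ^ 2)⁻¹ := by
    rw [Real.rpow_neg (by positivity)]
    norm_cast
  have hn : ‖z + Complex.I‖ ^ 2 = ‖z‖ ^ 2 + 2 * z.im + 1 := by
    rw [Complex.sq_norm, Complex.sq_norm, Complex.normSq_apply, Complex.normSq_apply]
    simp; ring
  have h1 : z.im ≤ ‖z‖ := (le_abs_self _).trans (Complex.abs_im_le_norm z)
  have h2 : 0 < z.im := hz
  have h3 : ‖z + Complex.I‖ ^ 2 ≤ 2 * (1 + ‖z‖ ^ 2) := by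
    rw [hn]; nlinarith [sq_nonneg (‖z‖ - 1)]
  have h4 : 0 < ‖z + Complex.I‖ ^ 2 := by rw [hn]; positivity
  have h5 : 1 + ‖z‖ ^ 2 ≤ ‖z + Complex.I‖ ^ 2 := by rw [hn]; linarith
  rw [hR]
  refine ⟨by gcongr, ?_, h4⟩
  rw [← div_eq_mul_inv, inv_eq_one_div, div_le_div_iff₀ (by positivity) (by positivity)]
  nlinarith

variable {U V w : ℂ → ℝ}

set_option maxHeartbeats 1000000 in
/-- There are only finitely many nodal domains. -/
theorem PlaneData.finite_nodal (h : PlaneData U V w) : (nodal w).Finite := by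
  obtain ⟨Φ, hΦ, hΦ'⟩ := exists_smooth_cayley
  set P : ℂ → ℝ := fun z => ‖px Φ z‖ ^ 2 with hP
  set R : ℂ → ℝ := fun z => (1 + ‖z‖ ^ 2) ^ (-2 : ℝ) with hR
  have hR0 : ∀ z, 0 ≤ R z := fun z => Real.rpow_nonneg (by positivity) _
  have hR1 : Integrable R := integrable_one_add_sq
  have hPz : ∀ z ∈ upper, P z = ((‖z + Complex.I‖ ^ 2) ^ 2)⁻¹ := fun z hz => by
    rw [hP]
    simp only [(hΦ' z hz).2, inv_pow]
  have hPR : ∀ z ∈ upper, P z ≤ R z := fun z hz => by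
    rw [hPz z hz]; exact (cayley_bounds hz).1
  have hRP : ∀ z ∈ upper, R z ≤ 4 * P z := fun z hz => by
    rw [hPz z hz]; exact (cayley_bounds hz).2.1
  have hPc : Continuous P := (contDiff_px hΦ).continuous.norm.pow 2
  have hPi : IntegrableOn P upper := by
    refine hR1.integrableOn.mono' hPc.aestronglyMeasurable ?_
    filter_upwards [self_mem_ae_restrict isOpen_upper.measurableSet] with z hz
    rw [Real.norm_of_nonneg (by positivity)]
    exact hPR z hz
  obtain ⟨B, hB0, hB⟩ := h.bounded
  obtain ⟨C₁, hC₁⟩ := h.decay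
  obtain ⟨C₂, hC₂⟩ := h.swap.decay
  set C := max (max C₁ C₂) 0 with hC
  have hCU : ∀ z ∈ upper, Real.exp (2 * U z) ≤ 4 * C * P z := fun z hz => by
    refine (hC₁ z).trans ?_
    have h1 : C₁ * R z ≤ C * R z := mul_le_mul_of_nonneg_right
      ((le_max_left _ _).trans (le_max_left _ _)) (hR0 z)
    have h2 := mul_le_mul_of_nonneg_left (hRP z hz) (le_max_right (max C₁ C₂) 0)
    linarith
  have hCV : ∀ z ∈ upper, Real.exp (2 * V z) ≤ 4 * C * P z := fun z hz => by
    refine (hC₂ z).trans ?_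
    have h1 : C₂ * R z ≤ C * R z := mul_le_mul_of_nonneg_right
      ((le_max_right _ _).trans (le_max_left _ _)) (hR0 z)
    have h2 := mul_le_mul_of_nonneg_left (hRP z hz) (le_max_right (max C₁ C₂) 0)
    linarith
  set c := 4 * C * (2 * Real.exp (2 * B)) with hc
  have hc0 : 0 ≤ c := by positivity
  have main : ∀ {U V w : ℂ → ℝ} (h : PlaneData U V w), (∀ z, |w z| ≤ B) →
      (∀ z ∈ upper, Real.exp (2 * V z) ≤ 4 * C * P z) → ∀ D ∈ nodal w, (∀ z ∈ D, 0 < w z) →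
      4 * π ≤ c * ∫ z in D, P z := by
    intro U V w h hB hCV D hD hpos
    have hsub := nodal_subset_upper hD
    refine mass_lower_bound (nodal_isOpen h.smooth.continuous hD) (nodal_nonempty hD) h.smooth hpos
      (fun t ht => h.isCompact_layer hD ht) (fun z _ => (le_abs_self _).trans (hB z)) hΦ
      (fun z hz => (hΦ' z (hsub hz)).1) (fun z hz => ?_) (hPi.mono_set hsub) hc0 (fun z hz => ?_)
    · rw [← norm_ne_zero_iff, (hΦ' z (hsub hz)).2]
      exact (inv_pos.2 (cayley_bounds (hsub hz)).2.2).ne'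
    · rw [h.eqn']
      have h1 : |2 * w z| ≤ 2 * B := by
        rw [abs_mul, abs_of_pos (two_pos : (0 : ℝ) < 2)]
        linarith [hB z]
      have h2 := (le_abs_self _).trans (abs_exp_sub_one_le_of_abs_le h1)
      rw [abs_of_pos (by linarith [hpos z hz])] at h2
      have h3 := hpos z hz
      calc Real.exp (2 * V z) * (Real.exp (2 * w z) - 1)
          ≤ Real.exp (2 * V z) * (Real.exp (2 * B) * (2 * w z)) :=
            mul_le_mul_of_nonneg_left h2 (Real.exp_pos _).le
        _ ≤ 4 * C * P z * (Real.exp (2 * B) * (2 * w z)) :=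
            mul_le_mul_of_nonneg_right (hCV z (hsub hz)) (by positivity)
        _ = c * w z * P z := by rw [hc]; ring
  have key : ∀ D ∈ nodal w, 4 * π ≤ c * ∫ z in D, P z := by
    intro D hD
    rcases nodal_pos_or_neg h.smooth.continuous hD with hs | hs
    · exact main h hB hCV D hD hs
    · exact main h.swap (fun z => by simpa using hB z) hCU D (by rwa [nodal_neg])
        fun z hz => by simpa using hs z hz
  by_contra hinf
  obtain ⟨n, hn⟩ := exists_nat_gt ((c * ∫ z in upper, P z) / (4 * π))
  obtain ⟨t, ht, htn⟩ := Set.Infinite.exists_subset_card_eq hinf n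
  have h1 : ∫ z in ⋃ D ∈ t, D, P z = ∑ D ∈ t, ∫ z in D, P z := by
    refine integral_biUnion_finset (s := id) t
      (fun D hD => (nodal_isOpen h.smooth.continuous (ht hD)).measurableSet) ?_
      fun D hD => hPi.mono_set (nodal_subset_upper (ht hD))
    intro D hD D' hD' hne
    exact (nodal_eq_or_disjoint (ht hD) (ht hD')).resolve_left hne
  have h2 : ∫ z in ⋃ D ∈ t, D, P z ≤ ∫ z in upper, P z :=
    setIntegral_mono_set hPi (Eventually.of_forall fun z => by positivity)
      (LE.le.eventuallyLE (Set.iUnion₂_subset fun D (hD : D ∈ t) =>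
        nodal_subset_upper (ht hD)))
  have h3 : ∑ _D ∈ t, 4 * π ≤ ∑ D ∈ t, c * ∫ z in D, P z :=
    Finset.sum_le_sum fun D hD => key D (ht hD)
  rw [Finset.sum_const, htn, nsmul_eq_mul, ← Finset.mul_sum, ← h1] at h3
  have h4 := mul_le_mul_of_nonneg_left h2 hc0
  rw [div_lt_iff₀ (by positivity)] at hn
  linarith

end Finite

section Hull

open Filter Topology

variable {U V w : ℂ → ℝ} {D E : Set ℂ} {x : ℂ}

lemma isClosed_component {F : Set ℂ} (hF : IsClosed F) (x : ℂ) :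
    IsClosed (connectedComponentIn F x) :=
  isClosed_of_closure_subset fun _ hz => closure_connectedComponentIn_inter_subset F x
    ⟨hz, closure_minimal (connectedComponentIn_subset F x) hF hz⟩

lemma disjoint_component {F : Set ℂ} {x y : ℂ} (h : y ∉ connectedComponentIn F x) :
    Disjoint (connectedComponentIn F y) (connectedComponentIn F x) := by
  rw [Set.disjoint_left]
  intro z hz hz'
  have hy : y ∈ F := by
    by_contra hy
    rw [connectedComponentIn_eq_empty hy] at hz
    exact hz
  refine h ?_
  rw [connectedComponentIn_eq hz', ← connectedComponentIn_eq hz]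
  exact mem_connectedComponentIn hy

/-- The components of the complement of an open set touch its boundary. -/
lemma component_compl_inter_closure (hD : IsOpen D) (hne : D.Nonempty) (hx : x ∈ Dᶜ) :
    (connectedComponentIn Dᶜ x ∩ closure D).Nonempty := by
  by_contra h
  rw [Set.not_nonempty_iff_eq_empty] at h
  set C := connectedComponentIn Dᶜ x with hC
  have hcl : IsClosed C := isClosed_component hD.isClosed_compl x
  have hop : IsOpen C := by
    rw [Metric.isOpen_iff]
    intro c hc
    have hc' : c ∈ (closure D)ᶜ := fun hc' => by
      have : c ∈ C ∩ closure D := ⟨hc, hc'⟩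
      rw [h] at this
      exact this
    obtain ⟨ε, hε, hb⟩ := Metric.isOpen_iff.1 isClosed_closure.isOpen_compl c hc'
    refine ⟨ε, hε, ?_⟩
    rw [hC, connectedComponentIn_eq hc]
    exact (convex_ball c ε).isPreconnected.subset_connectedComponentIn (Metric.mem_ball_self hε)
      (hb.trans (Set.compl_subset_compl.2 subset_closure))
  rcases isClopen_iff.1 ⟨hcl, hop⟩ with h0 | h0
  · have := mem_connectedComponentIn hx
    rw [← hC, h0] at this
    exact this
  · obtain ⟨d, hd⟩ := hne
    have : d ∈ C := by rw [h0]; trivial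
    exact connectedComponentIn_subset _ _ this hd

lemma isPreconnected_union_component (hD : IsOpen D) (hne : D.Nonempty) (hc : IsPreconnected D)
    (hx : x ∈ Dᶜ) : IsPreconnected (D ∪ connectedComponentIn Dᶜ x) := by
  obtain ⟨a, ha, ha'⟩ := component_compl_inter_closure hD hne hx
  have h1 : IsPreconnected (insert a D) :=
    hc.subset_closure (Set.subset_insert _ _) (Set.insert_subset ha' subset_closure)
  have h2 := h1.union a (Set.mem_insert _ _) ha isPreconnected_connectedComponentIn
  rwa [Set.insert_union, Set.insert_eq_of_mem (Set.mem_union_right D ha)] at h2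

lemma isPreconnected_compl_component (hD : IsOpen D) (hne : D.Nonempty) (hc : IsPreconnected D) :
    IsPreconnected (connectedComponentIn Dᶜ x)ᶜ := by
  obtain ⟨d, hd⟩ := hne
  have hDs : D ⊆ (connectedComponentIn Dᶜ x)ᶜ := fun z hz hz' =>
    connectedComponentIn_subset _ _ hz' hz
  refine isPreconnected_of_forall d fun y hy => ?_
  by_cases hyD : y ∈ D
  · exact ⟨D, hDs, hd, hyD, hc⟩
  · exact ⟨D ∪ connectedComponentIn Dᶜ y, Set.union_subset hDs
      (Set.subset_compl_iff_disjoint_right.2 (disjoint_component hy)), Or.inl hd,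
      Or.inr (mem_connectedComponentIn hyD), isPreconnected_union_component hD ⟨d, hd⟩ hc hyD⟩

/-- The component of the complement containing the closed lower half-plane. -/
def outer (D : Set ℂ) : Set ℂ := connectedComponentIn Dᶜ 0

lemma zero_notMem (hD : D ⊆ upper) : (0 : ℂ) ∈ Dᶜ := fun h => by
  have : 0 < (0 : ℂ).im := hD h
  simp at this

lemma isPreconnected_lower : IsPreconnected {z : ℂ | z.im ≤ 0} :=
  (convex_halfSpace_im_le 0).isPreconnected

lemma lower_subset_outer (hD : D ⊆ upper) : {z : ℂ | z.im ≤ 0} ⊆ outer D :=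
  isPreconnected_lower.subset_connectedComponentIn (by simp) fun z hz h =>
    not_lt.2 (show z.im ≤ 0 from hz) (hD h)

lemma compl_outer_subset (hD : D ⊆ upper) : (outer D)ᶜ ⊆ upper := fun z hz => by
  by_contra h
  exact hz (lower_subset_outer hD (show z.im ≤ 0 from not_lt.1 h))

lemma subset_compl_outer : D ⊆ (outer D)ᶜ := fun _ hz hz' => connectedComponentIn_subset _ _ hz' hz

/-- A connected set avoiding `D` which meets the outer component lies in it. -/
lemma subset_outer {s : Set ℂ} (hs : IsPreconnected s) (hd : s ⊆ Dᶜ) (h : (s ∩ outer D).Nonempty) :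
    s ⊆ outer D := by
  obtain ⟨a, ha, ha'⟩ := h
  rw [outer, connectedComponentIn_eq ha']
  exact hs.subset_connectedComponentIn ha hd

lemma subset_outer_of_closure {a : ℂ} (hE : E ⊆ upper) (hc : IsPreconnected D)
    (hDE : Disjoint D E) (ha : a ∈ closure D) (ha0 : a.im = 0) : D ⊆ outer E := by
  have h1 : IsPreconnected (insert a D) :=
    hc.subset_closure (Set.subset_insert _ _) (Set.insert_subset ha subset_closure)
  have haE : a ∈ outer E := lower_subset_outer hE ha0.le
  refine (Set.subset_insert a D).trans (subset_outer h1 ?_ ⟨a, Set.mem_insert _ _, haE⟩)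
  exact Set.insert_subset (connectedComponentIn_subset _ _ haE)
    (Set.subset_compl_iff_disjoint_right.2 hDE)

lemma disjoint_hulls {a b : ℂ} (hEo : IsOpen E) (hE0 : E.Nonempty) (hD : D ⊆ upper)
    (hE : E ⊆ upper) (hc : IsPreconnected D) (hc' : IsPreconnected E) (hDE : Disjoint D E)
    (ha : a ∈ closure D) (ha0 : a.im = 0) (hb : b ∈ closure E) (hb0 : b.im = 0) :
    Disjoint (outer D)ᶜ (outer E)ᶜ := by
  have h1 := subset_outer_of_closure hE hc hDE ha ha0
  have h2 := subset_outer_of_closure hD hc' hDE.symm hb hb0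
  have h3 : (outer E)ᶜ ⊆ outer D := by
    refine subset_outer (isPreconnected_compl_component hEo hE0 hc')
      (Set.compl_subset_compl.2 h1) ?_
    obtain ⟨e, he⟩ := hE0
    exact ⟨e, subset_compl_outer he, h2 he⟩
  rw [← Set.subset_compl_iff_disjoint_left, compl_compl]
  exact h3

namespace PlaneData

lemma exists_nodal_subset_hull (h : PlaneData U V w) (hD : D ∈ nodal w)
    (hDc : ¬ IsPreconnected Dᶜ) : ∃ E ∈ nodal w, (outer E)ᶜ ⊆ (outer D)ᶜ \ D := by
  have hw := h.smooth.continuous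
  have hDo := nodal_isOpen hw hD
  have hDne := nodal_nonempty hD
  have hDu := nodal_subset_upper hD
  obtain ⟨x, hxD, hx⟩ : ∃ x ∈ Dᶜ, x ∉ outer D := by
    by_contra! hcon
    refine hDc ?_
    have : outer D = Dᶜ := Set.Subset.antisymm (connectedComponentIn_subset _ _) hcon
    rw [← this]
    exact isPreconnected_connectedComponentIn
  obtain ⟨x₀, hx₀, hx₀'⟩ := component_compl_inter_closure hDo hDne hxD
  have hx₀D : x₀ ∉ D := connectedComponentIn_subset _ _ hx₀
  have hw0 : w x₀ = 0 := (h.closure_nodal hD hx₀').resolve_left hx₀D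
  have hx₀o : x₀ ∈ (outer D)ᶜ := fun h' => Set.disjoint_left.1 (disjoint_component hx) hx₀ h'
  have hnhds : (outer D)ᶜ ∈ 𝓝 x₀ :=
    (isClosed_component hDo.isClosed_compl 0).isOpen_compl.mem_nhds hx₀o
  obtain ⟨⟨a, ha, hwa⟩, b, hb, hwb⟩ := exists_pos_neg_near_zero h.smoothV h.smooth h.ne h.eqn' hw0
    hnhds
  obtain ⟨c, hc, hcw, hcD⟩ : ∃ c ∈ (outer D)ᶜ, w c ≠ 0 ∧ c ∉ D := by
    rcases nodal_pos_or_neg hw hD with hs | hs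
    · exact ⟨b, hb, hwb.ne, fun hbD => absurd (hs b hbD) hwb.not_gt⟩
    · exact ⟨a, ha, hwa.ne', fun haD => absurd (hs a haD) hwa.not_gt⟩
  obtain ⟨E, hE, hcE⟩ := exists_nodal (w := w) (x := c) ⟨compl_outer_subset hDu hc, hcw⟩
  have hEu := nodal_subset_upper hE
  have hED : Disjoint E D := (nodal_eq_or_disjoint hE hD).resolve_left fun e => hcD (e ▸ hcE)
  have hEc := nodal_isPreconnected hE
  have hdis : Disjoint E (outer D) := by
    rw [Set.disjoint_left]
    intro z hz hz'
    exact hc (subset_outer hEc (Set.subset_compl_iff_disjoint_right.2 hED) ⟨z, hz, hz'⟩ hcE)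
  have h1 : D ∪ outer D ⊆ outer E := by
    refine subset_outer (isPreconnected_union_component hDo hDne (nodal_isPreconnected hD)
      (zero_notMem hDu)) ?_ ⟨0, Or.inr (lower_subset_outer hDu (by simp)),
      lower_subset_outer hEu (by simp)⟩
    exact Set.union_subset (Set.subset_compl_iff_disjoint_left.2 hED)
      (Set.subset_compl_iff_disjoint_left.2 hdis)
  exact ⟨E, hE, fun z hz => ⟨fun hz' => hz (h1 (Or.inr hz')), fun hz' => hz (h1 (Or.inl hz'))⟩⟩

/-- Every nodal domain surrounds one without holes. -/
lemma exists_simple_nodal (h : PlaneData U V w) (hD : D ∈ nodal w) :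
    ∃ E ∈ nodal w, E ⊆ (outer D)ᶜ ∧ IsPreconnected Eᶜ := by
  have hfin : ∀ D, {E | E ∈ nodal w ∧ E ⊆ (outer D)ᶜ}.Finite := fun D =>
    h.finite_nodal.subset fun E hE => hE.1
  induction hn : {E | E ∈ nodal w ∧ E ⊆ (outer D)ᶜ}.ncard using Nat.strong_induction_on
    generalizing D with
  | _ n ih =>
    by_cases hDc : IsPreconnected Dᶜ
    · exact ⟨D, hD, subset_compl_outer, hDc⟩
    obtain ⟨D', hD', hsub⟩ := h.exists_nodal_subset_hull hD hDc
    have hlt : {E | E ∈ nodal w ∧ E ⊆ (outer D')ᶜ}.ncard <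
        {E | E ∈ nodal w ∧ E ⊆ (outer D)ᶜ}.ncard := by
      refine Set.ncard_lt_ncard ⟨fun E hE => ⟨hE.1, fun z hz => (hsub (hE.2 hz)).1⟩, fun hss => ?_⟩
        (hfin D)
      obtain ⟨d, hd⟩ := nodal_nonempty hD
      exact (hsub ((hss ⟨hD, subset_compl_outer⟩).2 hd)).2 hd
    obtain ⟨E, hE, hEs, hEc⟩ := ih _ (hn ▸ hlt) hD' rfl
    exact ⟨E, hE, fun z hz => (hsub (hEs hz)).1, hEc⟩

/-- At most two nodal domains reach the real axis. -/
theorem not_three_nodal (h : PlaneData U V w) {D : Fin 3 → Set ℂ} (hD : ∀ i, D i ∈ nodal w)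
    (hne : ∀ i j, i ≠ j → D i ≠ D j) (hcl : ∀ i, ∃ a ∈ closure (D i), a.im = 0) : False := by
  have hw := h.smooth.continuous
  choose E hE hEs hEc using fun i => h.exists_simple_nodal (hD i)
  choose a ha ha0 using hcl
  have hdisj : ∀ i j, i ≠ j → Disjoint (E i) (E j) := fun i j hij =>
    (disjoint_hulls (nodal_isOpen hw (hD j)) (nodal_nonempty (hD j))
      (nodal_subset_upper (hD i)) (nodal_subset_upper (hD j)) (nodal_isPreconnected (hD i))
      (nodal_isPreconnected (hD j)) ((nodal_eq_or_disjoint (hD i) (hD j)).resolve_left (hne i j hij))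
      (ha i) (ha0 i) (ha j) (ha0 j)).mono (hEs i) (hEs j)
  have hsum : ∀ f : ℂ → ℝ, (∀ z, 0 ≤ f z) → Integrable f →
      ∑ i, ∫ z in E i, f z ≤ ∫ z in upper, f z := by
    intro f hf hfi
    have h1 := integral_biUnion_finset (μ := volume) (f := f) Finset.univ (s := E)
      (fun i _ => (nodal_isOpen hw (hE i)).measurableSet) (fun i _ j _ hij => hdisj i j hij)
      fun i _ => hfi.integrableOn
    rw [← h1]
    exact setIntegral_mono_set hfi.integrableOn (Eventually.of_forall hf)
      (LE.le.eventuallyLE (Set.iUnion₂_subset fun i _ => nodal_subset_upper (hE i)))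
  have h1 := hsum _ (fun z => (Real.exp_pos _).le) h.integrableU
  have h2 := hsum _ (fun z => (Real.exp_pos _).le) h.integrableV
  have h3 := fun i => h.mass_gt (hE i) (hEc i)
  rw [Fin.sum_univ_three] at h1 h2
  have := h.mass
  linarith [h3 0, h3 1, h3 2]

end PlaneData

end Hull

section Crossing

open Filter Topology

variable {A W : Set ℂ} {x x' a e : ℂ}

/-- `(z - x) / (z - x')` has a continuous logarithm on a closed set when `x` and `x'` are joined by a
connected set avoiding it. -/
lemma exists_continuous_log (hA : IsClosed A) (hW : IsPreconnected W) (hd : Disjoint W A)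
    (hx : x ∈ W) (hx' : x' ∈ W) : ∃ L : ℂ → ℂ, ContinuousOn L A ∧
      ∀ z ∈ A, Complex.exp (L z) = (z - x) / (z - x') := by
  have hne : ∀ c ∈ W, ∀ z ∈ A, z - c ≠ 0 := fun c hc z hz h =>
    Set.disjoint_left.1 hd hc (by rwa [← sub_eq_zero.1 h])
  refine hW.induction₂ (fun x x' => ∃ L : ℂ → ℂ, ContinuousOn L A ∧
    ∀ z ∈ A, Complex.exp (L z) = (z - x) / (z - x')) ?_ ?_ ?_ hx hx'
  · intro c hc
    obtain ⟨ε, hε, hb⟩ := Metric.isOpen_iff.1 hA.isOpen_compl c (Set.disjoint_left.1 hd hc)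
    filter_upwards [self_mem_nhdsWithin,
      mem_nhdsWithin_of_mem_nhds (Metric.ball_mem_nhds c (half_pos hε))] with c' hc' hcc
    rw [Metric.mem_ball, dist_eq_norm] at hcc
    have hslit : ∀ z ∈ A, (z - c) / (z - c') ∈ Complex.slitPlane := by
      intro z hz
      have h1 : ε ≤ ‖z - c‖ := by
        by_contra h
        exact hb (by rw [Metric.mem_ball, dist_eq_norm]; exact not_le.1 h) hz
      have h0 := hne c' hc' z hz
      have h2 : (z - c) / (z - c') = 1 + (c' - c) / (z - c') := by field_simp; ring
      rw [h2]
      refine Complex.mem_slitPlane_of_norm_lt_one ?_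
      rw [norm_div, div_lt_one (norm_pos_iff.2 h0)]
      have h3 : ‖z - c‖ ≤ ‖z - c'‖ + ‖c' - c‖ := by
        calc ‖z - c‖ = ‖(z - c') + (c' - c)‖ := by ring_nf
          _ ≤ _ := norm_add_le _ _
      linarith
    refine ⟨fun z => Complex.log ((z - c) / (z - c')), ?_, fun z hz =>
      Complex.exp_log (Complex.slitPlane_ne_zero (hslit z hz))⟩
    exact ContinuousOn.clog (ContinuousOn.div (by fun_prop) (by fun_prop) (hne c' hc')) hslit
  · rintro c₁ c₂ c₃ h₁ h₂ h₃ ⟨L, hL, hL'⟩ ⟨M, hM, hM'⟩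
    refine ⟨L + M, hL.add hM, fun z hz => ?_⟩
    rw [Pi.add_apply, Complex.exp_add, hL' z hz, hM' z hz]
    have := hne c₂ h₂ z hz
    have := hne c₃ h₃ z hz
    field_simp
  · rintro c₁ c₂ h₁ h₂ ⟨L, hL, hL'⟩
    refine ⟨-L, hL.neg, fun z hz => ?_⟩
    rw [Pi.neg_apply, Complex.exp_neg, hL' z hz, inv_div]

/-- A closed set which is connected away from one of its points `a`, and which leaves `a` on both
sides of a segment through `a`, separates the end points of the segment. -/
lemma segment_separated {d₁ d₃ : ℂ} {ε : ℝ} (hA : IsClosed A) (haA : a ∈ A)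
    (hAc : IsPreconnected (A \ {a})) (hW : IsPreconnected W) (hd : Disjoint W A) (he : e ≠ 0)
    (hε : 0 < ε) (hx : a + ε * e ∈ W) (hx' : a - ε * e ∈ W)
    (hseg : ∀ z ∈ A, ∀ t : ℝ, |t| ≤ ε → z = a + t * e → t = 0) (hd₁ : d₁.im < 0)
    (hd₃ : 0 < d₃.im) (hr₁ : ∀ᶠ t : ℝ in 𝓝[>] 0, a + t * (e * d₁) ∈ A)
    (hr₃ : ∀ᶠ t : ℝ in 𝓝[>] 0, a + t * (e * d₃) ∈ A) : False := by
  obtain ⟨L, hL, hLe⟩ := exists_continuous_log hA hW hd hx hx'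
  set f : ℂ → ℂ := fun z => (z - (a + ε * e)) / (z - (a - ε * e)) with hf
  have hne : ∀ z ∈ A, z - (a - ε * e) ≠ 0 := fun z hz h =>
    Set.disjoint_left.1 hd hx' (by rwa [← sub_eq_zero.1 h])
  have hε' : (ε : ℂ) ≠ 0 := by exact_mod_cast hε.ne'
  have hslit : ∀ z ∈ A \ {a}, f z ∈ Complex.slitPlane := by
    rintro z ⟨hz, hza⟩
    rw [Complex.mem_slitPlane_iff_not_le_zero, Complex.le_def]
    rintro ⟨h1, h2⟩
    simp only [Complex.zero_re, Complex.zero_im] at h1 h2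
    set s := -(f z).re with hs
    have hs0 : 0 ≤ s := by linarith
    have hfz : f z = -(s : ℂ) := by
      apply Complex.ext <;> simp [hs, h2]
    have h3 : z - (a + ε * e) = -(s : ℂ) * (z - (a - ε * e)) := by
      rw [← hfz, hf]; simp only; rw [div_mul_cancel₀ _ (hne z hz)]
    have h1s : (1 + s : ℂ) ≠ 0 := by
      have : (0 : ℝ) < 1 + s := by linarith
      exact_mod_cast this.ne'
    have h4 : z = a + ((ε * (1 - s) / (1 + s) : ℝ) : ℂ) * e := by
      push_cast
      field_simp
      linear_combination h3
    have h5 := hseg z hz _ (by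
      rw [abs_div, abs_mul, abs_of_pos hε, abs_of_pos (show 0 < 1 + s by linarith),
        div_le_iff₀ (by linarith)]
      refine mul_le_mul_of_nonneg_left ?_ hε.le
      rw [abs_le]; constructor <;> linarith) h4
    rw [h5] at h4
    exact hza (by simpa using h4)
  set g : ℂ → ℂ := fun z => L z - Complex.log (f z) with hg
  have hfc : ContinuousOn f A := ContinuousOn.div (by fun_prop) (by fun_prop) hne
  have hgc : ContinuousOn g (A \ {a}) :=
    (hL.mono Set.sdiff_subset).sub ((hfc.mono Set.sdiff_subset).clog hslit)
  have hgn : ∀ z ∈ A \ {a}, ∃ n : ℤ, g z = n * (2 * π * Complex.I) := by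
    intro z hz
    have h1 : Complex.exp (L z) = Complex.exp (Complex.log (f z)) := by
      rw [hLe z hz.1, Complex.exp_log (Complex.slitPlane_ne_zero (hslit z hz))]
    obtain ⟨n, hn⟩ := Complex.exp_eq_exp_iff_exists_int.1 h1
    exact ⟨n, by rw [hg]; simp only; rw [hn]; ring⟩
  have hconst : ∀ z ∈ A \ {a}, ∀ z' ∈ A \ {a}, (g z).im = (g z').im := by
    intro z hz z' hz'
    have h1 := hAc.constant_of_mapsTo (T := Set.range ((↑) : ℤ → ℝ)) (f := fun z => (g z).im / (2 * π))
      Int.isClosedEmbedding_coe_real.isInducing.isDiscrete_range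
      ((Complex.continuous_im.comp_continuousOn hgc).div_const _) (fun z hz => by
        obtain ⟨n, hn⟩ := hgn z hz
        refine ⟨n, ?_⟩
        simp only [hn]
        simp) hz hz'
    have : (2 * π) ≠ 0 := by positivity
    field_simp at h1
    exact h1
  have hfa : f a = -1 := by
    rw [hf]; simp only [sub_add_cancel_left, sub_sub_cancel]
    field_simp
  have hray : ∀ d : ℂ, Tendsto (fun t : ℝ => a + t * (e * d)) (𝓝[>] 0) (𝓝 a) := by
    intro d
    have : Tendsto (fun t : ℝ => a + t * (e * d)) (𝓝 0) (𝓝 (a + (0 : ℝ) * (e * d))) :=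
      Continuous.tendsto (by fun_prop) 0
    rw [Complex.ofReal_zero, zero_mul, add_zero] at this
    exact this.mono_left nhdsWithin_le_nhds
  have hrayA : ∀ d : ℂ, (∀ᶠ t : ℝ in 𝓝[>] 0, a + t * (e * d) ∈ A) →
      Tendsto (fun t : ℝ => a + t * (e * d)) (𝓝[>] 0) (𝓝[A] a) := fun d hd =>
    tendsto_nhdsWithin_iff.2 ⟨hray d, hd⟩
  have him : ∀ (d : ℂ) (t : ℝ), 0 < t → d.im ≠ 0 →
      ∃ k : ℝ, 0 < k ∧ (f (a + t * (e * d))).im = k * d.im := by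
    intro d t ht hdi
    have hn : (t * d + ε : ℂ) ≠ 0 := fun h => by
      have := congrArg Complex.im h
      simp [ht.ne', hdi] at this
    have h1 : f (a + t * (e * d)) = (t * d - ε) / (t * d + ε) := by
      rw [hf]
      simp only
      have h2 : a + t * (e * d) - (a - ε * e) = e * (t * d + ε) := by ring
      have h3 : a + t * (e * d) - (a + ε * e) = e * (t * d - ε) := by ring
      rw [h2, h3, mul_div_mul_left _ _ he]
    have hnn := Complex.normSq_pos.2 hn
    refine ⟨2 * t * ε / Complex.normSq (t * d + ε), by positivity, ?_⟩
    rw [h1, Complex.div_im]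
    simp only [Complex.sub_im, Complex.mul_im, Complex.ofReal_re, Complex.ofReal_im, zero_mul,
      add_zero, sub_zero, Complex.add_re, Complex.mul_re, Complex.sub_re, Complex.add_im]
    field_simp
    ring
  have hane : ∀ (d : ℂ) (t : ℝ), 0 < t → d.im ≠ 0 → a + t * (e * d) ≠ a := by
    intro d t ht hdi h
    rw [add_eq_left, mul_eq_zero, mul_eq_zero] at h
    rcases h with h | h | h
    · exact ht.ne' (by exact_mod_cast h)
    · exact he h
    · rw [h] at hdi; simp at hdi
  have hlim1 : Tendsto (fun t : ℝ => (g (a + t * (e * d₁))).im) (𝓝[>] 0) (𝓝 ((L a).im + π)) := by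
    have h1 : Tendsto (fun t : ℝ => f (a + t * (e * d₁))) (𝓝[>] 0) (𝓝[{z | z.im < 0}] (-1)) := by
      refine tendsto_nhdsWithin_iff.2 ⟨?_, ?_⟩
      · rw [← hfa]; exact (hfc a haA).tendsto.comp (hrayA d₁ hr₁)
      · filter_upwards [self_mem_nhdsWithin] with t ht
        obtain ⟨k, hk, hk'⟩ := him d₁ t ht hd₁.ne
        show (f _).im < 0
        rw [hk']
        exact mul_neg_of_pos_of_neg hk hd₁
    have h2 := (Complex.tendsto_log_nhdsWithin_im_neg_of_re_neg_of_im_zero (z := -1) (by simp)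
      (by simp)).comp h1
    have h3 := ((hL a haA).tendsto.comp (hrayA d₁ hr₁)).sub h2
    have h4 := (Complex.continuous_im.tendsto _).comp h3
    simpa [Function.comp_def, hg] using h4
  have hlim3 : Tendsto (fun t : ℝ => (g (a + t * (e * d₃))).im) (𝓝[>] 0) (𝓝 ((L a).im - π)) := by
    have h1 : Tendsto (fun t : ℝ => f (a + t * (e * d₃))) (𝓝[>] 0) (𝓝[{z | 0 ≤ z.im}] (-1)) := by
      refine tendsto_nhdsWithin_iff.2 ⟨?_, ?_⟩
      · rw [← hfa]; exact (hfc a haA).tendsto.comp (hrayA d₃ hr₃)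
      · filter_upwards [self_mem_nhdsWithin] with t ht
        obtain ⟨k, hk, hk'⟩ := him d₃ t ht hd₃.ne'
        show 0 ≤ (f _).im
        rw [hk']
        exact (mul_pos hk hd₃).le
    have h2 := (Complex.tendsto_log_nhdsWithin_im_nonneg_of_re_neg_of_im_zero (z := -1) (by simp)
      (by simp)).comp h1
    have h3 := ((hL a haA).tendsto.comp (hrayA d₃ hr₃)).sub h2
    have h4 := (Complex.continuous_im.tendsto _).comp h3
    simpa [Function.comp_def, hg] using h4
  have heq : (fun t : ℝ => (g (a + t * (e * d₁))).im) =ᶠ[𝓝[>] 0]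
      fun t : ℝ => (g (a + t * (e * d₃))).im := by
    filter_upwards [self_mem_nhdsWithin, hr₁, hr₃] with t ht h1 h3
    exact hconst _ ⟨h1, hane d₁ t ht hd₁.ne⟩ _ ⟨h3, hane d₃ t ht hd₃.ne'⟩
  have := tendsto_nhds_unique (hlim1.congr' heq) hlim3
  linarith [Real.pi_pos]

end Crossing

section TwoZeros

open Filter Topology

variable {U V w : ℂ → ℝ} {D E : Set ℂ}

/-- Two rays from a point `a` which start in a connected open set can be joined within it. -/
lemma exists_closed_joining_rays {a c₁ c₃ : ℂ} (hDo : IsOpen D) (hDc : IsPreconnected D) (ha : a ∉ D)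
    (h₁ : ∀ᶠ t : ℝ in 𝓝[>] 0, a + t * c₁ ∈ D) (h₃ : ∀ᶠ t : ℝ in 𝓝[>] 0, a + t * c₃ ∈ D) :
    ∃ A, IsClosed A ∧ a ∈ A ∧ A ⊆ insert a D ∧ IsPreconnected (A \ {a}) ∧
      (∀ᶠ t : ℝ in 𝓝[>] 0, a + t * c₁ ∈ A) ∧ ∀ᶠ t : ℝ in 𝓝[>] 0, a + t * c₃ ∈ A := by
  obtain ⟨δ, hδ, hδ'⟩ := mem_nhdsGT_iff_exists_Ioc_subset.1 (h₁.and h₃)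
  have hδ : (0 : ℝ) < δ := hδ
  have hm₁ : ∀ t ∈ Set.Ioc 0 δ, a + (t : ℂ) * c₁ ∈ D := fun t ht => (hδ' ht).1
  have hm₃ : ∀ t ∈ Set.Ioc 0 δ, a + (t : ℂ) * c₃ ∈ D := fun t ht => (hδ' ht).2
  have hend : δ ∈ Set.Ioc 0 δ := ⟨hδ, le_rfl⟩
  have hpath := (hDo.isConnected_iff_isPathConnected.1 ⟨⟨_, hm₁ δ hend⟩, hDc⟩).joinedIn _ (hm₁ δ hend)
    _ (hm₃ δ hend)
  obtain ⟨γ, hγ⟩ := hpath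
  set T : ℂ → Set ℂ := fun c => (fun t : ℝ => a + t * c) '' Set.Ioc 0 δ with hT
  have hTcl : ∀ c, insert a (T c) = (fun t : ℝ => a + t * c) '' Set.Icc 0 δ := by
    intro c
    rw [← Set.Ioc_insert_left hδ.le, Set.image_insert_eq]
    simp [hT]
  have hcont : ∀ c : ℂ, Continuous fun t : ℝ => a + t * c := fun c => by fun_prop
  have hTc : ∀ c, IsPreconnected (T c) := fun c =>
    isPreconnected_Ioc.image _ (hcont c).continuousOn
  have hB : Set.range γ ∪ T c₁ ∪ T c₃ ⊆ D := by
    refine Set.union_subset (Set.union_subset (Set.range_subset_iff.2 hγ) ?_) ?_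
    · rintro _ ⟨t, ht, rfl⟩; exact hm₁ t ht
    · rintro _ ⟨t, ht, rfl⟩; exact hm₃ t ht
  refine ⟨insert a (Set.range γ ∪ T c₁ ∪ T c₃), ?_, Set.mem_insert _ _, Set.insert_subset_insert hB,
    ?_, ?_, ?_⟩
  · have e : insert a (Set.range γ ∪ T c₁ ∪ T c₃) =
        Set.range γ ∪ insert a (T c₁) ∪ insert a (T c₃) := by
      ext z; simp only [Set.mem_insert_iff, Set.mem_union]; tauto
    rw [e, hTcl, hTcl]
    exact (((isCompact_range γ.continuous).union (isCompact_Icc.image (hcont c₁))).union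
      (isCompact_Icc.image (hcont c₃))).isClosed
  · rw [Set.insert_sdiff_self_of_notMem fun h => ha (hB h)]
    refine IsPreconnected.union (a + δ * c₃) (Or.inl ⟨1, γ.target⟩) ⟨δ, hend, rfl⟩ ?_ (hTc c₃)
    exact IsPreconnected.union (a + δ * c₁) ⟨0, γ.source⟩ ⟨δ, hend, rfl⟩
      (isPreconnected_range γ.continuous) (hTc c₁)
  all_goals
    filter_upwards [Ioc_mem_nhdsGT hδ] with t ht
  · exact Or.inr (Or.inl (Or.inr ⟨t, ht, rfl⟩))
  · exact Or.inr (Or.inr ⟨t, ht, rfl⟩)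

lemma exp_im_pos {θ : ℝ} (h0 : 0 < θ) (h1 : θ < π) : 0 < (Complex.exp (θ * Complex.I)).im := by
  rw [Complex.exp_ofReal_mul_I_im]
  exact sin_pos_of_pos_of_lt_pi h0 h1

/-- A domain of the upper half-plane which reaches the boundary point `a` along two rays cuts off a
domain which reaches `a` in between from all the other boundary points. -/
lemma false_of_crossing {a b θ₁ θ₂ θ₃ : ℝ} (hDo : IsOpen D) (hDc : IsPreconnected D)
    (hEc : IsPreconnected E) (hD : D ⊆ upper) (hE : E ⊆ upper) (hDE : Disjoint D E) (hab : b ≠ a)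
    (hb : (b : ℂ) ∈ closure E) (h0 : 0 < θ₁) (h12 : θ₁ < θ₂) (h23 : θ₂ < θ₃) (hπ : θ₃ < π)
    (hr₁ : ∀ᶠ t : ℝ in 𝓝[>] 0, a + t * Complex.exp (θ₁ * Complex.I) ∈ D)
    (hr₂ : ∀ᶠ t : ℝ in 𝓝[>] 0, a + t * Complex.exp (θ₂ * Complex.I) ∈ E)
    (hr₃ : ∀ᶠ t : ℝ in 𝓝[>] 0, a + t * Complex.exp (θ₃ * Complex.I) ∈ D) : False := by
  have hreal : ∀ x : ℝ, (x : ℂ) ∉ upper := fun x hx => by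
    have : 0 < (x : ℂ).im := hx
    simp at this
  obtain ⟨A, hA, haA, hAD, hAc, hA₁, hA₃⟩ := exists_closed_joining_rays hDo hDc
    (fun h => hreal a (hD h)) hr₁ hr₃
  set e := Complex.exp (θ₂ * Complex.I) with he
  have heim : 0 < e.im := exp_im_pos (h0.trans h12) (h23.trans hπ)
  obtain ⟨ε, hε, hε'⟩ := mem_nhdsGT_iff_exists_Ioc_subset.1 hr₂
  have hε : (0 : ℝ) < ε := hε
  have hεE : ∀ t ∈ Set.Ioc 0 ε, (a : ℂ) + t * e ∈ E := fun t ht => hε' ht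
  set W : Set ℂ := insert (b : ℂ) E ∪ insert (b : ℂ) {z | z.im < 0} with hW
  have hbl : (b : ℂ) ∈ closure {z : ℂ | z.im < 0} := by
    rw [Complex.closure_setOfPred_im_lt]
    show (b : ℂ).im ≤ 0
    simp
  have hWc : IsPreconnected W :=
    IsPreconnected.union (b : ℂ) (Set.mem_insert _ _) (Set.mem_insert _ _)
      (hEc.subset_closure (Set.subset_insert _ _) (Set.insert_subset hb subset_closure))
      ((convex_halfSpace_im_lt 0).isPreconnected.subset_closure (Set.subset_insert _ _)
        (Set.insert_subset hbl subset_closure))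
  have hbA : (b : ℂ) ∉ A := fun h => by
    rcases hAD h with h | h
    · exact hab (by exact_mod_cast h)
    · exact hreal b (hD h)
  have hWA : Disjoint W A := by
    rw [Set.disjoint_left]
    rintro z ((rfl | hz) | (rfl | hz)) hzA
    · exact hbA hzA
    · rcases hAD hzA with rfl | h
      · exact hreal a (hE hz)
      · exact Set.disjoint_left.1 hDE h hz
    · exact hbA hzA
    · have hz : z.im < 0 := hz
      rcases hAD hzA with rfl | h
      · simp at hz
      · exact lt_asymm hz (hD h)
  have hdir : ∀ θ : ℝ, e * Complex.exp (((θ - θ₂ : ℝ) : ℂ) * Complex.I) =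
      Complex.exp (θ * Complex.I) := by
    intro θ
    rw [he, ← Complex.exp_add]
    push_cast
    ring_nf
  refine segment_separated (W := W) (e := e) (ε := ε)
    (d₁ := Complex.exp (((θ₁ - θ₂ : ℝ) : ℂ) * Complex.I))
    (d₃ := Complex.exp (((θ₃ - θ₂ : ℝ) : ℂ) * Complex.I)) hA haA hAc hWc hWA
    (Complex.exp_ne_zero _) hε (Or.inl (Or.inr (hεE ε ⟨hε, le_rfl⟩))) (Or.inr (Or.inr ?_)) ?_ ?_ ?_ ?_ ?_
  · show ((a : ℂ) - ε * e).im < 0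
    simp only [Complex.sub_im, Complex.ofReal_im, Complex.im_ofReal_mul, zero_sub,
      Left.neg_neg_iff]
    positivity
  · intro z hz t ht hzt
    by_contra h
    rcases lt_or_gt_of_ne h with h | h
    · rcases hAD hz with h' | h'
      · rw [h', left_eq_add, mul_eq_zero] at hzt
        rcases hzt with hzt | hzt
        · exact h.ne (by exact_mod_cast hzt)
        · exact Complex.exp_ne_zero _ hzt
      · have h2 : 0 < z.im := hD h'
        rw [hzt] at h2
        simp only [Complex.add_im, Complex.ofReal_im, Complex.im_ofReal_mul, zero_add] at h2
        nlinarith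
    · refine Set.disjoint_left.1 hWA (Or.inl (Or.inr ?_)) hz
      rw [hzt]
      exact hεE t ⟨h, (le_abs_self t).trans ht⟩
  · rw [Complex.exp_ofReal_mul_I_im]
    exact sin_neg_of_neg_of_neg_pi_lt (by linarith) (by linarith)
  · exact exp_im_pos (by linarith) (by linarith)
  · simpa only [hdir] using hA₁
  · simpa only [hdir] using hA₃

lemma mem_closure_of_ray {a : ℝ} {c : ℂ} (h : ∀ᶠ t : ℝ in 𝓝[>] 0, a + t * c ∈ D) :
    (a : ℂ) ∈ closure D := by
  have : Tendsto (fun t : ℝ => (a : ℂ) + t * c) (𝓝 0) (𝓝 ((a : ℂ) + (0 : ℝ) * c)) :=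
    Continuous.tendsto (by fun_prop) 0
  rw [Complex.ofReal_zero, zero_mul, add_zero] at this
  exact mem_closure_of_tendsto (this.mono_left nhdsWithin_le_nhds) h

lemma exists_nodal_of_ray {a θ : ℝ} (h0 : 0 < θ) (hπ : θ < π)
    (h : ∀ᶠ t : ℝ in 𝓝[>] 0, w (a + t * Complex.exp (θ * Complex.I)) ≠ 0) :
    ∃ D ∈ nodal w, ∀ᶠ t : ℝ in 𝓝[>] 0, a + t * Complex.exp (θ * Complex.I) ∈ D := by
  obtain ⟨δ, hδ, hδ'⟩ := mem_nhdsGT_iff_exists_Ioc_subset.1 h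
  have hδ : (0 : ℝ) < δ := hδ
  set e := Complex.exp (θ * Complex.I) with he
  have heim : 0 < e.im := exp_im_pos h0 hπ
  set T : Set ℂ := (fun t : ℝ => (a : ℂ) + t * e) '' Set.Ioc 0 δ with hT
  have hTs : T ⊆ nodalComplement w := by
    rintro _ ⟨t, ht, rfl⟩
    refine ⟨?_, hδ' ht⟩
    show 0 < ((a : ℂ) + t * e).im
    simp only [Complex.add_im, Complex.ofReal_im, Complex.im_ofReal_mul, zero_add]
    exact mul_pos ht.1 heim
  have hTc : IsPreconnected T := isPreconnected_Ioc.image _ (Continuous.continuousOn (by fun_prop))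
  have hmem : (a : ℂ) + δ * e ∈ T := ⟨δ, ⟨hδ, le_rfl⟩, rfl⟩
  obtain ⟨D, hD, hx⟩ := exists_nodal (hTs hmem)
  refine ⟨D, hD, ?_⟩
  filter_upwards [Ioc_mem_nhdsGT hδ] with t ht
  exact subset_nodal hD hTc hTs ⟨_, hmem, hx⟩ ⟨t, ht, rfl⟩

lemma PlaneData.false_of_rays (h : PlaneData U V w) {a b θ₁ θ₂ θ₃ θ₄ : ℝ} (hab : b ≠ a)
    (h0 : 0 < θ₁) (h12 : θ₁ < θ₂) (h23 : θ₂ < θ₃) (hπ : θ₃ < π) (h4 : 0 < θ₄) (h4π : θ₄ < π)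
    (hr₁ : ∀ᶠ t : ℝ in 𝓝[>] 0, 0 < w (a + t * Complex.exp (θ₁ * Complex.I)))
    (hr₂ : ∀ᶠ t : ℝ in 𝓝[>] 0, w (a + t * Complex.exp (θ₂ * Complex.I)) < 0)
    (hr₃ : ∀ᶠ t : ℝ in 𝓝[>] 0, 0 < w (a + t * Complex.exp (θ₃ * Complex.I)))
    (hr₄ : ∀ᶠ t : ℝ in 𝓝[>] 0, w (b + t * Complex.exp (θ₄ * Complex.I)) < 0) : False := by
  have hw := h.smooth.continuous
  obtain ⟨D₁, hD₁, hD₁r⟩ := exists_nodal_of_ray h0 (h12.trans (h23.trans hπ)) (hr₁.mono fun t ht => ht.ne')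
  obtain ⟨D₂, hD₂, hD₂r⟩ := exists_nodal_of_ray (h0.trans h12) (h23.trans hπ) (hr₂.mono fun t ht => ht.ne)
  obtain ⟨D₃, hD₃, hD₃r⟩ := exists_nodal_of_ray (h0.trans (h12.trans h23)) hπ (hr₃.mono fun t ht => ht.ne')
  obtain ⟨D₄, hD₄, hD₄r⟩ := exists_nodal_of_ray h4 h4π (hr₄.mono fun t ht => ht.ne)
  have hs₁ : ∀ z ∈ D₁, 0 < w z := by
    obtain ⟨t, ht, ht'⟩ := (hD₁r.and hr₁).exists
    exact nodal_pos hw hD₁ ht ht'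
  have hs₃ : ∀ z ∈ D₃, 0 < w z := by
    obtain ⟨t, ht, ht'⟩ := (hD₃r.and hr₃).exists
    exact nodal_pos hw hD₃ ht ht'
  have hs₂ : ∀ z ∈ D₂, w z < 0 := by
    obtain ⟨t, ht, ht'⟩ := (hD₂r.and hr₂).exists
    exact nodal_neg_of_neg hw hD₂ ht ht'
  have hs₄ : ∀ z ∈ D₄, w z < 0 := by
    obtain ⟨t, ht, ht'⟩ := (hD₄r.and hr₄).exists
    exact nodal_neg_of_neg hw hD₄ ht ht'
  have hpn : ∀ D ∈ nodal w, ∀ E, (∀ z ∈ D, 0 < w z) → (∀ z ∈ E, w z < 0) → D ≠ E := by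
    rintro D hD E hp hn rfl
    obtain ⟨z, hz⟩ := nodal_nonempty hD
    exact lt_asymm (hp z hz) (hn z hz)
  have hc₁ := mem_closure_of_ray hD₁r
  have hc₂ := mem_closure_of_ray hD₂r
  have hc₃ := mem_closure_of_ray hD₃r
  have hc₄ := mem_closure_of_ray hD₄r
  have key : ∀ E ∈ nodal w, ∀ x : ℝ, (x : ℂ) ∈ closure E → D₁ ≠ E → D₂ ≠ E → False := by
    intro E hE x hx h1 h2
    refine h.not_three_nodal (D := ![D₁, D₂, E]) ?_ ?_ ?_
    · intro i; fin_cases i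
      exacts [hD₁, hD₂, hE]
    · have h12 := hpn D₁ hD₁ D₂ hs₁ hs₂
      intro i j hij
      fin_cases i <;> fin_cases j <;> first | exact absurd rfl hij | skip
      exacts [h12, h1, h12.symm, h2, h1.symm, h2.symm]
    · intro i; fin_cases i
      exacts [⟨a, hc₁, Complex.ofReal_im a⟩, ⟨a, hc₂, Complex.ofReal_im a⟩, ⟨x, hx, Complex.ofReal_im x⟩]
  by_cases h13 : D₁ = D₃
  · refine key D₄ hD₄ b hc₄ (hpn D₁ hD₁ D₄ hs₁ hs₄) ?_
    intro h24
    rw [← h24] at hc₄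
    rw [← h13] at hD₃r
    exact false_of_crossing (nodal_isOpen hw hD₁) (nodal_isPreconnected hD₁) (nodal_isPreconnected hD₂)
      (nodal_subset_upper hD₁) (nodal_subset_upper hD₂)
      ((nodal_eq_or_disjoint hD₁ hD₂).resolve_left (hpn D₁ hD₁ D₂ hs₁ hs₂)) hab hc₄ h0 h12 h23 hπ
      hD₁r hD₂r hD₃r
  · exact key D₃ hD₃ a hc₃ h13 (hpn D₃ hD₃ D₂ hs₃ hs₂).symm

/-- `w` cannot vanish to third order at a boundary point and to second order at another one. -/
theorem PlaneData.false_of_van (h : PlaneData U V w) {a b : ℝ} (hab : b ≠ a) (ha : Van 3 w a)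
    (hb : Van 2 w b) : False := by
  obtain ⟨N, hN, β, hβ, hr⟩ := exists_alternating_rays h.smoothV h.smooth h.ne h.eqn' h.odd ha (by norm_num)
  obtain ⟨M, hM, γ, hγ, hs⟩ := exists_alternating_rays h.smoothV h.smooth h.ne h.eqn' h.odd hb (by norm_num)
  have hN' : (3 : ℝ) ≤ N := by exact_mod_cast hN
  have hM' : (2 : ℝ) ≤ M := by exact_mod_cast hM
  have hπ := Real.pi_pos
  have e : ∀ K c : ℝ, 0 < K → K * (c * π / (2 * K)) = c * π / 2 := by
    intro K c hK; field_simp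
  have s1 : ∀ K : ℝ, 0 < K → sin (K * (1 * π / (2 * K))) = 1 := by
    intro K hK; rw [e K 1 hK, one_mul, sin_pi_div_two]
  have s3 : ∀ K : ℝ, 0 < K → sin (K * (3 * π / (2 * K))) = -1 := by
    intro K hK
    rw [e K 3 hK, show 3 * π / 2 = π / 2 + π by ring, sin_add_pi, sin_pi_div_two]
  have s5 : ∀ K : ℝ, 0 < K → sin (K * (5 * π / (2 * K))) = 1 := by
    intro K hK
    rw [e K 5 hK, show 5 * π / 2 = π / 2 + 2 * π by ring, sin_add_two_pi, sin_pi_div_two]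
  have hN0 : (0 : ℝ) < N := by linarith
  have hM0 : (0 : ℝ) < M := by linarith
  have i0 : 0 < 1 * π / (2 * N) := by positivity
  have i1 : 1 * π / (2 * N) < 3 * π / (2 * N) := by gcongr; norm_num
  have i3 : 3 * π / (2 * N) < 5 * π / (2 * N) := by gcongr; norm_num
  have i5 : 5 * π / (2 * N) < π := by
    rw [div_lt_iff₀ (by positivity)]; nlinarith
  have j0 : 0 < 1 * π / (2 * M) := by positivity
  have j1 : 0 < 3 * π / (2 * M) := by positivity
  have j2 : 1 * π / (2 * M) < π := by
    rw [div_lt_iff₀ (by positivity)]; nlinarith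
  have j3 : 3 * π / (2 * M) < π := by
    rw [div_lt_iff₀ (by positivity)]; nlinarith
  have hneg : ∀ {x θ : ℝ}, (∀ᶠ t : ℝ in 𝓝[>] 0, 0 < w (x + t * Complex.exp (θ * Complex.I))) →
      ∀ᶠ t : ℝ in 𝓝[>] 0, (-w) (x + t * Complex.exp (θ * Complex.I)) < 0 :=
    fun h => h.mono fun t ht => by simpa using ht
  have hpos : ∀ {x θ : ℝ}, (∀ᶠ t : ℝ in 𝓝[>] 0, w (x + t * Complex.exp (θ * Complex.I)) < 0) →
      ∀ᶠ t : ℝ in 𝓝[>] 0, 0 < (-w) (x + t * Complex.exp (θ * Complex.I)) :=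
    fun h => h.mono fun t ht => by simpa using ht
  rcases lt_or_gt_of_ne hβ with hβ | hβ
  · have r1 := hpos ((hr (1 * π / (2 * N))).2 (by rw [s1 N hN0]; linarith))
    have r3 := hneg ((hr (3 * π / (2 * N))).1 (by rw [s3 N hN0]; linarith))
    have r5 := hpos ((hr (5 * π / (2 * N))).2 (by rw [s5 N hN0]; linarith))
    rcases lt_or_gt_of_ne hγ with hγ | hγ
    · exact h.swap.false_of_rays hab i0 i1 i3 i5 j1 j3 r1 r3 r5
        (hneg ((hs (3 * π / (2 * M))).1 (by rw [s3 M hM0]; linarith)))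
    · exact h.swap.false_of_rays hab i0 i1 i3 i5 j0 j2 r1 r3 r5
        (hneg ((hs (1 * π / (2 * M))).1 (by rw [s1 M hM0]; linarith)))
  · have r1 := (hr (1 * π / (2 * N))).1 (by rw [s1 N hN0]; linarith)
    have r3 := (hr (3 * π / (2 * N))).2 (by rw [s3 N hN0]; linarith)
    have r5 := (hr (5 * π / (2 * N))).1 (by rw [s5 N hN0]; linarith)
    rcases lt_or_gt_of_ne hγ with hγ | hγ
    · exact h.false_of_rays hab i0 i1 i3 i5 j0 j2 r1 r3 r5
        ((hs (1 * π / (2 * M))).2 (by rw [s1 M hM0]; linarith))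
    · exact h.false_of_rays hab i0 i1 i3 i5 j1 j3 r1 r3 r5
        ((hs (3 * π / (2 * M))).2 (by rw [s3 M hM0]; linarith))

end TwoZeros

section Homogeneous

open Filter Topology

variable {u : E3 → ℝ} {X v : E3}

lemma contDiffAt_of_contDiffOn_compl (hs : ContDiffOn ℝ ∞ u {0}ᶜ) (hX : X ≠ 0) :
    ContDiffAt ℝ ∞ u X :=
  hs.contDiffAt (isOpen_compl_singleton.mem_nhds hX)

lemma differentiableAt_fderiv (hs : ContDiffOn ℝ ∞ u {0}ᶜ) (hX : X ≠ 0) :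
    DifferentiableAt ℝ (fderiv ℝ u) X :=
  ((contDiffAt_of_contDiffOn_compl hs hX).fderiv_right (m := ∞) (by simp)).differentiableAt
    (by simp)

lemma fderiv_apply_self (hs : ContDiffOn ℝ ∞ u {0}ᶜ) (hh : Hom0 u) (hX : X ≠ 0) :
    fderiv ℝ u X X = 0 := by
  have h1 : HasDerivAt (fun t : ℝ => t • X) X 1 := by
    simpa using (hasDerivAt_id (1 : ℝ)).smul_const X
  have h2 : HasFDerivAt u (fderiv ℝ u X) ((1 : ℝ) • X) := by
    rw [one_smul]
    exact ((contDiffAt_of_contDiffOn_compl hs hX).differentiableAt (by simp)).hasFDerivAt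
  have h3 := h2.comp_hasDerivAt (1 : ℝ) h1
  have h4 : u ∘ (fun t : ℝ => t • X) =ᶠ[𝓝 1] fun _ => u X := by
    filter_upwards [lt_mem_nhds (zero_lt_one (α := ℝ))] with t ht using hh X t ht
  exact h3.unique ((hasDerivAt_const _ _).congr_of_eventuallyEq h4)

lemma fderiv_fderiv_apply_self (hs : ContDiffOn ℝ ∞ u {0}ᶜ) (hh : Hom0 u) (hX : X ≠ 0) (v : E3) :
    fderiv ℝ (fderiv ℝ u) X v X = -fderiv ℝ u X v := by
  have h1 := (differentiableAt_fderiv hs hX).hasFDerivAt.clm_apply (hasFDerivAt_id X)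
  have h2 : (fun Y => fderiv ℝ u Y (id Y)) =ᶠ[𝓝 X] fun _ => 0 := by
    filter_upwards [isOpen_compl_singleton.mem_nhds hX] with Y hY using fderiv_apply_self hs hh hY
  have h3 := h1.unique ((hasFDerivAt_const (0 : ℝ) X).congr_of_eventuallyEq h2)
  have h4 := congrArg (fun L : E3 →L[ℝ] ℝ => L v) h3
  simp at h4
  linarith

lemma fderiv_fderiv_symm (hs : ContDiffOn ℝ ∞ u {0}ᶜ) (hX : X ≠ 0) (v v' : E3) :
    fderiv ℝ (fderiv ℝ u) X v v' = fderiv ℝ (fderiv ℝ u) X v' v :=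
  (contDiffAt_of_contDiffOn_compl hs hX).isSymmSndFDerivAt
    (by simpa using WithTop.coe_le_coe.2 (le_top : (2 : ℕ∞) ≤ ⊤)) v v'

lemma lap_eq_sum (b : Fin 3 → E3) (hb : Orthonormal ℝ b) (X : E3) :
    lap u X = ∑ i, fderiv ℝ (fderiv ℝ u) X (b i) (b i) := by
  have h0 := InnerProductSpace.laplacian_eq_iteratedFDeriv_orthonormalBasis u
    (EuclideanSpace.basisFun (Fin 3) ℝ)
  have h1 := InnerProductSpace.laplacian_eq_iteratedFDeriv_orthonormalBasis u
    (OrthonormalBasis.mk hb (by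
      rw [hb.linearIndependent.span_eq_top_of_card_eq_finrank (by simp)]))
  have h2 := congrFun (h0.symm.trans h1) X
  simp only [EuclideanSpace.basisFun_apply, OrthonormalBasis.coe_mk] at h2
  rw [lap, h2]
  simp [iteratedFDeriv_two_apply]

lemma fderiv_smul_eq (hh : Hom0 u) {r : ℝ} (hr : 0 < r) (X : E3) :
    fderiv ℝ u X = r • fderiv ℝ u (r • X) := by
  rw [← fderiv_comp_smul]
  congr 1
  ext Y
  exact (hh Y r hr).symm

lemma fderiv_fderiv_smul_eq (hh : Hom0 u) {r : ℝ} (hr : 0 < r) (X : E3) :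
    fderiv ℝ (fderiv ℝ u) X = (r ^ 2) • fderiv ℝ (fderiv ℝ u) (r • X) := by
  have h2 : fderiv ℝ u = r • fun X => fderiv ℝ u (r • X) :=
    funext fun X => fderiv_smul_eq hh hr X
  have h3 : fderiv ℝ (fderiv ℝ u) X = r • fderiv ℝ (fun X => fderiv ℝ u (r • X)) X := by
    conv_lhs => rw [h2]
    exact congrFun (fderiv_const_smul_field (𝕜 := ℝ) (f := fun X => fderiv ℝ u (r • X)) r) X
  rw [h3, fderiv_comp_smul, smul_smul, sq]

lemma lap_smul (hh : Hom0 u) {r : ℝ} (hr : 0 < r) (X : E3) :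
    lap u X = r ^ 2 * lap u (r • X) := by
  have hb := (EuclideanSpace.basisFun (Fin 3) ℝ).orthonormal
  rw [lap_eq_sum _ hb, lap_eq_sum _ hb, fderiv_fderiv_smul_eq hh hr, Finset.mul_sum]
  simp

end Homogeneous

section Stereographic

open Filter Topology

/-- An orthonormal frame of `ℝ³`. -/
structure Frame (q y e : E3) : Prop where
  qq : ⟪q, q⟫ = 1
  yy : ⟪y, y⟫ = 1
  ee : ⟪e, e⟫ = 1
  qy : ⟪q, y⟫ = 0
  qe : ⟪q, e⟫ = 0
  ye : ⟪y, e⟫ = 0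

/-- Inverse stereographic projection from `e`, up to a positive factor. -/
def stereo (q y e : E3) (z : ℂ) : E3 :=
  (2 * z.re) • q + (2 * z.im) • y + (z.re ^ 2 + z.im ^ 2 - 1) • e

/-- The norm of the unnormalised inverse stereographic projection. -/
def conf (z : ℂ) : ℝ := 1 + (z.re ^ 2 + z.im ^ 2)

variable {q y e : E3} {u : E3 → ℝ}

lemma conf_pos (z : ℂ) : 0 < conf z := by rw [conf]; positivity

lemma conf_eq (z : ℂ) : conf z = 1 + ‖z‖ ^ 2 := by
  rw [conf, ← Complex.normSq_eq_norm_sq, Complex.normSq_apply]; ring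

lemma Frame.inner_comb (h : Frame q y e) (a b c a' b' c' : ℝ) :
    ⟪a • q + b • y + c • e, a' • q + b' • y + c' • e⟫ = a * a' + b * b' + c * c' := by
  have h1 : ⟪y, q⟫ = 0 := by rw [real_inner_comm]; exact h.qy
  have h2 : ⟪e, q⟫ = 0 := by rw [real_inner_comm]; exact h.qe
  have h3 : ⟪e, y⟫ = 0 := by rw [real_inner_comm]; exact h.ye
  simp only [inner_add_left, inner_add_right, real_inner_smul_left, real_inner_smul_right, h.qq,
    h.yy, h.ee, h.qy, h.qe, h.ye, h1, h2, h3]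
  ring

lemma Frame.inner_stereo (h : Frame q y e) (z : ℂ) :
    ⟪stereo q y e z, stereo q y e z⟫ = conf z ^ 2 := by
  rw [stereo, h.inner_comb, conf]; ring

lemma Frame.norm_stereo (h : Frame q y e) (z : ℂ) : ‖stereo q y e z‖ = conf z := by
  have := h.inner_stereo z
  rw [real_inner_self_eq_norm_sq] at this
  exact (pow_left_inj₀ (norm_nonneg _) (conf_pos z).le two_ne_zero).1 this

lemma Frame.stereo_ne_zero (h : Frame q y e) (z : ℂ) : stereo q y e z ≠ 0 := by
  rw [← norm_pos_iff, h.norm_stereo]; exact conf_pos z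

lemma hasFDerivAt_stereo (q y e : E3) (z : ℂ) : HasFDerivAt (stereo q y e)
    (((2 : ℝ) • Complex.reCLM).smulRight q + ((2 : ℝ) • Complex.imCLM).smulRight y +
      ((2 * z.re) • Complex.reCLM + (2 * z.im) • Complex.imCLM).smulRight e) z := by
  have h1 := Complex.reCLM.hasFDerivAt (x := z)
  have h2 := Complex.imCLM.hasFDerivAt (x := z)
  have h3 := (((h1.const_mul 2).smul_const q).add ((h2.const_mul 2).smul_const y)).add
    (((h1.pow 2).add (h2.pow 2)).sub_const 1 |>.smul_const e)
  refine (h3.congr_fderiv ?_)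
  ext
  all_goals simp

lemma contDiff_stereo (q y e : E3) : ContDiff ℝ ∞ (stereo q y e) := by
  have h1 : ContDiff ℝ ∞ fun z : ℂ => z.re := Complex.reCLM.contDiff
  have h2 : ContDiff ℝ ∞ fun z : ℂ => z.im := Complex.imCLM.contDiff
  unfold stereo
  fun_prop

lemma contDiff_comp_stereo (hF : Frame q y e) (hs : ContDiffOn ℝ ∞ u {0}ᶜ) :
    ContDiff ℝ ∞ fun z => u (stereo q y e z) :=
  contDiff_iff_contDiffAt.2 fun z =>
    (contDiffAt_of_contDiffOn_compl hs (hF.stereo_ne_zero z)).comp z (contDiff_stereo q y e).contDiffAt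

lemma px_comp_stereo (hF : Frame q y e) (hs : ContDiffOn ℝ ∞ u {0}ᶜ) :
    px (fun z => u (stereo q y e z)) =
      fun z => fderiv ℝ u (stereo q y e z) ((2 : ℝ) • q + (2 * z.re) • e) := by
  ext z
  have h := ((contDiffAt_of_contDiffOn_compl hs (hF.stereo_ne_zero z)).differentiableAt
    (by simp)).hasFDerivAt.comp z (hasFDerivAt_stereo q y e z)
  rw [px, show (fun z => u (stereo q y e z)) = u ∘ stereo q y e from rfl, h.fderiv]
  simp

lemma py_comp_stereo (hF : Frame q y e) (hs : ContDiffOn ℝ ∞ u {0}ᶜ) :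
    py (fun z => u (stereo q y e z)) =
      fun z => fderiv ℝ u (stereo q y e z) ((2 : ℝ) • y + (2 * z.im) • e) := by
  ext z
  have h := ((contDiffAt_of_contDiffOn_compl hs (hF.stereo_ne_zero z)).differentiableAt
    (by simp)).hasFDerivAt.comp z (hasFDerivAt_stereo q y e z)
  rw [py, show (fun z => u (stereo q y e z)) = u ∘ stereo q y e from rfl, h.fderiv]
  simp

lemma px_px_comp_stereo (hF : Frame q y e) (hs : ContDiffOn ℝ ∞ u {0}ᶜ) (z : ℂ) :
    px (px fun z => u (stereo q y e z)) z =
      fderiv ℝ (fderiv ℝ u) (stereo q y e z) ((2 : ℝ) • q + (2 * z.re) • e)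
        ((2 : ℝ) • q + (2 * z.re) • e) + 2 * fderiv ℝ u (stereo q y e z) e := by
  rw [px_comp_stereo hF hs]
  have h := ((differentiableAt_fderiv hs (hF.stereo_ne_zero z)).hasFDerivAt.comp z
    (hasFDerivAt_stereo q y e z)).clm_apply
    (((Complex.reCLM.hasFDerivAt (x := z)).const_mul 2).smul_const e |>.const_add ((2 : ℝ) • q))
  rw [px]
  refine (congrArg (fun L : ℂ →L[ℝ] ℝ => L 1) h.fderiv).trans ?_
  simp
  ring

lemma px_py_comp_stereo (hF : Frame q y e) (hs : ContDiffOn ℝ ∞ u {0}ᶜ) (z : ℂ) :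
    px (py fun z => u (stereo q y e z)) z =
      fderiv ℝ (fderiv ℝ u) (stereo q y e z) ((2 : ℝ) • q + (2 * z.re) • e)
        ((2 : ℝ) • y + (2 * z.im) • e) := by
  rw [py_comp_stereo hF hs]
  have h := ((differentiableAt_fderiv hs (hF.stereo_ne_zero z)).hasFDerivAt.comp z
    (hasFDerivAt_stereo q y e z)).clm_apply
    (((Complex.imCLM.hasFDerivAt (x := z)).const_mul 2).smul_const e |>.const_add ((2 : ℝ) • y))
  rw [px]
  refine (congrArg (fun L : ℂ →L[ℝ] ℝ => L 1) h.fderiv).trans ?_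
  simp
  ring

lemma py_py_comp_stereo (hF : Frame q y e) (hs : ContDiffOn ℝ ∞ u {0}ᶜ) (z : ℂ) :
    py (py fun z => u (stereo q y e z)) z =
      fderiv ℝ (fderiv ℝ u) (stereo q y e z) ((2 : ℝ) • y + (2 * z.im) • e)
        ((2 : ℝ) • y + (2 * z.im) • e) + 2 * fderiv ℝ u (stereo q y e z) e := by
  rw [py_comp_stereo hF hs]
  have h := ((differentiableAt_fderiv hs (hF.stereo_ne_zero z)).hasFDerivAt.comp z
    (hasFDerivAt_stereo q y e z)).clm_apply
    (((Complex.imCLM.hasFDerivAt (x := z)).const_mul 2).smul_const e |>.const_add ((2 : ℝ) • y))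
  rw [py]
  refine (congrArg (fun L : ℂ →L[ℝ] ℝ => L Complex.I) h.fderiv).trans ?_
  simp
  ring

/-- Stereographic projection is conformal. -/
lemma plap_comp_stereo (hF : Frame q y e) (hs : ContDiffOn ℝ ∞ u {0}ᶜ) (hh : Hom0 u) (z : ℂ) :
    plap (fun z => u (stereo q y e z)) z = 4 * lap u (stereo q y e z) := by
  rw [plap, px_px_comp_stereo hF hs, py_py_comp_stereo hF hs]
  set X := stereo q y e z with hX
  set a := (2 : ℝ) • q + (2 * z.re) • e with ha
  set c := (2 : ℝ) • y + (2 * z.im) • e with hc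
  set s := conf z with hsz
  have hs0 : 0 < s := conf_pos z
  have hX0 : X ≠ 0 := hF.stereo_ne_zero z
  have hself := fun v => fderiv_fderiv_apply_self hs hh hX0 v
  have hself' : ∀ v, fderiv ℝ (fderiv ℝ u) X X v = -fderiv ℝ u X v := fun v => by
    rw [fderiv_fderiv_symm hs hX0, hself]
  have h0 := fderiv_apply_self hs hh hX0
  have ha' : a = (2 : ℝ) • q + (0 : ℝ) • y + (2 * z.re) • e := by rw [ha]; simp
  have hc' : c = (0 : ℝ) • q + (2 : ℝ) • y + (2 * z.im) • e := by rw [hc]; simp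
  have hX' : X = (2 * z.re) • q + (2 * z.im) • y + (z.re ^ 2 + z.im ^ 2 - 1) • e := rfl
  have hse : s = 1 + (z.re ^ 2 + z.im ^ 2) := rfl
  have iXX : ⟪X, X⟫ = s ^ 2 := hF.inner_stereo z
  have iaa : ⟪a, a⟫ = 4 + 4 * z.re ^ 2 := by rw [ha', hF.inner_comb]; ring
  have icc : ⟪c, c⟫ = 4 + 4 * z.im ^ 2 := by rw [hc', hF.inner_comb]; ring
  have iac : ⟪a, c⟫ = 4 * z.re * z.im := by rw [ha', hc', hF.inner_comb]; ring
  have iaX : ⟪a, X⟫ = 2 * z.re * s := by rw [ha', hX', hF.inner_comb, hse]; ring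
  have icX : ⟪c, X⟫ = 2 * z.im * s := by rw [hc', hX', hF.inner_comb, hse]; ring
  have iXa : ⟪X, a⟫ = 2 * z.re * s := by rw [real_inner_comm, iaX]
  have iXc : ⟪X, c⟫ = 2 * z.im * s := by rw [real_inner_comm, icX]
  have ica : ⟪c, a⟫ = 4 * z.re * z.im := by rw [real_inner_comm, iac]
  set f₁ := (1 / 2 : ℝ) • (a - (2 * z.re / s) • X) with hf₁
  set f₂ := (1 / 2 : ℝ) • (c - (2 * z.im / s) • X) with hf₂
  set f₃ := s⁻¹ • X with hf₃
  have hb : Orthonormal ℝ ![f₁, f₂, f₃] := by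
    rw [orthonormal_iff_ite]
    intro i j
    fin_cases i <;> fin_cases j
    all_goals
      simp only [hf₁, hf₂, hf₃, inner_sub_left, inner_sub_right, real_inner_smul_left,
        real_inner_smul_right, iXX, iaa, icc, iac, iaX, icX, iXa, iXc, ica, Fin.zero_eta,
        Fin.mk_one, Fin.reduceFinMk, Matrix.cons_val, if_true, Fin.isValue, Fin.reduceEq, if_false,
        Matrix.cons_val_zero, Matrix.cons_val_one, zero_ne_one, one_ne_zero]
      field_simp
      try rw [hse]
      try ring
  rw [lap_eq_sum _ hb, Fin.sum_univ_three]
  have key : z.re • a + z.im • c = X + s • e := by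
    rw [ha, hc, hX', hse]; module
  have key' : z.re * fderiv ℝ u X a + z.im * fderiv ℝ u X c = s * fderiv ℝ u X e := by
    have := congrArg (fderiv ℝ u X) key
    simp only [map_add, map_smul, smul_eq_mul, h0, zero_add] at this
    exact this
  simp only [Matrix.cons_val_zero, Matrix.cons_val_one, Matrix.cons_val, hf₁, hf₂, hf₃, map_smul,
    map_sub, sub_apply, smul_apply, smul_eq_mul, hself, hself', h0]
  field_simp
  linear_combination -16 * s * key'

end Stereographic

section IntegralLaplacian

open Filter Topology

lemma plap_comp_smul {f : ℂ → ℝ} (hf : ContDiff ℝ ∞ f) (t : ℝ) :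
    plap (fun z => f (t • z)) = fun z => t ^ 2 * plap f (t • z) := by
  have hpx : ∀ g : ℂ → ℝ, px (fun z => g (t • z)) = fun z => t * px g (t • z) := fun g => by
    ext z
    rw [px, fderiv_comp_smul]
    rfl
  have hpy : ∀ g : ℂ → ℝ, py (fun z => g (t • z)) = fun z => t * py g (t • z) := fun g => by
    ext z
    rw [py, fderiv_comp_smul]
    rfl
  have hs : ContDiff ℝ ∞ fun z : ℂ => t • z := contDiff_const_smul t
  have e1 : (fun z => t * px f (t • z)) = (fun _ => t) * fun z => px f (t • z) := rfl
  have e2 : (fun z => t * py f (t • z)) = (fun _ => t) * fun z => py f (t • z) := rfl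
  have s1 : ContDiff ℝ ∞ fun z => px f (t • z) := (contDiff_px hf).comp hs
  have s2 : ContDiff ℝ ∞ fun z => py f (t • z) := (contDiff_py hf).comp hs
  ext z
  rw [plap, hpx, hpy, e1, e2, px_mul contDiff_const s1, py_mul contDiff_const s2, hpx, hpy, plap]
  simp only [px_const, py_const, Pi.add_apply, Pi.mul_apply, Pi.zero_apply]
  ring

/-- The integral of the Laplacian of a function with a limit at infinity vanishes. -/
lemma integral_plap_eq_zero {f : ℂ → ℝ} {c : ℝ} (hf : ContDiff ℝ ∞ f) (hi : Integrable (plap f))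
    (hlim : Tendsto f (cocompact ℂ) (𝓝 c)) : ∫ z, plap f z = 0 := by
  set g : ℂ → ℝ := f - fun _ => c with hg
  have hgs : ContDiff ℝ ∞ g := hf.sub contDiff_const
  have hpl : plap g = plap f := by rw [hg, plap_sub hf contDiff_const, plap_const, sub_zero]
  have hglim : Tendsto g (cocompact ℂ) (𝓝 0) := by
    have := hlim.sub_const c
    rwa [sub_self] at this
  obtain ⟨B, hB⟩ : ∃ B, ∀ z, |g z| ≤ B := by
    obtain ⟨K, hK, hKc⟩ := mem_cocompact.1 (hglim.eventually (Metric.ball_mem_nhds (0 : ℝ) one_pos))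
    obtain ⟨B, hB⟩ := hK.bddAbove_image hgs.continuous.abs.continuousOn
    refine ⟨max B 1, fun z => ?_⟩
    by_cases hz : z ∈ K
    · exact (hB ⟨z, hz, rfl⟩).trans (le_max_left _ _)
    · have : dist (g z) 0 < 1 := hKc hz
      rw [Real.dist_eq, sub_zero] at this
      exact this.le.trans (le_max_right _ _)
  let φ : ContDiffBump (0 : ℂ) := ⟨1, 2, one_pos, one_lt_two⟩
  have hφ : ContDiff ℝ ∞ (φ : ℂ → ℝ) := φ.contDiff
  have hφc : HasCompactSupport (φ : ℂ → ℝ) := φ.hasCompactSupport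
  set t : ℕ → ℝ := fun n => 1 / ((n : ℝ) + 1) with ht
  have ht0 : ∀ n, 0 < t n := fun n => by positivity
  have htlim : Tendsto t atTop (𝓝 0) := tendsto_one_div_add_atTop_nhds_zero_nat
  have hts : ∀ n, ContDiff ℝ ∞ fun z : ℂ => t n • z := fun n => contDiff_const_smul _
  have hcc : ∀ n, HasCompactSupport fun z => φ (t n • z) := fun n =>
    hφc.comp_homeomorph (Homeomorph.smulOfNeZero (t n) (ht0 n).ne')
  have hid : ∀ n, ∫ z, φ (t n • z) * plap f z = ∫ z, plap φ z * g ((t n)⁻¹ • z) := by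
    intro n
    have h0 : ContDiff ℝ ∞ fun z => φ (t n • z) := hφ.comp (hts n)
    rw [← hpl, green_symm h0 hgs (hcc n), plap_comp_smul hφ]
    have h1 := Measure.integral_comp_smul (volume : Measure ℂ)
      (fun z => plap φ z * g ((t n)⁻¹ • z)) (t n)
    rw [Complex.finrank_real_complex] at h1
    simp only [inv_smul_smul₀ (ht0 n).ne', smul_eq_mul] at h1
    have h2 : ∀ z : ℂ, t n ^ 2 * plap φ (t n • z) * g z = t n ^ 2 * (plap φ (t n • z) * g z) :=
      fun z => by ring
    simp only [h2]
    rw [integral_const_mul, h1, abs_of_pos (by have := ht0 n; positivity), ← mul_assoc,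
      mul_inv_cancel₀ (pow_ne_zero 2 (ht0 n).ne'), one_mul]
  have hl1 : Tendsto (fun n => ∫ z, φ (t n • z) * plap f z) atTop (𝓝 (∫ z, plap f z)) := by
    refine tendsto_integral_of_dominated_convergence (fun z => |plap f z|) ?_ hi.abs ?_ ?_
    · exact fun n => (((hφ.comp (hts n)).continuous).mul
        (contDiff_plap hf).continuous).aestronglyMeasurable
    · refine fun n => Eventually.of_forall fun z => ?_
      rw [Real.norm_eq_abs, abs_mul, abs_of_nonneg φ.nonneg]
      exact mul_le_of_le_one_left (abs_nonneg _) φ.le_one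
    · refine Eventually.of_forall fun z => ?_
      have h1 : Tendsto (fun n => t n • z) atTop (𝓝 0) := by
        simpa using htlim.smul_const z
      have h2 : Tendsto (fun n => φ (t n • z)) atTop (𝓝 (φ 0)) :=
        (hφ.continuous.tendsto 0).comp h1
      rw [φ.one_of_mem_closedBall (by simp [φ])] at h2
      simpa using h2.mul_const (plap f z)
  have hl2 : Tendsto (fun n => ∫ z, plap φ z * g ((t n)⁻¹ • z)) atTop (𝓝 (∫ _ : ℂ, (0 : ℝ))) := by
    refine tendsto_integral_of_dominated_convergence (fun z => |plap φ z| * B) ?_ ?_ ?_ ?_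
    · exact fun n => ((contDiff_plap hφ).continuous.mul
        (hgs.continuous.comp (continuous_const_smul _))).aestronglyMeasurable
    · exact ((contDiff_plap hφ).continuous.integrable_of_hasCompactSupport
        (hasCompactSupport_plap hφc)).abs.mul_const B
    · refine fun n => Eventually.of_forall fun z => ?_
      rw [Real.norm_eq_abs, abs_mul]
      exact mul_le_mul_of_nonneg_left (hB _) (abs_nonneg _)
    · have h0 : ∀ᵐ z : ℂ, z ≠ 0 := by
        rw [ae_iff]
        simp
      filter_upwards [h0] with z hz
      have h1 : Tendsto (fun n => (t n)⁻¹ • z) atTop (cocompact ℂ) := by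
        refine tendsto_cocompact_of_tendsto_dist_comp_atTop 0 ?_
        simp only [dist_zero_right, norm_smul]
        refine Tendsto.atTop_mul_const (norm_pos_iff.2 hz) ?_
        refine tendsto_norm_atTop_atTop.comp ?_
        exact tendsto_inv_nhdsGT_zero.comp
          (tendsto_nhdsWithin_iff.2 ⟨htlim, Eventually.of_forall ht0⟩)
      simpa using (hglim.comp h1).const_mul (plap φ z)
  rw [integral_zero] at hl2
  simp only [hid] at hl1
  exact tendsto_nhds_unique hl1 hl2

lemma integral_one_add_sq : ∫ z : ℂ, (1 + ‖z‖ ^ 2) ^ (-2 : ℝ) = π := by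
  have h := integral_fun_norm_addHaar (volume : Measure ℂ) fun r : ℝ => (1 + r ^ 2) ^ (-2 : ℝ)
  rw [h, Complex.finrank_real_complex]
  have hd : ∀ x ∈ Set.Ici (0 : ℝ), HasDerivAt (fun r : ℝ => -(1 / 2) * (1 + r ^ 2)⁻¹)
      (x ^ (2 - 1) • (1 + x ^ 2) ^ (-2 : ℝ)) x := by
    intro x _
    have h0 : (1 + x ^ 2) ≠ 0 := by positivity
    refine ((((hasDerivAt_id x).pow 2).const_add 1).inv h0 |>.const_mul (-(1 / 2))).congr_deriv ?_
    rw [Real.rpow_neg (by positivity), smul_eq_mul, Real.rpow_two]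
    simp
    field_simp
  have hl : Tendsto (fun r : ℝ => -(1 / 2) * (1 + r ^ 2)⁻¹) atTop (𝓝 (-(1 / 2) * 0)) := by
    refine Tendsto.const_mul _ (tendsto_inv_atTop_zero.comp ?_)
    exact tendsto_atTop_add_const_left _ _ (tendsto_pow_atTop two_ne_zero)
  have h1 := integral_Ioi_of_hasDerivAt_of_nonneg' hd (fun x hx => by
    have : (0 : ℝ) < x := hx
    positivity) hl
  rw [h1, measureReal_def, Complex.volume_ball]
  simp
  ring

end IntegralLaplacian

section Planar

open Filter Topology

variable {q y e : E3} {u : E3 → ℝ} {α : ℝ}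

lemma conf_rpow (z : ℂ) : (1 + ‖z‖ ^ 2) ^ (-2 : ℝ) = 1 / conf z ^ 2 := by
  rw [← conf_eq, Real.rpow_neg (conf_pos z).le, Real.rpow_two, one_div]

lemma hasFDerivAt_conf (z : ℂ) : HasFDerivAt conf
    ((2 * z.re) • Complex.reCLM + (2 * z.im) • Complex.imCLM) z := by
  have h1 := Complex.reCLM.hasFDerivAt (x := z)
  have h2 := Complex.imCLM.hasFDerivAt (x := z)
  refine (((h1.pow 2).add (h2.pow 2)).const_add 1).congr_fderiv ?_
  ext
  all_goals simp

lemma contDiff_conf : ContDiff ℝ ∞ conf := by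
  have h1 : ContDiff ℝ ∞ fun z : ℂ => z.re := Complex.reCLM.contDiff
  have h2 : ContDiff ℝ ∞ fun z : ℂ => z.im := Complex.imCLM.contDiff
  unfold conf
  fun_prop

/-- The logarithm of the conformal factor of stereographic projection. -/
def logRho (z : ℂ) : ℝ := Real.log 2 - Real.log (conf z)

lemma exp_logRho (z : ℂ) : Real.exp (2 * logRho z) = 4 * (1 / conf z ^ 2) := by
  rw [logRho, mul_sub, Real.exp_sub, two_mul, two_mul, Real.exp_add, Real.exp_add,
    Real.exp_log two_pos, Real.exp_log (conf_pos z)]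
  ring

lemma contDiff_logRho : ContDiff ℝ ∞ logRho :=
  contDiff_const.sub (contDiff_conf.log fun z => (conf_pos z).ne')

lemma hasFDerivAt_logRho (z : ℂ) : HasFDerivAt logRho
    (-((conf z)⁻¹ • ((2 * z.re) • Complex.reCLM + (2 * z.im) • Complex.imCLM))) z :=
  ((hasFDerivAt_conf z).log (conf_pos z).ne').const_sub _

lemma plap_logRho (z : ℂ) : plap logRho z = -4 * (1 / conf z ^ 2) := by
  have h1 : px logRho = fun z => -((conf z)⁻¹ * (2 * z.re)) := by
    ext z; rw [px, (hasFDerivAt_logRho z).fderiv]; simp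
  have h2 : py logRho = fun z => -((conf z)⁻¹ * (2 * z.im)) := by
    ext z; rw [py, (hasFDerivAt_logRho z).fderiv]; simp
  have hc : HasFDerivAt (fun z => (conf z)⁻¹)
      ((-(conf z ^ 2)⁻¹) • ((2 * z.re) • Complex.reCLM + (2 * z.im) • Complex.imCLM)) z :=
    (hasDerivAt_inv (conf_pos z).ne').comp_hasFDerivAt z (hasFDerivAt_conf z)
  have h3 := (hc.mul ((Complex.reCLM.hasFDerivAt (x := z)).const_mul 2)).neg
  have h4 := (hc.mul ((Complex.imCLM.hasFDerivAt (x := z)).const_mul 2)).neg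
  have e3 : px (fun z => -((conf z)⁻¹ * (2 * z.re))) z = _ :=
    congrArg (fun L : ℂ →L[ℝ] ℝ => L 1) h3.fderiv
  have e4 : py (fun z => -((conf z)⁻¹ * (2 * z.im))) z = _ :=
    congrArg (fun L : ℂ →L[ℝ] ℝ => L Complex.I) h4.fderiv
  rw [plap, h1, h2, e3, e4]
  simp
  have := (conf_pos z).ne'
  have hz : conf z = 1 + (z.re ^ 2 + z.im ^ 2) := rfl
  field_simp
  rw [hz]
  ring

/-- The conformal factor of the metric `e^{2u} g` in stereographic coordinates. -/
def planar (u : E3 → ℝ) (q y e : E3) (z : ℂ) : ℝ := u (stereo q y e z) + logRho z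

lemma exp_planar (z : ℂ) : Real.exp (2 * planar u q y e z) =
    Real.exp (2 * u (stereo q y e z)) * (4 * (1 / conf z ^ 2)) := by
  rw [planar, mul_add, Real.exp_add, exp_logRho]

lemma contDiff_planar (hF : Frame q y e) (hs : ContDiffOn ℝ ∞ u {0}ᶜ) :
    ContDiff ℝ ∞ (planar u q y e) :=
  (contDiff_comp_stereo hF hs).add contDiff_logRho

lemma plap_comp_stereo_of_mfe (hF : Frame q y e) (hu : MFE u α) (z : ℂ) :
    plap (fun z => u (stereo q y e z)) z =
      α * (4 * (1 / conf z ^ 2)) - Real.exp (2 * planar u q y e z) := by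
  obtain ⟨hs, hh, heq⟩ := hu
  have hc := inv_pos.2 (conf_pos z)
  rw [plap_comp_stereo hF hs hh, lap_smul hh hc, exp_planar]
  have h1 := heq ((conf z)⁻¹ • stereo q y e z) (by
    rw [S2, mem_sphere_zero_iff_norm, norm_smul, hF.norm_stereo, Real.norm_of_nonneg hc.le,
      inv_mul_cancel₀ (conf_pos z).ne'])
  rw [hh _ _ hc] at h1
  rw [inv_pow]
  linear_combination -4 * (conf z ^ 2)⁻¹ * h1

lemma plap_planar (hF : Frame q y e) (hu : MFE u α) (z : ℂ) :
    plap (planar u q y e) z =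
      (α - 1) * (4 * (1 / conf z ^ 2)) - Real.exp (2 * planar u q y e z) := by
  have e1 : planar u q y e = (fun z => u (stereo q y e z)) + logRho := rfl
  have h := plap_comp_stereo_of_mfe hF hu z
  rw [e1, plap_add (contDiff_comp_stereo hF hu.1) contDiff_logRho, Pi.add_apply, h, plap_logRho,
    ← e1]
  ring

lemma exists_bound_of_hom0 (hs : ContDiffOn ℝ ∞ u {0}ᶜ) (hh : Hom0 u) :
    ∃ B, ∀ X : E3, X ≠ 0 → |u X| ≤ B := by
  have h1 : ContinuousOn (fun X => |u X|) S2 :=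
    (hs.continuousOn.mono fun X hX h0 => by
      rw [S2, mem_sphere_zero_iff_norm, h0, norm_zero] at hX
      exact zero_ne_one hX).abs
  obtain ⟨B, hB⟩ := (isCompact_sphere (0 : E3) 1).bddAbove_image h1
  refine ⟨B, fun X hX => ?_⟩
  have hn := norm_pos_iff.2 hX
  rw [← hh X ‖X‖⁻¹ (inv_pos.2 hn)]
  refine hB ⟨_, ?_, rfl⟩
  rw [mem_sphere_zero_iff_norm, norm_smul, norm_inv, norm_norm, inv_mul_cancel₀ hn.ne']

lemma tendsto_conf : Tendsto conf (cocompact ℂ) atTop := by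
  rw [show conf = fun z => 1 + ‖z‖ ^ 2 from funext conf_eq]
  exact tendsto_atTop_add_const_left _ _ ((tendsto_pow_atTop two_ne_zero).comp
    (tendsto_norm_cocompact_atTop))

lemma tendsto_comp_stereo (hF : Frame q y e) (hs : ContDiffOn ℝ ∞ u {0}ᶜ) (hh : Hom0 u) :
    Tendsto (fun z => u (stereo q y e z)) (cocompact ℂ) (𝓝 (u e)) := by
  have he : e ≠ 0 := fun h => by have := hF.ee; rw [h, inner_zero_left] at this; norm_num at this
  have h1 : (fun z => u (stereo q y e z)) = fun z => u ((conf z)⁻¹ • stereo q y e z) :=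
    funext fun z => (hh _ _ (inv_pos.2 (conf_pos z))).symm
  rw [h1]
  refine ((contDiffAt_of_contDiffOn_compl hs he).continuousAt.tendsto).comp ?_
  rw [tendsto_iff_norm_sub_tendsto_zero]
  have h2 : ∀ z, ‖(conf z)⁻¹ • stereo q y e z - e‖ = Real.sqrt (4 * (conf z)⁻¹) := by
    intro z
    rw [← Real.sqrt_sq (norm_nonneg _), ← real_inner_self_eq_norm_sq]
    congr 1
    have h3 : (conf z)⁻¹ • stereo q y e z - e = ((conf z)⁻¹ * (2 * z.re)) • q +
        ((conf z)⁻¹ * (2 * z.im)) • y + ((conf z)⁻¹ * (z.re ^ 2 + z.im ^ 2 - 1) - 1) • e := by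
      rw [stereo]; module
    rw [h3, hF.inner_comb]
    have := (conf_pos z).ne'
    have hz : conf z = 1 + (z.re ^ 2 + z.im ^ 2) := rfl
    field_simp
    rw [hz]
    ring
  simp only [h2]
  have h4 : Tendsto (fun z => 4 * (conf z)⁻¹) (cocompact ℂ) (𝓝 (4 * 0)) :=
    (tendsto_inv_atTop_zero.comp tendsto_conf).const_mul 4
  have h5 := (Real.continuous_sqrt.tendsto _).comp h4
  rw [mul_zero, Real.sqrt_zero] at h5
  exact h5

lemma Frame.neg (hF : Frame q y e) : Frame q (-y) e where
  qq := hF.qq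
  yy := by rw [inner_neg_neg]; exact hF.yy
  ee := hF.ee
  qy := by rw [inner_neg_right, hF.qy, neg_zero]
  qe := hF.qe
  ye := by rw [inner_neg_left, hF.ye, neg_zero]

lemma stereo_conj (z : ℂ) : stereo q y e (starRingEnd ℂ z) = stereo q (-y) e z := by
  simp [stereo]

lemma conf_conj (z : ℂ) : conf (starRingEnd ℂ z) = conf z := by simp [conf]

lemma planar_conj (z : ℂ) : planar u q y e (starRingEnd ℂ z) = planar u q (-y) e z := by
  rw [planar, planar, stereo_conj, logRho, logRho, conf_conj]

lemma Frame.refl_stereo (hF : Frame q y e) (z : ℂ) :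
    Refl y (stereo q y e z) = stereo q (-y) e z := by
  have h1 : ⟪stereo q y e z, y⟫ = 2 * z.im := by
    have := hF.inner_comb (2 * z.re) (2 * z.im) (z.re ^ 2 + z.im ^ 2 - 1) 0 1 0
    simpa [stereo] using this
  rw [Refl, h1, stereo, stereo]
  module

lemma integrable_exp_planar (hF : Frame q y e) (hu : MFE u α) :
    Integrable fun z => Real.exp (2 * planar u q y e z) := by
  obtain ⟨B, hB⟩ := exists_bound_of_hom0 hu.1 hu.2.1
  refine (integrable_one_add_sq.const_mul (Real.exp (2 * B) * 4)).mono'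
    (Real.continuous_exp.comp (continuous_const.mul
      (contDiff_planar hF hu.1).continuous)).aestronglyMeasurable (Eventually.of_forall fun z => ?_)
  rw [Real.norm_of_nonneg (Real.exp_pos _).le, exp_planar, conf_rpow, ← mul_assoc]
  gcongr
  exact (le_abs_self _).trans (hB _ (hF.stereo_ne_zero z))

lemma integral_exp_planar (hF : Frame q y e) (hu : MFE u α) :
    ∫ z, Real.exp (2 * planar u q y e z) = 4 * π * α := by
  have i1 := integrable_exp_planar hF hu
  have i2 : Integrable fun z => α * (4 * (1 / conf z ^ 2)) := by
    simp only [← conf_rpow]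
    exact (integrable_one_add_sq.const_mul 4).const_mul α
  have hp : plap (fun z => u (stereo q y e z)) =
      fun z => α * (4 * (1 / conf z ^ 2)) - Real.exp (2 * planar u q y e z) :=
    funext (plap_comp_stereo_of_mfe hF hu)
  have h := integral_plap_eq_zero (contDiff_comp_stereo hF hu.1) (by rw [hp]; exact i2.sub i1)
    (tendsto_comp_stereo hF hu.1 hu.2.1)
  rw [hp, integral_sub i2 i1, integral_const_mul, integral_const_mul] at h
  simp only [← conf_rpow] at h
  rw [integral_one_add_sq] at h
  linarith

lemma Frame.expand (hF : Frame q y e) (x : E3) : x = ⟪q, x⟫ • q + ⟪y, x⟫ • y + ⟪e, x⟫ • e := by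
  have h1 : ⟪y, q⟫ = 0 := by rw [real_inner_comm]; exact hF.qy
  have h2 : ⟪e, q⟫ = 0 := by rw [real_inner_comm]; exact hF.qe
  have h3 : ⟪e, y⟫ = 0 := by rw [real_inner_comm]; exact hF.ye
  have hb : Orthonormal ℝ ![q, y, e] := by
    rw [orthonormal_iff_ite]
    intro i j
    fin_cases i <;> fin_cases j
    all_goals simp [hF.qq, hF.yy, hF.ee, hF.qy, hF.qe, hF.ye, h1, h2, h3,
      -inner_self_eq_norm_sq_to_K]
  have := (OrthonormalBasis.mk hb (by
    rw [hb.linearIndependent.span_eq_top_of_card_eq_finrank (by simp)])).sum_repr' x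
  rw [Fin.sum_univ_three] at this
  simpa using this.symm

/-- Every direction other than that of `e` is in the image of the stereographic parametrisation. -/
lemma Frame.exists_stereo (hF : Frame q y e) {x : E3} (hx : x ∈ S2) (hxe : x ≠ e) :
    ∃ (z : ℂ) (r : ℝ), 0 < r ∧ stereo q y e z = r • x ∧ (⟪y, x⟫ = 0 → z.im = 0) := by
  have hexp := hF.expand x
  set a := ⟪q, x⟫
  set b := ⟪y, x⟫
  set c := ⟪e, x⟫
  have hn : a * a + b * b + c * c = 1 := by
    rw [← hF.inner_comb, ← hexp, real_inner_self_eq_norm_sq, mem_sphere_zero_iff_norm.1 hx, one_pow]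
  have hc : c < 1 := by
    by_contra h
    have h1 : c = 1 := by nlinarith [mul_self_nonneg a, mul_self_nonneg b]
    have h2 : a = 0 := by rw [h1] at hn; nlinarith [mul_self_nonneg a, mul_self_nonneg b]
    have h3 : b = 0 := by rw [h1] at hn; nlinarith [mul_self_nonneg a, mul_self_nonneg b]
    rw [h1, h2, h3] at hexp
    exact hxe (by simpa using hexp)
  have hc' : 0 < 1 - c := by linarith
  refine ⟨⟨a / (1 - c), b / (1 - c)⟩, 2 / (1 - c), by positivity, ?_, fun hb => by simp [hb]⟩
  have h4 : (a / (1 - c)) ^ 2 + (b / (1 - c)) ^ 2 - 1 = 2 / (1 - c) * c := by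
    field_simp
    linear_combination hn
  rw [stereo]
  simp only
  rw [h4]
  conv_rhs => rw [hexp]
  module

lemma planeData (hF : Frame q y e) (hu : MFE u α) (hα1 : 2 < α) (hα2 : α ≤ 3) {w : E3 → ℝ}
    (hw : w = fun x => u x - u (Refl y x)) (hw0 : ∃ x ∈ S2, w x ≠ 0) :
    PlaneData (planar u q y e) (planar u q (-y) e) (fun z => w (stereo q y e z)) := by
  have hF' := hF.neg
  obtain ⟨B, hB⟩ := exists_bound_of_hom0 hu.1 hu.2.1
  have hdiff : (fun z => w (stereo q y e z)) = planar u q y e - planar u q (-y) e := by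
    ext z
    rw [hw, Pi.sub_apply, planar, planar]
    simp only
    rw [hF.refl_stereo]
    ring
  have hsU := contDiff_planar hF hu.1
  have hsV := contDiff_planar hF' hu.1
  have hM := Real.exp_pos (2 * B)
  have hbd : ∀ {y : E3}, Frame q y e → ∀ z, Real.exp (2 * u (stereo q y e z)) ≤ Real.exp (2 * B) :=
    fun hF z => Real.exp_le_exp.2 (by
      have := (le_abs_self _).trans (hB _ (hF.stereo_ne_zero z)); linarith)
  refine ⟨hsU, hsV, by rw [hdiff]; exact hsU.sub hsV, fun z => congrFun hdiff z,
    fun z => (planar_conj z).symm, ?_, ?_, ?_, ?_, ?_, ?_⟩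
  · intro z
    rw [hdiff, plap_sub hsU hsV, Pi.sub_apply, plap_planar hF hu, plap_planar hF' hu]
    ring
  · set m := min 1 ((α - 1) / Real.exp (2 * B)) with hm
    have hm0 : 0 < m := lt_min one_pos (div_pos (by linarith) hM)
    have hm1 : m ≤ 1 := min_le_left _ _
    have hmM : m * Real.exp (2 * B) ≤ α - 1 := by
      rw [← le_div_iff₀ hM]; exact min_le_right _ _
    have key : ∀ {y : E3}, Frame q y e → ∀ z,
        -plap (planar u q y e) z ≤ (1 - m) * Real.exp (2 * planar u q y e z) := by
      intro y hF z
      have h1 : 0 < 4 * (1 / conf z ^ 2) := by have := conf_pos z; positivity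
      have h2 := mul_le_mul_of_nonneg_left (hbd hF z) hm0.le
      have h3 := mul_le_mul_of_nonneg_right (h2.trans hmM) h1.le
      rw [plap_planar hF hu]
      rw [exp_planar] at *
      linarith
    exact ⟨1 - m, by linarith, by linarith, key hF, key hF'⟩
  · refine ⟨Real.exp (2 * B) * 4, fun z => ?_⟩
    rw [exp_planar, conf_rpow, ← mul_assoc]
    have := conf_pos z
    gcongr
    exact (le_abs_self _).trans (hB _ (hF.stereo_ne_zero z))
  · have h1 := (tendsto_comp_stereo hF hu.1 hu.2.1).sub (tendsto_comp_stereo hF' hu.1 hu.2.1)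
    rw [sub_self] at h1
    refine h1.congr fun z => ?_
    rw [hw, ← hF.refl_stereo]
  · have hi := integrable_exp_planar hF hu
    have hmp : MeasurePreserving Complex.conjLIE volume volume := Complex.conjLIE.measurePreserving
    have h1 : ∫ z in upper, Real.exp (2 * planar u q (-y) e z) =
        ∫ z in {z : ℂ | z.im < 0}, Real.exp (2 * planar u q y e z) := by
      have h := hmp.setIntegral_preimage_emb Complex.conjLIE.toHomeomorph.measurableEmbedding
        (fun z => Real.exp (2 * planar u q y e z)) {z | z.im < 0}
      have : (Complex.conjLIE ⁻¹' {z : ℂ | z.im < 0}) = upper := by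
        ext z
        show (starRingEnd ℂ z).im < 0 ↔ 0 < z.im
        simp
      rw [← h, this]
      refine integral_congr_ae (Eventually.of_forall fun z => ?_)
      show _ = Real.exp (2 * planar u q y e (starRingEnd ℂ z))
      rw [planar_conj]
    have hd : Disjoint upper {z : ℂ | z.im < 0} := by
      rw [Set.disjoint_left]
      intro z hz hz'
      exact lt_asymm (show 0 < z.im from hz) (show z.im < 0 from hz')
    rw [h1, ← setIntegral_union hd (isOpen_lt Complex.continuous_im continuous_const).measurableSet
      hi.integrableOn hi.integrableOn]
    calc _ ≤ ∫ z, Real.exp (2 * planar u q y e z) :=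
          setIntegral_le_integral hi (Eventually.of_forall fun z => (Real.exp_pos _).le)
      _ ≤ 12 * π := by
        rw [integral_exp_planar hF hu]
        nlinarith [Real.pi_pos]
  · obtain ⟨x, hx, hwx⟩ := hw0
    have hxe : x ≠ e := by
      rintro rfl
      have : ⟪x, y⟫ = 0 := by rw [real_inner_comm]; exact hF.ye
      rw [hw] at hwx
      simp [Refl, this] at hwx
    obtain ⟨z, r, hr, hz, -⟩ := hF.exists_stereo hx hxe
    intro h0
    have h1 := congrFun h0 z
    simp only [Pi.zero_apply] at h1
    rw [hw] at h1 hwx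
    simp only at h1 hwx
    have h2 : Refl y (r • x) = r • Refl y x := by
      rw [Refl, Refl, real_inner_smul_left]; module
    rw [hz, h2, hu.2.1 _ _ hr, hu.2.1 _ _ hr] at h1
    exact hwx h1

end Planar

section Reflection

open Filter Topology

variable {q y e x : E3} {u w : E3 → ℝ} {α : ℝ}

lemma hasFDerivAt_refl (y x : E3) : HasFDerivAt (Refl y)
    (ContinuousLinearMap.id ℝ E3 - (2 : ℝ) • (innerSL ℝ y).smulRight y) x := by
  have h : Refl y = (ContinuousLinearMap.id ℝ E3 - (2 : ℝ) • (innerSL ℝ y).smulRight y) := by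
    ext1 X
    simp [Refl, real_inner_comm, mul_smul]
  rw [h]
  exact (ContinuousLinearMap.id ℝ E3 - (2 : ℝ) • (innerSL ℝ y).smulRight y).hasFDerivAt

lemma contDiff_refl (y : E3) : ContDiff ℝ ∞ (Refl y) := by
  exact contDiff_id.sub ((contDiff_const.mul (contDiff_id.inner ℝ contDiff_const)).smul
    contDiff_const)

lemma refl_smul (r : ℝ) : Refl y (r • x) = r • Refl y x := by
  rw [Refl, Refl, real_inner_smul_left]; module

lemma refl_refl (hy : ⟪y, y⟫ = 1) (x : E3) : Refl y (Refl y x) = x := by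
  simp only [Refl, inner_sub_left, real_inner_smul_left, hy]; module

lemma refl_of_inner_eq_zero (h : ⟪x, y⟫ = 0) : Refl y x = x := by simp [Refl, h]

lemma refl_ne_zero (hy : ⟪y, y⟫ = 1) (hx : x ≠ 0) : Refl y x ≠ 0 := fun h => hx (by
  rw [← refl_refl hy x, h]; simp [Refl])

lemma hom0_sub_refl (hh : Hom0 u) (hw : w = fun x => u x - u (Refl y x)) : Hom0 w := by
  intro x r hr
  rw [hw]
  simp only
  rw [refl_smul, hh _ _ hr, hh _ _ hr]

lemma contDiffOn_sub_refl (hy : ⟪y, y⟫ = 1) (hs : ContDiffOn ℝ ∞ u {0}ᶜ)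
    (hw : w = fun x => u x - u (Refl y x)) : ContDiffOn ℝ ∞ w {0}ᶜ := by
  rw [hw]
  exact hs.sub (hs.comp (contDiff_refl y).contDiffOn fun x hx => refl_ne_zero hy hx)

lemma fderiv_sub_refl_apply (hy : ⟪y, y⟫ = 1) (hs : ContDiffOn ℝ ∞ u {0}ᶜ)
    (hw : w = fun x => u x - u (Refl y x)) (hx0 : x ≠ 0) (hx : ⟪x, y⟫ = 0) :
    fderiv ℝ w x (-y) = 2 * fderiv ℝ u x (-y) := by
  have hu := ((contDiffAt_of_contDiffOn_compl hs hx0).differentiableAt (by simp)).hasFDerivAt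
  have hu' : HasFDerivAt u (fderiv ℝ u x) (Refl y x) := by rwa [refl_of_inner_eq_zero hx]
  have h := hu.sub (hu'.comp x (hasFDerivAt_refl y x))
  have e : w = u - u ∘ Refl y := hw
  rw [e, h.fderiv]
  rw [real_inner_self_eq_norm_sq] at hy
  simp [hy, two_mul]

lemma norm_eq_one_of_mem (hx : x ∈ S2) : ‖x‖ = 1 := mem_sphere_zero_iff_norm.1 hx

lemma ne_zero_of_mem (hx : x ∈ S2) : x ≠ 0 := by
  rw [← norm_ne_zero_iff, norm_eq_one_of_mem hx]; exact one_ne_zero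

lemma stereo_real (q y e : E3) (b : ℝ) :
    stereo q y e b = (2 * b) • q + (b ^ 2 - 1) • e := by simp [stereo]

lemma px_eq_zero_of_real {f : ℂ → ℝ} (hf : Differentiable ℝ f) (h0 : ∀ z : ℂ, z.im = 0 → f z = 0)
    {z : ℂ} (hz : z.im = 0) : px f z = 0 := by
  have h1 : HasDerivAt (fun t : ℝ => z + (t : ℂ)) 1 0 := by
    simpa using (Complex.ofRealCLM.hasDerivAt (x := 0)).const_add z
  have h2 : HasFDerivAt f (fderiv ℝ f z) (z + ((0 : ℝ) : ℂ)) := by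
    simpa using (hf z).hasFDerivAt
  have h3 := h2.comp_hasDerivAt (0 : ℝ) h1
  have h4 : f ∘ (fun t : ℝ => z + (t : ℂ)) = fun _ => 0 := by
    ext t; exact h0 _ (by simp [hz])
  rw [h4] at h3
  exact h3.unique (hasDerivAt_const _ _)

/-- The odd part of `u` across the great circle through `q` in an eigendirection of the Hessian
at the critical point `q` vanishes to third order at `q`. -/
lemma van_three (hF : Frame q y e) (hu : MFE u α) (hw : w = fun x => u x - u (Refl y x))
    (h : PlaneData (planar u q y e) (planar u q (-y) e) (fun z => w (stereo q y e z)))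
    (hcrit : fderiv ℝ u q = 0) (heig : fderiv ℝ (fderiv ℝ u) q e y = 0) :
    Van 3 (fun z => w (stereo q y e z)) ((1 : ℝ) : ℂ) := by
  obtain ⟨hs, hh, -⟩ := hu
  have hF' := hF.neg
  have hq0 : q ≠ 0 := fun h0 => by
    have := hF.qq; rw [h0, inner_zero_left] at this; exact zero_ne_one this
  have hpt : ∀ y, stereo q y e ((1 : ℝ) : ℂ) = (2 : ℝ) • q := fun y => by
    rw [stereo_real]; simp
  have h1 : fderiv ℝ u ((2 : ℝ) • q) = 0 := by
    have := fderiv_smul_eq hh two_pos q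
    rw [hcrit] at this
    simpa using this.symm
  have hqy : fderiv ℝ (fderiv ℝ u) q q y = 0 := by
    rw [fderiv_fderiv_symm hs hq0, fderiv_fderiv_apply_self hs hh hq0, hcrit]; simp
  have h2 : ∀ v v', fderiv ℝ (fderiv ℝ u) ((2 : ℝ) • q) v v' =
      (1 / 4) * fderiv ℝ (fderiv ℝ u) q v v' := fun v v' => by
    rw [fderiv_fderiv_smul_eq hh two_pos q]
    simp
    ring
  have hsu := contDiff_comp_stereo hF hs
  have hsv := contDiff_comp_stereo hF' hs
  have hdiff : (fun z => w (stereo q y e z)) =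
      (fun z => u (stereo q y e z)) - fun z => u (stereo q (-y) e z) := by
    ext z
    rw [hw, Pi.sub_apply]
    simp only
    rw [hF.refl_stereo]
  set W := fun z => w (stereo q y e z) with hW
  have hsW : ContDiff ℝ ∞ W := h.smooth
  have hpyW : py W = py (fun z => u (stereo q y e z)) - py (fun z => u (stereo q (-y) e z)) := by
    rw [hdiff, py_sub hsu hsv]
  have hre : (((1 : ℝ) : ℂ)).im = 0 := by simp
  have hp0 : ∀ z : ℂ, z.im = 0 → W z = 0 := fun z hz => h.eq_zero_of_real hz
  have hpx : ∀ z : ℂ, z.im = 0 → px W z = 0 := fun z hz =>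
    px_eq_zero_of_real (hsW.differentiable (by simp)) hp0 hz
  have hpxx : px (px W) ((1 : ℝ) : ℂ) = 0 :=
    px_eq_zero_of_real ((contDiff_px hsW).differentiable (by simp)) hpx hre
  have hpy : py W ((1 : ℝ) : ℂ) = 0 := by
    rw [hpyW, Pi.sub_apply, py_comp_stereo hF hs, py_comp_stereo hF' hs]
    simp only [hpt, h1]
    simp
  have hpxy : px (py W) ((1 : ℝ) : ℂ) = 0 := by
    rw [hpyW, px_sub (contDiff_py hsu) (contDiff_py hsv), Pi.sub_apply, px_py_comp_stereo hF hs,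
      px_py_comp_stereo hF' hs, hpt, hpt, h2, h2]
    simp [heig, hqy]
  have hpyy : py (py W) ((1 : ℝ) : ℂ) = 0 := by
    have e1 := h.eqn ((1 : ℝ) : ℂ)
    have e2 := hp0 _ hre
    have e3 := h.diff ((1 : ℝ) : ℂ)
    rw [e2] at e3
    rw [sub_eq_zero.1 e3.symm, sub_self, plap, hpxx] at e1
    linarith
  exact ⟨hp0 _ hre, ⟨hpx _ hre, ⟨hpxx, trivial, trivial⟩, ⟨by rw [py_px_comm hsW]; exact hpxy,
    trivial, trivial⟩⟩, hpy, ⟨hpxy, trivial, trivial⟩, ⟨hpyy, trivial, trivial⟩⟩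

/-- The normal derivative of the odd part of `u` has no zero on the great circle, apart from `q`
and possibly the pole `e`. -/
lemma fderiv_ne_zero_of_frame (hF : Frame q y e) (hu : MFE u α) (hα1 : 2 < α) (hα2 : α ≤ 3)
    (hw : w = fun x => u x - u (Refl y x)) (hw0 : ∃ x ∈ S2, w x ≠ 0) (hcrit : fderiv ℝ u q = 0)
    (heig : fderiv ℝ (fderiv ℝ u) q e y = 0) {p : E3} (hp : p ∈ S2) (hpy : ⟪y, p⟫ = 0)
    (hpq : p ≠ q) (hpe : p ≠ e) : fderiv ℝ w p (-y) ≠ 0 := by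
  intro h0
  have h := planeData hF hu hα1 hα2 hw hw0
  have hsw := contDiffOn_sub_refl hF.yy hu.1 hw
  have hhw := hom0_sub_refl hu.2.1 hw
  obtain ⟨b, r, hr, hb, him⟩ := hF.exists_stereo hp hpe
  have hbr : b = ((b.re : ℝ) : ℂ) := by apply Complex.ext <;> simp [him hpy]
  have hb1 : b.re ≠ 1 := by
    intro h1
    rw [h1] at hbr
    have h2 : (2 : ℝ) • q = r • p := by rw [← hb, hbr, stereo_real]; simp
    have h3 := congrArg norm h2
    have hq : ‖q‖ = 1 := by
      have := hF.qq
      rw [real_inner_self_eq_norm_sq] at this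
      exact (pow_eq_one_iff_of_nonneg (norm_nonneg _) two_ne_zero).1 this
    rw [norm_smul, norm_smul, hq, norm_eq_one_of_mem hp, Real.norm_of_nonneg hr.le] at h3
    norm_num at h3
    rw [← h3] at h2
    exact hpq (smul_right_injective _ two_ne_zero h2).symm
  refine h.false_of_van hb1 (van_three hF hu hw h hcrit heig) ?_
  rw [← hbr]
  refine ⟨h.eq_zero_of_real (him hpy), ⟨px_eq_zero_of_real (h.smooth.differentiable (by simp))
    (fun z hz => h.eq_zero_of_real hz) (him hpy), trivial, trivial⟩, ?_, trivial, trivial⟩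
  rw [fderiv_smul_eq hhw hr] at h0
  rw [py_comp_stereo hF hsw]
  simp only [him hpy, hb]
  simp at h0 ⊢
  exact h0.resolve_left hr.ne'

end Reflection

section Cross

variable {q z : E3}

lemma frame_cross (hq : ‖q‖ = 1) (hz : ‖z‖ = 1) (hzq : ⟪z, q⟫ = 0) : Frame q (cross q z) z := by
  have hqq : ⟪q, q⟫ = 1 := by rw [real_inner_self_eq_norm_sq, hq, one_pow]
  have hzz : ⟪z, z⟫ = 1 := by rw [real_inner_self_eq_norm_sq, hz, one_pow]
  have hqz : ⟪q, z⟫ = 0 := by rw [real_inner_comm]; exact hzq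
  refine ⟨hqq, ?_, hzz, ?_, hqz, ?_⟩
  all_goals
    simp only [cross, PiLp.inner_apply, Fin.sum_univ_three, crossProduct] at *
    simp at *
  · linear_combination (z 0 ^ 2 + z 1 ^ 2 + z 2 ^ 2) * hqq + hzz -
      (q 0 * z 0 + q 1 * z 1 + q 2 * z 2) * hqz
  · ring
  · ring

lemma Frame.neg_pole {y e : E3} (hF : Frame q y e) : Frame q y (-e) where
  qq := hF.qq
  yy := hF.yy
  ee := by rw [inner_neg_neg]; exact hF.ee
  qy := hF.qy
  qe := by rw [inner_neg_right, hF.qe, neg_zero]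
  ye := by rw [inner_neg_right, hF.ye, neg_zero]

lemma Frame.swap {y e : E3} (hF : Frame q y e) : Frame e y q where
  qq := hF.ee
  yy := hF.yy
  ee := hF.qq
  qy := by rw [real_inner_comm]; exact hF.ye
  qe := by rw [real_inner_comm]; exact hF.qe
  ye := by rw [real_inner_comm]; exact hF.qy

end Cross

section Sign

variable {q y e : E3} {f : E3 → ℝ}

/-- A smooth homogeneous function whose normal derivative does not vanish on a punctured great
circle has normal derivative of one sign there. -/
lemma one_sign (hF : Frame q y e) (hs : ContDiffOn ℝ ∞ f {0}ᶜ) (hh : Hom0 f)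
    (h0 : ∀ x ∈ circleOf y \ {q}, fderiv ℝ f x (-y) ≠ 0) :
    (∀ x ∈ circleOf y \ {q}, 0 < fderiv ℝ f x (-y)) ∨
      ∀ x ∈ circleOf y \ {q}, fderiv ℝ f x (-y) < 0 := by
  have hG := hF.swap
  set g : ℝ → ℝ := fun b => fderiv ℝ f (stereo e y q b) (-y) with hg
  have hcont : Continuous g := by
    refine continuous_iff_continuousAt.2 fun b => ?_
    have h1 := (differentiableAt_fderiv hs (hG.stereo_ne_zero b)).continuousAt
    have h2 : ContinuousAt (fun b : ℝ => stereo e y q b) b :=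
      ((contDiff_stereo e y q).continuous.comp Complex.continuous_ofReal).continuousAt
    exact (ContinuousAt.comp (f := fun b : ℝ => stereo e y q b) h1 h2).clm_apply
      continuousAt_const
  have hne : ∀ b, g b ≠ 0 := by
    intro b
    have hc := conf_pos b
    have hc' := inv_pos.2 hc
    set x := (conf b)⁻¹ • stereo e y q b with hx
    have hxm : x ∈ circleOf y \ {q} := by
      refine ⟨⟨?_, ?_⟩, ?_⟩
      · rw [S2, mem_sphere_zero_iff_norm, hx, norm_smul, hG.norm_stereo, Real.norm_of_nonneg hc'.le,
          inv_mul_cancel₀ hc.ne']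
      · rw [hx, real_inner_smul_left, stereo_real, inner_add_left, real_inner_smul_left,
          real_inner_smul_left, hG.qy, hF.qy]
        simp
      · intro hxq
        have h1 : stereo e y q b = conf b • q := by
          conv_rhs => rw [← show x = q from hxq]
          rw [hx, smul_smul, mul_inv_cancel₀ hc.ne', one_smul]
        have h2 : ⟪q, _⟫ = ⟪q, _⟫ := congrArg (fun v => ⟪q, v⟫) h1
        rw [stereo_real, inner_add_right, real_inner_smul_right, real_inner_smul_right,
          real_inner_smul_right, hF.qe, hF.qq, conf] at h2
        simp at h2
        linarith
    have h1 := h0 x hxm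
    intro h2
    refine h1 ?_
    have h3 := fderiv_smul_eq hh hc' (stereo e y q b)
    rw [← hx] at h3
    have h4 : g b = (conf b)⁻¹ * fderiv ℝ f x (-y) := by rw [hg]; simp only; rw [h3]; rfl
    rw [h2] at h4
    exact (mul_eq_zero.1 h4.symm).resolve_left hc'.ne'
  have hsign : (∀ b, 0 < g b) ∨ ∀ b, g b < 0 := by
    by_contra! hcon
    obtain ⟨⟨b, hb⟩, c, hc⟩ := hcon
    obtain ⟨d, hd⟩ := mem_range_of_exists_le_of_exists_ge hcont ⟨b, hb⟩ ⟨c, hc⟩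
    exact hne d hd
  have key : ∀ x ∈ circleOf y \ {q}, ∃ b : ℝ, ∃ r : ℝ, 0 < r ∧ fderiv ℝ f x (-y) = r * g b := by
    rintro x ⟨⟨hx, hxy⟩, hxq⟩
    obtain ⟨b, r, hr, hb, him⟩ := hG.exists_stereo hx hxq
    have him := him (by rw [real_inner_comm]; exact hxy)
    have hbr : ((b.re : ℝ) : ℂ) = b := by apply Complex.ext <;> simp [him]
    refine ⟨b.re, r, hr, ?_⟩
    rw [hg]
    simp only
    rw [hbr, hb, fderiv_smul_eq hh hr x]
    rfl
  refine hsign.imp (fun h x hx => ?_) fun h x hx => ?_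
  all_goals
    obtain ⟨b, r, hr, hb⟩ := key x hx
    rw [hb]
  · exact mul_pos hr (h b)
  · exact mul_neg_of_pos_of_neg hr (h b)

end Sign

end SphereMFE

end

theorem stmt4 (α : ℝ) (hα1 : 2 < α) (hα2 : α ≤ 3) (u : E3 → ℝ) (hu : MFE u α)
    (q z : E3) (hq : q ∈ S2) (hcrit : fderiv ℝ u q = 0)
    (hzq : ⟪z, q⟫ = 0) (hz1 : ‖z‖ = 1) (heig : HessEigen u q z)
    (y : E3) (hy : y = cross q z)
    (w : E3 → ℝ) (hw : w = fun x => u x - u (Refl y x))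
    (hw0 : ∃ x ∈ S2, w x ≠ 0) :
    ((∀ x ∈ circleOf y \ {q}, 0 < fderiv ℝ w x (-y)) ∨
        ∀ x ∈ circleOf y \ {q}, fderiv ℝ w x (-y) < 0) ∧
      ((∀ x ∈ circleOf y \ {q}, 0 < fderiv ℝ u x (-y)) ∨
        ∀ x ∈ circleOf y \ {q}, fderiv ℝ u x (-y) < 0) := by
  have hF : SphereMFE.Frame q y z := hy ▸ SphereMFE.frame_cross (SphereMFE.norm_eq_one_of_mem hq) hz1 hzq
  have hH : fderiv ℝ (fderiv ℝ u) q z y = 0 := by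
    obtain ⟨lam, hlam⟩ := heig
    have h := hlam y (by rw [real_inner_comm]; exact hF.qy)
    have hzy : ⟪z, y⟫ = 0 := by rw [real_inner_comm]; exact hF.ye
    rw [iteratedFDeriv_two_apply, hzy, mul_zero] at h
    simpa using h
  have hne : ∀ x ∈ circleOf y \ {q}, fderiv ℝ w x (-y) ≠ 0 := by
    rintro x ⟨⟨hx, hxy⟩, hxq⟩
    have hyx : ⟪y, x⟫ = 0 := by rw [real_inner_comm]; exact hxy
    by_cases hxz : x = z
    · have hxz' : x ≠ -z := by
        rintro h
        have h1 : ⟪z, z⟫ = ⟪z, -z⟫ := congrArg (fun v => ⟪z, v⟫) (hxz.symm.trans h)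
        rw [inner_neg_right, hF.ee] at h1
        norm_num at h1
      exact SphereMFE.fderiv_ne_zero_of_frame hF.neg_pole hu hα1 hα2 hw hw0 hcrit (by simp [hH]) hx hyx
        hxq hxz'
    · exact SphereMFE.fderiv_ne_zero_of_frame hF hu hα1 hα2 hw hw0 hcrit hH hx hyx hxq hxz
  have hsign := SphereMFE.one_sign hF (SphereMFE.contDiffOn_sub_refl hF.yy hu.1 hw)
    (SphereMFE.hom0_sub_refl hu.2.1 hw) hne
  have htwo : ∀ x ∈ circleOf y \ {q}, fderiv ℝ w x (-y) = 2 * fderiv ℝ u x (-y) := fun x hx =>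
    SphereMFE.fderiv_sub_refl_apply hF.yy hu.1 hw (SphereMFE.ne_zero_of_mem hx.1.1) hx.1.2
  refine ⟨hsign, hsign.imp (fun h x hx => ?_) fun h x hx => ?_⟩
  all_goals
    have h1 := h x hx
    rw [htwo x hx] at h1
    linarith
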